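/- Let n ≥ 2, q > 2 and p > 0, and let f be a positive smooth even function on the unit sphere S^{n−1}. Then there exist a convex body Ω in ℝⁿ that is origin-symmetric with smooth, strictly convex boundary, and a constant τ₁ > 0, such that the support function h of Ω satisfies the Monge–Ampère equation τ₁ · Ṽ_{γ,q}(Ω, ∇h(x) + h(x)x) · h(x)^{1−p} · det(∇²h(x) + h(x)I) = f(x) for every x ∈ S^{n−1}, where ∇ and ∇² denote the covariant gradient and Hessian on S^{n−1}. (Smooth even solution to the L_p-Gaussian chord Minkowski problem.) -/

import Mathlib

open MeasureTheory Filter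
open scoped RealInnerProductSpace Topology

noncomputable section

/-- `n`-dimensional Euclidean space. -/
abbrev Eucl (n : ℕ) := EuclideanSpace ℝ (Fin n)

/-- The support function of `K`, as a `1`-homogeneous function on all of `ℝⁿ`;
its restriction to the unit sphere is the usual support function `h_K`. -/
def suppFun {n : ℕ} (K : Set (Eucl n)) (x : Eucl n) : ℝ :=
  sSup ((fun y => ⟪x, y⟫) '' K)

/-- The radial function `ρ_K(ξ) = max {c > 0 : c • ξ ∈ K}`. -/
def radFun {n : ℕ} (K : Set (Eucl n)) (ξ : Eucl n) : ℝ :=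
  sSup {c : ℝ | 0 < c ∧ c • ξ ∈ K}

/-- `Ṽ_{γ,q}(K, y) = 2 e^{-|y|²/2} ∫_K e^{-|z|²/2} |z - y|^{-(n-q+1)} dz`. -/
def Vtilde {n : ℕ} (q : ℝ) (K : Set (Eucl n)) (y : Eucl n) : ℝ :=
  2 * Real.exp (-‖y‖ ^ 2 / 2) *
    ∫ z in K, Real.exp (-‖z‖ ^ 2 / 2) / ‖z - y‖ ^ ((n : ℝ) - q + 1)

/-- The Gaussian chord integral
`I_{γ,q}(K) = ∫_K ∫_K e^{-(|z|²+|y|²)/2} |z - y|^{-(n-q+1)} dz dy`. -/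
def gaussChord {n : ℕ} (q : ℝ) (K : Set (Eucl n)) : ℝ :=
  ∫ y in K, ∫ z in K,
    Real.exp (-(‖z‖ ^ 2 + ‖y‖ ^ 2) / 2) / ‖z - y‖ ^ ((n : ℝ) - q + 1)

/-- The rank-one map `v ↦ ⟪x, v⟫ • x` (orthogonal projection onto `ℝ x` when `‖x‖ = 1`). -/
def rankOne {n : ℕ} (x : Eucl n) : Eucl n →ₗ[ℝ] Eucl n where
  toFun v := ⟪x, v⟫ • x
  map_add' v w := by simp [inner_add_right, add_smul]
  map_smul' c v := by simp [inner_smul_right, mul_smul]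

/-- For the `1`-homogeneous extension `H` of the support function `h` of a smooth strictly
convex body, `fderiv ℝ (gradient H) x` vanishes on `ℝ x` and restricts on the tangent space
`x^⊥` to the matrix of principal radii of curvature `∇²h + h I`.  Adding the rank-one
projection onto `ℝ x` therefore makes the determinant of the ambient map equal to
`det(∇²h + h I)`, the reciprocal Gauss curvature. -/
def curvDet {n : ℕ} (H : Eucl n → ℝ) (x : Eucl n) : ℝ :=
  LinearMap.det
    ((fderiv ℝ (fun y => gradient H y) x : Eucl n →ₗ[ℝ] Eucl n) + rankOne x)

/-- A convex body in `ℝⁿ` which is origin-symmetric and has smooth, strictly convex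
boundary (encoded via smoothness of its support function away from the origin and
positivity of the curvature determinant on the sphere). -/
def IsSmoothBody {n : ℕ} (Ω : Set (Eucl n)) : Prop :=
  IsCompact Ω ∧ Convex ℝ Ω ∧ (0 : Eucl n) ∈ interior Ω ∧ (∀ x ∈ Ω, -x ∈ Ω) ∧
    ContDiffOn ℝ (⊤ : ℕ∞) (suppFun Ω) {(0 : Eucl n)}ᶜ ∧
    ∀ x ∈ Metric.sphere (0 : Eucl n) 1, 0 < curvDet (suppFun Ω) x

/-- The normalizing factor
`θ(t) = (∫_{S^{n-1}} Ṽ_{γ,q}(Ω, ρ(ξ)ξ) ρ(ξ)ⁿ dξ) / (∫_{S^{n-1}} h(x)^p f(x) dx)`. -/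
def theta {n : ℕ} (q p : ℝ) (f : Eucl n → ℝ) (K : Set (Eucl n)) : ℝ :=
  (∫ ξ in Metric.sphere (0 : Eucl n) 1,
      Vtilde q K (radFun K ξ • ξ) * radFun K ξ ^ n ∂μH[(n : ℝ) - 1]) /
  ∫ x in Metric.sphere (0 : Eucl n) 1, suppFun K x ^ p * f x ∂μH[(n : ℝ) - 1]

/-- The right-hand side `-θ h^p 𝒦 f / Ṽ_{γ,q}(K, ∇h + h x) + h` of the normalized Gauss
curvature flow, expressed through the `1`-homogeneous extension of the support function
(`gradient (suppFun K) x = ∇h(x) + h(x) x` and `𝒦 = (curvDet (suppFun K) x)⁻¹`). -/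
def flowRHS {n : ℕ} (q p : ℝ) (f : Eucl n → ℝ) (K : Set (Eucl n)) (x : Eucl n) : ℝ :=
  -(theta q p f K) * suppFun K x ^ p * (curvDet (suppFun K) x)⁻¹ * f x /
      Vtilde q K (gradient (suppFun K) x) + suppFun K x

/-- `K : ℝ → Set (Eucl n)` solves the normalized Gauss curvature flow
`∂h/∂t = -θ(t) h^p 𝒦 f / Ṽ_{γ,q} + h` on the time set `S`. -/
def IsGaussChordFlow {n : ℕ} (q p : ℝ) (f : Eucl n → ℝ) (S : Set ℝ)
    (K : ℝ → Set (Eucl n)) : Prop :=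
  ∀ t ∈ S, ∀ x ∈ Metric.sphere (0 : Eucl n) 1,
    HasDerivWithinAt (fun s => suppFun (K s) x) (flowRHS q p f (K t) x) S t

/-- The Wulff shape (Aleksandrov body) of a function `φ` on the unit sphere. -/
def wulff {n : ℕ} (φ : Eucl n → ℝ) : Set (Eucl n) :=
  {x | ∀ u ∈ Metric.sphere (0 : Eucl n) 1, ⟪x, u⟫ ≤ φ u}

/-- `ν` is a Gauss map of `∂K`: at every boundary point `y` of `K`, `ν y` is an outer
unit normal, i.e. `y · ν y = h_K(ν y)`. -/
def IsGaussMap {n : ℕ} (K : Set (Eucl n)) (ν : Eucl n → Eucl n) : Prop :=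
  ∀ y ∈ frontier K, ν y ∈ Metric.sphere (0 : Eucl n) 1 ∧ ⟪y, ν y⟫ = suppFun K (ν y)

set_option linter.unusedSectionVars false

/-! ### Bounded measurable functions with a weighted Lipschitz condition -/

section LipW

variable {T : Type} [MeasurableSpace T]

/-- Bounded strongly measurable functions `F : T → V` such that `‖F t - F t'‖ ≤ C |ω t t'|`
whenever `ω t t' ≠ 0`, realised inside `ℓ^∞` by recording values and difference quotients. -/
def lipSub (ω : T → T → ℝ) (V : Type) [NormedAddCommGroup V] [NormedSpace ℝ V] :
    Submodule ℝ (lp (fun _ : T ⊕ T × T => V) ⊤) where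
  carrier := {L | StronglyMeasurable (fun t => L (Sum.inl t)) ∧
    ∀ t t', L (Sum.inr (t, t')) = (ω t t')⁻¹ • (L (Sum.inl t) - L (Sum.inl t'))}
  add_mem' := by
    rintro a b ⟨ha, ha'⟩ ⟨hb, hb'⟩
    refine ⟨ha.add hb, fun t t' => ?_⟩
    simp only [lp.coeFn_add, Pi.add_apply, ha', hb', ← smul_add]
    congr 1; abel
  zero_mem' := ⟨stronglyMeasurable_const, fun t t' => by simp⟩
  smul_mem' := by
    rintro c a ⟨ha, ha'⟩
    refine ⟨ha.const_smul c, fun t t' => ?_⟩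
    simp only [lp.coeFn_smul, Pi.smul_apply, ha', ← smul_sub]
    rw [smul_comm]

variable {ω : T → T → ℝ} {V V' V'' : Type} [NormedAddCommGroup V] [NormedSpace ℝ V]
  [NormedAddCommGroup V'] [NormedSpace ℝ V'] [NormedAddCommGroup V''] [NormedSpace ℝ V'']

/-- The normed space of bounded measurable functions with a weighted Lipschitz condition. -/
def LipW (ω : T → T → ℝ) (V : Type) [NormedAddCommGroup V] [NormedSpace ℝ V] : Type :=
  lipSub ω V

namespace LipW

instance : NormedAddCommGroup (LipW ω V) := inferInstanceAs (NormedAddCommGroup (lipSub ω V))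
instance : NormedSpace ℝ (LipW ω V) := inferInstanceAs (NormedSpace ℝ (lipSub ω V))

/-- The underlying function. -/
def toFun (F : LipW ω V) (t : T) : V := F.1 (Sum.inl t)

instance : CoeFun (LipW ω V) (fun _ => T → V) := ⟨toFun⟩

@[simp] theorem coe_add (F G : LipW ω V) (t : T) : (F + G) t = F t + G t := rfl
@[simp] theorem coe_sub (F G : LipW ω V) (t : T) : (F - G) t = F t - G t := rfl
@[simp] theorem coe_neg (F : LipW ω V) (t : T) : (-F) t = -F t := rfl
@[simp] theorem coe_smul (c : ℝ) (F : LipW ω V) (t : T) : (c • F) t = c • F t := rfl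
@[simp] theorem coe_zero (t : T) : (0 : LipW ω V) t = 0 := rfl

theorem stronglyMeasurable (F : LipW ω V) : StronglyMeasurable (fun t => F t) := F.2.1

theorem norm_apply_le (F : LipW ω V) (t : T) : ‖F t‖ ≤ ‖F‖ :=
  lp.norm_apply_le_norm (by simp) F.1 (Sum.inl t)

theorem norm_sub_le (F : LipW ω V) {t t' : T} (h : ω t t' ≠ 0) :
    ‖F t - F t'‖ ≤ ‖F‖ * |ω t t'| := by
  have h1 := lp.norm_apply_le_norm (by simp) F.1 (Sum.inr (t, t'))
  rw [F.2.2 t t', norm_smul, norm_inv, Real.norm_eq_abs] at h1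
  have h2 : 0 < |ω t t'| := abs_pos.2 h
  rwa [inv_mul_le_iff₀ h2, mul_comm] at h1

@[ext] theorem ext {F G : LipW ω V} (h : ∀ t, F t = G t) : F = G := by
  apply Subtype.ext
  apply lp.ext
  funext i
  rcases i with t | ⟨t, t'⟩
  · exact h t
  · rw [F.2.2, G.2.2]
    have h1 : F.1 (Sum.inl t) = G.1 (Sum.inl t) := h t
    have h2 : F.1 (Sum.inl t') = G.1 (Sum.inl t') := h t'
    rw [h1, h2]

/-- Building an element from pointwise bounds. -/
def mk (F : T → V) (C : ℝ) (hm : StronglyMeasurable F) (hb : ∀ t, ‖F t‖ ≤ C)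
    (hl : ∀ t t', ω t t' ≠ 0 → ‖F t - F t'‖ ≤ C * |ω t t'|) : LipW ω V :=
  ⟨⟨fun i => Sum.elim F (fun z => (ω z.1 z.2)⁻¹ • (F z.1 - F z.2)) i, by
    apply memℓp_infty
    refine ⟨|C|, ?_⟩
    rintro _ ⟨i, rfl⟩
    rcases i with t | ⟨t, t'⟩
    · exact (hb t).trans (le_abs_self C)
    · by_cases h : ω t t' = 0
      · simp [h]
      · have h2 : 0 < |ω t t'| := abs_pos.2 h
        simp only [Sum.elim_inr, norm_smul, norm_inv, Real.norm_eq_abs]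
        rw [inv_mul_le_iff₀ h2]
        calc _ ≤ _ := hl t t' h
          _ ≤ |C| * |ω t t'| := by gcongr; exact le_abs_self C
          _ = _ := mul_comm _ _⟩,
    hm, fun t t' => rfl⟩

@[simp] theorem mk_apply (F : T → V) (C : ℝ) (hm hb) (hl) (t : T) :
    (mk (ω := ω) F C hm hb hl) t = F t := rfl

theorem norm_le {F : LipW ω V} {C : ℝ} (hC : 0 ≤ C) (hb : ∀ t, ‖F t‖ ≤ C)
    (hl : ∀ t t', ω t t' ≠ 0 → ‖F t - F t'‖ ≤ C * |ω t t'|) : ‖F‖ ≤ C := by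
  refine lp.norm_le_of_forall_le (f := F.1) hC ?_
  rintro (t | ⟨t, t'⟩)
  · exact hb t
  · rw [F.2.2]
    by_cases h : ω t t' = 0
    · simp [h, hC]
    · have h2 : 0 < |ω t t'| := abs_pos.2 h
      rw [norm_smul, norm_inv, Real.norm_eq_abs, inv_mul_le_iff₀ h2, mul_comm]
      exact hl t t' h

theorem isClosed_set [CompleteSpace V] :
    IsClosed (lipSub ω V : Set (lp (fun _ : T ⊕ T × T => V) ⊤)) := by
  have hev : ∀ i : T ⊕ T × T, Continuous fun L : lp (fun _ : T ⊕ T × T => V) ⊤ => L i := by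
    intro i
    refine LipschitzWith.continuous (K := 1) (LipschitzWith.of_dist_le_mul fun a b => ?_)
    rw [dist_eq_norm, dist_eq_norm, NNReal.coe_one, one_mul]
    exact lp.norm_apply_le_norm (by simp) (a - b) i
  refine isClosed_of_closure_subset fun L hL => ?_
  obtain ⟨u, hu, hlim⟩ := mem_closure_iff_seq_limit.1 hL
  have hpt : ∀ i, Tendsto (fun n => u n i) atTop (𝓝 (L i)) := fun i =>
    ((hev i).tendsto L).comp hlim
  refine ⟨stronglyMeasurable_of_tendsto atTop (fun n => (hu n).1)
    (tendsto_pi_nhds.2 fun t => hpt _), fun t t' => ?_⟩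
  refine tendsto_nhds_unique (hpt (Sum.inr (t, t'))) ?_
  have : (fun n => u n (Sum.inr (t, t'))) =
      fun n => (ω t t')⁻¹ • (u n (Sum.inl t) - u n (Sum.inl t')) :=
    funext fun n => (hu n).2 t t'
  rw [this]
  exact ((hpt _).sub (hpt _)).const_smul _

instance [CompleteSpace V] : CompleteSpace (LipW ω V) :=
  (isClosed_set (ω := ω) (V := V)).completeSpace_coe

/-- Building a continuous linear map into `LipW` from pointwise bounds. -/
def mkCLM {W : Type} [NormedAddCommGroup W] [NormedSpace ℝ W] (L : W → T → V) (C : ℝ)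
    (hadd : ∀ a b t, L (a + b) t = L a t + L b t) (hsmul : ∀ (c : ℝ) a t, L (c • a) t = c • L a t)
    (hm : ∀ a, StronglyMeasurable (L a)) (hb : ∀ a t, ‖L a t‖ ≤ C * ‖a‖)
    (hl : ∀ a t t', ω t t' ≠ 0 → ‖L a t - L a t'‖ ≤ C * ‖a‖ * |ω t t'|) : W →L[ℝ] LipW ω V :=
  LinearMap.mkContinuous
    { toFun := fun a => mk (L a) (C * ‖a‖) (hm a) (hb a) (hl a)
      map_add' := fun a b => by ext t; simp [hadd]
      map_smul' := fun c a => by ext t; simp [hsmul] } |C| (fun a => by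
        refine norm_le (by positivity) (fun t => ?_) fun t t' h => ?_
        · refine (hb a t).trans ?_
          gcongr; exact le_abs_self C
        · refine (hl a t t' h).trans ?_
          gcongr; exact le_abs_self C)

@[simp] theorem mkCLM_apply {W : Type} [NormedAddCommGroup W] [NormedSpace ℝ W] (L : W → T → V)
    (C : ℝ) (hadd hsmul hm hb) (hl) (a : W) (t : T) :
    (mkCLM (ω := ω) L C hadd hsmul hm hb hl a) t = L a t := rfl

theorem norm_mkCLM_apply_le {W : Type} [NormedAddCommGroup W] [NormedSpace ℝ W] (L : W → T → V)
    (C : ℝ) (hadd hsmul hm hb) (hl) (a : W) :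
    ‖mkCLM (ω := ω) L C hadd hsmul hm hb hl a‖ ≤ |C| * ‖a‖ :=
  (LinearMap.mkContinuous_norm_le _ (abs_nonneg C) _ |> ContinuousLinearMap.le_of_opNorm_le _) a

/-- Evaluation at a point. -/
def ev (t : T) : LipW ω V →L[ℝ] V :=
  LinearMap.mkContinuous ⟨⟨fun F => F t, fun _ _ => rfl⟩, fun _ _ => rfl⟩ 1
    fun F => by rw [one_mul]; exact norm_apply_le F t

@[simp] theorem ev_apply (t : T) (F : LipW ω V) : ev t F = F t := rfl

/-- Constant functions. -/
def constL (ω : T → T → ℝ) : V →L[ℝ] LipW ω V :=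
  mkCLM (fun v _ => v) 1 (fun _ _ _ => rfl) (fun _ _ _ => rfl)
    (fun _ => stronglyMeasurable_const) (fun a _ => by simp)
    (fun a t t' _ => by simp only [sub_self, norm_zero]; positivity)

@[simp] theorem constL_apply (v : V) (t : T) : (constL ω v) t = v := rfl

/-- Pointwise bilinear products. -/
def bilin (B : V →L[ℝ] V' →L[ℝ] V'') : LipW ω V →L[ℝ] LipW ω V' →L[ℝ] LipW ω V'' :=
  have key : ∀ (F : LipW ω V) (G : LipW ω V') (t t' : T), ω t t' ≠ 0 →
      ‖B (F t) (G t) - B (F t') (G t')‖ ≤ 2 * ‖B‖ * ‖F‖ * ‖G‖ * |ω t t'| := by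
    intro F G t t' h
    have h1 : B (F t) (G t) - B (F t') (G t') =
        B (F t - F t') (G t) + B (F t') (G t - G t') := by simp
    rw [h1]
    calc _ ≤ ‖B‖ * ‖F t - F t'‖ * ‖G t‖ + ‖B‖ * ‖F t'‖ * ‖G t - G t'‖ :=
          (norm_add_le _ _).trans (add_le_add (B.le_opNorm₂ _ _) (B.le_opNorm₂ _ _))
      _ ≤ ‖B‖ * (‖F‖ * |ω t t'|) * ‖G‖ + ‖B‖ * ‖F‖ * (‖G‖ * |ω t t'|) := by
          gcongr
          · exact F.norm_sub_le h
          · exact G.norm_apply_le t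
          · exact F.norm_apply_le t'
          · exact G.norm_sub_le h
      _ = _ := by ring
  have key' : ∀ (F : LipW ω V) (G : LipW ω V') (t : T),
      ‖B (F t) (G t)‖ ≤ 2 * ‖B‖ * ‖F‖ * ‖G‖ := by
    intro F G t
    calc _ ≤ ‖B‖ * ‖F t‖ * ‖G t‖ := B.le_opNorm₂ _ _
      _ ≤ ‖B‖ * ‖F‖ * ‖G‖ := by gcongr; exacts [F.norm_apply_le t, G.norm_apply_le t]
      _ ≤ _ := by
        have : 0 ≤ ‖B‖ * ‖F‖ * ‖G‖ := by positivity
        linarith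
  LinearMap.mkContinuous₂
    (LinearMap.mk₂ ℝ (fun F G => mk (fun t => B (F t) (G t)) (2 * ‖B‖ * ‖F‖ * ‖G‖)
        (B.continuous₂.comp_stronglyMeasurable
          (F.stronglyMeasurable.prodMk G.stronglyMeasurable)) (key' F G) (key F G))
      (fun _ _ _ => by ext t; simp; rfl) (fun _ _ _ => by ext t; simp; rfl)
      (fun _ _ _ => by ext t; simp; rfl) (fun _ _ _ => by ext t; simp; rfl))
    (2 * ‖B‖) (fun F G => norm_le (by positivity) (key' F G) (key F G))

@[simp] theorem bilin_apply (B : V →L[ℝ] V' →L[ℝ] V'') (F : LipW ω V) (G : LipW ω V') (t : T) :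
    (bilin B F G) t = B (F t) (G t) := rfl

/-- Postcomposition with a continuous linear map. -/
def post (B : V →L[ℝ] V') : LipW ω V →L[ℝ] LipW ω V' :=
  have hl : ∀ (F : LipW ω V) (t t' : T), ω t t' ≠ 0 →
      ‖B (F t) - B (F t')‖ ≤ ‖B‖ * ‖F‖ * |ω t t'| := fun F t t' h => by
    rw [← map_sub, mul_assoc]
    exact B.le_opNorm_of_le (F.norm_sub_le h)
  mkCLM (fun F t => B (F t)) ‖B‖ (fun _ _ _ => by simp) (fun _ _ _ => by simp)
    (fun F => B.continuous.comp_stronglyMeasurable F.stronglyMeasurable)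
    (fun F t => B.le_opNorm_of_le (F.norm_apply_le t)) hl

@[simp] theorem post_apply (B : V →L[ℝ] V') (F : LipW ω V) (t : T) : (post B F) t = B (F t) := rfl

theorem norm_post_le (B : V →L[ℝ] V') (F : LipW ω V) : ‖post B F‖ ≤ ‖B‖ * ‖F‖ := by
  have := norm_mkCLM_apply_le (ω := ω) (fun (F : LipW ω V) t => B (F t)) ‖B‖
    (fun _ _ _ => by simp) (fun _ _ _ => by simp)
    (fun F => B.continuous.comp_stronglyMeasurable F.stronglyMeasurable)
    (fun F t => B.le_opNorm_of_le (F.norm_apply_le t)) (fun F t t' h => by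
      rw [← map_sub, mul_assoc]
      exact B.le_opNorm_of_le (F.norm_sub_le h)) F
  rwa [abs_norm] at this

/-- Pairing of two functions. -/
def pair : (LipW ω V × LipW ω V') →L[ℝ] LipW ω (V × V') :=
  (post (ContinuousLinearMap.inl ℝ V V')).comp (ContinuousLinearMap.fst ℝ _ _) +
    (post (ContinuousLinearMap.inr ℝ V V')).comp (ContinuousLinearMap.snd ℝ _ _)

@[simp] theorem pair_apply (F : LipW ω V × LipW ω V') (t : T) :
    (pair F) t = (F.1 t, F.2 t) := by
  simp [pair]

end LipW

end LipW

section Remainder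

variable {V V' : Type} [NormedAddCommGroup V] [NormedSpace ℝ V] [FiniteDimensional ℝ V]
  [NormedAddCommGroup V'] [NormedSpace ℝ V']

theorem exists_norm_le_on_ball {Φ : V → V'} (h : Continuous Φ) (r : ℝ) :
    ∃ C, 0 ≤ C ∧ ∀ a, ‖a‖ ≤ r → ‖Φ a‖ ≤ C := by
  have := FiniteDimensional.proper_real V
  obtain ⟨C, hC⟩ := (isCompact_closedBall (0 : V) r).exists_bound_of_continuousOn h.continuousOn
  exact ⟨max C 0, le_max_right _ _, fun a ha =>
    (hC a (by simpa using ha)).trans (le_max_left _ _)⟩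

theorem exists_lipschitz_on_ball {Φ : V → V'} (h : ContDiff ℝ (⊤ : ℕ∞) Φ) (r : ℝ) :
    ∃ C, 0 ≤ C ∧ ∀ a b, ‖a‖ ≤ r → ‖b‖ ≤ r → ‖Φ a - Φ b‖ ≤ C * ‖a - b‖ := by
  have h1 := contDiff_infty_iff_fderiv.1 h
  obtain ⟨C, hC0, hC⟩ := exists_norm_le_on_ball h1.2.continuous r
  refine ⟨C, hC0, fun a b ha hb => ?_⟩
  exact (convex_closedBall (0 : V) r).norm_image_sub_le_of_norm_fderiv_le (𝕜 := ℝ)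
    (fun x _ => h1.1 x) (fun x hx => hC x (by simpa using hx)) (by simpa using hb)
    (by simpa using ha)

theorem exists_remainder_bound {Φ : V → V'} (h : ContDiff ℝ (⊤ : ℕ∞) Φ) (r : ℝ) :
    ∃ C, 0 ≤ C ∧ ∀ a b, ‖a‖ ≤ r → ‖b‖ ≤ r →
      ‖Φ (a + b) - Φ a - fderiv ℝ Φ a b‖ ≤ C * ‖b‖ ^ 2 := by
  have h1 := contDiff_infty_iff_fderiv.1 h
  obtain ⟨C, hC0, hC⟩ := exists_lipschitz_on_ball h1.2 (r + r)
  refine ⟨C, hC0, fun a b ha hb => ?_⟩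
  have hr : 0 ≤ r := (norm_nonneg a).trans ha
  have := (convex_closedBall (0 : V) ‖b‖).norm_image_sub_le_of_norm_hasFDerivWithin_le
    (f := fun c => Φ (a + c) - fderiv ℝ Φ a c) (f' := fun c => fderiv ℝ Φ (a + c) - fderiv ℝ Φ a)
    (C := C * ‖b‖) (x := 0) (y := b)
    (fun c _ => by
      have h2 : HasFDerivAt (fun c => Φ (a + c)) (fderiv ℝ Φ (a + c)) c :=
        (hasFDerivAt_comp_add_left a).2 (h1.1 (a + c)).hasFDerivAt
      exact (h2.sub (fderiv ℝ Φ a).hasFDerivAt).hasFDerivWithinAt)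
    (fun c hc => by
      have hc' : ‖c‖ ≤ ‖b‖ := by simpa using hc
      refine (hC (a + c) a ((norm_add_le _ _).trans (by linarith)) (by linarith)).trans ?_
      rw [add_sub_cancel_left]
      gcongr)
    (by simp) (by simp)
  simp only [add_zero, map_zero, sub_zero] at this
  rw [sub_right_comm, sq, ← mul_assoc]
  exact this

theorem exists_remainder_lipschitz {Φ : V → V'} (h : ContDiff ℝ (⊤ : ℕ∞) Φ) (r : ℝ) :
    ∃ C, 0 ≤ C ∧ ∀ a₁ a₂ b₁ b₂ m, ‖a₁‖ ≤ r → ‖a₂‖ ≤ r → ‖b₁‖ ≤ m → ‖b₂‖ ≤ m → m ≤ r →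
      ‖(Φ (a₁ + b₁) - Φ a₁ - fderiv ℝ Φ a₁ b₁) - (Φ (a₂ + b₂) - Φ a₂ - fderiv ℝ Φ a₂ b₂)‖ ≤
        C * (m * ‖b₁ - b₂‖ + m ^ 2 * ‖a₁ - a₂‖) := by
  have h1 := contDiff_infty_iff_fderiv.1 h
  have h2 := contDiff_infty_iff_fderiv.1 h1.2
  obtain ⟨C, hC0, hC⟩ := exists_lipschitz_on_ball h1.2 (r + r)
  obtain ⟨C', hC'0, hC'⟩ := exists_remainder_bound h1.2 r
  refine ⟨C + C', by positivity, fun a₁ a₂ b₁ b₂ m ha₁ ha₂ hb₁ hb₂ hm => ?_⟩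
  have hm0 : 0 ≤ m := (norm_nonneg _).trans hb₁
  have A := (convex_closedBall (0 : V) m).norm_image_sub_le_of_norm_hasFDerivWithin_le
    (f := fun c => Φ (a₁ + c) - fderiv ℝ Φ a₁ c)
    (f' := fun c => fderiv ℝ Φ (a₁ + c) - fderiv ℝ Φ a₁)
    (C := C * m) (x := b₂) (y := b₁)
    (fun c _ => by
      have h2 : HasFDerivAt (fun c => Φ (a₁ + c)) (fderiv ℝ Φ (a₁ + c)) c :=
        (hasFDerivAt_comp_add_left a₁).2 (h1.1 (a₁ + c)).hasFDerivAt
      exact (h2.sub (fderiv ℝ Φ a₁).hasFDerivAt).hasFDerivWithinAt)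
    (fun c hc => by
      have hc' : ‖c‖ ≤ m := by simpa using hc
      refine (hC (a₁ + c) a₁ ((norm_add_le _ _).trans (by linarith)) (by linarith)).trans ?_
      rw [add_sub_cancel_left]
      gcongr)
    (by simpa using hb₂) (by simpa using hb₁)
  have B := (convex_closedBall (0 : V) r).norm_image_sub_le_of_norm_hasFDerivWithin_le
    (f := fun a => Φ (a + b₂) - Φ a - fderiv ℝ Φ a b₂)
    (f' := fun a => fderiv ℝ Φ (a + b₂) - fderiv ℝ Φ a - (fderiv ℝ (fderiv ℝ Φ) a).flip b₂)
    (C := C' * m ^ 2) (x := a₂) (y := a₁)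
    (fun a _ => by
      have e1 : HasFDerivAt (fun a => Φ (a + b₂)) (fderiv ℝ Φ (a + b₂)) a :=
        (hasFDerivAt_comp_add_right b₂).2 (h1.1 (a + b₂)).hasFDerivAt
      have e2 : HasFDerivAt (fun a => fderiv ℝ Φ a b₂) ((fderiv ℝ (fderiv ℝ Φ) a).flip b₂) a := by
        have := (h2.1 a).hasFDerivAt.clm_apply (hasFDerivAt_const b₂ a)
        simpa using this
      exact ((e1.sub (h1.1 a).hasFDerivAt).sub e2).hasFDerivWithinAt)
    (fun a ha => by
      have ha' : ‖a‖ ≤ r := by simpa using ha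
      have hsymm : (fderiv ℝ (fderiv ℝ Φ) a).flip b₂ = fderiv ℝ (fderiv ℝ Φ) a b₂ := by
        ext v
        have := (h.contDiffAt (x := a)).isSymmSndFDerivAt (by
          simp only [minSmoothness_of_isRCLikeNormedField]
          exact WithTop.coe_le_coe.2 (le_top : (2 : ℕ∞) ≤ ⊤))
        exact this v b₂
      rw [hsymm]
      refine (hC' a b₂ ha' (by linarith)).trans ?_
      gcongr)
    (by simpa using ha₂) (by simpa using ha₁)
  calc _ = ‖((Φ (a₁ + b₁) - fderiv ℝ Φ a₁ b₁) - (Φ (a₁ + b₂) - fderiv ℝ Φ a₁ b₂)) +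
        ((Φ (a₁ + b₂) - Φ a₁ - fderiv ℝ Φ a₁ b₂) - (Φ (a₂ + b₂) - Φ a₂ - fderiv ℝ Φ a₂ b₂))‖ := by
        congr 1; abel
    _ ≤ C * m * ‖b₁ - b₂‖ + C' * m ^ 2 * ‖a₁ - a₂‖ := (norm_add_le _ _).trans (add_le_add A B)
    _ ≤ _ := by
      have p1 : 0 ≤ C' * (m * ‖b₁ - b₂‖) := by positivity
      have p2 : 0 ≤ C * (m ^ 2 * ‖a₁ - a₂‖) := by positivity
      nlinarith

end Remainder

namespace LipW

variable {T : Type} [MeasurableSpace T] {ω : T → T → ℝ} {V : Type} [NormedAddCommGroup V]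
  [NormedSpace ℝ V] [FiniteDimensional ℝ V] {V' : Type} [NormedAddCommGroup V'] [NormedSpace ℝ V']

theorem exists_nem {Φ : V → V'} (h : ContDiff ℝ (⊤ : ℕ∞) Φ) (F : LipW ω V) :
    ∃ G : LipW ω V', ∀ t, G t = Φ (F t) := by
  obtain ⟨C, hC0, hC⟩ := exists_norm_le_on_ball h.continuous ‖F‖
  obtain ⟨C', hC'0, hC'⟩ := exists_lipschitz_on_ball h ‖F‖
  refine ⟨mk (fun t => Φ (F t)) (max C (C' * ‖F‖))
    (h.continuous.comp_stronglyMeasurable F.stronglyMeasurable)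
    (fun t => (hC _ (F.norm_apply_le t)).trans (le_max_left _ _)) (fun t t' hω => ?_),
    fun t => rfl⟩
  calc _ ≤ C' * ‖F t - F t'‖ := hC' _ _ (F.norm_apply_le t) (F.norm_apply_le t')
    _ ≤ C' * (‖F‖ * |ω t t'|) := by gcongr; exact F.norm_sub_le hω
    _ = C' * ‖F‖ * |ω t t'| := by ring
    _ ≤ _ := by gcongr; exact le_max_right _ _

open Classical in
/-- The Nemytskii operator `F ↦ Φ ∘ F`. -/
def nem (Φ : V → V') (F : LipW ω V) : LipW ω V' :=
  if h : ContDiff ℝ (⊤ : ℕ∞) Φ then (exists_nem h F).choose else 0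

theorem nem_apply {Φ : V → V'} (h : ContDiff ℝ (⊤ : ℕ∞) Φ) (F : LipW ω V) (t : T) :
    nem Φ F t = Φ (F t) := by
  rw [nem, dif_pos h]
  exact (exists_nem h F).choose_spec t

theorem hasFDerivAt_nem {Φ : V → V'} (h : ContDiff ℝ (⊤ : ℕ∞) Φ) (F : LipW ω V) :
    HasFDerivAt (nem (ω := ω) Φ)
      (bilin (ContinuousLinearMap.id ℝ (V →L[ℝ] V')) (nem (fderiv ℝ Φ) F)) F := by
  have h1 := (contDiff_infty_iff_fderiv.1 h).2
  obtain ⟨C, hC0, hC⟩ := exists_remainder_bound h (‖F‖ + 1)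
  obtain ⟨C', hC'0, hC'⟩ := exists_remainder_lipschitz h (‖F‖ + 1)
  rw [hasFDerivAt_iff_isLittleO_nhds_zero]
  have hF := norm_nonneg F
  have key : ∀ G : LipW ω V, ‖G‖ ≤ 1 →
      ‖nem Φ (F + G) - nem Φ F -
        bilin (ContinuousLinearMap.id ℝ (V →L[ℝ] V')) (nem (fderiv ℝ Φ) F) G‖ ≤
        (C + C' * (1 + ‖F‖)) * ‖G‖ ^ 2 := by
    intro G hG
    have e : ∀ t, (nem Φ (F + G) - nem Φ F -
        bilin (ContinuousLinearMap.id ℝ (V →L[ℝ] V')) (nem (fderiv ℝ Φ) F) G) t =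
        Φ (F t + G t) - Φ (F t) - fderiv ℝ Φ (F t) (G t) := by
      intro t
      simp [nem_apply h, nem_apply h1]
    refine norm_le (by positivity) (fun t => ?_) fun t t' hω => ?_
    · rw [e]
      calc _ ≤ C * ‖G t‖ ^ 2 := hC _ _ ((F.norm_apply_le t).trans (by linarith))
            ((G.norm_apply_le t).trans (by linarith))
        _ ≤ C * ‖G‖ ^ 2 := by gcongr; exact G.norm_apply_le t
        _ ≤ _ := by gcongr; simp only [le_add_iff_nonneg_right]; positivity
    · rw [e, e]
      calc _ ≤ C' * (‖G‖ * ‖G t - G t'‖ + ‖G‖ ^ 2 * ‖F t - F t'‖) :=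
            hC' _ _ _ _ ‖G‖ ((F.norm_apply_le t).trans (by linarith))
              ((F.norm_apply_le t').trans (by linarith)) (G.norm_apply_le t) (G.norm_apply_le t')
              (by linarith)
        _ ≤ C' * (‖G‖ * (‖G‖ * |ω t t'|) + ‖G‖ ^ 2 * (‖F‖ * |ω t t'|)) := by
            gcongr
            · exact G.norm_sub_le hω
            · exact F.norm_sub_le hω
        _ = (0 + C' * (1 + ‖F‖)) * ‖G‖ ^ 2 * |ω t t'| := by ring
        _ ≤ _ := by gcongr
  refine Asymptotics.IsBigO.trans_isLittleO (g := fun G : LipW ω V => ‖G‖ ^ 2) ?_ ?_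
  · refine Asymptotics.IsBigO.of_bound (C + C' * (1 + ‖F‖)) ?_
    filter_upwards [Metric.ball_mem_nhds (0 : LipW ω V) one_pos] with G hG
    rw [Real.norm_of_nonneg (by positivity)]
    exact key G (by simpa using (mem_ball_zero_iff.1 hG).le)
  · exact Asymptotics.isLittleO_norm_pow_id one_lt_two

theorem contDiff_nem {Φ : V → V'} (h : ContDiff ℝ (⊤ : ℕ∞) Φ) :
    ContDiff ℝ (⊤ : ℕ∞) (nem (ω := ω) Φ) := by
  rw [contDiff_infty]
  intro k
  induction k generalizing V' with
  | zero =>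
    exact contDiff_zero.2 (continuous_iff_continuousAt.2 fun F =>
      (hasFDerivAt_nem h F).continuousAt)
  | succ k ih =>
    have := contDiff_succ_iff_hasFDerivAt (𝕜 := ℝ) (f := nem (ω := ω) Φ) (n := k)
    push_cast
    rw [this]
    refine ⟨fun F => bilin (ContinuousLinearMap.id ℝ (V →L[ℝ] V')) (nem (fderiv ℝ Φ) F), ?_,
      hasFDerivAt_nem h⟩
    exact (ContinuousLinearMap.contDiff _).comp (ih (contDiff_infty_iff_fderiv.1 h).2)

end LipW

/-- The unit sphere of `ℝⁿ` as a type. -/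
abbrev Sph (n : ℕ) := Metric.sphere (0 : Eucl n) 1

/-- The normalized rotation-invariant measure on the sphere. -/
def sig (n : ℕ) : Measure (Sph n) :=
  ((volume : Measure (Eucl n)).toSphere Set.univ)⁻¹ • (volume : Measure (Eucl n)).toSphere

/-- The action of a linear isometry on the sphere. -/
def sphMap {n : ℕ} (A : Eucl n ≃ₗᵢ[ℝ] Eucl n) (x : Sph n) : Sph n :=
  ⟨A x, by simp⟩

section Sphere

variable {n : ℕ}

@[simp] theorem coe_sphMap (A : Eucl n ≃ₗᵢ[ℝ] Eucl n) (x : Sph n) : (sphMap A x : Eucl n) = A x :=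
  rfl

theorem continuous_sphMap (A : Eucl n ≃ₗᵢ[ℝ] Eucl n) : Continuous (sphMap A) :=
  (A.continuous.comp continuous_subtype_val).subtype_mk _

theorem Sph.norm_eq (x : Sph n) : ‖(x : Eucl n)‖ = 1 := by simp

theorem Sph.inner_self (x : Sph n) : ⟪(x : Eucl n), (x : Eucl n)⟫ = 1 := by
  rw [real_inner_self_eq_norm_sq, Sph.norm_eq]; norm_num

open scoped Pointwise in
theorem measurePreserving_sphMap (A : Eucl n ≃ₗᵢ[ℝ] Eucl n) :
    MeasurePreserving (sphMap A) (sig n) (sig n) := by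
  refine ⟨(continuous_sphMap A).measurable, ?_⟩
  rw [sig, Measure.map_smul]
  congr 1
  ext s hs
  rw [Measure.map_apply (continuous_sphMap A).measurable hs, Measure.toSphere_apply' _ hs,
    Measure.toSphere_apply' _ ((continuous_sphMap A).measurable hs)]
  congr 1
  have : (Set.Ioo (0 : ℝ) 1 • ((↑) '' (sphMap A ⁻¹' s) : Set (Eucl n))) =
      A ⁻¹' (Set.Ioo (0 : ℝ) 1 • ((↑) '' s : Set (Eucl n))) := by
    ext v
    simp only [Set.mem_smul, Set.mem_image, Set.mem_preimage]
    constructor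
    · rintro ⟨c, hc, _, ⟨x, hx, rfl⟩, rfl⟩
      exact ⟨c, hc, A x, ⟨sphMap A x, hx, rfl⟩, by simp⟩
    · rintro ⟨c, hc, _, ⟨x, hx, rfl⟩, h⟩
      refine ⟨c, hc, A.symm x, ⟨sphMap A.symm x, ?_, rfl⟩, ?_⟩
      · have : sphMap A (sphMap A.symm x) = x := Subtype.ext (by simp)
        simpa [Set.mem_preimage, this] using hx
      · rw [← map_smul, h]; simp
  rw [this]
  exact A.measurePreserving.measure_preimage_equiv (f := A.toMeasurableEquiv) _

theorem integral_sphMap {V : Type} [NormedAddCommGroup V] [NormedSpace ℝ V]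
    (A : Eucl n ≃ₗᵢ[ℝ] Eucl n) (F : Sph n → V) :
    ∫ y, F (sphMap A y) ∂(sig n) = ∫ y, F y ∂(sig n) := by
  have e : MeasurableEmbedding (sphMap A) := by
    refine (Topology.IsClosedEmbedding.measurableEmbedding ?_)
    refine (continuous_sphMap A).isClosedEmbedding fun x y h => ?_
    have := congrArg (Subtype.val) h
    exact Subtype.ext (A.injective this)
  exact (measurePreserving_sphMap A).integral_comp e F

theorem exists_isometry_sph (x y : Sph n) :
    ∃ A : Eucl n ≃ₗᵢ[ℝ] Eucl n, sphMap A x = y := by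
  refine ⟨(ℝ ∙ ((x : Eucl n) - y))ᗮ.reflection, Subtype.ext ?_⟩
  exact Submodule.reflection_sub (by simp)

variable [hn : Fact (2 ≤ n)]

instance : Nontrivial (Eucl n) := by
  have := hn.out
  have : Nonempty (Fin n) := ⟨⟨0, by omega⟩⟩
  infer_instance

instance : IsProbabilityMeasure (sig n) := by
  refine ⟨?_⟩
  rw [sig, Measure.smul_apply, smul_eq_mul]
  refine ENNReal.inv_mul_cancel ?_ (measure_ne_top _ _)
  rw [Ne, Measure.measure_univ_eq_zero]
  exact Measure.toSphere_ne_zero _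

instance : Nonempty (Sph n) := by
  obtain ⟨x, hx⟩ := exists_norm_eq (Eucl n) (zero_le_one)
  exact ⟨⟨x, by simpa using hx⟩⟩

/-- A base point on the sphere. -/
def baseP (n : ℕ) [Fact (2 ≤ n)] : Sph n := Classical.arbitrary _

end Sphere

section Kernels

variable {n : ℕ}

/-- Radial projection. -/
def nx (x : Eucl n) : Eucl n := ‖x‖⁻¹ • x

/-- Projection onto the orthogonal complement of a unit vector `x`. -/
def pjL (x : Eucl n) : Eucl n →L[ℝ] Eucl n :=
  ContinuousLinearMap.id ℝ _ - (innerSL ℝ x).smulRight x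

theorem pjL_apply (x v : Eucl n) : pjL x v = v - ⟪x, v⟫ • x := by
  simp [pjL]

/-- The rank one map `w ↦ ⟪u, w⟫ v`. -/
def tens (u v : Eucl n) : Eucl n →L[ℝ] Eucl n := (innerSL ℝ u).smulRight v

theorem tens_apply (u v w : Eucl n) : tens u v w = ⟪u, w⟫ • v := by simp [tens]

theorem norm_tens_le (u v : Eucl n) : ‖tens u v‖ ≤ ‖u‖ * ‖v‖ := by
  rw [tens, ContinuousLinearMap.norm_smulRight_apply, innerSL_apply_norm]

def bb (x y : Eucl n) : ℝ := (1 + ⟪x, y⟫) / 2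

def kerZ (N : ℕ) (x y : Eucl n) : ℝ := bb x y ^ N

def kerV (N : ℕ) (x y : Eucl n) : Eucl n :=
  (N / 2 * bb x y ^ (N - 1)) • pjL x y + bb x y ^ N • x

def kerM (N : ℕ) (x y : Eucl n) : Eucl n →L[ℝ] Eucl n :=
  (N * (N - 1) / 4 * bb x y ^ (N - 2)) • tens (pjL x y) (pjL x y) +
    (bb x y ^ N - ⟪x, y⟫ * (N / 2 * bb x y ^ (N - 1))) • pjL x

theorem norm_nx {x : Eucl n} (hx : x ≠ 0) : ‖nx x‖ = 1 := by
  rw [nx, norm_smul, norm_inv, norm_norm, inv_mul_cancel₀ (norm_ne_zero_iff.2 hx)]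

theorem nx_of_norm {x : Eucl n} (hx : ‖x‖ = 1) : nx x = x := by simp [nx, hx]

theorem norm_smul_nx (x : Eucl n) : ‖x‖ • nx x = x := by
  by_cases hx : x = 0
  · simp [hx]
  · rw [nx, smul_smul, mul_inv_cancel₀ (norm_ne_zero_iff.2 hx), one_smul]

theorem hasFDerivAt_norm' {x : Eucl n} (hx : x ≠ 0) :
    HasFDerivAt (fun x : Eucl n => ‖x‖) (innerSL ℝ (nx x)) x := by
  have h := (hasStrictFDerivAt_norm_sq x).hasFDerivAt.sqrt (by positivity)
  simp only [Real.sqrt_sq (norm_nonneg _)] at h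
  refine h.congr_fderiv ?_
  ext v
  simp [nx]
  ring

theorem hasFDerivAt_nx {x : Eucl n} (hx : x ≠ 0) :
    HasFDerivAt (nx : Eucl n → Eucl n) (‖x‖⁻¹ • pjL (nx x)) x := by
  have h0 : ‖x‖ ≠ 0 := norm_ne_zero_iff.2 hx
  have h := ((hasDerivAt_inv h0).comp_hasFDerivAt x (hasFDerivAt_norm' hx)).smul (hasFDerivAt_id x)
  refine h.congr_fderiv ?_
  ext1 v
  simp only [smul_apply, pjL_apply, add_apply,
    ContinuousLinearMap.smulRight_apply, innerSL_apply_apply, ContinuousLinearMap.id_apply,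
    Function.comp_apply, id, smul_sub, smul_eq_mul]
  rw [sub_eq_add_neg]
  congr 1
  rw [← neg_smul, neg_mul, neg_smul, ← neg_smul, nx, smul_smul, smul_smul]
  congr 1
  field_simp

theorem hasFDerivAt_inner_nx {x : Eucl n} (hx : x ≠ 0) (y : Eucl n) :
    HasFDerivAt (fun x : Eucl n => ⟪nx x, y⟫) (‖x‖⁻¹ • innerSL ℝ (pjL (nx x) y)) x := by
  have h := (hasFDerivAt_nx hx).inner ℝ (hasFDerivAt_const y x)
  refine h.congr_fderiv ?_
  ext1 v
  simp [pjL_apply, inner_sub_left, inner_smul_left, real_inner_comm]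
  ring_nf
  simp

theorem hasFDerivAt_bb_pow {x : Eucl n} (hx : x ≠ 0) (y : Eucl n) (N : ℕ) :
    HasFDerivAt (fun x : Eucl n => bb (nx x) y ^ N)
      ((N / 2 * bb (nx x) y ^ (N - 1)) • (‖x‖⁻¹ • innerSL ℝ (pjL (nx x) y))) x := by
  have h1 : HasFDerivAt (fun x : Eucl n => bb (nx x) y)
      ((1 / 2 : ℝ) • (‖x‖⁻¹ • innerSL ℝ (pjL (nx x) y))) x := by
    have := ((hasFDerivAt_inner_nx hx y).const_add 1).const_mul (1 / 2 : ℝ)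
    refine this.congr_of_eventuallyEq (Eventually.of_forall fun z => ?_)
    simp only [bb]; ring
  refine (h1.pow N).congr_fderiv ?_
  rw [smul_smul (_ : ℝ) (1 / 2 : ℝ)]
  congr 1
  simp only [nsmul_eq_mul]
  ring

theorem hasFDerivAt_kerZ {x : Eucl n} (hx : x ≠ 0) (y : Eucl n) (N : ℕ) :
    HasFDerivAt (fun x : Eucl n => ‖x‖ * kerZ N (nx x) y) (innerSL ℝ (kerV N (nx x) y)) x := by
  have h0 : ‖x‖ ≠ 0 := norm_ne_zero_iff.2 hx
  have h := (hasFDerivAt_norm' hx).mul (hasFDerivAt_bb_pow hx y N)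
  refine h.congr_fderiv ?_
  ext1 v
  simp only [kerV, map_add, add_apply, smul_apply,
    smul_eq_mul, innerSL_apply_apply, inner_smul_left, RCLike.conj_to_real]
  field_simp

theorem hasFDerivAt_pjL_nx {x : Eucl n} (hx : x ≠ 0) (y : Eucl n) :
    HasFDerivAt (fun x : Eucl n => pjL (nx x) y)
      (-(‖x‖⁻¹ • (tens (pjL (nx x) y) (nx x) + ⟪nx x, y⟫ • pjL (nx x)))) x := by
  have h := (hasFDerivAt_const y x).sub ((hasFDerivAt_inner_nx hx y).smul (hasFDerivAt_nx hx))
  have e : (fun x : Eucl n => pjL (nx x) y) = fun x => y - ⟪nx x, y⟫ • nx x := by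
    ext1 z; rw [pjL_apply]
  rw [e]
  refine h.congr_fderiv ?_
  ext1 v
  simp only [neg_apply, smul_apply,
    add_apply, tens_apply, sub_apply,
    zero_apply, ContinuousLinearMap.smulRight_apply, innerSL_apply_apply,
    smul_eq_mul]
  module

theorem hasFDerivAt_kerV {x : Eucl n} (hx : x ≠ 0) (y : Eucl n) (N : ℕ) :
    HasFDerivAt (fun x : Eucl n => kerV N (nx x) y) (‖x‖⁻¹ • kerM N (nx x) y) x := by
  have h := (((hasFDerivAt_bb_pow hx y (N - 1)).const_mul ((N : ℝ) / 2)).smul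
    (hasFDerivAt_pjL_nx hx y)).add ((hasFDerivAt_bb_pow hx y N).smul (hasFDerivAt_nx hx))
  refine h.congr_fderiv ?_
  ext1 v
  simp only [kerM, neg_apply, smul_apply,
    add_apply, tens_apply, ContinuousLinearMap.smulRight_apply,
    innerSL_apply_apply, smul_eq_mul]
  have h2 : N - 1 - 1 = N - 2 := by omega
  rw [h2]
  rcases N with _ | N
  · simp
  · push_cast
    module

theorem continuous_bb : Continuous fun z : Eucl n × Eucl n => bb z.1 z.2 := by
  unfold bb; fun_prop

theorem continuous_pjL : Continuous (pjL : Eucl n → Eucl n →L[ℝ] Eucl n) := by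
  unfold pjL
  refine continuous_const.sub ?_
  exact ((ContinuousLinearMap.smulRightL ℝ (Eucl n) (Eucl n)).continuous₂).comp
    ((innerSL ℝ).continuous.prodMk continuous_id)

theorem continuous_tens : Continuous fun z : Eucl n × Eucl n => tens z.1 z.2 := by
  unfold tens
  exact ((ContinuousLinearMap.smulRightL ℝ (Eucl n) (Eucl n)).continuous₂).comp
    (((innerSL ℝ).continuous.comp continuous_fst).prodMk continuous_snd)

theorem continuous_kerZ (N : ℕ) : Continuous fun z : Eucl n × Eucl n => kerZ N z.1 z.2 :=
  continuous_bb.pow N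

theorem continuous_pjL_apply : Continuous fun z : Eucl n × Eucl n => pjL z.1 z.2 :=
  (continuous_pjL.comp continuous_fst).clm_apply continuous_snd

theorem continuous_kerV (N : ℕ) : Continuous fun z : Eucl n × Eucl n => kerV N z.1 z.2 := by
  unfold kerV
  exact ((continuous_const.mul (continuous_bb.pow _)).smul continuous_pjL_apply).add
    ((continuous_bb.pow _).smul continuous_fst)

theorem continuous_kerM (N : ℕ) : Continuous fun z : Eucl n × Eucl n => kerM N z.1 z.2 := by
  unfold kerM
  refine ((continuous_const.mul (continuous_bb.pow _)).smul (continuous_tens.comp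
    (continuous_pjL_apply.prodMk continuous_pjL_apply))).add ?_
  exact ((continuous_bb.pow _).sub ((continuous_fst.inner continuous_snd).mul
    (continuous_const.mul (continuous_bb.pow _)))).smul (continuous_pjL.comp continuous_fst)

/-- Differentiation under the integral sign over the sphere. -/
theorem hasFDerivAt_integral_sph [Fact (2 ≤ n)] {V : Type} [NormedAddCommGroup V]
    [NormedSpace ℝ V] {F : Eucl n → Eucl n → V} {F' : Eucl n → Eucl n → Eucl n →L[ℝ] V}
    (hF : ContinuousOn (fun z : Eucl n × Eucl n => F z.1 z.2) ({0}ᶜ ×ˢ Set.univ))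
    (hF' : ContinuousOn (fun z : Eucl n × Eucl n => F' z.1 z.2) ({0}ᶜ ×ˢ Set.univ))
    (h : ∀ x ≠ 0, ∀ y : Sph n, HasFDerivAt (fun x => F x y) (F' x y) x) {g : Sph n → ℝ}
    (hg : Continuous g) {x : Eucl n} (hx : x ≠ 0) :
    HasFDerivAt (fun x => ∫ y, g y • F x y ∂(sig n)) (∫ y, g y • F' x y ∂(sig n)) x := by
  have hc : ∀ x : Eucl n, x ≠ 0 → Continuous fun y : Sph n => g y • F x y := fun x hx =>
    hg.smul (hF.comp_continuous (by fun_prop : Continuous fun y : Sph n => (x, (y : Eucl n)))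
      (fun y => ⟨hx, trivial⟩))
  have hc' : Continuous fun y : Sph n => g y • F' x y :=
    hg.smul (hF'.comp_continuous (by fun_prop : Continuous fun y : Sph n => (x, (y : Eucl n)))
      (fun y => ⟨hx, trivial⟩))
  have hx' : 0 < ‖x‖ := norm_pos_iff.2 hx
  have hball : ∀ z ∈ Metric.closedBall x (‖x‖ / 2), z ≠ 0 := by
    rintro z hz rfl
    rw [Metric.mem_closedBall, dist_zero_left] at hz
    linarith
  have hcomp : IsCompact (Metric.closedBall x (‖x‖ / 2) ×ˢ Metric.sphere (0 : Eucl n) 1) :=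
    (isCompact_closedBall _ _).prod (isCompact_sphere _ _)
  obtain ⟨C, hC⟩ := hcomp.exists_bound_of_continuousOn
    (hF'.mono (Set.prod_mono (fun z hz => hball z hz) (Set.subset_univ _)))
  obtain ⟨M, hM⟩ := (isCompact_univ : IsCompact (Set.univ : Set (Sph n))).exists_bound_of_continuousOn
    hg.continuousOn
  refine hasFDerivAt_integral_of_dominated_of_fderiv_le (F' := fun x y => g y • F' x y)
    (bound := fun _ => M * C) (Metric.ball_mem_nhds x (half_pos hx')) ?_ ?_ ?_ ?_ ?_ ?_
  · filter_upwards [Metric.ball_mem_nhds x (half_pos hx')] with z hz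
    exact (hc z (hball z (Metric.ball_subset_closedBall hz))).aestronglyMeasurable
  · exact (hc x hx).integrable_of_hasCompactSupport (HasCompactSupport.of_compactSpace _)
  · exact hc'.aestronglyMeasurable
  · refine Eventually.of_forall fun y z hz => ?_
    rw [norm_smul]
    have := hC (z, y) ⟨Metric.ball_subset_closedBall hz, y.2⟩
    have h2 := hM y trivial
    exact mul_le_mul h2 this (norm_nonneg _) ((norm_nonneg _).trans h2)
  · exact integrable_const _
  · refine Eventually.of_forall fun y z hz => ?_
    exact (h z (hball z (Metric.ball_subset_closedBall hz)) y).const_smul (g y)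

attribute [irreducible] kerZ kerV kerM pjL tens nx bb

end Kernels

section Moments

variable {n : ℕ}

/-- The trace as a continuous linear functional. -/
def trL (n : ℕ) : (Eucl n →L[ℝ] Eucl n) →L[ℝ] ℝ :=
  LinearMap.toContinuousLinearMap ((LinearMap.trace ℝ (Eucl n)).comp (ContinuousLinearMap.coeLM ℝ))

theorem trL_apply (A : Eucl n →L[ℝ] Eucl n) : trL n A = LinearMap.trace ℝ (Eucl n) A := rfl

theorem trL_tens (u v : Eucl n) : trL n (tens u v) = ⟪u, v⟫ := by
  rw [trL_apply, tens]
  exact LinearMap.trace_smulRight (R := ℝ) (M := Eucl n) (innerSL ℝ u : Eucl n →ₗ[ℝ] ℝ) v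

theorem trL_id : trL n (ContinuousLinearMap.id ℝ (Eucl n)) = n := by
  rw [trL_apply, ContinuousLinearMap.coe_id, LinearMap.trace_id]; simp

theorem trL_pjL {x : Eucl n} (hx : ‖x‖ = 1) : trL n (pjL x) = n - 1 := by
  have : pjL x = ContinuousLinearMap.id ℝ (Eucl n) - tens x x := by rw [pjL, tens]
  rw [this, map_sub, trL_id, trL_tens, real_inner_self_eq_norm_sq, hx]; norm_num

theorem inner_pjL_pjL {x : Eucl n} (hx : ‖x‖ = 1) (y : Eucl n) :
    ⟪pjL x y, pjL x y⟫ = ‖y‖ ^ 2 - ⟪x, y⟫ ^ 2 := by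
  simp only [pjL_apply, inner_sub_left, inner_sub_right, inner_smul_left, inner_smul_right,
    real_inner_self_eq_norm_sq, hx, RCLike.conj_to_real, real_inner_comm x y]
  ring

theorem integrable_sph {V : Type} [NormedAddCommGroup V]
    {F : Sph n → V} (hF : Continuous F) : Integrable F (sig n) := by
  have : IsFiniteMeasure (sig n) := by
    rw [sig]
    rcases eq_or_ne ((volume : Measure (Eucl n)).toSphere Set.univ) 0 with h | h
    · rw [Measure.measure_univ_eq_zero.1 h, smul_zero]; infer_instance
    · exact Measure.smul_finite _ (ENNReal.inv_ne_top.2 h)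
  exact hF.integrable_of_hasCompactSupport (HasCompactSupport.of_compactSpace _)

variable [hn : Fact (2 ≤ n)]

/-- The normalizing constants of the zonal kernels. -/
def cc (n : ℕ) [Fact (2 ≤ n)] (N : ℕ) : ℝ := ∫ y, kerZ N (baseP n : Eucl n) y ∂(sig n)

theorem integral_kerZ (N : ℕ) (x : Sph n) : ∫ y, kerZ N (x : Eucl n) y ∂(sig n) = cc n N := by
  obtain ⟨A, hA⟩ := exists_isometry_sph (baseP n) x
  rw [← integral_sphMap A, cc, ← hA]
  simp [kerZ, bb]

theorem continuousOn_nx : ContinuousOn (nx : Eucl n → Eucl n) {0}ᶜ := fun _ hx =>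
  (hasFDerivAt_nx hx).continuousAt.continuousWithinAt

theorem continuousOn_nx_fst :
    ContinuousOn (fun z : Eucl n × Eucl n => (nx z.1, z.2)) ({0}ᶜ ×ˢ Set.univ) :=
  (continuousOn_nx.comp continuousOn_fst fun _ hz => hz.1).prodMk continuousOn_snd

theorem integral_innerSL {F : Sph n → Eucl n} (hF : Continuous F) :
    ∫ y, innerSL ℝ (F y) ∂(sig n) = innerSL ℝ (∫ y, F y ∂(sig n)) := by
  exact ((innerSL ℝ : Eucl n →L⋆[ℝ] Eucl n →L[ℝ] ℝ)).integral_comp_comm (integrable_sph hF)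

variable {g : Sph n → ℝ}

/-- The zonal operator applied to `g`, extended homogeneously, has the expected gradient. -/
theorem hasFDerivAt_integral_kerZ (N : ℕ) (hg : Continuous g) {x : Eucl n} (hx : x ≠ 0) :
    HasFDerivAt (fun x => ‖x‖ * ∫ y, g y * kerZ N (nx x) y ∂(sig n))
      (innerSL ℝ (∫ y, g y • kerV N (nx x) y ∂(sig n))) x := by
  have h := hasFDerivAt_integral_sph
    (F := fun x y => ‖x‖ * kerZ N (nx x) y) (F' := fun x y => innerSL ℝ (kerV N (nx x) y))
    ((continuous_norm.comp continuous_fst).continuousOn.mul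
      ((continuous_kerZ N).comp_continuousOn continuousOn_nx_fst))
    ((innerSL ℝ).continuous.comp_continuousOn
      ((continuous_kerV N).comp_continuousOn continuousOn_nx_fst))
    (fun x hx y => hasFDerivAt_kerZ hx y N) hg hx
  have e : ∫ y, g y • innerSL ℝ (kerV N (nx x) y) ∂(sig n) =
      innerSL ℝ (∫ y, g y • kerV N (nx x) y ∂(sig n)) := by
    rw [← integral_innerSL]
    · refine integral_congr_ae (Eventually.of_forall fun y => ?_)
      simp
    · exact hg.smul ((continuous_kerV N).comp (by fun_prop : Continuous fun y : Sph n =>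
        (nx x, (y : Eucl n))))
  rw [e] at h
  refine h.congr_of_eventuallyEq (Eventually.of_forall fun z => ?_)
  simp only [smul_eq_mul]
  rw [← integral_const_mul]
  refine integral_congr_ae (Eventually.of_forall fun y => ?_)
  simp only; ring

theorem hasFDerivAt_integral_kerV (N : ℕ) (hg : Continuous g) {x : Eucl n} (hx : x ≠ 0) :
    HasFDerivAt (fun x => ∫ y, g y • kerV N (nx x) y ∂(sig n))
      (‖x‖⁻¹ • ∫ y, g y • kerM N (nx x) y ∂(sig n)) x := by
  have h := hasFDerivAt_integral_sph
    (F := fun x y => kerV N (nx x) y) (F' := fun x y => ‖x‖⁻¹ • kerM N (nx x) y)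
    ((continuous_kerV N).comp_continuousOn continuousOn_nx_fst)
    (((continuous_norm.comp continuous_fst).continuousOn.inv₀
        (fun z hz => norm_ne_zero_iff.2 hz.1)).smul
      ((continuous_kerM N).comp_continuousOn continuousOn_nx_fst))
    (fun x hx y => hasFDerivAt_kerV hx y N) hg hx
  refine h.congr_fderiv ?_
  rw [← integral_smul]
  refine integral_congr_ae (Eventually.of_forall fun y => ?_)
  simp only
  rw [smul_comm]

theorem Sph.ne_zero (x : Sph n) : (x : Eucl n) ≠ 0 := by
  intro h
  have := Sph.norm_eq x
  rw [h] at this; simp at this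

/-- The radial projection as a point of the sphere. -/
def nxS {x : Eucl n} (hx : x ≠ 0) : Sph n := ⟨nx x, by simpa using norm_nx hx⟩

theorem integral_kerV (N : ℕ) (x : Sph n) :
    ∫ y, kerV N (x : Eucl n) y ∂(sig n) = cc n N • (x : Eucl n) := by
  have h1 := hasFDerivAt_integral_kerZ (n := n) (g := fun _ => 1) N continuous_const (Sph.ne_zero x)
  have h2 : HasFDerivAt (fun x : Eucl n => ‖x‖ * cc n N) (cc n N • innerSL ℝ (nx (x : Eucl n)))
      (x : Eucl n) := (hasFDerivAt_norm' (Sph.ne_zero x)).mul_const _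
  have h3 : (fun z : Eucl n => ‖z‖ * ∫ y, (1 : ℝ) * kerZ N (nx z) y ∂(sig n)) =ᶠ[𝓝 (x : Eucl n)]
      fun z => ‖z‖ * cc n N := by
    filter_upwards [isOpen_ne.mem_nhds (Sph.ne_zero x)] with z hz
    simp only [one_mul]
    have h0 := integral_kerZ N (nxS hz)
    simp only [nxS] at h0
    rw [h0]
  have h4 := (h1.congr_of_eventuallyEq h3.symm).unique h2
  rw [nx_of_norm (Sph.norm_eq x)] at h4
  have h5 : cc n N • innerSL ℝ (x : Eucl n) = innerSL ℝ (cc n N • (x : Eucl n)) := by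
    simp
  rw [h5] at h4
  simpa using (innerSL_inj (𝕜 := ℝ)).1 h4

theorem integral_kerM (N : ℕ) (x : Sph n) :
    ∫ y, kerM N (x : Eucl n) y ∂(sig n) = cc n N • pjL (x : Eucl n) := by
  have h1 := hasFDerivAt_integral_kerV (n := n) (g := fun _ => 1) N continuous_const (Sph.ne_zero x)
  have h2 := (hasFDerivAt_nx (Sph.ne_zero x)).const_smul (cc n N)
  have h3 : (fun z : Eucl n => ∫ y, (1 : ℝ) • kerV N (nx z) y ∂(sig n)) =ᶠ[𝓝 (x : Eucl n)]
      cc n N • nx := by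
    filter_upwards [isOpen_ne.mem_nhds (Sph.ne_zero x)] with z hz
    simp only [one_smul]
    exact integral_kerV N (nxS hz)
  have h4 := (h1.congr_of_eventuallyEq h3.symm).unique h2
  rw [nx_of_norm (Sph.norm_eq x), Sph.norm_eq] at h4
  simpa using h4

/-- The eigenvalue-type numbers `N (N + n - 2)`. -/
def lam (n N : ℕ) : ℝ := N * (N + n - 2)

theorem trL_kerM (N : ℕ) (x y : Sph n) :
    trL n (kerM (N + 1) x y) = (N + 1) * (N + (n - 1) / 2) * kerZ N (x : Eucl n) y -
      (lam n (N + 1) - (n - 1)) * kerZ (N + 1) (x : Eucl n) y := by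
  simp only [kerM, map_add, map_smul, trL_tens, trL_pjL (Sph.norm_eq x),
    inner_pjL_pjL (Sph.norm_eq x), Sph.norm_eq y, kerZ, smul_eq_mul]
  have hs : ⟪(x : Eucl n), (y : Eucl n)⟫ = 2 * bb (x : Eucl n) y - 1 := by unfold bb; ring
  rw [hs]
  generalize bb (x : Eucl n) y = b
  rcases N with _ | N
  · simp [lam]; ring
  · have h2 : N + 1 + 1 - 2 = N := by omega
    have h1 : N + 1 + 1 - 1 = N + 1 := by omega
    rw [h2, h1, lam]
    push_cast
    ring

theorem continuous_kerZ_sph (N : ℕ) (x : Eucl n) : Continuous fun y : Sph n => kerZ N x y :=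
  (continuous_kerZ N).comp (by fun_prop : Continuous fun y : Sph n => (x, (y : Eucl n)))
theorem continuous_kerV_sph (N : ℕ) (x : Eucl n) : Continuous fun y : Sph n => kerV N x y :=
  (continuous_kerV N).comp (by fun_prop : Continuous fun y : Sph n => (x, (y : Eucl n)))
theorem continuous_kerM_sph (N : ℕ) (x : Eucl n) : Continuous fun y : Sph n => kerM N x y :=
  (continuous_kerM N).comp (by fun_prop : Continuous fun y : Sph n => (x, (y : Eucl n)))

theorem cc_zero : cc n 0 = 1 := by simp [cc, kerZ]

theorem cc_rec (N : ℕ) :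
    cc n (N + 1) * (2 * (N + n - 1)) = cc n N * (2 * N + n - 1) := by
  have hn2 := hn.out
  have x := baseP n
  have h := congrArg (trL n) (integral_kerM (N + 1) x)
  rw [← (trL n).integral_comp_comm (integrable_sph (continuous_kerM_sph _ _)), map_smul,
    trL_pjL (Sph.norm_eq x)] at h
  simp only [trL_kerM] at h
  rw [integral_sub ((integrable_sph (continuous_kerZ_sph _ _)).const_mul _)
    ((integrable_sph (continuous_kerZ_sph _ _)).const_mul _), integral_const_mul,
    integral_const_mul, integral_kerZ, integral_kerZ, lam] at h
  push_cast at h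
  have hN : (0 : ℝ) < N + 1 := by positivity
  simp only [smul_eq_mul] at h
  have : (N + 1 : ℝ) * (cc n (N + 1) * (2 * (N + n - 1)) - cc n N * (2 * N + n - 1)) = 0 := by
    linarith
  rcases mul_eq_zero.1 this with h' | h'
  · linarith
  · linarith

theorem cc_pos (N : ℕ) : 0 < cc n N := by
  have hn2 : (2 : ℝ) ≤ n := by exact_mod_cast hn.out
  induction N with
  | zero => rw [cc_zero]; norm_num
  | succ N ih =>
    have h := cc_rec (n := n) N
    have hN : (0 : ℝ) ≤ N := by positivity
    have : 0 < cc n (N + 1) * (2 * (N + n - 1)) := by rw [h]; apply mul_pos ih; linarith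
    exact pos_of_mul_pos_left this (by linarith)

theorem cc_le_two_mul (N : ℕ) : cc n N ≤ 2 * cc n (N + 1) := by
  have hn2 : (2 : ℝ) ≤ n := by exact_mod_cast hn.out
  have h := cc_rec (n := n) N
  have h1 := cc_pos (n := n) N
  have h2 := cc_pos (n := n) (N + 1)
  have hN : (0 : ℝ) ≤ N := by positivity
  by_contra hc
  push Not at hc
  nlinarith [mul_pos h2 (show (0 : ℝ) < n - 1 by linarith)]

end Moments

section KernelBounds

variable {n : ℕ}

theorem inner_sph (x y : Sph n) : ⟪(x : Eucl n), (y : Eucl n)⟫ = 2 * bb (x : Eucl n) y - 1 := by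
  unfold bb; ring

theorem abs_inner_sph_le (x y : Sph n) : |⟪(x : Eucl n), (y : Eucl n)⟫| ≤ 1 := by
  have := abs_real_inner_le_norm (x : Eucl n) (y : Eucl n)
  rwa [Sph.norm_eq, Sph.norm_eq, one_mul] at this

theorem bb_nonneg (x y : Sph n) : 0 ≤ bb (x : Eucl n) y := by
  have := abs_le.1 (abs_inner_sph_le x y)
  rw [inner_sph] at this; linarith [this.1]

theorem bb_le_one (x y : Sph n) : bb (x : Eucl n) y ≤ 1 := by
  have := abs_le.1 (abs_inner_sph_le x y)
  rw [inner_sph] at this; linarith [this.2]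

theorem dist_sq_sph (x y : Sph n) : dist x y ^ 2 = 4 * (1 - bb (x : Eucl n) y) := by
  rw [Subtype.dist_eq, dist_eq_norm, norm_sub_sq_real, Sph.norm_eq, Sph.norm_eq, inner_sph]
  ring

theorem dist_sph_le_two (x y : Sph n) : dist x y ≤ 2 := by
  have h := dist_sq_sph x y
  have := bb_nonneg x y
  nlinarith [dist_nonneg (x := x) (y := y)]

theorem continuous_bb_sph (x : Sph n) : Continuous fun y : Sph n => bb (x : Eucl n) y :=
  continuous_bb.comp (by fun_prop : Continuous fun y : Sph n => ((x : Eucl n), (y : Eucl n)))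

/-- The square root of `N + 1`, the inverse length scale of the `N`-th kernel. -/
def th (N : ℕ) : ℝ := √(N + 1)

theorem th_sq (N : ℕ) : th N ^ 2 = N + 1 := Real.sq_sqrt (by positivity)

theorem one_le_th (N : ℕ) : 1 ≤ th N := by
  rw [th, Real.one_le_sqrt]; simp

theorem th_pos (N : ℕ) : 0 < th N := lt_of_lt_of_le one_pos (one_le_th N)

variable [hn : Fact (2 ≤ n)]

theorem cc_second_difference (M : ℕ) :
    (M + 1 : ℝ) ^ 2 * (cc n M - 2 * cc n (M + 1) + cc n (M + 2)) ≤ n ^ 2 * cc n M := by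
  have hn2 : (2 : ℝ) ≤ n := by exact_mod_cast hn.out
  have h1 := cc_rec (n := n) M
  have h2 := cc_rec (n := n) (M + 1)
  have h0 := cc_pos (n := n) M
  have hM : (0 : ℝ) ≤ M := by positivity
  push_cast at h2
  have e1 : cc n (M + 1) = cc n M * (1 - (n - 1) / (2 * (M + n - 1))) := by
    have : (0 : ℝ) < M + n - 1 := by linarith
    field_simp
    linarith
  have e2 : cc n (M + 2) = cc n (M + 1) * (1 - (n - 1) / (2 * (M + n))) := by
    have : (0 : ℝ) < M + n := by linarith
    field_simp
    linarith
  have e3 : cc n M - 2 * cc n (M + 1) + cc n (M + 2) = cc n M *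
      (((n - 1) / 2 + (n - 1) ^ 2 / 4) / ((M + n - 1) * (M + n))) := by
    rw [e2, e1]
    have h3 : (0 : ℝ) < M + n := by linarith
    have h4 : (0 : ℝ) < M + n - 1 := by linarith
    field_simp
    ring
  rw [e3]
  have h3 : (0 : ℝ) < M + n := by linarith
  have h4 : (0 : ℝ) < M + n - 1 := by linarith
  have h5 : (M + 1 : ℝ) ^ 2 * (((n - 1) / 2 + (n - 1) ^ 2 / 4) / ((M + n - 1) * (M + n))) ≤
      n ^ 2 := by
    rw [mul_div_assoc', div_le_iff₀ (by positivity)]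
    have h6 : (M + 1 : ℝ) ^ 2 ≤ (M + n - 1) * (M + n) := by nlinarith
    have h7 : ((n : ℝ) - 1) / 2 + (n - 1) ^ 2 / 4 ≤ n ^ 2 := by nlinarith
    have h8 : (0 : ℝ) ≤ ((n : ℝ) - 1) / 2 + (n - 1) ^ 2 / 4 := by
      have : (0 : ℝ) ≤ n - 1 := by linarith
      positivity
    calc _ ≤ ((M + n - 1) * (M + n)) * (n : ℝ) ^ 2 := by gcongr
      _ = _ := by ring
  calc _ = cc n M * ((M + 1 : ℝ) ^ 2 *
        (((n - 1) / 2 + (n - 1) ^ 2 / 4) / ((M + n - 1) * (M + n)))) := by ring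
    _ ≤ cc n M * n ^ 2 := by gcongr
    _ = _ := by ring

theorem cc_sub_three_le (N : ℕ) : cc n (N - 3) ≤ 8 * cc n N := by
  have h (N) := cc_le_two_mul (n := n) N
  have h' (N) := cc_pos (n := n) N
  rcases N with _ | _ | _ | N
  · simp only [zero_tsub]; linarith [h' 0]
  · norm_num; linarith [h 0, h' 1]
  · norm_num; linarith [h 0, h 1, h' 2]
  · have e : N + 1 + 1 + 1 - 3 = N := by omega
    rw [e]
    linarith [h N, h (N + 1), h (N + 2)]

theorem integrable_pow_bb (N : ℕ) (x : Sph n) :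
    Integrable (fun y : Sph n => bb (x : Eucl n) y ^ N) (sig n) :=
  integrable_sph ((continuous_bb_sph x).pow N)

theorem integral_pow_bb (N : ℕ) (x : Sph n) :
    ∫ y : Sph n, bb (x : Eucl n) y ^ N ∂(sig n) = cc n N := by
  rw [← integral_kerZ N x]; simp [kerZ]

theorem integral_sq_mul_pow_bb (M : ℕ) (x : Sph n) :
    ∫ y : Sph n, (1 - bb (x : Eucl n) y) ^ 2 * bb (x : Eucl n) y ^ M ∂(sig n) =
      cc n M - 2 * cc n (M + 1) + cc n (M + 2) := by
  have i0 := integrable_pow_bb M x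
  have i1 := (integrable_pow_bb (M + 1) x).const_mul 2
  have i2 := integrable_pow_bb (M + 2) x
  have i3 : Integrable (fun y : Sph n => bb (x : Eucl n) y ^ M - 2 * bb (x : Eucl n) y ^ (M + 1))
      (sig n) := i0.sub i1
  calc _ = ∫ y : Sph n, (bb (x : Eucl n) y ^ M - 2 * bb (x : Eucl n) y ^ (M + 1) +
        bb (x : Eucl n) y ^ (M + 2)) ∂(sig n) := by
        congr 1; ext y; ring
    _ = _ := by
        rw [integral_add i3 i2, integral_sub i0 i1, integral_const_mul]
        simp only [integral_pow_bb]

/-- The constant in the fourth moment bound. -/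
def momC (n : ℕ) : ℝ := 64 * (1 + 256 * n ^ 2)

theorem integral_moment_le (N : ℕ) (x : Sph n) :
    ∫ y : Sph n, (1 + th N * dist x y) ^ 4 * bb (x : Eucl n) y ^ (N - 3) ∂(sig n) ≤
      momC n * cc n N := by
  set M := N - 3 with hM
  have hNM : (N + 1 : ℝ) ≤ 4 * (M + 1) := by
    have : N + 1 ≤ 4 * (M + 1) := by omega
    exact_mod_cast this
  have c := continuous_bb_sph x
  have i0 : Integrable (fun y : Sph n => 8 * bb (x : Eucl n) y ^ M) (sig n) :=
    integrable_sph (by fun_prop)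
  have i1 : Integrable (fun y : Sph n => 128 * (N + 1 : ℝ) ^ 2 *
      ((1 - bb (x : Eucl n) y) ^ 2 * bb (x : Eucl n) y ^ M)) (sig n) :=
    integrable_sph (by fun_prop)
  have hint : ∫ y : Sph n, (8 * bb (x : Eucl n) y ^ M + 128 * (N + 1 : ℝ) ^ 2 *
      ((1 - bb (x : Eucl n) y) ^ 2 * bb (x : Eucl n) y ^ M)) ∂(sig n) =
      8 * cc n M + 128 * (N + 1 : ℝ) ^ 2 * (cc n M - 2 * cc n (M + 1) + cc n (M + 2)) := by
    rw [integral_add i0 i1, integral_const_mul, integral_const_mul, integral_sq_mul_pow_bb,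
      integral_pow_bb]
  have hle : ∫ y : Sph n, (1 + th N * dist x y) ^ 4 * bb (x : Eucl n) y ^ M ∂(sig n) ≤
      ∫ y : Sph n, (8 * bb (x : Eucl n) y ^ M + 128 * (N + 1 : ℝ) ^ 2 *
      ((1 - bb (x : Eucl n) y) ^ 2 * bb (x : Eucl n) y ^ M)) ∂(sig n) := by
    refine integral_mono (integrable_sph (by fun_prop)) (i0.add i1) fun y => ?_
    have hb := bb_nonneg x y
    have hd := dist_sq_sph x y
    have ht : (th N * dist x y) ^ 4 = 16 * (N + 1 : ℝ) ^ 2 * (1 - bb (x : Eucl n) y) ^ 2 := by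
      calc _ = (th N ^ 2) ^ 2 * (dist x y ^ 2) ^ 2 := by ring
        _ = _ := by rw [th_sq, hd]; ring
    have h8 : (1 + th N * dist x y) ^ 4 ≤ 8 * (1 + (th N * dist x y) ^ 4) := by
      generalize th N * dist x y = t
      nlinarith [sq_nonneg (t - 1), sq_nonneg (t ^ 2 - 1), sq_nonneg (t ^ 2 - t),
        sq_nonneg (t + 1), mul_nonneg (sq_nonneg (t - 1)) (sq_nonneg (t - 1)),
        mul_nonneg (sq_nonneg (t - 1)) (sq_nonneg (t + 1)), mul_nonneg (sq_nonneg (t - 1)) (sq_nonneg t)]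
    rw [ht] at h8
    calc _ ≤ 8 * (1 + 16 * (N + 1 : ℝ) ^ 2 * (1 - bb (x : Eucl n) y) ^ 2) *
          bb (x : Eucl n) y ^ M := by gcongr
      _ = _ := by ring
  refine hle.trans ?_
  rw [hint]
  have h1 := cc_second_difference (n := n) M
  have h2 := cc_sub_three_le (n := n) N
  rw [← hM] at h2
  have h3 := cc_pos (n := n) M
  have hpos : 0 ≤ cc n M - 2 * cc n (M + 1) + cc n (M + 2) := by
    rw [← integral_sq_mul_pow_bb M x]
    refine integral_nonneg fun y => ?_
    have hb := bb_nonneg x y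
    simp only [Pi.zero_apply]
    positivity
  have h4 : (N + 1 : ℝ) ^ 2 * (cc n M - 2 * cc n (M + 1) + cc n (M + 2)) ≤ 16 * (n ^ 2 * cc n M) := by
    calc _ ≤ (4 * (M + 1 : ℝ)) ^ 2 * (cc n M - 2 * cc n (M + 1) + cc n (M + 2)) := by gcongr
      _ = 16 * ((M + 1 : ℝ) ^ 2 * (cc n M - 2 * cc n (M + 1) + cc n (M + 2))) := by ring
      _ ≤ _ := by gcongr
  have h5 : (8 + 2048 * n ^ 2 : ℝ) * cc n M ≤ (8 + 2048 * n ^ 2 : ℝ) * (8 * cc n N) := by gcongr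
  rw [momC]
  linarith

end KernelBounds

section KernelBounds

variable {n : ℕ}

theorem tens_sub_tens (u v : Eucl n) : tens u u - tens v v = tens (u - v) u + tens v (u - v) := by
  ext1 w
  simp only [sub_apply, add_apply, tens_apply, inner_sub_left]
  module

theorem norm_tens_sub_tens_le (u v : Eucl n) :
    ‖tens u u - tens v v‖ ≤ ‖u - v‖ * (‖u‖ + ‖v‖) := by
  rw [tens_sub_tens]
  refine (norm_add_le _ _).trans ?_
  nlinarith [norm_tens_le (u - v) u, norm_tens_le v (u - v)]

theorem norm_pjL_sub_le (x y : Sph n) : ‖pjL (x : Eucl n) - pjL (y : Eucl n)‖ ≤ 2 * dist x y := by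
  have : pjL (x : Eucl n) - pjL (y : Eucl n) = tens (y : Eucl n) y - tens (x : Eucl n) x := by
    ext1 w; simp only [sub_apply, pjL_apply, tens_apply]; abel
  rw [this]
  refine (norm_tens_sub_tens_le _ _).trans ?_
  rw [Sph.norm_eq, Sph.norm_eq, ← dist_eq_norm, ← Subtype.dist_eq, dist_comm]
  linarith

theorem norm_pjL_apply_le (x y : Sph n) : ‖pjL (x : Eucl n) y‖ ≤ dist x y := by
  have h := inner_pjL_pjL (Sph.norm_eq x) y
  rw [real_inner_self_eq_norm_sq, Sph.norm_eq, inner_sph] at h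
  have h2 := dist_sq_sph x y
  have h3 := bb_nonneg x y
  have h4 := bb_le_one x y
  refine abs_le_of_sq_le_sq' ?_ dist_nonneg |>.2
  nlinarith [mul_nonneg h3 (sub_nonneg.2 h4)]

theorem norm_pjL_le (x : Sph n) : ‖pjL (x : Eucl n)‖ ≤ 2 := by
  have : pjL (x : Eucl n) = ContinuousLinearMap.id ℝ (Eucl n) - tens x x := by rw [pjL, tens]
  rw [this]
  refine (norm_sub_le _ _).trans ?_
  have h1 := ContinuousLinearMap.norm_id_le (𝕜 := ℝ) (E := Eucl n)
  have h2 := norm_tens_le (x : Eucl n) x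
  rw [Sph.norm_eq] at h2
  linarith

theorem abs_bb_sub_le (x₁ x₂ y : Sph n) :
    |bb (x₁ : Eucl n) y - bb (x₂ : Eucl n) y| ≤ dist x₁ x₂ * (dist x₁ y + dist x₂ y) / 4 := by
  have h1 := dist_sq_sph x₁ y
  have h2 := dist_sq_sph x₂ y
  have e : bb (x₁ : Eucl n) y - bb (x₂ : Eucl n) y =
      (dist x₂ y - dist x₁ y) * (dist x₁ y + dist x₂ y) / 4 := by
    linear_combination (1 / 4 : ℝ) * h1 - (1 / 4 : ℝ) * h2
  rw [e, abs_div, abs_mul, abs_of_pos (by norm_num : (0 : ℝ) < 4),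
    abs_of_nonneg (add_nonneg dist_nonneg dist_nonneg)]
  have h3 : |dist x₂ y - dist x₁ y| ≤ dist x₁ x₂ := by
    rw [dist_comm x₁ x₂]; exact abs_dist_sub_le x₂ x₁ y
  have : (0 : ℝ) ≤ dist x₁ y + dist x₂ y := add_nonneg dist_nonneg dist_nonneg
  gcongr

theorem abs_pow_sub_pow_le_of_le_one {a b : ℝ} (ha : 0 ≤ a) (ha1 : a ≤ 1) (hb : 0 ≤ b) (hb1 : b ≤ 1) {j m : ℕ}
    (hj : m ≤ j - 1) : |a ^ j - b ^ j| ≤ j * |a - b| * (a ^ m + b ^ m) := by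
  have h : |a ^ j - b ^ j| ≤ |a - b| * j * max |a| |b| ^ (j - 1) := abs_pow_sub_pow_le a b j
  rw [abs_of_nonneg ha, abs_of_nonneg hb] at h
  have h2 : max a b ^ (j - 1) ≤ a ^ m + b ^ m := by
    rcases max_cases a b with ⟨e, -⟩ | ⟨e, -⟩ <;> rw [e]
    · exact (pow_le_pow_of_le_one ha ha1 hj).trans (by linarith [pow_nonneg hb m])
    · exact (pow_le_pow_of_le_one hb hb1 hj).trans (by linarith [pow_nonneg ha m])
  calc _ ≤ _ := h
    _ ≤ |a - b| * j * (a ^ m + b ^ m) := by gcongr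
    _ = _ := by ring

/-- The envelope controlling the increments of the kernels. -/
def env (N : ℕ) (x₁ x₂ y : Sph n) : ℝ :=
  (1 + th N * dist x₁ y) ^ 3 * bb (x₁ : Eucl n) y ^ (N - 3) +
    (1 + th N * dist x₂ y) ^ 3 * bb (x₂ : Eucl n) y ^ (N - 3)

/-- A family of kernels of order `k` at scale `1 / th N`. -/
structure KerBound {V : Type} [NormedAddCommGroup V] [NormedSpace ℝ V] (k : ℕ)
    (K : ℕ → Sph n → Sph n → V) (P : Sph n → V) (C : ℝ) : Prop where
  bound : ∀ N x y, ‖K N x y‖ ≤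
    C * (th N ^ k * ((1 + th N * dist x y) ^ 2 * bb (x : Eucl n) y ^ (N - 3)))
  lip : ∀ N x₁ x₂ y, th N * dist x₁ x₂ ≤ 1 →
    ‖K N x₁ y - K N x₂ y‖ ≤ C * (th N ^ k * (th N * dist x₁ x₂) * env N x₁ x₂ y)
  cont : ∀ N x, Continuous (K N x)
  normP : ∀ x, ‖P x‖ ≤ C
  lipP : ∀ x₁ x₂, ‖P x₁ - P x₂‖ ≤ C * dist x₁ x₂

section Aux

variable (N : ℕ) (x₁ x₂ y : Sph n)

theorem pow_bb_le {j : ℕ} (hj : N - 3 ≤ j) (x : Sph n) :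
    bb (x : Eucl n) y ^ j ≤ bb (x : Eucl n) y ^ (N - 3) :=
  pow_le_pow_of_le_one (bb_nonneg x y) (bb_le_one x y) hj

variable {N x₁ x₂}

theorem scale_le_two_mul (hr : th N * dist x₁ x₂ ≤ 1) : 1 + th N * dist x₁ y ≤ 2 * (1 + th N * dist x₂ y) := by
  have h := dist_triangle x₁ x₂ y
  have h2 : 0 ≤ th N * dist x₂ y := mul_nonneg (th_pos N).le dist_nonneg
  nlinarith [mul_le_mul_of_nonneg_left h (th_pos N).le]

theorem env_facts (hr : th N * dist x₁ x₂ ≤ 1) {j : ℕ} (hj : N - 3 ≤ j - 1)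
    (hjN : j ≤ N) :
    (1 + th N * dist x₁ y) ^ 2 * |bb (x₁ : Eucl n) y ^ j - bb (x₂ : Eucl n) y ^ j| ≤
      4 * (th N * dist x₁ x₂) * env N x₁ x₂ y := by
  have h := abs_pow_sub_pow_le_of_le_one (bb_nonneg x₁ y) (bb_le_one x₁ y) (bb_nonneg x₂ y) (bb_le_one x₂ y) hj
  have hb := abs_bb_sub_le x₁ x₂ y
  have t12 := scale_le_two_mul y hr
  have t21 := scale_le_two_mul y (N := N) (x₁ := x₂) (x₂ := x₁) (by rwa [dist_comm])
  have β1 := pow_nonneg (bb_nonneg x₁ y) (N - 3)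
  have β2 := pow_nonneg (bb_nonneg x₂ y) (N - 3)
  rw [env]
  have hth := th_pos N
  have hd1 := dist_nonneg (x := x₁) (y := y)
  have hd2 := dist_nonneg (x := x₂) (y := y)
  have hd := dist_nonneg (x := x₁) (y := x₂)
  have hjN' : (j : ℝ) ≤ th N ^ 2 := by
    rw [th_sq]; have : (j : ℝ) ≤ N := by exact_mod_cast hjN
    linarith
  set r := dist x₁ x₂
  set ρ₁ := th N * dist x₁ y with hρ1
  set ρ₂ := th N * dist x₂ y with hρ2
  have p1 : 0 ≤ ρ₁ := by positivity
  have p2 : 0 ≤ ρ₂ := by positivity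
  set B1 := bb (x₁ : Eucl n) y ^ (N - 3)
  set B2 := bb (x₂ : Eucl n) y ^ (N - 3)
  have h3 : |bb (x₁ : Eucl n) y ^ j - bb (x₂ : Eucl n) y ^ j| ≤
      th N * r * ((1 + ρ₁) * B1 + (1 + ρ₂) * B2) := by
    calc _ ≤ _ := h
      _ ≤ th N ^ 2 * (r * (dist x₁ y + dist x₂ y) / 4) * (B1 + B2) := by gcongr
      _ = th N * r * ((ρ₁ + ρ₂) / 4 * (B1 + B2)) := by rw [hρ1, hρ2]; ring
      _ ≤ th N * r * ((1 + ρ₁) * B1 + (1 + ρ₂) * B2) := by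
          gcongr
          nlinarith
  have h4 : (1 + ρ₁) ^ 2 ≤ 4 * (1 + ρ₂) ^ 2 := by nlinarith
  calc _ ≤ (1 + ρ₁) ^ 2 * (th N * r * ((1 + ρ₁) * B1 + (1 + ρ₂) * B2)) := by gcongr
    _ = th N * r * ((1 + ρ₁) ^ 3 * B1 + (1 + ρ₁) ^ 2 * ((1 + ρ₂) * B2)) := by ring
    _ ≤ th N * r * (4 * ((1 + ρ₁) ^ 3 * B1) + 4 * (1 + ρ₂) ^ 2 * ((1 + ρ₂) * B2)) := by
        have h5 : 0 ≤ (1 + ρ₁) ^ 3 * B1 := by positivity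
        have h6 : (1 + ρ₁) ^ 2 * ((1 + ρ₂) * B2) ≤ 4 * (1 + ρ₂) ^ 2 * ((1 + ρ₂) * B2) := by gcongr
        exact mul_le_mul_of_nonneg_left (by linarith) (by positivity)
    _ = _ := by ring

theorem env_ge :
    (1 + th N * dist x₂ y) * bb (x₂ : Eucl n) y ^ (N - 3) ≤ env N x₁ x₂ y := by
  rw [env]
  have β1 := pow_nonneg (bb_nonneg x₁ y) (N - 3)
  have β2 := pow_nonneg (bb_nonneg x₂ y) (N - 3)
  have p1 : 0 ≤ th N * dist x₁ y := mul_nonneg (th_pos N).le dist_nonneg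
  have p2 : 0 ≤ th N * dist x₂ y := mul_nonneg (th_pos N).le dist_nonneg
  have h : (1 + th N * dist x₂ y) ≤ (1 + th N * dist x₂ y) ^ 3 := by
    apply le_self_pow₀ <;> [linarith; norm_num]
  have : 0 ≤ (1 + th N * dist x₁ y) ^ 3 * bb (x₁ : Eucl n) y ^ (N - 3) := by positivity
  nlinarith [mul_le_mul_of_nonneg_right h β2]

theorem abs_sub_pow_le_env (hr : th N * dist x₁ x₂ ≤ 1) {j : ℕ} (hj : N - 3 ≤ j - 1)
    (hjN : j ≤ N) :
    |bb (x₁ : Eucl n) y ^ j - bb (x₂ : Eucl n) y ^ j| ≤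
      4 * (th N * dist x₁ x₂) * env N x₁ x₂ y := by
  refine le_trans ?_ (env_facts y hr hj hjN)
  apply le_mul_of_one_le_left (abs_nonneg _)
  have p1 : 0 ≤ th N * dist x₁ y := mul_nonneg (th_pos N).le dist_nonneg
  apply one_le_pow₀; linarith

end Aux

theorem natCast_le_th_sq (N : ℕ) : (N : ℝ) ≤ th N ^ 2 := by rw [th_sq]; linarith

theorem natCast_mul_sub_one_nonneg (N : ℕ) : (0 : ℝ) ≤ N * (N - 1) := by
  rcases N with _ | N
  · simp
  · push_cast; ring_nf; positivity

theorem natCast_mul_sub_one_le (N : ℕ) : (N : ℝ) * (N - 1) ≤ th N ^ 4 := by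
  have : th N ^ 4 = (N + 1 : ℝ) ^ 2 := by rw [← th_sq]; ring
  rw [this]
  have : (0 : ℝ) ≤ N := by positivity
  nlinarith

theorem env_nonneg (N : ℕ) (x₁ x₂ y : Sph n) : 0 ≤ env N x₁ x₂ y := by
  rw [env]
  have β1 := bb_nonneg x₁ y
  have β2 := bb_nonneg x₂ y
  have := th_pos N
  positivity

variable [hn : Fact (2 ≤ n)]

theorem kerBound_kerZ :
    KerBound 0 (fun N (x y : Sph n) => kerZ N (x : Eucl n) y) (fun _ => 1) 4 where
  bound N x y := by
    have h := pow_bb_le N y (by omega : N - 3 ≤ N) x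
    have hb := bb_nonneg x y
    have := th_pos N
    rw [kerZ, Real.norm_of_nonneg (by positivity), pow_zero, one_mul]
    have h2 : 1 ≤ (1 + th N * dist x y) ^ 2 := by
      apply one_le_pow₀
      have : 0 ≤ th N * dist x y := by positivity
      linarith
    have h3 : 0 ≤ bb (x : Eucl n) y ^ (N - 3) := by positivity
    nlinarith
  lip N x₁ x₂ y hr := by
    simp only [kerZ, pow_zero, Real.norm_eq_abs]
    rw [one_mul, ← mul_assoc]
    rcases N with _ | N
    · simp only [pow_zero, sub_self, abs_zero]
      have := env_nonneg 0 x₁ x₂ y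
      have := th_pos 0
      positivity
    · exact abs_sub_pow_le_env y hr (by omega) le_rfl
  cont N x := continuous_kerZ_sph N (x : Eucl n)
  normP x := by norm_num
  lipP x₁ x₂ := by simp

theorem kerBound_kerV :
    KerBound 1 (fun N (x y : Sph n) => kerV N (x : Eucl n) y) (fun x => (x : Eucl n)) 20 where
  bound N x y := by
    have h0 := pow_bb_le N y (by omega : N - 3 ≤ N) x
    have h1 := pow_bb_le N y (by omega : N - 3 ≤ N - 1) x
    have hb := bb_nonneg x y
    have ht := one_le_th N
    have hp := norm_pjL_apply_le x y
    have hN := natCast_le_th_sq N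
    rw [kerV]
    refine (norm_add_le _ _).trans ?_
    rw [norm_smul, norm_smul, Sph.norm_eq, Real.norm_of_nonneg (by positivity),
      Real.norm_of_nonneg (by positivity), mul_one, pow_one]
    have hρ : 0 ≤ th N * dist x y := mul_nonneg (by linarith) dist_nonneg
    have hβ : 0 ≤ bb (x : Eucl n) y ^ (N - 3) := by positivity
    have e1 : N / 2 * bb (x : Eucl n) y ^ (N - 1) * ‖pjL (x : Eucl n) y‖ ≤
        th N ^ 2 / 2 * bb (x : Eucl n) y ^ (N - 3) * dist x y := by gcongr
    have e2 : bb (x : Eucl n) y ^ N ≤ th N * bb (x : Eucl n) y ^ (N - 3) := by nlinarith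
    have e3 : th N ^ 2 / 2 * bb (x : Eucl n) y ^ (N - 3) * dist x y =
      (th N * bb (x : Eucl n) y ^ (N - 3)) * ((th N * dist x y) / 2) := by ring
    have e4 : 0 ≤ th N * bb (x : Eucl n) y ^ (N - 3) := by positivity
    have e5 : (th N * dist x y) / 2 + 1 ≤ 20 * (1 + th N * dist x y) ^ 2 := by nlinarith
    calc _ ≤ (th N * bb (x : Eucl n) y ^ (N - 3)) * ((th N * dist x y) / 2 + 1) := by linarith
      _ ≤ (th N * bb (x : Eucl n) y ^ (N - 3)) * (20 * (1 + th N * dist x y) ^ 2) := by gcongr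
      _ = _ := by ring
  lip N x₁ x₂ y hr := by
    have ht := one_le_th N
    have hN := natCast_le_th_sq N
    have hp := norm_pjL_apply_le x₁ y
    have hp' : ‖pjL (x₁ : Eucl n) y - pjL (x₂ : Eucl n) y‖ ≤ 2 * dist x₁ x₂ := by
      have := (pjL (x₁ : Eucl n) - pjL (x₂ : Eucl n)).le_of_opNorm_le (norm_pjL_sub_le x₁ x₂) y
      rwa [Sph.norm_eq, mul_one] at this
    have hx : ‖(x₁ : Eucl n) - x₂‖ = dist x₁ x₂ := by rw [Subtype.dist_eq, dist_eq_norm]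
    have q2 := env_ge (N := N) (x₁ := x₁) (x₂ := x₂) y
    have hQ := env_nonneg N x₁ x₂ y
    have b2 := bb_nonneg x₂ y
    have r0 : 0 ≤ dist x₁ x₂ := dist_nonneg
    have c1 := pow_bb_le N y (by omega : N - 3 ≤ N) x₂
    have c2 := pow_bb_le N y (by omega : N - 3 ≤ N - 1) x₂
    have p2 : 0 ≤ th N * dist x₂ y := mul_nonneg (by linarith) dist_nonneg
    have p1 : 0 ≤ th N * dist x₁ y := mul_nonneg (by linarith) dist_nonneg
    have hβ : 0 ≤ bb (x₂ : Eucl n) y ^ (N - 3) := by positivity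
    have c3 : bb (x₂ : Eucl n) y ^ (N - 3) ≤ env N x₁ x₂ y := by nlinarith
    have f1 := env_facts y hr (j := N - 1) (by omega) (by omega)
    have f0 := abs_sub_pow_le_env y hr (j := N) (by omega) le_rfl
    have e : kerV N (x₁ : Eucl n) y - kerV N (x₂ : Eucl n) y =
        (N / 2 * (bb (x₁ : Eucl n) y ^ (N - 1) - bb (x₂ : Eucl n) y ^ (N - 1))) • pjL (x₁ : Eucl n) y +
        (N / 2 * bb (x₂ : Eucl n) y ^ (N - 1)) • (pjL (x₁ : Eucl n) y - pjL (x₂ : Eucl n) y) +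
        (bb (x₁ : Eucl n) y ^ N - bb (x₂ : Eucl n) y ^ N) • (x₁ : Eucl n) +
        bb (x₂ : Eucl n) y ^ N • ((x₁ : Eucl n) - x₂) := by
      rw [kerV, kerV]; module
    rw [e]
    refine norm_add₄_le.trans ?_
    rw [norm_smul, norm_smul, norm_smul, norm_smul, Sph.norm_eq, hx, pow_one,
      Real.norm_of_nonneg (show 0 ≤ (N : ℝ) / 2 * bb (x₂ : Eucl n) y ^ (N - 1) by positivity),
      Real.norm_of_nonneg (show 0 ≤ bb (x₂ : Eucl n) y ^ N by positivity), norm_mul,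
      Real.norm_of_nonneg (show 0 ≤ (N : ℝ) / 2 by positivity), Real.norm_eq_abs, Real.norm_eq_abs]
    set D1 := |bb (x₁ : Eucl n) y ^ (N - 1) - bb (x₂ : Eucl n) y ^ (N - 1)|
    set D0 := |bb (x₁ : Eucl n) y ^ N - bb (x₂ : Eucl n) y ^ N|
    set r := dist x₁ x₂
    set E := env N x₁ x₂ y
    have hD1 : 0 ≤ D1 := abs_nonneg _
    have t0 := th_pos N
    have T0 : 0 ≤ th N * r * E := by positivity
    have T1 : N / 2 * D1 * ‖pjL (x₁ : Eucl n) y‖ ≤ 2 * (th N * (th N * r * E)) := by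
      calc _ ≤ th N ^ 2 / 2 * D1 * dist x₁ y := by gcongr
        _ = th N / 2 * (th N * dist x₁ y * D1) := by ring
        _ ≤ th N / 2 * ((1 + th N * dist x₁ y) ^ 2 * D1) := by gcongr; nlinarith
        _ ≤ th N / 2 * (4 * (th N * r) * E) := by gcongr
        _ = _ := by ring
    have T2 : N / 2 * bb (x₂ : Eucl n) y ^ (N - 1) * ‖pjL (x₁ : Eucl n) y - pjL (x₂ : Eucl n) y‖ ≤
        th N * (th N * r * E) := by
      calc _ ≤ th N ^ 2 / 2 * E * (2 * r) := by gcongr; exact c2.trans c3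
        _ = _ := by ring
    have T3 : D0 * 1 ≤ 4 * (th N * (th N * r * E)) := by nlinarith
    have T4 : bb (x₂ : Eucl n) y ^ N * r ≤ th N * (th N * r * E) := by
      have : 1 ≤ th N * th N := by nlinarith
      calc _ ≤ E * r := by gcongr; exact c1.trans c3
        _ ≤ (th N * th N) * (E * r) := le_mul_of_one_le_left (by positivity) this
        _ = _ := by ring
    linarith [mul_nonneg t0.le T0]
  cont N x := continuous_kerV_sph N (x : Eucl n)
  normP x := by rw [Sph.norm_eq]; norm_num
  lipP x₁ x₂ := by
    rw [← dist_eq_norm, ← Subtype.dist_eq]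
    linarith [dist_nonneg (x := x₁) (y := x₂)]

theorem abs_inner_sub_le (x₁ x₂ y : Sph n) :
    |⟪(x₁ : Eucl n), (y : Eucl n)⟫ - ⟪(x₂ : Eucl n), (y : Eucl n)⟫| ≤ dist x₁ x₂ := by
  rw [← inner_sub_left]
  refine (abs_real_inner_le_norm _ _).trans ?_
  rw [Sph.norm_eq, mul_one, Subtype.dist_eq, dist_eq_norm]

set_option maxHeartbeats 1000000 in
theorem kerBound_kerM :
    KerBound 2 (fun N (x y : Sph n) => kerM N (x : Eucl n) y) (fun x => pjL (x : Eucl n)) 30 where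
  bound N x y := by
    have h0 := pow_bb_le N y (by omega : N - 3 ≤ N) x
    have h1 := pow_bb_le N y (by omega : N - 3 ≤ N - 1) x
    have h2 := pow_bb_le N y (by omega : N - 3 ≤ N - 2) x
    have hb := bb_nonneg x y
    have ht := one_le_th N
    have t0 := th_pos N
    have hp := norm_pjL_apply_le x y
    have hN := natCast_le_th_sq N
    have hN2 := natCast_mul_sub_one_le N
    have hN3 := natCast_mul_sub_one_nonneg N
    have hs := abs_inner_sph_le x y
    have hβ : 0 ≤ bb (x : Eucl n) y ^ (N - 3) := by positivity
    have hρ : 0 ≤ th N * dist x y := mul_nonneg (by linarith) dist_nonneg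
    rw [kerM]
    refine (norm_add_le _ _).trans ?_
    rw [norm_smul, norm_smul,
      Real.norm_of_nonneg (show 0 ≤ (N : ℝ) * (N - 1) / 4 * bb (x : Eucl n) y ^ (N - 2) by positivity),
      Real.norm_eq_abs]
    have T1 : (N : ℝ) * (N - 1) / 4 * bb (x : Eucl n) y ^ (N - 2) *
        ‖tens (pjL (x : Eucl n) y) (pjL (x : Eucl n) y)‖ ≤
        th N ^ 4 / 4 * bb (x : Eucl n) y ^ (N - 3) * (dist x y * dist x y) := by
      have := (norm_tens_le (pjL (x : Eucl n) y) (pjL (x : Eucl n) y)).trans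
        (mul_le_mul hp hp (norm_nonneg _) dist_nonneg)
      gcongr
    have T2 : |bb (x : Eucl n) y ^ N - ⟪(x : Eucl n), (y : Eucl n)⟫ *
        (N / 2 * bb (x : Eucl n) y ^ (N - 1))| * ‖pjL (x : Eucl n)‖ ≤
        (bb (x : Eucl n) y ^ (N - 3) + 1 * (th N ^ 2 / 2 * bb (x : Eucl n) y ^ (N - 3))) * 2 := by
      have h3 : |bb (x : Eucl n) y ^ N - ⟪(x : Eucl n), (y : Eucl n)⟫ *
        (N / 2 * bb (x : Eucl n) y ^ (N - 1))| ≤ bb (x : Eucl n) y ^ (N - 3) +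
          1 * (th N ^ 2 / 2 * bb (x : Eucl n) y ^ (N - 3)) := by
        refine (abs_sub _ _).trans ?_
        rw [abs_mul, abs_of_nonneg (show 0 ≤ bb (x : Eucl n) y ^ N by positivity),
          abs_of_nonneg (show 0 ≤ (N : ℝ) / 2 * bb (x : Eucl n) y ^ (N - 1) by positivity)]
        gcongr
      exact mul_le_mul h3 (norm_pjL_le x) (norm_nonneg _) (by positivity)
    have e3 : th N ^ 4 / 4 * bb (x : Eucl n) y ^ (N - 3) * (dist x y * dist x y) =
      (th N ^ 2 * bb (x : Eucl n) y ^ (N - 3)) * ((th N * dist x y) ^ 2 / 4) := by ring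
    have e6 : bb (x : Eucl n) y ^ (N - 3) ≤ th N ^ 2 * bb (x : Eucl n) y ^ (N - 3) :=
      le_mul_of_one_le_left hβ (one_le_pow₀ ht)
    have e5 : (th N * dist x y) ^ 2 / 4 + 3 ≤ 30 * (1 + th N * dist x y) ^ 2 := by nlinarith
    calc _ ≤ (th N ^ 2 * bb (x : Eucl n) y ^ (N - 3)) * ((th N * dist x y) ^ 2 / 4 + 3) := by linarith
      _ ≤ (th N ^ 2 * bb (x : Eucl n) y ^ (N - 3)) * (30 * (1 + th N * dist x y) ^ 2) := by gcongr
      _ = _ := by ring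
  lip N x₁ x₂ y hr := by
    have ht := one_le_th N
    have t0 := th_pos N
    have hN := natCast_le_th_sq N
    have hN2 := natCast_mul_sub_one_le N
    have hN3 := natCast_mul_sub_one_nonneg N
    have hp := norm_pjL_apply_le x₁ y
    have hp2 := norm_pjL_apply_le x₂ y
    have hp' : ‖pjL (x₁ : Eucl n) y - pjL (x₂ : Eucl n) y‖ ≤ 2 * dist x₁ x₂ := by
      have := (pjL (x₁ : Eucl n) - pjL (x₂ : Eucl n)).le_of_opNorm_le (norm_pjL_sub_le x₁ x₂) y
      rwa [Sph.norm_eq, mul_one] at this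
    have q2 := env_ge (N := N) (x₁ := x₁) (x₂ := x₂) y
    have hQ := env_nonneg N x₁ x₂ y
    have b2 := bb_nonneg x₂ y
    have r0 : 0 ≤ dist x₁ x₂ := dist_nonneg
    have c0 := pow_bb_le N y (by omega : N - 3 ≤ N) x₂
    have c1 := pow_bb_le N y (by omega : N - 3 ≤ N - 1) x₂
    have c2 := pow_bb_le N y (by omega : N - 3 ≤ N - 2) x₂
    have p2 : 0 ≤ th N * dist x₂ y := mul_nonneg (by linarith) dist_nonneg
    have p1 : 0 ≤ th N * dist x₁ y := mul_nonneg (by linarith) dist_nonneg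
    have hβ : 0 ≤ bb (x₂ : Eucl n) y ^ (N - 3) := by positivity
    have c3 : bb (x₂ : Eucl n) y ^ (N - 3) ≤ env N x₁ x₂ y := by nlinarith
    have f2 := env_facts y hr (j := N - 2) (by omega) (by omega)
    have f1 := abs_sub_pow_le_env y hr (j := N - 1) (by omega) (by omega)
    have f0 := abs_sub_pow_le_env y hr (j := N) (by omega) le_rfl
    have t12 := scale_le_two_mul y hr
    have hs1 := abs_inner_sph_le x₁ y
    have hs2 := abs_inner_sph_le x₂ y
    have hs := abs_inner_sub_le x₁ x₂ y
    have hP1 := norm_pjL_le x₁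
    have hP := norm_pjL_sub_le x₁ x₂
    have hTT := norm_tens_sub_tens_le (pjL (x₁ : Eucl n) y) (pjL (x₂ : Eucl n) y)
    have hT1 := norm_tens_le (pjL (x₁ : Eucl n) y) (pjL (x₁ : Eucl n) y)
    set s₁ := ⟪(x₁ : Eucl n), (y : Eucl n)⟫
    set s₂ := ⟪(x₂ : Eucl n), (y : Eucl n)⟫
    set b₁ := bb (x₁ : Eucl n) y
    set b₂ := bb (x₂ : Eucl n) y
    have e : kerM N (x₁ : Eucl n) y - kerM N (x₂ : Eucl n) y =
        (N * (N - 1) / 4 * (b₁ ^ (N - 2) - b₂ ^ (N - 2))) • tens (pjL (x₁ : Eucl n) y) (pjL x₁ y) +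
        (N * (N - 1) / 4 * b₂ ^ (N - 2)) • (tens (pjL (x₁ : Eucl n) y) (pjL (x₁ : Eucl n) y) -
          tens (pjL (x₂ : Eucl n) y) (pjL (x₂ : Eucl n) y)) +
        ((b₁ ^ N - b₂ ^ N) - (N / 2) * ((s₁ - s₂) * b₂ ^ (N - 1) + s₁ * (b₁ ^ (N - 1) - b₂ ^ (N - 1))))
          • pjL (x₁ : Eucl n) +
        (b₂ ^ N - s₂ * (N / 2 * b₂ ^ (N - 1))) • (pjL (x₁ : Eucl n) - pjL x₂) := by
      rw [kerM, kerM]; module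
    rw [e]
    refine norm_add₄_le.trans ?_
    set r := dist x₁ x₂
    set E := env N x₁ x₂ y
    have hq : 0 ≤ (N : ℝ) * (N - 1) / 4 := by positivity
    have T0 : 0 ≤ th N * r * E := by positivity
    have T1 : ‖(N * (N - 1) / 4 * (b₁ ^ (N - 2) - b₂ ^ (N - 2))) •
        tens (pjL (x₁ : Eucl n) y) (pjL x₁ y)‖ ≤ th N ^ 2 * (th N * r * E) := by
      rw [norm_smul, norm_mul, Real.norm_of_nonneg hq, Real.norm_eq_abs]
      have := hT1.trans (mul_le_mul hp hp (norm_nonneg _) dist_nonneg)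
      calc _ ≤ th N ^ 4 / 4 * |b₁ ^ (N - 2) - b₂ ^ (N - 2)| * (dist x₁ y * dist x₁ y) := by gcongr
        _ = th N ^ 2 / 4 * ((th N * dist x₁ y) ^ 2 * |b₁ ^ (N - 2) - b₂ ^ (N - 2)|) := by ring
        _ ≤ th N ^ 2 / 4 * ((1 + th N * dist x₁ y) ^ 2 * |b₁ ^ (N - 2) - b₂ ^ (N - 2)|) := by
          gcongr; linarith
        _ ≤ th N ^ 2 / 4 * (4 * (th N * r) * E) := by gcongr
        _ = _ := by ring
    have T2 : ‖(N * (N - 1) / 4 * b₂ ^ (N - 2)) • (tens (pjL (x₁ : Eucl n) y) (pjL (x₁ : Eucl n) y) -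
          tens (pjL (x₂ : Eucl n) y) (pjL (x₂ : Eucl n) y))‖ ≤ 2 * (th N ^ 2 * (th N * r * E)) := by
      rw [norm_smul, Real.norm_of_nonneg (by positivity)]
      have : ‖tens (pjL (x₁ : Eucl n) y) (pjL (x₁ : Eucl n) y) -
          tens (pjL (x₂ : Eucl n) y) (pjL (x₂ : Eucl n) y)‖ ≤ 2 * r * (dist x₁ y + dist x₂ y) :=
        hTT.trans (mul_le_mul hp' (add_le_add hp hp2) (by positivity) (by positivity))
      calc _ ≤ th N ^ 4 / 4 * b₂ ^ (N - 3) * (2 * r * (dist x₁ y + dist x₂ y)) := by gcongr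
        _ = th N ^ 2 * (th N * r * ((th N * dist x₁ y + th N * dist x₂ y) / 2 * b₂ ^ (N - 3))) := by
          ring
        _ ≤ th N ^ 2 * (th N * r * (2 * (1 + th N * dist x₂ y) * b₂ ^ (N - 3))) := by
          gcongr; linarith
        _ = th N ^ 2 * (th N * r * (2 * ((1 + th N * dist x₂ y) * b₂ ^ (N - 3)))) := by ring
        _ ≤ th N ^ 2 * (th N * r * (2 * E)) := by gcongr
        _ = _ := by ring
    have e6 : th N * r * E ≤ th N ^ 2 * (th N * r * E) :=
      le_mul_of_one_le_left T0 (one_le_pow₀ ht)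
    have e7 : r * E ≤ th N * r * E := by nlinarith [mul_nonneg r0 hQ]
    have e8 : th N ^ 2 * (r * E) ≤ th N ^ 2 * (th N * r * E) := by gcongr
    have T3 : ‖((b₁ ^ N - b₂ ^ N) - (N / 2) * ((s₁ - s₂) * b₂ ^ (N - 1) +
        s₁ * (b₁ ^ (N - 1) - b₂ ^ (N - 1)))) • pjL (x₁ : Eucl n)‖ ≤
          14 * (th N ^ 2 * (th N * r * E)) := by
      rw [norm_smul, Real.norm_eq_abs]
      have h3 : |(b₁ ^ N - b₂ ^ N) - (N / 2) * ((s₁ - s₂) * b₂ ^ (N - 1) +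
        s₁ * (b₁ ^ (N - 1) - b₂ ^ (N - 1)))| ≤ 7 * (th N ^ 2 * (th N * r * E)) := by
        have g1 : |(s₁ - s₂) * b₂ ^ (N - 1)| ≤ r * E := by
          rw [abs_mul, abs_of_nonneg (show 0 ≤ b₂ ^ (N - 1) by positivity)]
          exact mul_le_mul hs (c1.trans c3) (by positivity) r0
        have g2 : |s₁ * (b₁ ^ (N - 1) - b₂ ^ (N - 1))| ≤ 1 * (4 * (th N * r) * E) := by
          rw [abs_mul]
          exact mul_le_mul hs1 f1 (abs_nonneg _) (by norm_num)
        have g3 : |(N : ℝ) / 2 * ((s₁ - s₂) * b₂ ^ (N - 1) + s₁ * (b₁ ^ (N - 1) - b₂ ^ (N - 1)))| ≤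
            th N ^ 2 / 2 * (r * E + 1 * (4 * (th N * r) * E)) := by
          rw [abs_mul, abs_of_nonneg (show 0 ≤ (N : ℝ) / 2 by positivity)]
          have := (abs_add_le ((s₁ - s₂) * b₂ ^ (N - 1)) (s₁ * (b₁ ^ (N - 1) - b₂ ^ (N - 1)))).trans
            (add_le_add g1 g2)
          gcongr
        refine (abs_sub _ _).trans ((add_le_add f0 g3).trans ?_)
        linarith
      calc _ ≤ (7 * (th N ^ 2 * (th N * r * E))) * 2 :=
            mul_le_mul h3 hP1 (norm_nonneg _) (by positivity)
        _ = _ := by ring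
    have T4 : ‖(b₂ ^ N - s₂ * (N / 2 * b₂ ^ (N - 1))) • (pjL (x₁ : Eucl n) - pjL x₂)‖ ≤
        3 * (th N ^ 2 * (th N * r * E)) := by
      rw [norm_smul, Real.norm_eq_abs]
      have h3 : |b₂ ^ N - s₂ * (N / 2 * b₂ ^ (N - 1))| ≤ E + 1 * (th N ^ 2 / 2 * E) := by
        refine (abs_sub _ _).trans ?_
        rw [abs_mul, abs_of_nonneg (show 0 ≤ b₂ ^ N by positivity),
          abs_of_nonneg (show 0 ≤ (N : ℝ) / 2 * b₂ ^ (N - 1) by positivity)]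
        have := c0.trans c3
        have := c1.trans c3
        gcongr
      calc _ ≤ (E + 1 * (th N ^ 2 / 2 * E)) * (2 * r) :=
            mul_le_mul h3 hP (norm_nonneg _) (by positivity)
        _ = 2 * (r * E) + th N ^ 2 * (r * E) := by ring
        _ ≤ _ := by linarith
    have : 0 ≤ th N ^ 2 * (th N * r * E) := by positivity
    linarith
  cont N x := continuous_kerM_sph N (x : Eucl n)
  normP x := (norm_pjL_le x).trans (by norm_num)
  lipP x₁ x₂ := (norm_pjL_sub_le x₁ x₂).trans (by
    linarith [dist_nonneg (x := x₁) (y := x₂)])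

end KernelBounds

section ZonalOperators

variable {n : ℕ} [hn : Fact (2 ≤ n)]
variable {V : Type} [NormedAddCommGroup V] [NormedSpace ℝ V]

/-- The normalized zonal operator with kernel `K N`. -/
def kop (K : ℕ → Sph n → Sph n → V) (N : ℕ) (g : Sph n → ℝ) (x : Sph n) : V :=
  (cc n N)⁻¹ • ∫ y, g y • K N x y ∂(sig n)

theorem momC_ge : 64 ≤ momC n := by
  rw [momC]; nlinarith [sq_nonneg (n : ℝ)]

variable {k : ℕ} {K : ℕ → Sph n → Sph n → V} {P : Sph n → V} {C : ℝ}

theorem KerBound.nonneg (hK : KerBound k K P C) : 0 ≤ C :=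
  (norm_nonneg _).trans (hK.normP (baseP n))

theorem KerBound.integrable (hK : KerBound k K P C) {g : Sph n → ℝ} (hg : Continuous g) (N : ℕ)
    (x : Sph n) : Integrable (fun y => g y • K N x y) (sig n) :=
  integrable_sph (hg.smul (hK.cont N x))

theorem continuous_weight (N j : ℕ) (x : Sph n) : Continuous fun y : Sph n =>
    (1 + th N * dist x y) ^ j * bb (x : Eucl n) y ^ (N - 3) := by
  have := continuous_bb_sph x
  fun_prop

theorem KerBound.norm_integral_le (hK : KerBound k K P C) {g : Sph n → ℝ}
    (N : ℕ) (x : Sph n) {m : ℝ} (hm : ∀ y, |g y| ≤ m * (1 + th N * dist x y)) :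
    ‖(cc n N)⁻¹ • ∫ y, g y • K N x y ∂(sig n)‖ ≤ C * momC n * (m * th N ^ k) := by
  have hc := cc_pos (n := n) N
  have ht := th_pos N
  have hC := hK.nonneg
  have m0 : 0 ≤ m := by
    have := (abs_nonneg _).trans (hm x)
    simpa using this
  rw [norm_smul, norm_inv, Real.norm_of_nonneg hc.le, inv_mul_le_iff₀ hc]
  have h1 : ‖∫ y, g y • K N x y ∂(sig n)‖ ≤ ∫ y : Sph n, (C * m * th N ^ k) *
      ((1 + th N * dist x y) ^ 4 * bb (x : Eucl n) y ^ (N - 3)) ∂(sig n) := by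
    refine norm_integral_le_of_norm_le ((integrable_sph (continuous_weight N 4 x)).const_mul _)
      (Eventually.of_forall fun y => ?_)
    have hb := bb_nonneg x y
    have hd := dist_nonneg (x := x) (y := y)
    rw [norm_smul, Real.norm_eq_abs]
    calc _ ≤ (m * (1 + th N * dist x y)) *
          (C * (th N ^ k * ((1 + th N * dist x y) ^ 2 * bb (x : Eucl n) y ^ (N - 3)))) :=
          mul_le_mul (hm y) (hK.bound N x y) (norm_nonneg _) (by positivity)
      _ = (C * m * th N ^ k) * ((1 + th N * dist x y) ^ 3 * bb (x : Eucl n) y ^ (N - 3)) := by ring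
      _ ≤ _ := by
        gcongr
        · have : 0 ≤ th N * dist x y := by positivity
          linarith
        · norm_num
  refine h1.trans ?_
  rw [integral_const_mul]
  calc _ ≤ (C * m * th N ^ k) * (momC n * cc n N) := by
        gcongr; exact integral_moment_le N x
    _ = _ := by ring

theorem KerBound.kop_eq (hK : KerBound k K P C)
    (hP : ∀ N x, ∫ y, K N x y ∂(sig n) = cc n N • P x) {g : Sph n → ℝ} (hg : Continuous g)
    (N : ℕ) (x : Sph n) (c : ℝ) :
    kop K N g x = (cc n N)⁻¹ • ∫ y, (g y - c) • K N x y ∂(sig n) + c • P x := by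
  have hc := cc_pos (n := n) N
  have i1 := hK.integrable (g := fun y => g y - c) (by fun_prop) N x
  have i2 := hK.integrable (g := fun _ => c) continuous_const N x
  have h : ∫ y, g y • K N x y ∂(sig n) =
      ∫ y, (g y - c) • K N x y ∂(sig n) + c • (cc n N • P x) := by
    rw [← hP, ← integral_smul, ← integral_add i1 i2]
    refine integral_congr_ae (Eventually.of_forall fun y => ?_)
    simp only; module
  rw [kop, h, smul_add, smul_smul, smul_smul]
  congr 2
  field_simp

theorem KerBound.norm_kop_le (hK : KerBound k K P C)
    (hP : ∀ N x, ∫ y, K N x y ∂(sig n) = cc n N • P x) {g : Sph n → ℝ} (hg : Continuous g)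
    (N : ℕ) (x : Sph n) {m M : ℝ} (hm : ∀ y, |g y - g x| ≤ m * (1 + th N * dist x y))
    (hM : |g x| ≤ M) :
    ‖kop K N g x‖ ≤ C * momC n * (m * th N ^ k + M) := by
  have hC := hK.nonneg
  have hmo := momC_ge (n := n)
  have M0 := (abs_nonneg _).trans hM
  rw [hK.kop_eq hP hg N x (g x)]
  refine (norm_add_le _ _).trans ?_
  have h1 := hK.norm_integral_le N x hm
  have h2 : ‖g x • P x‖ ≤ M * C := by
    rw [norm_smul]; exact mul_le_mul hM (hK.normP x) (norm_nonneg _) M0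
  have h3 : M * C ≤ C * momC n * M := by
    have : 0 ≤ M * C := by positivity
    nlinarith
  linarith

theorem KerBound.norm_kop_sub_le (hK : KerBound k K P C)
    (hP : ∀ N x, ∫ y, K N x y ∂(sig n) = cc n N • P x) {g : Sph n → ℝ} (hg : Continuous g)
    (N : ℕ) (x₁ x₂ : Sph n) {m M D : ℝ}
    (hm : ∀ x y, |g y - g x| ≤ m * (1 + th N * dist x y))
    (hM : ∀ x, |g x| ≤ M) (hD0 : 0 ≤ D) (hD : 1 ≤ th N * dist x₁ x₂ → |g x₁ - g x₂| ≤ D) :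
    ‖kop K N g x₁ - kop K N g x₂‖ ≤
      3 * C * momC n * (m * th N ^ k * min 1 (th N * dist x₁ x₂) + M * dist x₁ x₂ + D) := by
  have hC := hK.nonneg
  have hmo := momC_ge (n := n)
  have M0 := (abs_nonneg _).trans (hM x₁)
  have ht := th_pos N
  have hr := dist_nonneg (x := x₁) (y := x₂)
  have hc := cc_pos (n := n) N
  have m0 : 0 ≤ m := by
    have := (abs_nonneg _).trans (hm x₁ x₁)
    simpa using this
  have a1 : C * M * dist x₁ x₂ ≤ C * momC n * (M * dist x₁ x₂) := by
    have : 0 ≤ C * (M * dist x₁ x₂) := by positivity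
    nlinarith
  have a2 : 0 ≤ C * momC n * (M * dist x₁ x₂) := by positivity
  have a3 : C * D ≤ C * momC n * D := by
    have : 0 ≤ C * D := by positivity
    nlinarith
  have a4 : 0 ≤ C * momC n * D := by positivity
  rcases le_total (th N * dist x₁ x₂) 1 with h | h
  · rw [min_eq_right h]
    set r := dist x₁ x₂
    have e : kop K N g x₁ - kop K N g x₂ =
        (cc n N)⁻¹ • ∫ y, (g y - g x₁) • (K N x₁ y - K N x₂ y) ∂(sig n) +
          g x₁ • (P x₁ - P x₂) := by
      rw [hK.kop_eq hP hg N x₁ (g x₁), hK.kop_eq hP hg N x₂ (g x₁)]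
      have i1 := hK.integrable (g := fun y => g y - g x₁) (by fun_prop) N x₁
      have i2 := hK.integrable (g := fun y => g y - g x₁) (by fun_prop) N x₂
      have : ∫ y, (g y - g x₁) • (K N x₁ y - K N x₂ y) ∂(sig n) =
          ∫ y, (g y - g x₁) • K N x₁ y ∂(sig n) - ∫ y, (g y - g x₁) • K N x₂ y ∂(sig n) := by
        rw [← integral_sub i1 i2]
        simp only [smul_sub]
      rw [this]; module
    rw [e]
    refine (norm_add_le _ _).trans ?_
    have b2 : ‖g x₁ • (P x₁ - P x₂)‖ ≤ C * M * r := by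
      rw [norm_smul]
      calc _ ≤ M * (C * r) := mul_le_mul (hM x₁) (hK.lipP x₁ x₂) (norm_nonneg _) M0
        _ = _ := by ring
    have b1 : ‖(cc n N)⁻¹ • ∫ y, (g y - g x₁) • (K N x₁ y - K N x₂ y) ∂(sig n)‖ ≤
        3 * C * momC n * (m * th N ^ k * (th N * r)) := by
      rw [norm_smul, norm_inv, Real.norm_of_nonneg hc.le, inv_mul_le_iff₀ hc]
      have w1 := integrable_sph (continuous_weight N 4 x₁)
      have w2 := (integrable_sph (continuous_weight N 4 x₂)).const_mul 2
      have h1 : ‖∫ y, (g y - g x₁) • (K N x₁ y - K N x₂ y) ∂(sig n)‖ ≤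
          ∫ y : Sph n, (C * m * th N ^ k * (th N * r)) *
          ((1 + th N * dist x₁ y) ^ 4 * bb (x₁ : Eucl n) y ^ (N - 3) +
          2 * ((1 + th N * dist x₂ y) ^ 4 * bb (x₂ : Eucl n) y ^ (N - 3))) ∂(sig n) := by
        refine norm_integral_le_of_norm_le ((w1.add w2).const_mul _)
          (Eventually.of_forall fun y => ?_)
        have hb := bb_nonneg x₁ y
        have hb2 := bb_nonneg x₂ y
        have hd := dist_nonneg (x := x₁) (y := y)
        have hd2 := dist_nonneg (x := x₂) (y := y)
        have t12 := scale_le_two_mul y h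
        rw [norm_smul, Real.norm_eq_abs]
        have g1 : (1 + th N * dist x₁ y) * ((1 + th N * dist x₂ y) ^ 3 * bb (x₂ : Eucl n) y ^ (N - 3)) ≤
          2 * (1 + th N * dist x₂ y) * ((1 + th N * dist x₂ y) ^ 3 * bb (x₂ : Eucl n) y ^ (N - 3)) := by
          gcongr
        calc _ ≤ (m * (1 + th N * dist x₁ y)) *
              (C * (th N ^ k * (th N * r) * env N x₁ x₂ y)) :=
              mul_le_mul (hm x₁ y) (hK.lip N x₁ x₂ y h) (norm_nonneg _) (by positivity)
          _ = (C * m * th N ^ k * (th N * r)) * ((1 + th N * dist x₁ y) * env N x₁ x₂ y) := by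
            ring
          _ ≤ _ := by
            refine mul_le_mul_of_nonneg_left ?_ (by positivity)
            rw [env]
            linarith
      refine h1.trans ?_
      rw [integral_const_mul, integral_add w1 w2, integral_const_mul]
      have q1 := integral_moment_le N x₁
      have q2 := integral_moment_le N x₂
      calc _ ≤ (C * m * th N ^ k * (th N * r)) * (3 * (momC n * cc n N)) := by
            gcongr; linarith
        _ = _ := by ring
    linarith
  · rw [min_eq_left h]
    have hD' := hD h
    set r := dist x₁ x₂
    rw [hK.kop_eq hP hg N x₁ (g x₁), hK.kop_eq hP hg N x₂ (g x₂)]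
    have h1 := hK.norm_integral_le N x₁ (hm x₁)
    have h2 := hK.norm_integral_le N x₂ (hm x₂)
    set A := (cc n N)⁻¹ • ∫ y, (g y - g x₁) • K N x₁ y ∂(sig n)
    set B := (cc n N)⁻¹ • ∫ y, (g y - g x₂) • K N x₂ y ∂(sig n)
    have e : A + g x₁ • P x₁ - (B + g x₂ • P x₂) = (A - B) + (g x₁ • (P x₁ - P x₂) +
        (g x₁ - g x₂) • P x₂) := by module
    rw [e]
    have b2 : ‖g x₁ • (P x₁ - P x₂)‖ ≤ C * M * r := by
      rw [norm_smul]
      calc _ ≤ M * (C * r) := mul_le_mul (hM x₁) (hK.lipP x₁ x₂) (norm_nonneg _) M0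
        _ = _ := by ring
    have b3 : ‖(g x₁ - g x₂) • P x₂‖ ≤ D * C := by
      rw [norm_smul]
      exact mul_le_mul hD' (hK.normP x₂) (norm_nonneg _) hD0
    have b0 : 0 ≤ C * momC n * (m * th N ^ k) := by positivity
    have := norm_add_le (A - B) (g x₁ • (P x₁ - P x₂) + (g x₁ - g x₂) • P x₂)
    have := norm_sub_le A B
    have := norm_add_le (g x₁ • (P x₁ - P x₂)) ((g x₁ - g x₂) • P x₂)
    linarith

end ZonalOperators

/-- The series `∑ f` converges with sum at most `C`. -/
def SumLe (f : ℕ → ℝ) (C : ℝ) : Prop := Summable f ∧ ∑' N, f N ≤ C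

theorem SumLe.of_partial {f : ℕ → ℝ} {C : ℝ} (hf : ∀ N, 0 ≤ f N)
    (h : ∀ M, ∑ N ∈ Finset.range M, f N ≤ C) : SumLe f C :=
  ⟨summable_of_sum_range_le hf h, Real.tsum_le_of_sum_range_le hf h⟩

theorem SumLe.add {f g : ℕ → ℝ} {C D : ℝ} (hf : SumLe f C) (hg : SumLe g D) :
    SumLe (fun N => f N + g N) (C + D) :=
  ⟨hf.1.add hg.1, by rw [hf.1.tsum_add hg.1]; exact add_le_add hf.2 hg.2⟩

theorem SumLe.const_mul {f : ℕ → ℝ} {C a : ℝ} (ha : 0 ≤ a) (hf : SumLe f C) :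
    SumLe (fun N => a * f N) (a * C) :=
  ⟨hf.1.mul_left a, by rw [tsum_mul_left]; exact mul_le_mul_of_nonneg_left hf.2 ha⟩

theorem SumLe.mono {f g : ℕ → ℝ} {C D : ℝ} (hg : SumLe g C) (hf : ∀ N, 0 ≤ f N)
    (h : ∀ N, f N ≤ g N) (hD : C ≤ D) : SumLe f D :=
  have hs := Summable.of_nonneg_of_le hf h hg.1
  ⟨hs, (hs.tsum_le_tsum h hg.1).trans (hg.2.trans hD)⟩

theorem SumLe.norm_tsum_le {V : Type} [NormedAddCommGroup V] {F : ℕ → V} {f : ℕ → ℝ} {C : ℝ}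
    (hf : SumLe f C) (h : ∀ N, ‖F N‖ ≤ f N) : ‖∑' N, F N‖ ≤ C :=
  (tsum_of_norm_bounded hf.1.hasSum h).trans hf.2

theorem SumLe.summable {V : Type} [NormedAddCommGroup V] [CompleteSpace V] {F : ℕ → V}
    {f : ℕ → ℝ} {C : ℝ} (hf : SumLe f C) (h : ∀ N, ‖F N‖ ≤ f N) : Summable F :=
  Summable.of_norm_bounded hf.1 h

/-- `(N + 1)^{1/4}`. -/
def ro (N : ℕ) : ℝ := √(th N)

theorem ro_sq (N : ℕ) : ro N ^ 2 = th N := Real.sq_sqrt (th_pos N).le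

theorem ro_pow_four (N : ℕ) : ro N ^ 4 = N + 1 := by
  rw [← th_sq, ← ro_sq]; ring

theorem one_le_ro (N : ℕ) : 1 ≤ ro N := Real.one_le_sqrt.2 (one_le_th N)

theorem ro_pos (N : ℕ) : 0 < ro N := lt_of_lt_of_le one_pos (one_le_ro N)

theorem sumLe_telescope {u : ℕ → ℝ} (hu0 : 0 ≤ u 0)
    (hu : ∀ N : ℕ, 0 < u (N + 1) ∧ u (N + 1) ≤ 4 * (N + 1) * (u (N + 1) - u N)) {s : ℝ}
    (hs : 0 ≤ s) :
    SumLe (fun N => ((N : ℝ) + 1)⁻¹ * (u (N + 1))⁻¹ * min 1 ((s * u (N + 1)) ^ 2)) (16 * s) := by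
  have hpos : ∀ N, 0 ≤ u N := fun N => by
    rcases N with _ | N
    exacts [hu0, (hu N).1.le]
  refine SumLe.of_partial (fun N => ?_) fun M => ?_
  · have := (hu N).1
    positivity
  have key : ∀ N : ℕ, ((N : ℝ) + 1)⁻¹ * (u (N + 1))⁻¹ * min 1 ((s * u (N + 1)) ^ 2) ≤
      16 * s * (s * u (N + 1) / (1 + s * u (N + 1)) - s * u N / (1 + s * u N)) := by
    intro N
    obtain ⟨hb, hab⟩ := hu N
    set b := u (N + 1)
    have ha := hpos N
    set a := u N
    have hν : (0 : ℝ) < N + 1 := by positivity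
    have hab' : a ≤ b := by
      by_contra hh; push Not at hh
      nlinarith
    have e : s * b / (1 + s * b) - s * a / (1 + s * a) =
        s * (b - a) / ((1 + s * b) * (1 + s * a)) := by
      field_simp; ring
    rw [e]
    have h1 : s * (b / (4 * (N + 1))) / ((1 + s * b) * (1 + s * b)) ≤
        s * (b - a) / ((1 + s * b) * (1 + s * a)) := by
      have : b / (4 * (N + 1)) ≤ b - a := by rw [div_le_iff₀ (by positivity)]; linarith
      have : 0 ≤ b - a := sub_nonneg.2 hab'
      gcongr
    have h2 : ((N : ℝ) + 1)⁻¹ * b⁻¹ * min 1 ((s * b) ^ 2) ≤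
        16 * s * (s * (b / (4 * (N + 1))) / ((1 + s * b) * (1 + s * b))) := by
      have e2 : 16 * s * (s * (b / (4 * (N + 1))) / ((1 + s * b) * (1 + s * b))) =
          ((N : ℝ) + 1)⁻¹ * b⁻¹ * (4 * (s * b) ^ 2 / (1 + s * b) ^ 2) := by
        field_simp; ring
      rw [e2]
      refine mul_le_mul_of_nonneg_left ?_ (by positivity)
      have hw : 0 ≤ s * b := by positivity
      rw [le_div_iff₀ (by positivity)]
      rcases le_total (s * b) 1 with h | h
      · have : min 1 ((s * b) ^ 2) ≤ (s * b) ^ 2 := min_le_right _ _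
        calc _ ≤ (s * b) ^ 2 * (1 + s * b) ^ 2 := by gcongr
          _ ≤ (s * b) ^ 2 * 2 ^ 2 := by gcongr; linarith
          _ = _ := by ring
      · have : min 1 ((s * b) ^ 2) ≤ 1 := min_le_left _ _
        calc _ ≤ 1 * (1 + s * b) ^ 2 := by gcongr
          _ ≤ 1 * (2 * (s * b)) ^ 2 := by gcongr; linarith
          _ = _ := by ring
    exact h2.trans (mul_le_mul_of_nonneg_left h1 (by positivity))
  refine (Finset.sum_le_sum fun N _ => key N).trans ?_
  rw [← Finset.mul_sum, Finset.sum_range_sub (fun N => s * u N / (1 + s * u N))]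
  have h1 : s * u M / (1 + s * u M) ≤ 1 := by
    have := hpos M
    rw [div_le_one (by positivity)]; linarith
  have h2 : 0 ≤ s * u 0 / (1 + s * u 0) := by positivity
  calc _ ≤ 16 * s * 1 := by gcongr; linarith
    _ = _ := by ring

theorem sumLe_ro_five {s : ℝ} (hs : 0 ≤ s) :
    SumLe (fun N => (ro N ^ 5)⁻¹ * min 1 ((s * ro N) ^ 2)) (16 * s) := by
  have := sumLe_telescope (u := fun N => √√(N : ℝ)) (by positivity) (fun N => ?_) hs
  · convert this using 2 with N
    push_cast
    change _ = ((N : ℝ) + 1)⁻¹ * (ro N)⁻¹ * min 1 ((s * ro N) ^ 2)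
    rw [← ro_pow_four]
    ring_nf
  · push_cast
    change 0 < ro N ∧ ro N ≤ 4 * ((N : ℝ) + 1) * (ro N - √√(N : ℝ))
    have hr := ro_pos N
    refine ⟨hr, ?_⟩
    set a := √√(N : ℝ)
    have ha : 0 ≤ a := by positivity
    have ha4 : a ^ 4 = N := by
      have : a ^ 2 = √(N : ℝ) := Real.sq_sqrt (by positivity)
      calc a ^ 4 = (a ^ 2) ^ 2 := by ring
        _ = _ := by rw [this]; exact Real.sq_sqrt (by positivity)
    have h4 := ro_pow_four N
    have hab : a ≤ ro N := by
      by_contra hh; push Not at hh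
      have := pow_lt_pow_left₀ hh hr.le (n := 4) (by norm_num)
      linarith
    rw [← h4]
    have h1 : 1 ≤ 4 * ro N ^ 3 * (ro N - a) := by
      have e : (1 : ℝ) = (ro N - a) * (ro N ^ 3 + ro N ^ 2 * a + ro N * a ^ 2 + a ^ 3) := by
        nlinarith
      have : ro N ^ 3 + ro N ^ 2 * a + ro N * a ^ 2 + a ^ 3 ≤ 4 * ro N ^ 3 := by
        have i1 : ro N ^ 2 * a ≤ ro N ^ 2 * ro N := by gcongr
        have i2 : ro N * a ^ 2 ≤ ro N * ro N ^ 2 := by gcongr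
        have i3 : a ^ 3 ≤ ro N ^ 3 := by gcongr
        nlinarith
      have h0 : 0 ≤ ro N - a := sub_nonneg.2 hab
      nlinarith
    nlinarith

theorem sumLe_ro_six {s : ℝ} (hs : 0 ≤ s) :
    SumLe (fun N => (ro N ^ 6)⁻¹ * min 1 ((s * ro N ^ 2) ^ 2)) (16 * s) := by
  have := sumLe_telescope (u := fun N => √(N : ℝ)) (by positivity) (fun N => ?_) hs
  · convert this using 2 with N
    push_cast
    change _ = ((N : ℝ) + 1)⁻¹ * (th N)⁻¹ * min 1 ((s * th N) ^ 2)
    rw [← ro_pow_four, ← ro_sq]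
    ring_nf
  · push_cast
    change 0 < th N ∧ th N ≤ 4 * ((N : ℝ) + 1) * (th N - √(N : ℝ))
    have hr := th_pos N
    refine ⟨hr, ?_⟩
    have ha : 0 ≤ √(N : ℝ) := by positivity
    have ha2 : √(N : ℝ) ^ 2 = N := Real.sq_sqrt (by positivity)
    have h2 := th_sq N
    set a := √(N : ℝ)
    have hab : a ≤ th N := by
      by_contra hh; push Not at hh
      nlinarith
    rw [← h2]
    have h1 : 1 ≤ 2 * th N * (th N - a) := by nlinarith
    nlinarith

section Coefficients

variable {n : ℕ} [hn : Fact (2 ≤ n)]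

theorem sq_le_lam (N : ℕ) : ((N : ℝ) + 1) ^ 2 ≤ lam n (N + 1) := by
  have : (2 : ℝ) ≤ n := by exact_mod_cast hn.out
  rw [lam]; push_cast
  nlinarith [(Nat.cast_nonneg N : (0 : ℝ) ≤ N)]

theorem lam_pos (N : ℕ) : 0 < lam n (N + 1) := lt_of_lt_of_le (by positivity) (sq_le_lam N)

/-- Partial products `∏_{1 ≤ j ≤ N} (1 + 1/(η⁴ λ_j))`. -/
def pN (n : ℕ) (η : ℝ) : ℕ → ℝ
  | 0 => 1
  | N + 1 => pN n η N * (1 + 1 / (η ^ 4 * lam n (N + 1)))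

theorem one_le_pN {η : ℝ} (hη : 0 < η) (N : ℕ) : 1 ≤ pN n η N := by
  induction N with
  | zero => exact le_rfl
  | succ N ih =>
    have := lam_pos (n := n) N
    rw [pN]
    have h : 0 ≤ 1 / (η ^ 4 * lam n (N + 1)) := by positivity
    nlinarith

theorem pN_mono {η : ℝ} (hη : 0 < η) : Monotone (pN n η) :=
  monotone_nat_of_le_succ fun N => by
    have := lam_pos (n := n) N
    have h : 0 ≤ 1 / (η ^ 4 * lam n (N + 1)) := by positivity
    have := one_le_pN (n := n) hη N
    rw [pN]
    nlinarith

theorem bddAbove_pN {η : ℝ} (hη : 0 < η) : BddAbove (Set.range (pN n η)) := by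
  refine ⟨Real.exp (2 * (η ^ 4)⁻¹), ?_⟩
  rintro _ ⟨N, rfl⟩
  have h : pN n η N ≤ Real.exp (2 * (η ^ 4)⁻¹ * (1 - 1 / (N + 1))) := by
    induction N with
    | zero => simp [pN]
    | succ N ih =>
      rw [pN]
      have hl := lam_pos (n := n) N
      have h1 := one_le_pN (n := n) hη N
      have h2 : 1 + 1 / (η ^ 4 * lam n (N + 1)) ≤ Real.exp ((η ^ 4)⁻¹ * (((N : ℝ) + 1) ^ 2)⁻¹) := by
        refine le_trans ?_ (Real.add_one_le_exp _)
        rw [add_comm, one_div, mul_inv]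
        gcongr
        exact sq_le_lam N
      calc _ ≤ Real.exp (2 * (η ^ 4)⁻¹ * (1 - 1 / (N + 1))) *
            Real.exp ((η ^ 4)⁻¹ * (((N : ℝ) + 1) ^ 2)⁻¹) := by
            gcongr
        _ = Real.exp ((η ^ 4)⁻¹ * (2 * (1 - 1 / (N + 1)) + (((N : ℝ) + 1) ^ 2)⁻¹)) := by
            rw [← Real.exp_add]; ring_nf
        _ ≤ _ := by
            rw [mul_comm 2 (η ^ 4)⁻¹, mul_assoc]
            gcongr
            push_cast
            have : 0 ≤ 2 * (1 - 1 / ((N : ℝ) + 1 + 1)) - (2 * (1 - 1 / ((N : ℝ) + 1)) +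
              (((N : ℝ) + 1) ^ 2)⁻¹) := by
              have : 2 * (1 - 1 / ((N : ℝ) + 1 + 1)) - (2 * (1 - 1 / ((N : ℝ) + 1)) +
                (((N : ℝ) + 1) ^ 2)⁻¹) = N / (((N : ℝ) + 1) ^ 2 * (N + 1 + 1)) := by
                field_simp; ring
              rw [this]; positivity
            linarith
  refine h.trans (Real.exp_le_exp.2 ?_)
  have : (0 : ℝ) ≤ 1 / (N + 1) := by positivity
  have : 0 ≤ 2 * (η ^ 4)⁻¹ := by positivity
  nlinarith

/-- Normalized partial products, increasing to `1`. -/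
def sN (n : ℕ) (η : ℝ) (N : ℕ) : ℝ := pN n η N / ⨆ M, pN n η M

/-- The coefficients of the resolvent. -/
def cf (n : ℕ) (η : ℝ) : ℕ → ℝ
  | 0 => sN n η 0
  | N + 1 => sN n η (N + 1) - sN n η N

theorem iSup_pN_pos {η : ℝ} (hη : 0 < η) : 0 < ⨆ M, pN n η M :=
  lt_of_lt_of_le (lt_of_lt_of_le one_pos (one_le_pN hη 0)) (le_ciSup (bddAbove_pN hη) 0)

theorem sN_pos {η : ℝ} (hη : 0 < η) (N : ℕ) : 0 < sN n η N :=
  div_pos (lt_of_lt_of_le one_pos (one_le_pN hη N)) (iSup_pN_pos hη)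

theorem sN_le_one {η : ℝ} (hη : 0 < η) (N : ℕ) : sN n η N ≤ 1 :=
  (div_le_one (iSup_pN_pos hη)).2 (le_ciSup (bddAbove_pN hη) N)

theorem tendsto_sN {η : ℝ} (hη : 0 < η) : Tendsto (sN n η) atTop (𝓝 1) := by
  have := (tendsto_atTop_ciSup (pN_mono (n := n) hη) (bddAbove_pN hη)).div_const (⨆ M, pN n η M)
  rwa [div_self (iSup_pN_pos hη).ne'] at this

theorem cf_nonneg {η : ℝ} (hη : 0 < η) (N : ℕ) : 0 ≤ cf n η N := by
  rcases N with _ | N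
  · exact (sN_pos hη 0).le
  · exact sub_nonneg.2 (div_le_div_of_nonneg_right (pN_mono hη N.le_succ) (iSup_pN_pos hη).le)

theorem sum_cf (η : ℝ) (M : ℕ) : ∑ N ∈ Finset.range (M + 1), cf n η N = sN n η M := by
  induction M with
  | zero => simp [cf]
  | succ M ih => rw [Finset.sum_range_succ, ih, cf]; ring

theorem cf_succ_mul {η : ℝ} (hη : 0 < η) (N : ℕ) :
    cf n η (N + 1) * (η ^ 4 * lam n (N + 1)) = sN n η N := by
  have hl := lam_pos (n := n) N
  rw [cf, sN, sN, pN]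
  field_simp
  ring

theorem sumLe_cf {η : ℝ} (hη : 0 < η) : SumLe (cf n η) 1 := by
  refine SumLe.of_partial (cf_nonneg hη) fun M => ?_
  rcases M with _ | M
  · simp
  · rw [sum_cf]; exact sN_le_one hη M

theorem cf_le {η : ℝ} (hη : 0 < η) (hη1 : η ≤ 1) (N : ℕ) :
    cf n η N ≤ 4 * (η ^ 4)⁻¹ * (ro N ^ 8)⁻¹ := by
  have hr : ro N ^ 8 = ((N : ℝ) + 1) ^ 2 := by
    rw [← ro_pow_four]; ring
  rw [hr]
  rcases N with _ | N
  · have h1 : cf n η 0 ≤ 1 := sN_le_one hη 0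
    have h2 : 1 ≤ (η ^ 4)⁻¹ := (one_le_inv₀ (by positivity)).2 (pow_le_one₀ hη.le hη1)
    norm_num
    linarith
  · have h := cf_succ_mul (n := n) hη N
    have h1 := sN_le_one (n := n) hη N
    have hl := sq_le_lam (n := n) N
    have hc := cf_nonneg (n := n) hη (N + 1)
    push_cast
    have hη4 : 0 < η ^ 4 := by positivity
    rw [mul_assoc, ← mul_inv, ← div_eq_mul_inv, le_div_iff₀ (by positivity)]
    have : cf n η (N + 1) * (η ^ 4 * ((N : ℝ) + 1) ^ 2) ≤ 1 :=
      le_trans (by gcongr) (h.le.trans h1)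
    have h3 : ((N : ℝ) + 1 + 1) ^ 2 ≤ 4 * ((N : ℝ) + 1) ^ 2 := by
      nlinarith [(Nat.cast_nonneg N : (0 : ℝ) ≤ N)]
    calc _ ≤ cf n η (N + 1) * (η ^ 4 * (4 * ((N : ℝ) + 1) ^ 2)) := by gcongr
      _ ≤ _ := by linarith

variable {η : ℝ}

theorem sumLe_cf_ro_two (hη : 0 < η) (hη1 : η ≤ 1) :
    SumLe (fun N => η ^ 2 * (cf n η N * ro N ^ 2)) 65 := by
  refine SumLe.mono ((sumLe_cf (n := n) hη).add
    ((sumLe_ro_six (s := η ^ 2) (by positivity)).const_mul (a := 4 * (η ^ 2)⁻¹) (by positivity)))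
    (fun N => ?_) (fun N => ?_) ?_
  · have := cf_nonneg (n := n) hη N
    positivity
  · have hc := cf_nonneg (n := n) hη N
    have hr := ro_pos N
    rcases le_total (η ^ 2 * ro N ^ 2) 1 with h | h
    · have : 0 ≤ 4 * (η ^ 2)⁻¹ * ((ro N ^ 6)⁻¹ * min 1 ((η ^ 2 * ro N ^ 2) ^ 2)) := by positivity
      nlinarith
    · rw [min_eq_left (one_le_pow₀ h)]
      have : η ^ 2 * (cf n η N * ro N ^ 2) ≤
          η ^ 2 * ((4 * (η ^ 4)⁻¹ * (ro N ^ 8)⁻¹) * ro N ^ 2) := by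
        gcongr; exact cf_le hη hη1 N
      have e : η ^ 2 * ((4 * (η ^ 4)⁻¹ * (ro N ^ 8)⁻¹) * ro N ^ 2) =
        4 * (η ^ 2)⁻¹ * ((ro N ^ 6)⁻¹ * 1) := by field_simp
      linarith
  · field_simp; norm_num

theorem sumLe_cf_ro_three (hη : 0 < η) (hη1 : η ≤ 1) :
    SumLe (fun N => η ^ 4 * (cf n η N * ro N ^ 3)) (65 * η) := by
  refine SumLe.mono (((sumLe_cf (n := n) hη).const_mul hη.le).add
    ((sumLe_ro_five hη.le).const_mul (a := 4) (by norm_num)))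
    (fun N => ?_) (fun N => ?_) (by linarith)
  · have := cf_nonneg (n := n) hη N
    have := ro_pos N
    positivity
  · have hc := cf_nonneg (n := n) hη N
    have hr := ro_pos N
    rcases le_total (η * ro N) 1 with h | h
    · have h1 : 0 ≤ 4 * ((ro N ^ 5)⁻¹ * min 1 ((η * ro N) ^ 2)) := by positivity
      have h2 : (η * ro N) ^ 3 ≤ 1 := pow_le_one₀ (by positivity) h
      have : η ^ 4 * (cf n η N * ro N ^ 3) = η * cf n η N * (η * ro N) ^ 3 := by ring
      have : η * cf n η N * (η * ro N) ^ 3 ≤ η * cf n η N * 1 := by gcongr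
      linarith
    · rw [min_eq_left (one_le_pow₀ h)]
      have : η ^ 4 * (cf n η N * ro N ^ 3) ≤
          η ^ 4 * ((4 * (η ^ 4)⁻¹ * (ro N ^ 8)⁻¹) * ro N ^ 3) := by
        gcongr; exact cf_le hη hη1 N
      have e : η ^ 4 * ((4 * (η ^ 4)⁻¹ * (ro N ^ 8)⁻¹) * ro N ^ 3) =
        4 * ((ro N ^ 5)⁻¹ * 1) := by field_simp
      have : 0 ≤ η * cf n η N := by positivity
      linarith

theorem sumLe_cf_ro_one (hη : 0 < η) (hη1 : η ≤ 1) :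
    SumLe (fun N => η ^ 2 * (cf n η N * ro N)) (66 * η) := by
  refine SumLe.mono (((sumLe_cf_ro_two (n := n) hη hη1).const_mul hη.le).add
    ((sumLe_cf (n := n) hη).const_mul hη.le)) (fun N => ?_) (fun N => ?_) (by linarith)
  · have := cf_nonneg (n := n) hη N
    have := ro_pos N
    positivity
  · have hc := cf_nonneg (n := n) hη N
    have hr := ro_pos N
    have h : η * ro N ≤ (η * ro N) ^ 2 + 1 := by nlinarith [sq_nonneg (η * ro N - 1), mul_pos hη hr]
    have : η * cf n η N * (η * ro N) ≤ η * cf n η N * ((η * ro N) ^ 2 + 1) := by gcongr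
    nlinarith

theorem sumLe_cf_ro_min (hη : 0 < η) (hη1 : η ≤ 1) {r : ℝ} (hr : 0 ≤ r) :
    SumLe (fun N => η ^ 4 * (cf n η N * (ro N ^ 3 * min 1 (th N * r)))) (64 * √r) := by
  refine SumLe.mono ((sumLe_ro_five (Real.sqrt_nonneg r)).const_mul (a := 4) (by norm_num))
    (fun N => ?_) (fun N => ?_) (by linarith)
  · have := cf_nonneg (n := n) hη N
    have := ro_pos N
    have : 0 ≤ min 1 (th N * r) := le_min zero_le_one (mul_nonneg (th_pos N).le hr)
    positivity
  · have hc := cf_le (n := n) hη hη1 N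
    have hr' := ro_pos N
    have e : (√r * ro N) ^ 2 = th N * r := by
      rw [mul_pow, Real.sq_sqrt hr, ro_sq]; ring
    rw [e]
    have ht := th_pos N
    calc η ^ 4 * (cf n η N * (ro N ^ 3 * min 1 (th N * r))) ≤
          η ^ 4 * ((4 * (η ^ 4)⁻¹ * (ro N ^ 8)⁻¹) * (ro N ^ 3 * min 1 (th N * r))) := by gcongr
      _ = _ := by field_simp

end Coefficients

section OperatorSums

variable {n : ℕ} [hn : Fact (2 ≤ n)]

/-- The weight defining `C^{1/2}` functions on the sphere. -/
def wS (n : ℕ) (x y : Sph n) : ℝ := √(dist x y)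

/-- The weight defining Lipschitz functions on the sphere. -/
def wL (n : ℕ) (x y : Sph n) : ℝ := dist x y

/-- The space `C^{1/2}(S^{n-1})`. -/
abbrev YS (n : ℕ) := LipW (wS n) ℝ

variable {V : Type} [NormedAddCommGroup V] [NormedSpace ℝ V]

theorem norm_sub_le_sqrt_dist (g : LipW (wS n) V) (x y : Sph n) :
    ‖g x - g y‖ ≤ ‖g‖ * √(dist x y) := by
  rcases eq_or_ne x y with rfl | h
  · simp
  · have h1 : wS n x y ≠ 0 := (Real.sqrt_pos.2 (dist_pos.2 h)).ne'
    have := g.norm_sub_le h1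
    rwa [wS, abs_of_nonneg (Real.sqrt_nonneg _)] at this

theorem norm_sub_le_dist (g : LipW (wL n) V) (x y : Sph n) :
    ‖g x - g y‖ ≤ ‖g‖ * dist x y := by
  rcases eq_or_ne x y with rfl | h
  · simp
  · have := g.norm_sub_le (t := x) (t' := y) (dist_pos.2 h).ne'
    rwa [wL, abs_of_nonneg dist_nonneg] at this

theorem le_two_mul_sqrt {r : ℝ} (h0 : 0 ≤ r) (h2 : r ≤ 2) : r ≤ 2 * √r := by
  have := Real.sq_sqrt h0
  have h : √r ≤ 2 := by rw [Real.sqrt_le_iff]; constructor <;> linarith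
  nlinarith [Real.sqrt_nonneg r]

theorem continuous_of_le_sqrt {F : Sph n → V} {C : ℝ}
    (h : ∀ x y, ‖F x - F y‖ ≤ C * √(dist x y)) : Continuous F := by
  rw [continuous_iff_continuousAt]
  intro x
  rw [ContinuousAt, tendsto_iff_norm_sub_tendsto_zero]
  refine squeeze_zero (fun _ => norm_nonneg _) (fun y => h y x) ?_
  have : Continuous fun y : Sph n => C * √(dist y x) := by fun_prop
  simpa using this.tendsto x

theorem LipW.continuous_S (g : LipW (wS n) V) : Continuous fun x => g x :=
  continuous_of_le_sqrt (norm_sub_le_sqrt_dist g)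

/-- The sum `∑ a c_N 𝒦_N g`. -/
def zop (K : ℕ → Sph n → Sph n → V) (a η : ℝ) (g : Sph n → ℝ) (x : Sph n) : V :=
  ∑' N, (a * cf n η N) • kop K N g x

/-- Summation hypotheses yielding bounds for `zop`. -/
structure OpSum (n k : ℕ) (a η : ℝ) (wt : ℝ → ℝ) (m : ℕ → ℝ) (D : ℕ → ℝ → ℝ) (S : ℝ) : Prop where
  nonneg : 0 ≤ a
  pos : 0 < η
  D_nonneg : ∀ N r, 0 ≤ r → 0 ≤ D N r
  sup : SumLe (fun N => a * (cf n η N * (m N * th N ^ k + 1))) S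
  diff : ∀ r, 0 ≤ r → r ≤ 2 →
    SumLe (fun N => a * (cf n η N * (m N * th N ^ k * min 1 (th N * r) + r + D N r))) (S * wt r)

/-- `g` is controlled at all scales by `m` and `D`, with constant `G`. -/
structure Scaled (g : Sph n → ℝ) (m : ℕ → ℝ) (D : ℕ → ℝ → ℝ) (G : ℝ) : Prop where
  cont : Continuous g
  nonneg : 0 ≤ G
  osc : ∀ N x y, |g y - g x| ≤ G * m N * (1 + th N * dist x y)
  bound : ∀ x, |g x| ≤ G
  diff : ∀ N x y, 1 ≤ th N * dist x y → |g x - g y| ≤ G * D N (dist x y)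

variable {k : ℕ} {K : ℕ → Sph n → Sph n → V} {P : Sph n → V} {C a η S G : ℝ} {wt : ℝ → ℝ}
  {m : ℕ → ℝ} {D : ℕ → ℝ → ℝ} {g : Sph n → ℝ}

theorem norm_term_le (hK : KerBound k K P C)
    (hP : ∀ N x, ∫ y, K N x y ∂(sig n) = cc n N • P x) (hS : OpSum n k a η wt m D S)
    (hg : Scaled g m D G) (x : Sph n) (N : ℕ) :
    ‖(a * cf n η N) • kop K N g x‖ ≤
      C * momC n * G * (a * (cf n η N * (m N * th N ^ k + 1))) := by
  have hc := cf_nonneg (n := n) hS.pos N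
  have ha := hS.nonneg
  rw [norm_smul, Real.norm_of_nonneg (by positivity)]
  calc _ ≤ a * cf n η N * (C * momC n * (G * m N * th N ^ k + G)) := by
        gcongr
        exact hK.norm_kop_le hP hg.cont N x (hg.osc N x) (hg.bound x)
    _ = _ := by ring

theorem momC_pos : 0 < momC n := lt_of_lt_of_le (by norm_num) momC_ge

theorem KerBound.const_nonneg (hK : KerBound k K P C) (hg : Scaled g m D G) :
    0 ≤ C * momC n * G := mul_nonneg (mul_nonneg hK.nonneg momC_pos.le) hg.nonneg

theorem summable_zop [CompleteSpace V] (hK : KerBound k K P C)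
    (hP : ∀ N x, ∫ y, K N x y ∂(sig n) = cc n N • P x) (hS : OpSum n k a η wt m D S)
    (hg : Scaled g m D G) (x : Sph n) : Summable fun N => (a * cf n η N) • kop K N g x :=
  (hS.sup.const_mul (hK.const_nonneg hg)).summable (norm_term_le hK hP hS hg x)

theorem norm_zop_le (hK : KerBound k K P C)
    (hP : ∀ N x, ∫ y, K N x y ∂(sig n) = cc n N • P x) (hS : OpSum n k a η wt m D S)
    (hg : Scaled g m D G) (x : Sph n) : ‖zop K a η g x‖ ≤ C * momC n * G * S :=
  (hS.sup.const_mul (hK.const_nonneg hg)).norm_tsum_le (norm_term_le hK hP hS hg x)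

theorem norm_zop_sub_le [CompleteSpace V] (hK : KerBound k K P C)
    (hP : ∀ N x, ∫ y, K N x y ∂(sig n) = cc n N • P x) (hS : OpSum n k a η wt m D S)
    (hg : Scaled g m D G) (x₁ x₂ : Sph n) :
    ‖zop K a η g x₁ - zop K a η g x₂‖ ≤ 3 * (C * momC n * G) * (S * wt (dist x₁ x₂)) := by
  rw [zop, zop, ← (summable_zop hK hP hS hg x₁).tsum_sub (summable_zop hK hP hS hg x₂)]
  refine ((hS.diff _ dist_nonneg (dist_sph_le_two x₁ x₂)).const_mul
    (mul_nonneg (by norm_num) (hK.const_nonneg hg))).norm_tsum_le fun N => ?_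
  have hc := cf_nonneg (n := n) hS.pos N
  have ha := hS.nonneg
  rw [← smul_sub, norm_smul, Real.norm_of_nonneg (by positivity)]
  calc _ ≤ a * cf n η N * (3 * C * momC n * (G * m N * th N ^ k * min 1 (th N * dist x₁ x₂) +
          G * dist x₁ x₂ + G * D N (dist x₁ x₂))) := by
        gcongr
        exact hK.norm_kop_sub_le hP hg.cont N x₁ x₂ (hg.osc N) hg.bound
          (mul_nonneg hg.nonneg (hS.D_nonneg N _ dist_nonneg)) (hg.diff N x₁ x₂)
    _ = _ := by ring

/-- Scales controlling a `C^{1/2}` function. -/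
def mS (N : ℕ) : ℝ := (ro N)⁻¹

theorem YS.scaled (g : YS n) {D : ℕ → ℝ → ℝ} (hD : ∀ N r, 0 ≤ r → 1 ≤ th N * r → √r ≤ D N r) :
    Scaled (fun x => g x) mS D ‖g‖ where
  cont := g.continuous_S
  nonneg := norm_nonneg _
  osc N x y := by
    refine (norm_sub_le_sqrt_dist g y x).trans ?_
    rw [mul_assoc, dist_comm]
    gcongr
    have hr := ro_pos N
    have hd := dist_nonneg (x := x) (y := y)
    have h2 : (ro N * √(dist x y)) ^ 2 = th N * dist x y := by
      rw [mul_pow, ro_sq, Real.sq_sqrt hd]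
    rw [mS, inv_mul_eq_div, le_div_iff₀ hr, ← h2]
    nlinarith [sq_nonneg (ro N * √(dist x y) - 1), Real.sqrt_nonneg (dist x y)]
  bound x := g.norm_apply_le x
  diff N x y h := (norm_sub_le_sqrt_dist g x y).trans (by gcongr; exact hD N _ dist_nonneg h)

theorem scaled_of_lipschitz {g : Sph n → ℝ} {L : ℝ} (hb : ∀ x, |g x| ≤ L)
    (hL : ∀ x y, |g x - g y| ≤ L * dist x y) :
    Scaled g (fun N => (th N)⁻¹) (fun _ r => r) L where
  cont := by
    have L0 : 0 ≤ L := (abs_nonneg _).trans (hb (baseP n))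
    exact (LipschitzWith.of_dist_le_mul (K := ⟨L, L0⟩) fun x y => hL x y).continuous
  nonneg := (abs_nonneg _).trans (hb (baseP n))
  osc N x y := by
    have L0 : 0 ≤ L := (abs_nonneg _).trans (hb (baseP n))
    refine (hL y x).trans ?_
    rw [mul_assoc, dist_comm]
    gcongr
    have ht := th_pos N
    rw [inv_mul_eq_div, le_div_iff₀ ht]
    nlinarith
  bound := hb
  diff N x y _ := hL x y

theorem kop_add (hK : KerBound k K P C) {f g : Sph n → ℝ} (hf : Continuous f) (hg : Continuous g)
    (N : ℕ) (x : Sph n) :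
    kop K N (fun y => f y + g y) x = kop K N f x + kop K N g x := by
  rw [kop, kop, kop, ← smul_add, ← integral_add (hK.integrable hf N x) (hK.integrable hg N x)]
  simp only [add_smul]

theorem kop_smul (c : ℝ) (g : Sph n → ℝ) (N : ℕ) (x : Sph n) :
    kop K N (fun y => c * g y) x = c • kop K N g x := by
  rw [kop, kop, smul_comm c, ← integral_smul c]
  simp only [mul_smul]

/-- The operator `zop` as a continuous linear map on `C^{1/2}`. -/
def zopL [CompleteSpace V] (hK : KerBound k K P C)
    (hP : ∀ N x, ∫ y, K N x y ∂(sig n) = cc n N • P x) (hS : OpSum n k a η wt mS D S)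
    (hD : ∀ N r, 0 ≤ r → 1 ≤ th N * r → √r ≤ D N r)
    (hwt : ∀ r, 0 ≤ r → r ≤ 2 → wt r ≤ 2 * √r) (hS0 : 0 ≤ S) :
    YS n →L[ℝ] LipW (fun x y : Sph n => wt (dist x y)) V :=
  have h3 : ∀ a' : YS n, ∀ x y : Sph n,
    ‖zop K a η (fun x => a' x) x - zop K a η (fun x => a' x) y‖ ≤
      3 * (C * momC n * S) * ‖a'‖ * wt (dist x y) := fun a' x y =>
    (norm_zop_sub_le hK hP hS (YS.scaled a' hD) x y).trans (le_of_eq (by ring))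
  have hC : 0 ≤ C * momC n * S := mul_nonneg (mul_nonneg hK.nonneg momC_pos.le) hS0
  LipW.mkCLM (fun g x => zop K a η (fun x => g x) x) (3 * (C * momC n * S))
    (fun f g x => by
      rw [zop, zop, zop, ← (summable_zop hK hP hS (YS.scaled f hD) x).tsum_add
        (summable_zop hK hP hS (YS.scaled g hD) x)]
      refine tsum_congr fun N => ?_
      rw [← smul_add, ← kop_add hK f.continuous_S g.continuous_S]; rfl)
    (fun c g x => by
      rw [zop, zop, ← tsum_const_smul'' c]
      refine tsum_congr fun N => ?_
      rw [smul_comm c, ← kop_smul c]; rfl)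
    (fun g => (continuous_of_le_sqrt (C := 3 * (C * momC n * S) * ‖g‖ * 2) fun x y =>
      (h3 g x y).trans (by
        rw [mul_assoc _ (2 : ℝ)]
        gcongr
        exact hwt _ dist_nonneg (dist_sph_le_two x y))).stronglyMeasurable)
    (fun g x => (norm_zop_le hK hP hS (YS.scaled g hD) x).trans (by
      have : 0 ≤ C * momC n * S * ‖g‖ := by positivity
      linarith))
    (fun g x y _ => (h3 g x y).trans (by gcongr; exact le_abs_self _))

theorem sqrt_min_le {r : ℝ} (hr : 0 ≤ r) (N : ℕ) : min 1 (th N * r) ≤ ro N * √r := by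
  have h2 : (ro N * √r) ^ 2 = th N * r := by
    rw [mul_pow, ro_sq, Real.sq_sqrt hr]
  have h0 : 0 ≤ ro N * √r := mul_nonneg (ro_pos N).le (Real.sqrt_nonneg _)
  rw [← h2]
  rcases le_total (ro N * √r) 1 with h | h
  · exact (min_le_right _ _).trans (by nlinarith)
  · exact (min_le_left _ _).trans h

theorem min_th_nonneg {r : ℝ} (hr : 0 ≤ r) (N : ℕ) : 0 ≤ min 1 (th N * r) :=
  le_min zero_le_one (mul_nonneg (th_pos N).le hr)

end OperatorSums

section Instances

variable {n : ℕ} [hn : Fact (2 ≤ n)] {η : ℝ}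

theorem opSum_Z (hη : 0 < η) : OpSum n 0 1 η Real.sqrt mS (fun _ r => √r) 260 where
  nonneg := zero_le_one
  pos := hη
  D_nonneg _ _ _ := Real.sqrt_nonneg _
  sup := ((sumLe_cf hη).const_mul (a := 2) (by norm_num)).mono
    (fun N => by
      have := cf_nonneg (n := n) hη N
      have := ro_pos N
      rw [mS]; positivity)
    (fun N => by
      have h := cf_nonneg (n := n) hη N
      have : (ro N)⁻¹ ≤ 1 := inv_le_one_of_one_le₀ (one_le_ro N)
      rw [mS, pow_zero, mul_one]
      nlinarith) (by norm_num)
  diff r hr hr2 := ((sumLe_cf hη).const_mul (a := 4 * √r) (by positivity)).mono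
    (fun N => by
      have := cf_nonneg (n := n) hη N
      have := ro_pos N
      have := min_th_nonneg hr N
      rw [mS]; positivity)
    (fun N => by
      have h := cf_nonneg (n := n) hη N
      have h1 := sqrt_min_le hr N
      have h2 := le_two_mul_sqrt hr hr2
      have h0 := ro_pos N
      rw [mS, pow_zero, mul_one, one_mul, mul_comm]
      refine mul_le_mul_of_nonneg_right ?_ h
      have : (ro N)⁻¹ * min 1 (th N * r) ≤ √r := by
        rw [inv_mul_eq_div, div_le_iff₀ h0]; linarith
      linarith) (by nlinarith [Real.sqrt_nonneg r])

theorem opSum_A (hη : 0 < η) (hη1 : η ≤ 1) :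
    OpSum n 1 (η ^ 2) η Real.sqrt mS (fun _ r => √r) 260 where
  nonneg := by positivity
  pos := hη
  D_nonneg _ _ _ := Real.sqrt_nonneg _
  sup := ((sumLe_cf_ro_two hη hη1).const_mul (a := 2) (by norm_num)).mono
    (fun N => by
      have := cf_nonneg (n := n) hη N
      have := ro_pos N
      have := th_pos N
      rw [mS]; positivity)
    (fun N => by
      have h := cf_nonneg (n := n) hη N
      have h1 := one_le_ro N
      have h0 := ro_pos N
      have e : (ro N)⁻¹ * th N ^ 1 = ro N := by rw [← ro_sq]; field_simp
      rw [mS, e]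
      calc η ^ 2 * (cf n η N * (ro N + 1)) ≤ η ^ 2 * (cf n η N * (2 * ro N ^ 2)) := by
            gcongr; nlinarith
        _ = _ := by ring) (by norm_num)
  diff r hr hr2 := ((sumLe_cf_ro_two hη hη1).const_mul (a := 4 * √r) (by positivity)).mono
    (fun N => by
      have := cf_nonneg (n := n) hη N
      have := ro_pos N
      have := min_th_nonneg hr N
      have := th_pos N
      rw [mS]; positivity)
    (fun N => by
      have h := cf_nonneg (n := n) hη N
      have h1 := sqrt_min_le hr N
      have h2 := le_two_mul_sqrt hr hr2
      have h3 := one_le_ro N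
      have h0 := ro_pos N
      have e : (ro N)⁻¹ * th N ^ 1 = ro N := by rw [← ro_sq]; field_simp
      rw [mS, e]
      have hs := Real.sqrt_nonneg r
      calc η ^ 2 * (cf n η N * (ro N * min 1 (th N * r) + r + √r)) ≤
            η ^ 2 * (cf n η N * (ro N * (ro N * √r) + 2 * √r + √r)) := by gcongr
        _ ≤ η ^ 2 * (cf n η N * (4 * √r * ro N ^ 2)) := by
            gcongr
            have : 1 ≤ ro N ^ 2 := one_le_pow₀ h3
            nlinarith
        _ = _ := by ring) (by linarith)

theorem opSum_E (hη : 0 < η) (hη1 : η ≤ 1) :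
    OpSum n 1 (η ^ 4) η (fun r => r) mS (fun N r => r * ro N) 260 where
  nonneg := by positivity
  pos := hη
  D_nonneg N r hr := mul_nonneg hr (ro_pos N).le
  sup := ((sumLe_cf_ro_three hη hη1).const_mul (a := 2) (by norm_num)).mono
    (fun N => by
      have := cf_nonneg (n := n) hη N
      have := ro_pos N
      have := th_pos N
      rw [mS]; positivity)
    (fun N => by
      have h := cf_nonneg (n := n) hη N
      have h1 := one_le_ro N
      have h0 := ro_pos N
      have e : (ro N)⁻¹ * th N ^ 1 = ro N := by rw [← ro_sq]; field_simp
      rw [mS, e]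
      have h3 : ro N ≤ ro N ^ 3 := le_self_pow₀ h1 (by norm_num)
      calc η ^ 4 * (cf n η N * (ro N + 1)) ≤ η ^ 4 * (cf n η N * (2 * ro N ^ 3)) := by
            gcongr; linarith
        _ = _ := by ring) (by linarith)
  diff r hr hr2 := ((sumLe_cf_ro_three hη hη1).const_mul (a := 3 * r) (by positivity)).mono
    (fun N => by
      have := cf_nonneg (n := n) hη N
      have := ro_pos N
      have := min_th_nonneg hr N
      have := th_pos N
      rw [mS]; positivity)
    (fun N => by
      have h := cf_nonneg (n := n) hη N
      have h1 : min 1 (th N * r) ≤ th N * r := min_le_right _ _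
      have h3 := one_le_ro N
      have h0 := ro_pos N
      have e : (ro N)⁻¹ * th N ^ 1 = ro N := by rw [← ro_sq]; field_simp
      rw [mS, e]
      calc η ^ 4 * (cf n η N * (ro N * min 1 (th N * r) + r + r * ro N)) ≤
            η ^ 4 * (cf n η N * (ro N * (th N * r) + r + r * ro N)) := by gcongr
        _ ≤ η ^ 4 * (cf n η N * (3 * r * ro N ^ 3)) := by
            gcongr
            rw [← ro_sq]
            have a1 : 1 ≤ ro N ^ 3 := one_le_pow₀ h3
            have a2 : ro N ≤ ro N ^ 3 := le_self_pow₀ h3 (by norm_num)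
            nlinarith
        _ = _ := by ring) (by nlinarith)

theorem opSum_M (hη : 0 < η) (hη1 : η ≤ 1) :
    OpSum n 2 (η ^ 4) η Real.sqrt mS (fun _ r => √r) 260 where
  nonneg := by positivity
  pos := hη
  D_nonneg _ _ _ := Real.sqrt_nonneg _
  sup := ((sumLe_cf_ro_three hη hη1).const_mul (a := 2) (by norm_num)).mono
    (fun N => by
      have := cf_nonneg (n := n) hη N
      have := ro_pos N
      have := th_pos N
      rw [mS]; positivity)
    (fun N => by
      have h := cf_nonneg (n := n) hη N
      have h1 := one_le_ro N
      have h0 := ro_pos N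
      have e : (ro N)⁻¹ * th N ^ 2 = ro N ^ 3 := by rw [← ro_sq]; field_simp
      rw [mS, e]
      have h3 : 1 ≤ ro N ^ 3 := one_le_pow₀ h1
      calc η ^ 4 * (cf n η N * (ro N ^ 3 + 1)) ≤ η ^ 4 * (cf n η N * (2 * ro N ^ 3)) := by
            gcongr; linarith
        _ = _ := by ring) (by linarith)
  diff r hr hr2 := ((sumLe_cf_ro_min hη hη1 hr).add
      ((sumLe_cf_ro_three hη hη1).const_mul (a := 3 * √r) (by positivity))).mono
    (fun N => by
      have := cf_nonneg (n := n) hη N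
      have := ro_pos N
      have := min_th_nonneg hr N
      have := th_pos N
      rw [mS]; positivity)
    (fun N => by
      have h := cf_nonneg (n := n) hη N
      have h2 := le_two_mul_sqrt hr hr2
      have h3 := one_le_ro N
      have h0 := ro_pos N
      have e : (ro N)⁻¹ * th N ^ 2 = ro N ^ 3 := by rw [← ro_sq]; field_simp
      rw [mS, e]
      have hs := Real.sqrt_nonneg r
      calc η ^ 4 * (cf n η N * (ro N ^ 3 * min 1 (th N * r) + r + √r)) ≤
            η ^ 4 * (cf n η N * (ro N ^ 3 * min 1 (th N * r) + 3 * √r * ro N ^ 3)) := by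
            rw [add_assoc]
            gcongr
            have a1 : 1 ≤ ro N ^ 3 := one_le_pow₀ h3
            nlinarith
        _ = _ := by ring) (by nlinarith [Real.sqrt_nonneg r])

theorem opSum_A_lip (hη : 0 < η) (hη1 : η ≤ 1) :
    OpSum n 1 (η ^ 2) η Real.sqrt (fun N => (th N)⁻¹) (fun _ r => r) (330 * η) where
  nonneg := by positivity
  pos := hη
  D_nonneg _ _ h := h
  sup := ((sumLe_cf_ro_one hη hη1).const_mul (a := 2) (by norm_num)).mono
    (fun N => by
      have := cf_nonneg (n := n) hη N
      have := th_pos N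
      positivity)
    (fun N => by
      have h := cf_nonneg (n := n) hη N
      have h1 := one_le_ro N
      have h0 := th_pos N
      rw [pow_one, inv_mul_cancel₀ h0.ne']
      calc η ^ 2 * (cf n η N * (1 + 1)) ≤ η ^ 2 * (cf n η N * (2 * ro N)) := by
            gcongr; linarith
        _ = _ := by ring) (by linarith)
  diff r hr hr2 := ((sumLe_cf_ro_one hη hη1).const_mul (a := 5 * √r) (by positivity)).mono
    (fun N => by
      have := cf_nonneg (n := n) hη N
      have := min_th_nonneg hr N
      have := th_pos N
      positivity)
    (fun N => by
      have h := cf_nonneg (n := n) hη N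
      have h1 := sqrt_min_le hr N
      have h2 := le_two_mul_sqrt hr hr2
      have h3 := one_le_ro N
      have h0 := th_pos N
      have hs := Real.sqrt_nonneg r
      rw [pow_one, inv_mul_cancel₀ h0.ne']
      calc η ^ 2 * (cf n η N * (1 * min 1 (th N * r) + r + r)) ≤
            η ^ 2 * (cf n η N * (1 * (ro N * √r) + 2 * √r + 2 * √r)) := by gcongr
        _ ≤ η ^ 2 * (cf n η N * (5 * √r * ro N)) := by
            gcongr
            nlinarith
        _ = _ := by ring) (by nlinarith [Real.sqrt_nonneg r])

theorem opSum_E_lip (hη : 0 < η) (hη1 : η ≤ 1) :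
    OpSum n 1 (η ^ 4) η (fun r => r) (fun N => (th N)⁻¹) (fun _ r => r) (330 * η) where
  nonneg := by positivity
  pos := hη
  D_nonneg _ _ h := h
  sup := ((sumLe_cf_ro_three hη hη1).const_mul (a := 2) (by norm_num)).mono
    (fun N => by
      have := cf_nonneg (n := n) hη N
      have := th_pos N
      positivity)
    (fun N => by
      have h := cf_nonneg (n := n) hη N
      have h1 := one_le_pow₀ (one_le_ro N) (n := 3)
      have h0 := th_pos N
      rw [pow_one, inv_mul_cancel₀ h0.ne']
      calc η ^ 4 * (cf n η N * (1 + 1)) ≤ η ^ 4 * (cf n η N * (2 * ro N ^ 3)) := by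
            gcongr; linarith
        _ = _ := by ring) (by linarith)
  diff r hr hr2 := ((sumLe_cf_ro_three hη hη1).const_mul (a := 3 * r) (by positivity)).mono
    (fun N => by
      have := cf_nonneg (n := n) hη N
      have := min_th_nonneg hr N
      have := th_pos N
      positivity)
    (fun N => by
      have h := cf_nonneg (n := n) hη N
      have h1 : min 1 (th N * r) ≤ th N * r := min_le_right _ _
      have h3 := one_le_ro N
      have h0 := th_pos N
      rw [pow_one, inv_mul_cancel₀ h0.ne']
      calc η ^ 4 * (cf n η N * (1 * min 1 (th N * r) + r + r)) ≤
            η ^ 4 * (cf n η N * (1 * (th N * r) + r + r)) := by gcongr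
        _ ≤ η ^ 4 * (cf n η N * (3 * r * ro N ^ 3)) := by
            gcongr
            rw [← ro_sq]
            have a1 : 1 ≤ ro N ^ 3 := one_le_pow₀ h3
            have a2 : ro N ^ 2 ≤ ro N ^ 3 := pow_le_pow_right₀ h3 (by norm_num)
            nlinarith
        _ = _ := by ring) (by nlinarith)

theorem opSum_M_lip (hη : 0 < η) (hη1 : η ≤ 1) :
    OpSum n 2 (η ^ 4) η Real.sqrt (fun N => (th N)⁻¹) (fun _ r => r) (330 * η) where
  nonneg := by positivity
  pos := hη
  D_nonneg _ _ h := h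
  sup := ((sumLe_cf_ro_three hη hη1).const_mul (a := 2) (by norm_num)).mono
    (fun N => by
      have := cf_nonneg (n := n) hη N
      have := th_pos N
      positivity)
    (fun N => by
      have h := cf_nonneg (n := n) hη N
      have h1 := one_le_ro N
      have h0 := th_pos N
      have e : (th N)⁻¹ * th N ^ 2 = ro N ^ 2 := by rw [← ro_sq]; have := ro_pos N; field_simp
      rw [e]
      have a1 : 1 ≤ ro N ^ 3 := one_le_pow₀ h1
      have a2 : ro N ^ 2 ≤ ro N ^ 3 := pow_le_pow_right₀ h1 (by norm_num)
      calc η ^ 4 * (cf n η N * (ro N ^ 2 + 1)) ≤ η ^ 4 * (cf n η N * (2 * ro N ^ 3)) := by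
            gcongr; linarith
        _ = _ := by ring) (by linarith)
  diff r hr hr2 := ((sumLe_cf_ro_three hη hη1).const_mul (a := 5 * √r) (by positivity)).mono
    (fun N => by
      have := cf_nonneg (n := n) hη N
      have := min_th_nonneg hr N
      have := th_pos N
      positivity)
    (fun N => by
      have h := cf_nonneg (n := n) hη N
      have h1 := sqrt_min_le hr N
      have h2 := le_two_mul_sqrt hr hr2
      have h3 := one_le_ro N
      have h0 := ro_pos N
      have hs := Real.sqrt_nonneg r
      have e : (th N)⁻¹ * th N ^ 2 = ro N ^ 2 := by rw [← ro_sq]; field_simp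
      rw [e]
      calc η ^ 4 * (cf n η N * (ro N ^ 2 * min 1 (th N * r) + r + r)) ≤
            η ^ 4 * (cf n η N * (ro N ^ 2 * (ro N * √r) + 2 * √r + 2 * √r)) := by gcongr
        _ ≤ η ^ 4 * (cf n η N * (5 * √r * ro N ^ 3)) := by
            gcongr
            have a1 : 1 ≤ ro N ^ 3 := one_le_pow₀ h3
            nlinarith
        _ = _ := by ring) (by nlinarith [Real.sqrt_nonneg r])

end Instances

section ResolventOperators

variable {n : ℕ} [hn : Fact (2 ≤ n)] {η : ℝ}

theorem integral_kerZ' (N : ℕ) (x : Sph n) :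
    ∫ y : Sph n, kerZ N (x : Eucl n) y ∂(sig n) = cc n N • (1 : ℝ) := by
  rw [integral_kerZ]; simp

/-- The resolvent `(1 - η⁴ Δ)⁻¹` on the sphere. -/
def Rop (hη : 0 < η) : YS n →L[ℝ] YS n :=
  zopL kerBound_kerZ integral_kerZ' (opSum_Z hη) (fun _ _ _ _ => le_rfl)
    (fun r _ _ => by linarith [Real.sqrt_nonneg r]) (by norm_num)

/-- `η²` times the gradient of the homogeneous extension of the resolvent. -/
def Aop (hη : 0 < η) (hη1 : η ≤ 1) : YS n →L[ℝ] LipW (wS n) (Eucl n) :=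
  zopL kerBound_kerV integral_kerV (opSum_A hη hη1) (fun _ _ _ _ => le_rfl)
    (fun r _ _ => by linarith [Real.sqrt_nonneg r]) (by norm_num)

theorem sqrt_le_mul_ro (N : ℕ) (r : ℝ) (hr : 0 ≤ r) (h : 1 ≤ th N * r) : √r ≤ r * ro N := by
  have h2 : (ro N * √r) ^ 2 = th N * r := by rw [mul_pow, ro_sq, Real.sq_sqrt hr]
  have h0 : 0 ≤ ro N * √r := mul_nonneg (ro_pos N).le (Real.sqrt_nonneg _)
  have h1 : 1 ≤ ro N * √r := by nlinarith
  calc √r = √r * 1 := by ring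
    _ ≤ √r * (ro N * √r) := by gcongr
    _ = (√r * √r) * ro N := by ring
    _ = _ := by rw [Real.mul_self_sqrt hr]

/-- `η⁴` times the gradient of the homogeneous extension of the resolvent. -/
def Eop (hη : 0 < η) (hη1 : η ≤ 1) : YS n →L[ℝ] LipW (wL n) (Eucl n) :=
  zopL kerBound_kerV integral_kerV (opSum_E hη hη1) sqrt_le_mul_ro
    (fun _ => le_two_mul_sqrt) (by norm_num)

/-- `η⁴` times the Hessian of the homogeneous extension of the resolvent. -/
def Mop (hη : 0 < η) (hη1 : η ≤ 1) : YS n →L[ℝ] LipW (wS n) (Eucl n →L[ℝ] Eucl n) :=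
  zopL kerBound_kerM integral_kerM (opSum_M hη hη1) (fun _ _ _ _ => le_rfl)
    (fun r _ _ => by linarith [Real.sqrt_nonneg r]) (by norm_num)

section Norms

variable {V : Type} [NormedAddCommGroup V] [NormedSpace ℝ V] [CompleteSpace V]
  {k : ℕ} {K : ℕ → Sph n → Sph n → V} {P : Sph n → V} {C a S : ℝ} {wt : ℝ → ℝ} {D : ℕ → ℝ → ℝ}

theorem zopL_apply (hK : KerBound k K P C)
    (hP : ∀ N x, ∫ y, K N x y ∂(sig n) = cc n N • P x) (hS : OpSum n k a η wt mS D S)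
    (hD : ∀ N r, 0 ≤ r → 1 ≤ th N * r → √r ≤ D N r)
    (hwt : ∀ r, 0 ≤ r → r ≤ 2 → wt r ≤ 2 * √r) (hS0 : 0 ≤ S) (g : YS n) (x : Sph n) :
    zopL hK hP hS hD hwt hS0 g x = zop K a η (fun x => g x) x := rfl

theorem norm_zopL_le_of_scaled (hK : KerBound k K P C)
    (hP : ∀ N x, ∫ y, K N x y ∂(sig n) = cc n N • P x) (hS : OpSum n k a η wt mS D S)
    (hD : ∀ N r, 0 ≤ r → 1 ≤ th N * r → √r ≤ D N r)
    (hwt : ∀ r, 0 ≤ r → r ≤ 2 → wt r ≤ 2 * √r) (hS0 : 0 ≤ S) {g : YS n}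
    {m : ℕ → ℝ} {D' : ℕ → ℝ → ℝ} {S' G : ℝ} (hS' : OpSum n k a η wt m D' S') (hS'0 : 0 ≤ S')
    (hg : Scaled (fun x => g x) m D' G) :
    ‖zopL hK hP hS hD hwt hS0 g‖ ≤ 3 * (C * momC n * G) * S' := by
  have h0 := hK.const_nonneg hg
  refine LipW.norm_le (by positivity) (fun x => ?_) fun x y h => ?_
  · rw [zopL_apply]
    refine (norm_zop_le hK hP hS' hg x).trans ?_
    have := mul_nonneg h0 hS'0
    linarith
  · rw [zopL_apply, zopL_apply]
    refine (norm_zop_sub_le hK hP hS' hg x y).trans ?_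
    rw [← mul_assoc]
    gcongr; exact le_abs_self _

end Norms

/-- A bound for all the operators. -/
def CO (n : ℕ) : ℝ := 30000 * momC n

theorem CO_pos : 0 < CO n := mul_pos (by norm_num) momC_pos

theorem norm_Rop_le (hη : 0 < η) (g : YS n) : ‖Rop hη g‖ ≤ CO n * ‖g‖ := by
  refine (norm_zopL_le_of_scaled _ _ _ _ _ _ (opSum_Z hη) (by norm_num)
    (YS.scaled g fun _ _ _ _ => le_rfl)).trans ?_
  have := mul_nonneg (momC_pos (n := n)).le (norm_nonneg g)
  rw [CO]; nlinarith

theorem norm_Aop_le (hη : 0 < η) (hη1 : η ≤ 1) (g : YS n) : ‖Aop hη hη1 g‖ ≤ CO n * ‖g‖ := by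
  refine (norm_zopL_le_of_scaled _ _ _ _ _ _ (opSum_A hη hη1) (by norm_num)
    (YS.scaled g fun _ _ _ _ => le_rfl)).trans ?_
  have := mul_nonneg (momC_pos (n := n)).le (norm_nonneg g)
  rw [CO]; nlinarith

theorem norm_Eop_le (hη : 0 < η) (hη1 : η ≤ 1) (g : YS n) : ‖Eop hη hη1 g‖ ≤ CO n * ‖g‖ := by
  refine (norm_zopL_le_of_scaled _ _ _ _ _ _ (opSum_E hη hη1) (by norm_num)
    (YS.scaled g sqrt_le_mul_ro)).trans ?_
  have := mul_nonneg (momC_pos (n := n)).le (norm_nonneg g)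
  rw [CO]; nlinarith

theorem norm_Mop_le (hη : 0 < η) (hη1 : η ≤ 1) (g : YS n) : ‖Mop hη hη1 g‖ ≤ CO n * ‖g‖ := by
  refine (norm_zopL_le_of_scaled _ _ _ _ _ _ (opSum_M hη hη1) (by norm_num)
    (YS.scaled g fun _ _ _ _ => le_rfl)).trans ?_
  have := mul_nonneg (momC_pos (n := n)).le (norm_nonneg g)
  rw [CO]; nlinarith

section Lipschitz

variable {g : YS n} {L : ℝ}

theorem norm_Aop_le_of_lipschitz (hb : ∀ x, |g x| ≤ L)
    (hL : ∀ x y, |g x - g y| ≤ L * dist x y) (hη : 0 < η) (hη1 : η ≤ 1) :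
    ‖Aop hη hη1 g‖ ≤ CO n * L * η := by
  refine (norm_zopL_le_of_scaled _ _ _ _ _ _ (opSum_A_lip hη hη1) (by positivity)
    (scaled_of_lipschitz hb hL)).trans ?_
  have := mul_nonneg (mul_nonneg (momC_pos (n := n)).le ((abs_nonneg _).trans (hb (baseP n)))) hη.le
  rw [CO]; nlinarith

theorem norm_Eop_le_of_lipschitz (hb : ∀ x, |g x| ≤ L)
    (hL : ∀ x y, |g x - g y| ≤ L * dist x y) (hη : 0 < η) (hη1 : η ≤ 1) :
    ‖Eop hη hη1 g‖ ≤ CO n * L * η := by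
  refine (norm_zopL_le_of_scaled _ _ _ _ _ _ (opSum_E_lip hη hη1) (by positivity)
    (scaled_of_lipschitz hb hL)).trans ?_
  have := mul_nonneg (mul_nonneg (momC_pos (n := n)).le ((abs_nonneg _).trans (hb (baseP n)))) hη.le
  rw [CO]; nlinarith

theorem norm_Mop_le_of_lipschitz (hb : ∀ x, |g x| ≤ L)
    (hL : ∀ x y, |g x - g y| ≤ L * dist x y) (hη : 0 < η) (hη1 : η ≤ 1) :
    ‖Mop hη hη1 g‖ ≤ CO n * L * η := by
  refine (norm_zopL_le_of_scaled _ _ _ _ _ _ (opSum_M_lip hη hη1) (by positivity)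
    (scaled_of_lipschitz hb hL)).trans ?_
  have := mul_nonneg (mul_nonneg (momC_pos (n := n)).le ((abs_nonneg _).trans (hb (baseP n)))) hη.le
  rw [CO]; nlinarith

end Lipschitz

/-! ### The resolvent identity -/

theorem trL_kop_kerM_succ {g : Sph n → ℝ} (hg : Continuous g) (N : ℕ) (x : Sph n) :
    trL n (kop (fun N (x y : Sph n) => kerM N (x : Eucl n) y) (N + 1) g x) =
      lam n (N + 1) * (kop (fun N (x y : Sph n) => kerZ N (x : Eucl n) y) N g x -
        kop (fun N (x y : Sph n) => kerZ N (x : Eucl n) y) (N + 1) g x) +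
      (n - 1) * kop (fun N (x y : Sph n) => kerZ N (x : Eucl n) y) (N + 1) g x := by
  have i0 := kerBound_kerZ.integrable hg N x
  have i1 := kerBound_kerZ.integrable hg (N + 1) x
  have iM := kerBound_kerM.integrable hg (N + 1) x
  simp only [smul_eq_mul] at i0 i1
  have c0 := cc_pos (n := n) N
  have c1 := cc_pos (n := n) (N + 1)
  have hr := cc_rec (n := n) N
  simp only [kop, map_smul, smul_eq_mul]
  rw [← ContinuousLinearMap.integral_comp_comm _ iM]
  simp only [map_smul, trL_kerM, smul_eq_mul]
  have e : ∫ y : Sph n, g y * ((N + 1) * (N + (n - 1) / 2) * kerZ N (x : Eucl n) y -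
      (lam n (N + 1) - (n - 1)) * kerZ (N + 1) (x : Eucl n) y) ∂(sig n) =
      ((N : ℝ) + 1) * (N + (n - 1) / 2) * ∫ y : Sph n, g y * kerZ N (x : Eucl n) y ∂(sig n) -
      (lam n (N + 1) - (n - 1)) * ∫ y : Sph n, g y * kerZ (N + 1) (x : Eucl n) y ∂(sig n) := by
    rw [← integral_const_mul, ← integral_const_mul,
      ← integral_sub (i0.const_mul _) (i1.const_mul _)]
    congr 1; funext y; ring
  rw [e, lam]
  push_cast
  field_simp
  linear_combination (∫ y : Sph n, g y * kerZ N (x : Eucl n) y ∂(sig n)) * (N + 1) * (-hr)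

theorem trL_kop_kerM_zero (g : Sph n → ℝ) (x : Sph n) :
    trL n (kop (fun N (x y : Sph n) => kerM N (x : Eucl n) y) 0 g x) =
      (n - 1) * kop (fun N (x y : Sph n) => kerZ N (x : Eucl n) y) 0 g x := by
  have : ∀ y : Sph n, kerM 0 (x : Eucl n) y = pjL (x : Eucl n) := fun y => by
    rw [kerM]
    have e0 : ((0 : ℕ) : ℝ) * (((0 : ℕ) : ℝ) - 1) / 4 * bb (x : Eucl n) y ^ (0 - 2) = 0 := by simp
    rw [e0]
    ext1 v
    simp only [add_apply, smul_apply, zero_smul]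
    simp
  simp only [kop, this, integral_smul_const, map_smul, trL_pjL (Sph.norm_eq x), kerZ, pow_zero,
    smul_eq_mul, mul_one]
  ring

theorem tendsto_kop_kerZ (g : YS n) (x : Sph n) :
    Tendsto (fun N => kop (fun N (x y : Sph n) => kerZ N (x : Eucl n) y) N (fun y => g y) x) atTop
      (𝓝 (g x)) := by
  rw [tendsto_iff_norm_sub_tendsto_zero]
  have hs := YS.scaled g (D := fun _ r => √r) fun _ _ _ _ => le_rfl
  have hro : Tendsto ro atTop atTop := by
    refine Real.tendsto_sqrt_atTop.comp (Real.tendsto_sqrt_atTop.comp ?_)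
    exact tendsto_atTop_add_const_right _ _ tendsto_natCast_atTop_atTop
  have h2 : Tendsto (fun N => 4 * momC n * ‖g‖ * (ro N)⁻¹) atTop (𝓝 0) := by
    simpa using hro.inv_tendsto_atTop.const_mul (4 * momC n * ‖g‖)
  refine squeeze_zero (fun _ => norm_nonneg _) (fun N => ?_) h2
  rw [kerBound_kerZ.kop_eq integral_kerZ' g.continuous_S N x (g x), smul_eq_mul _ (1 : ℝ), mul_one,
    add_sub_cancel_right]
  have := kerBound_kerZ.norm_integral_le (g := fun y => g y - g x) N x (hs.osc N x)
  rw [pow_zero, mul_one, mS] at this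
  linarith

theorem Rop_sub_trL_Mop (hη : 0 < η) (hη1 : η ≤ 1) (g : YS n) (x : Sph n) :
    Rop hη g x - (trL n (Mop hη hη1 g x) - η ^ 4 * (n - 1) * Rop hη g x) = g x := by
  set T : ℕ → ℝ := fun N => kop (fun N (x y : Sph n) => kerZ N (x : Eucl n) y) N (fun y => g y) x
    with hT
  have sR : HasSum (fun N => cf n η N * T N) (Rop hη g x) := by
    change HasSum _ (∑' N, _)
    have := (summable_zop kerBound_kerZ integral_kerZ' (opSum_Z hη)
      (YS.scaled g fun _ _ _ _ => le_rfl) x).hasSum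
    simpa only [one_mul, smul_eq_mul] using this
  have sM := ((summable_zop kerBound_kerM integral_kerM (opSum_M hη hη1)
      (YS.scaled g fun _ _ _ _ => le_rfl) x).hasSum.mapL (trL n))
  have h1 := (sR.sub (sM.sub (sR.mul_left (η ^ 4 * (n - 1))))).tendsto_sum_nat
  have h2 := (tendsto_add_atTop_iff_nat 1).2 h1
  refine tendsto_nhds_unique h2 ?_
  have key : ∀ M, ∑ N ∈ Finset.range (M + 1), (cf n η N * T N -
      (trL n ((η ^ 4 * cf n η N) • kop (fun N (x y : Sph n) => kerM N (x : Eucl n) y) N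
        (fun y => g y) x) - η ^ 4 * (n - 1) * (cf n η N * T N))) = sN n η M * T M := by
    intro M
    induction M with
    | zero =>
      simp only [zero_add, Finset.sum_range_one, map_smul, trL_kop_kerM_zero, smul_eq_mul]
      simp only [cf, hT]; ring
    | succ M ih =>
      have hc := cf_succ_mul (n := n) hη M
      rw [Finset.sum_range_succ, ih, map_smul, trL_kop_kerM_succ g.continuous_S, smul_eq_mul]
      simp only [cf, hT] at hc ⊢
      linear_combination -(kop (fun N (x y : Sph n) => kerZ N (x : Eucl n) y) M (fun y => g y) x -
        kop (fun N (x y : Sph n) => kerZ N (x : Eucl n) y) (M + 1) (fun y => g y) x) * hc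
  have h3 := (tendsto_sN (n := n) hη).mul (tendsto_kop_kerZ g x)
  rw [one_mul] at h3
  exact h3.congr fun M => (key M).symm

end ResolventOperators

section Derivatives

variable {n : ℕ} [hn : Fact (2 ≤ n)] {η : ℝ}

/-- Radial projection to the sphere (with a junk value at the origin). -/
def sx (x : Eucl n) : Sph n := if h : x ≠ 0 then nxS h else baseP n

theorem coe_sx {x : Eucl n} (hx : x ≠ 0) : (sx x : Eucl n) = nx x := by
  rw [sx, dif_pos hx]; rfl

theorem sx_coe (x : Sph n) : sx (x : Eucl n) = x := by
  ext1
  rw [coe_sx (Sph.ne_zero x), nx_of_norm (Sph.norm_eq x)]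

theorem ne_zero_of_mem_half_ball {x z : Eucl n} (hz : z ∈ Metric.ball x (‖x‖ / 2)) :
    z ≠ 0 ∧ ‖z‖⁻¹ ≤ 2 * ‖x‖⁻¹ := by
  rw [Metric.mem_ball, dist_eq_norm] at hz
  have h1 := norm_sub_norm_le x z
  rw [norm_sub_rev] at h1
  have h0 := norm_nonneg (z - x)
  have h2 : 0 < ‖x‖ := by linarith
  have h3 : ‖x‖ / 2 < ‖z‖ := by linarith
  refine ⟨norm_pos_iff.1 (by linarith), ?_⟩
  have h4 := inv_anti₀ (by linarith : 0 < ‖x‖ / 2) h3.le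
  rwa [inv_div, div_eq_mul_inv] at h4

theorem hasFDerivAt_tsum_of_ne_zero {V : Type} [NormedAddCommGroup V] [NormedSpace ℝ V]
    [CompleteSpace V] {F : ℕ → Eucl n → V} {F' : ℕ → Eucl n → Eucl n →L[ℝ] V} {u : ℕ → ℝ}
    (hu : Summable u) (hF : ∀ N z, z ≠ 0 → HasFDerivAt (F N) (F' N z) z)
    (hF' : ∀ N z, z ≠ 0 → ‖F' N z‖ ≤ (1 + ‖z‖⁻¹) * u N) {x : Eucl n} (hx : x ≠ 0)
    (h0 : Summable fun N => F N x) :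
    HasFDerivAt (fun z => ∑' N, F N z) (∑' N, F' N x) x := by
  have hxs : x ∈ Metric.ball x (‖x‖ / 2) := Metric.mem_ball_self (by simpa using hx)
  refine hasFDerivAt_tsum_of_isPreconnected (hu.mul_left (1 + 2 * ‖x‖⁻¹))
    Metric.isOpen_ball (convex_ball _ _).isPreconnected
    (fun N z hz => hF N z (ne_zero_of_mem_half_ball hz).1) (fun N z hz => ?_) hxs h0 hxs
  obtain ⟨hz0, h2⟩ := ne_zero_of_mem_half_ball hz
  have h1 := hF' N z hz0
  have h3 : 0 ≤ u N := by
    by_contra hneg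
    have := mul_neg_of_pos_of_neg (by positivity : 0 < 1 + ‖z‖⁻¹) (not_le.1 hneg)
    linarith [norm_nonneg (F' N z)]
  exact h1.trans (by gcongr)

theorem hasFDerivAt_kop_kerV {g : Sph n → ℝ} (hg : Continuous g) (c : ℝ) (N : ℕ) {z : Eucl n}
    (hz : z ≠ 0) :
    HasFDerivAt (fun z => c • kop (fun N (x y : Sph n) => kerV N (x : Eucl n) y) N g (sx z))
      (‖z‖⁻¹ • c • kop (fun N (x y : Sph n) => kerM N (x : Eucl n) y) N g (sx z)) z := by
  have h := ((hasFDerivAt_integral_kerV (n := n) N hg hz).const_smul ((cc n N)⁻¹)).const_smul c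
  refine (h.congr_fderiv ?_).congr_of_eventuallyEq ?_
  · simp only [kop, coe_sx hz, smul_comm ‖z‖⁻¹]
  · filter_upwards [isOpen_ne.mem_nhds hz] with w hw
    simp only [kop, coe_sx hw, Pi.smul_apply]

theorem hasFDerivAt_kop_kerZ {g : Sph n → ℝ} (hg : Continuous g) (c : ℝ) (N : ℕ) {z : Eucl n}
    (hz : z ≠ 0) :
    HasFDerivAt
      (fun z => c * (‖z‖ * kop (fun N (x y : Sph n) => kerZ N (x : Eucl n) y) N g (sx z)))
      (innerSL ℝ (c • kop (fun N (x y : Sph n) => kerV N (x : Eucl n) y) N g (sx z))) z := by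
  have h := ((hasFDerivAt_integral_kerZ (n := n) N hg hz).const_mul ((cc n N)⁻¹)).const_mul c
  refine (h.congr_fderiv ?_).congr_of_eventuallyEq ?_
  · simp only [kop, coe_sx hz, map_smul]
  · filter_upwards [isOpen_ne.mem_nhds hz] with w hw
    simp only [kop, coe_sx hw, smul_eq_mul]
    ring

theorem hasFDerivAt_Eop (hη : 0 < η) (hη1 : η ≤ 1) (g : YS n) {x : Eucl n} (hx : x ≠ 0) :
    HasFDerivAt (fun x => Eop hη hη1 g (sx x)) (‖x‖⁻¹ • Mop hη hη1 g (sx x)) x := by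
  have hs := YS.scaled g (D := fun _ r => √r) fun _ _ _ _ => le_rfl
  have hS := opSum_M (n := n) hη hη1
  have h := hasFDerivAt_tsum_of_ne_zero
    (hS.sup.const_mul (kerBound_kerM.const_nonneg hs)).1
    (fun N z hz => hasFDerivAt_kop_kerV g.continuous_S (η ^ 4 * cf n η N) N hz)
    (fun N z hz => ?_) hx (summable_zop kerBound_kerV integral_kerV (opSum_E hη hη1)
      (YS.scaled g sqrt_le_mul_ro) (sx x))
  · refine h.congr_fderiv ?_
    rw [tsum_const_smul'']; rfl
  · have h1 := norm_term_le kerBound_kerM integral_kerM hS hs (sx z) N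
    have h2 := (norm_nonneg _).trans h1
    rw [norm_smul, norm_inv, norm_norm, one_add_mul]
    exact (mul_le_mul_of_nonneg_left h1 (by positivity)).trans (le_add_of_nonneg_left h2)

theorem hasFDerivAt_Rop (hη : 0 < η) (hη1 : η ≤ 1) (g : YS n) {x : Eucl n} (hx : x ≠ 0) :
    HasFDerivAt (fun x => η ^ 4 * (‖x‖ * Rop hη g (sx x))) (innerSL ℝ (Eop hη hη1 g (sx x))) x := by
  have hs := YS.scaled g (D := fun _ r => √r) fun _ _ _ _ => le_rfl
  have hsE := YS.scaled g sqrt_le_mul_ro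
  have hS := opSum_E (n := n) hη hη1
  have sE := summable_zop kerBound_kerV integral_kerV hS hsE (sx x)
  have s0 := ((summable_zop kerBound_kerZ integral_kerZ' (opSum_Z hη) hs (sx x)).mul_left
    ‖x‖).mul_left (η ^ 4)
  have h := hasFDerivAt_tsum_of_ne_zero
    (hS.sup.const_mul (kerBound_kerV.const_nonneg hsE)).1
    (fun N z hz => hasFDerivAt_kop_kerZ g.continuous_S (η ^ 4 * cf n η N) N hz)
    (fun N z hz => ?_) hx (s0.congr fun N => ?_)
  · refine (h.congr_fderiv ?_).congr_of_eventuallyEq (Eventually.of_forall fun z => ?_)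
    · exact ((innerSL ℝ).map_tsum sE).symm
    · change η ^ 4 * (‖z‖ * ∑' N, _) = _
      rw [← tsum_mul_left, ← tsum_mul_left]
      congr 1; ext1 N
      rw [smul_eq_mul]; ring
  · have h1 := norm_term_le kerBound_kerV integral_kerV hS hsE (sx z) N
    have h2 := (norm_nonneg _).trans h1
    rw [innerSL_apply_norm, one_add_mul]
    exact h1.trans (le_add_of_nonneg_right (mul_nonneg (by positivity) h2))
  · rw [smul_eq_mul]; ring

theorem Aop_apply (hη : 0 < η) (hη1 : η ≤ 1) (g : YS n) (x : Sph n) :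
    η ^ 2 • Aop hη hη1 g x = Eop hη hη1 g x := by
  change η ^ 2 • (∑' N, _) = ∑' N, _
  rw [← tsum_const_smul'']
  congr 1; ext1 N
  rw [smul_smul]; congr 1; ring

theorem inner_kerV (N : ℕ) (x y : Sph n) : ⟪(x : Eucl n), kerV N (x : Eucl n) y⟫ =
    kerZ N (x : Eucl n) y := by
  simp [kerV, kerZ, inner_add_right, inner_smul_right, pjL_apply, inner_sub_right]

theorem inner_Eop (hη : 0 < η) (hη1 : η ≤ 1) (g : YS n) (x : Sph n) :
    ⟪(x : Eucl n), Eop hη hη1 g x⟫ = η ^ 4 * Rop hη g x := by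
  have hsE := YS.scaled g sqrt_le_mul_ro
  have sE := summable_zop kerBound_kerV integral_kerV (opSum_E hη hη1) hsE x
  change innerSL ℝ (x : Eucl n) (∑' N, _) = η ^ 4 * ∑' N, _
  rw [(innerSL ℝ (x : Eucl n)).map_tsum sE, ← tsum_mul_left]
  congr 1; ext1 N
  rw [map_smul, kop, map_smul, ← ContinuousLinearMap.integral_comp_comm _
    (kerBound_kerV.integrable g.continuous_S N x), kop]
  simp only [map_smul, innerSL_apply_apply, inner_kerV, smul_eq_mul]
  ring

theorem inner_kerM (N : ℕ) (x y : Sph n) (v : Eucl n) :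
    ⟪(x : Eucl n), kerM N (x : Eucl n) y v⟫ = 0 := by
  simp only [kerM, add_apply, smul_apply, tens_apply, pjL_apply, inner_sub_right, inner_smul_right,
    Sph.inner_self, inner_add_right]
  simp

theorem inner_Mop (hη : 0 < η) (hη1 : η ≤ 1) (g : YS n) (x : Sph n) (v : Eucl n) :
    ⟪(x : Eucl n), Mop hη hη1 g x v⟫ = 0 := by
  have hs := YS.scaled g (D := fun _ r => √r) fun _ _ _ _ => le_rfl
  have sM := summable_zop kerBound_kerM integral_kerM (opSum_M hη hη1) hs x
  change ((innerSL ℝ (x : Eucl n)).comp (ContinuousLinearMap.apply ℝ (Eucl n) v)) (∑' N, _) = 0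
  rw [ContinuousLinearMap.map_tsum _ sM]
  refine (tsum_congr fun N => ?_).trans tsum_zero
  rw [map_smul, kop, map_smul, ← ContinuousLinearMap.integral_comp_comm _
    (kerBound_kerM.integrable g.continuous_S N x)]
  simp [inner_kerM]

end Derivatives

section SmoothTools

/-- A smooth function which is the identity on `[1/32, ∞)` and at least `1/64` everywhere. -/
def clampE (t : ℝ) : ℝ := 1 / 64 + (t - 1 / 64) * Real.smoothTransition (64 * t - 1)

theorem clampE_of_le {t : ℝ} (h : 1 / 32 ≤ t) : clampE t = t := by
  rw [clampE, Real.smoothTransition.one_of_one_le (by linarith)]; ring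

theorem clampE_pos (t : ℝ) : 0 < clampE t := by
  rw [clampE]
  rcases le_total t (1 / 64) with h | h
  · rw [Real.smoothTransition.zero_of_nonpos (by linarith)]; norm_num
  · have := mul_nonneg (sub_nonneg.2 h) (Real.smoothTransition.nonneg (64 * t - 1))
    linarith

theorem contDiff_clampE : ContDiff ℝ (⊤ : ℕ∞) clampE := by
  unfold clampE
  exact contDiff_const.add ((contDiff_id.sub contDiff_const).mul
    (Real.smoothTransition.contDiff.comp ((contDiff_const.mul contDiff_id).sub contDiff_const)))

/-- A globally smooth function equal to `t ^ s` for `t ≥ 1/32`. -/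
def powE (s t : ℝ) : ℝ := clampE t ^ s

theorem powE_of_le (s : ℝ) {t : ℝ} (h : 1 / 32 ≤ t) : powE s t = t ^ s := by
  rw [powE, clampE_of_le h]

theorem contDiff_powE (s : ℝ) : ContDiff ℝ (⊤ : ℕ∞) (powE s) :=
  contDiff_clampE.rpow_const_of_ne fun t => (clampE_pos t).ne'

variable {n : ℕ}

theorem det_eq_matrix_det (M : Eucl n →L[ℝ] Eucl n) :
    M.det = Matrix.det (LinearMap.toMatrix (EuclideanSpace.basisFun (Fin n) ℝ).toBasis
      (EuclideanSpace.basisFun (Fin n) ℝ).toBasis (M : Eucl n →ₗ[ℝ] Eucl n)) := by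
  rw [LinearMap.det_toMatrix]

theorem contDiff_det : ContDiff ℝ (⊤ : ℕ∞) fun M : Eucl n →L[ℝ] Eucl n => M.det := by
  simp only [det_eq_matrix_det, Matrix.det_apply]
  refine ContDiff.sum fun σ _ => ContDiff.const_smul _ (contDiff_prod fun i _ => ?_)
  simp only [LinearMap.toMatrix_apply]
  have : (fun M : Eucl n →L[ℝ] Eucl n => (EuclideanSpace.basisFun (Fin n) ℝ).toBasis.repr
      ((M : Eucl n →ₗ[ℝ] Eucl n) ((EuclideanSpace.basisFun (Fin n) ℝ).toBasis i)) (σ i)) =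
      fun M : Eucl n →L[ℝ] Eucl n => EuclideanSpace.proj (𝕜 := ℝ) (σ i)
        (M ((EuclideanSpace.basisFun (Fin n) ℝ).toBasis i)) := by
    ext1 M; simp
  rw [this]
  exact (EuclideanSpace.proj (𝕜 := ℝ) (σ i)).contDiff.comp (contDiff_id.clm_apply contDiff_const)

theorem hasFDerivAt_det_one_add :
    HasFDerivAt (fun M : Eucl n →L[ℝ] Eucl n => (1 + M).det) (trL n) 0 := by
  have hd : ContDiff ℝ (⊤ : ℕ∞) fun M : Eucl n →L[ℝ] Eucl n => (1 + M).det :=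
    contDiff_det.comp (contDiff_const.add contDiff_id)
  have h := (hd.differentiable (by simp) 0).hasFDerivAt
  refine h.congr_fderiv ?_
  ext1 M
  have hl : HasDerivAt (fun t : ℝ => t • M) M 0 := by
    simpa using (hasDerivAt_id (0 : ℝ)).smul_const M
  have h2 : HasDerivAt (fun t : ℝ => (1 + t • M).det)
      (fderiv ℝ (fun M : Eucl n →L[ℝ] Eucl n => (1 + M).det) 0 M) 0 := by
    have h3 : HasFDerivAt (fun M : Eucl n →L[ℝ] Eucl n => (1 + M).det)
      (fderiv ℝ (fun M : Eucl n →L[ℝ] Eucl n => (1 + M).det) 0) ((0 : ℝ) • M) := by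
      have : (0 : ℝ) • M = 0 := by ext1; simp
      rw [this]; exact h
    exact h3.comp_hasDerivAt (0 : ℝ) hl
  refine h2.unique ?_
  set b := (EuclideanSpace.basisFun (Fin n) ℝ).toBasis
  set A := LinearMap.toMatrix b b (M : Eucl n →ₗ[ℝ] Eucl n) with hA
  have e : ∀ t : ℝ, (1 + t • M).det = 1 + A.trace * t +
      (Matrix.det (1 + (Polynomial.X : Polynomial ℝ) • A.map Polynomial.C)).divX.divX.eval t *
        t ^ 2 := by
    intro t
    rw [det_eq_matrix_det, ← Matrix.det_one_add_smul]
    congr 1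
    change LinearMap.toMatrix b b (LinearMap.id + t • (M : Eucl n →ₗ[ℝ] Eucl n)) = _
    rw [map_add, map_smul, LinearMap.toMatrix_id]
  simp only [e]
  have htr : trL n M = A.trace := by rw [trL_apply, LinearMap.trace_eq_matrix_trace ℝ b]
  rw [htr]
  set P := (Matrix.det (1 + (Polynomial.X : Polynomial ℝ) • A.map Polynomial.C)).divX.divX
  have := (((hasDerivAt_id (0 : ℝ)).const_mul A.trace).const_add 1).add
    ((P.hasDerivAt 0).mul ((hasDerivAt_id (0 : ℝ)).pow 2))
  refine (this.congr_deriv ?_).congr_of_eventuallyEq (Eventually.of_forall fun t => ?_)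
  · simp
  · simp

end SmoothTools

section StrictLipschitz

variable {E F : Type} [NormedAddCommGroup E] [NormedSpace ℝ E] [NormedAddCommGroup F]
  [NormedSpace ℝ F]

theorem exists_strict_bound {N : E → F} {L : E →L[ℝ] F} {p : E} (h : HasStrictFDerivAt N L p)
    {c : ℝ} (hc : 0 < c) : ∃ δ > 0, ∀ a b, ‖a - p‖ ≤ δ → ‖b - p‖ ≤ δ →
      ‖N a - N b - L (a - b)‖ ≤ c * ‖a - b‖ := by
  have h1 := h.isLittleO.bound hc
  obtain ⟨δ, hδ, h2⟩ := Metric.eventually_nhds_iff.1 h1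
  refine ⟨δ / 2, by positivity, fun a b ha hb => h2 (y := (a, b)) ?_⟩
  rw [Prod.dist_eq, max_lt_iff, dist_eq_norm, dist_eq_norm]
  constructor <;> dsimp only <;> linarith

theorem exists_lipschitz_near {N : E → F} {L : E →L[ℝ] F} {p : E} (h : HasStrictFDerivAt N L p) :
    ∃ δ > 0, ∀ a b, ‖a - p‖ ≤ δ → ‖b - p‖ ≤ δ → ‖N a - N b‖ ≤ (‖L‖ + 1) * ‖a - b‖ := by
  obtain ⟨δ, hδ, h1⟩ := exists_strict_bound h one_pos
  refine ⟨δ, hδ, fun a b ha hb => ?_⟩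
  have h2 := h1 a b ha hb
  have h3 := L.le_opNorm (a - b)
  have h4 := norm_add_le (N a - N b - L (a - b)) (L (a - b))
  rw [sub_add_cancel] at h4
  linarith

end StrictLipschitz

section ChordOperator

variable {n : ℕ} [hn : Fact (2 ≤ n)]
variable {V V' : Type} [NormedAddCommGroup V] [NormedSpace ℝ V] [NormedAddCommGroup V']
  [NormedSpace ℝ V']

open Classical in
/-- The weight controlling functions of `(ζ, x)` which are Hölder in `x` relative to `‖ζ - x‖`. -/
def wZ (n : ℕ) (a b : Eucl n × Sph n) : ℝ :=
  if a.1 = b.1 then √(dist a.2 b.2 / max ‖a.1 - a.2‖ ‖a.1 - b.2‖) else 0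

/-- Bounded functions of `(ζ, x)` which are Hölder in `x` relative to `‖ζ - x‖`. -/
abbrev ZS (n : ℕ) (V : Type) [NormedAddCommGroup V] [NormedSpace ℝ V] := LipW (wZ n) V

theorem wZ_nonneg (a b : Eucl n × Sph n) : 0 ≤ wZ n a b := by
  unfold wZ; split_ifs <;> positivity

theorem ZS.norm_sub_le (F : ZS n V) (ζ : Eucl n) (x y : Sph n) :
    ‖F (ζ, x) - F (ζ, y)‖ ≤ ‖F‖ * √(dist x y / max ‖ζ - x‖ ‖ζ - y‖) := by
  rcases eq_or_ne x y with rfl | h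
  · simp
  · have hd : 0 < dist x y := dist_pos.2 h
    have hm : 0 < max ‖ζ - x‖ ‖ζ - (y : Eucl n)‖ := by
      rcases (norm_nonneg (ζ - (x : Eucl n))).lt_or_eq with h1 | h1
      · exact lt_max_of_lt_left h1
      · refine lt_max_of_lt_right (norm_pos_iff.2 fun h2 => h (Subtype.ext ?_))
        rw [← sub_eq_zero.1 (norm_eq_zero.1 h1.symm), ← sub_eq_zero.1 h2]
    have h1 : wZ n (ζ, x) (ζ, y) = √(dist x y / max ‖ζ - x‖ ‖ζ - y‖) := by simp [wZ]
    have h2 : wZ n (ζ, x) (ζ, y) ≠ 0 := by rw [h1]; positivity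
    have := LipW.norm_sub_le F h2
    rwa [abs_of_nonneg (wZ_nonneg _ _), h1] at this

theorem le_wZ {a b : Eucl n × Sph n} (h : wZ n a b ≠ 0) {F : Eucl n × Sph n → V} {C : ℝ}
    (hF : ∀ ζ x y, ‖F (ζ, x) - F (ζ, y)‖ ≤ C * √(dist x y / max ‖ζ - (x : Eucl n)‖ ‖ζ - y‖)) :
    ‖F a - F b‖ ≤ C * |wZ n a b| := by
  obtain ⟨ζ, x⟩ := a
  obtain ⟨ξ, y⟩ := b
  by_cases h1 : ζ = ξ
  · subst h1
    rw [abs_of_nonneg (wZ_nonneg _ _)]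
    simpa [wZ] using hF ζ x y
  · simp [wZ, h1] at h

theorem abs_rpow_sub_rpow_le {a b : ℝ} (ha : 0 < a) (hb : 0 < b) (s : ℝ) :
    |a ^ s - b ^ s| ≤ |s| * |a - b| * (a ^ (s - 1) + b ^ (s - 1)) := by
  have hd : ∀ c ∈ Set.uIcc a b, HasDerivWithinAt (fun x : ℝ => x ^ s) (s * c ^ (s - 1))
      (Set.uIcc a b) c := fun c hc => by
    have hc0 : 0 < c := lt_of_lt_of_le (lt_min ha hb) hc.1
    exact (Real.hasDerivAt_rpow_const (Or.inl hc0.ne')).hasDerivWithinAt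
  have hbd : ∀ c ∈ Set.uIcc a b, ‖s * c ^ (s - 1)‖ ≤ |s| * (a ^ (s - 1) + b ^ (s - 1)) := by
    intro c hc
    have hm : 0 < min a b := lt_min ha hb
    have hc0 : 0 < c := lt_of_lt_of_le hm hc.1
    rw [norm_mul, Real.norm_eq_abs, Real.norm_of_nonneg (by positivity)]
    gcongr
    have ha' : 0 < a ^ (s - 1) := by positivity
    have hb' : 0 < b ^ (s - 1) := by positivity
    rcases le_total 0 (s - 1) with hs | hs
    · calc c ^ (s - 1) ≤ (max a b) ^ (s - 1) := Real.rpow_le_rpow hc0.le hc.2 hs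
        _ ≤ _ := by rcases max_choice a b with h | h <;> rw [h] <;> linarith
    · calc c ^ (s - 1) ≤ (min a b) ^ (s - 1) := Real.rpow_le_rpow_of_nonpos hm hc.1 hs
        _ ≤ _ := by rcases min_choice a b with h | h <;> rw [h] <;> linarith
  have := (convex_uIcc a b).norm_image_sub_le_of_norm_hasDerivWithin_le hd hbd
    Set.right_mem_uIcc Set.left_mem_uIcc
  rw [Real.norm_eq_abs, Real.norm_eq_abs] at this
  linarith

/-- Admissible weights for the chord operator with exponent `s`. -/
structure ChordWeight (n : ℕ) (s : ℝ) (w : Eucl n → ℝ) (C : ℝ) : Prop where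
  meas : Measurable w
  nonneg : ∀ ζ, 0 ≤ w ζ
  zero : ∀ ζ, 1 ≤ ‖ζ‖ → w ζ = 0
  integrable : ∀ x : Sph n, Integrable fun ζ => w ζ * ‖ζ - x‖ ^ (s - 1)
  le : ∀ x : Sph n, ∫ ζ, w ζ * ‖ζ - x‖ ^ (s - 1) ≤ C

namespace ChordWeight

variable {s C : ℝ} {w : Eucl n → ℝ}

theorem nonneg_const (hw : ChordWeight n s w C) : 0 ≤ C :=
  (integral_nonneg fun ζ => mul_nonneg (hw.nonneg ζ) (by positivity)).trans
    (hw.le (Classical.arbitrary _))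

theorem norm_sub_pos {ζ : Eucl n} (h : ‖ζ‖ < 1) (x : Sph n) : 0 < ‖ζ - x‖ := by
  rw [norm_pos_iff, sub_ne_zero]
  rintro rfl
  rw [Sph.norm_eq] at h
  exact lt_irrefl _ h

theorem norm_sub_le_two {ζ : Eucl n} (h : ‖ζ‖ < 1) (x : Sph n) : ‖ζ - x‖ ≤ 2 := by
  have := norm_sub_le ζ (x : Eucl n)
  rw [Sph.norm_eq] at this
  linarith

theorem rpow_le {d : ℝ} (h : 0 < d) (h2 : d ≤ 2) (s : ℝ) : d ^ s ≤ 2 * d ^ (s - 1) := by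
  have : d ^ s = d * d ^ (s - 1) := by
    rw [Real.rpow_sub_one h.ne']; field_simp
  rw [this]
  gcongr

theorem aesm (hw : ChordWeight n s w C) (F : ZS n ℝ) (x : Sph n) :
    AEStronglyMeasurable (fun ζ => w ζ * ‖ζ - x‖ ^ s * F (ζ, x)) := by
  refine AEStronglyMeasurable.mul (Measurable.aestronglyMeasurable ?_) ?_
  · exact hw.meas.mul ((measurable_id.sub_const _).norm.pow_const s)
  · exact (F.stronglyMeasurable.comp_measurable measurable_prodMk_right).aestronglyMeasurable

theorem norm_le (hw : ChordWeight n s w C) (F : ZS n ℝ) (x : Sph n) (ζ : Eucl n) :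
    ‖w ζ * ‖ζ - x‖ ^ s * F (ζ, x)‖ ≤ 2 * ‖F‖ * (w ζ * ‖ζ - x‖ ^ (s - 1)) := by
  rcases le_or_gt 1 ‖ζ‖ with h | h
  · simp [hw.zero ζ h]
  · have hp := norm_sub_pos h x
    have h1 := rpow_le hp (norm_sub_le_two h x) s
    have h2 := F.norm_apply_le (ζ, x)
    rw [norm_mul, Real.norm_of_nonneg (mul_nonneg (hw.nonneg ζ) (by positivity))]
    calc _ ≤ w ζ * (2 * ‖ζ - x‖ ^ (s - 1)) * ‖F‖ := by
          have := hw.nonneg ζ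
          gcongr
      _ = _ := by ring

theorem integrable_mul (hw : ChordWeight n s w C) (F : ZS n ℝ) (x : Sph n) :
    Integrable fun ζ => w ζ * ‖ζ - x‖ ^ s * F (ζ, x) :=
  ((hw.integrable x).const_mul (2 * ‖F‖)).mono' (hw.aesm F x)
    (Eventually.of_forall (hw.norm_le F x))

/-- The chord operator, pointwise. -/
def kfun (_ : ChordWeight n s w C) (F : ZS n ℝ) (x : Sph n) : ℝ :=
  ∫ ζ, w ζ * ‖ζ - x‖ ^ s * F (ζ, x)

theorem norm_kfun_le (hw : ChordWeight n s w C) (F : ZS n ℝ) (x : Sph n) :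
    ‖hw.kfun F x‖ ≤ 2 * C * ‖F‖ := by
  refine (norm_integral_le_of_norm_le ((hw.integrable x).const_mul (2 * ‖F‖))
    (Eventually.of_forall (hw.norm_le F x))).trans ?_
  rw [integral_const_mul]
  nlinarith [mul_le_mul_of_nonneg_left (hw.le x) (norm_nonneg F)]

theorem norm_sub_le (hw : ChordWeight n s w C) (F : ZS n ℝ) (x y : Sph n) (ζ : Eucl n) :
    ‖w ζ * ‖ζ - x‖ ^ s * F (ζ, x) - w ζ * ‖ζ - y‖ ^ s * F (ζ, y)‖ ≤
      ‖F‖ * √(dist x y) * (2 + 2 * |s|) *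
        (w ζ * ‖ζ - x‖ ^ (s - 1) + w ζ * ‖ζ - y‖ ^ (s - 1)) := by
  rcases le_or_gt 1 ‖ζ‖ with h | h
  · simp [hw.zero ζ h]
  · have hx := norm_sub_pos h x
    have hy := norm_sub_pos h y
    set a := ‖ζ - x‖ with ha
    set b := ‖ζ - y‖ with hb
    set r := dist x y with hr
    have hr0 : 0 ≤ r := dist_nonneg
    have hr2 : r ≤ 2 * √r := le_two_mul_sqrt hr0 (dist_sph_le_two x y)
    have hab : |a - b| ≤ r := by
      refine (abs_norm_sub_norm_le _ _).trans (le_of_eq ?_)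
      rw [sub_sub_sub_cancel_left, hr, dist_comm, Subtype.dist_eq, dist_eq_norm]
    have h1 : ‖F (ζ, x) - F (ζ, y)‖ ≤ ‖F‖ * √(r / max a b) := ZS.norm_sub_le F ζ x y
    have h2 : √(r / max a b) ≤ √r * (2 / a) := by
      calc √(r / max a b) ≤ √(r / a) := by gcongr; exact le_max_left _ _
        _ = √r * (√a / a) := by rw [Real.sqrt_div hr0, Real.sqrt_div_self']; ring
        _ ≤ _ := by
          gcongr
          rw [Real.sqrt_le_iff]
          exact ⟨by norm_num, (norm_sub_le_two h x).trans (by norm_num)⟩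
    have h3 : |a ^ s - b ^ s| ≤ |s| * r * (a ^ (s - 1) + b ^ (s - 1)) := by
      refine (abs_rpow_sub_rpow_le hx hy s).trans ?_
      gcongr
    have h4 : a ^ s * (2 / a) = 2 * a ^ (s - 1) := by
      rw [Real.rpow_sub_one hx.ne']; field_simp
    have hw0 := hw.nonneg ζ
    have hb0 : 0 ≤ b ^ (s - 1) := by positivity
    have hF := F.norm_apply_le (ζ, y)
    have e : w ζ * a ^ s * F (ζ, x) - w ζ * b ^ s * F (ζ, y) =
      w ζ * (a ^ s * (F (ζ, x) - F (ζ, y)) + (a ^ s - b ^ s) * F (ζ, y)) := by ring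
    rw [e, norm_mul, Real.norm_of_nonneg hw0]
    calc _ ≤ w ζ * (a ^ s * (‖F‖ * (√r * (2 / a))) +
          |s| * (2 * √r) * (a ^ (s - 1) + b ^ (s - 1)) * ‖F‖) := by
          refine mul_le_mul_of_nonneg_left ((norm_add_le _ _).trans (add_le_add ?_ ?_)) hw0
          · rw [norm_mul, Real.norm_of_nonneg (by positivity : 0 ≤ a ^ s)]
            have := h1.trans (mul_le_mul_of_nonneg_left h2 (norm_nonneg F))
            gcongr
          · rw [norm_mul, Real.norm_eq_abs]
            have : |a ^ s - b ^ s| ≤ |s| * (2 * √r) * (a ^ (s - 1) + b ^ (s - 1)) :=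
              h3.trans (by gcongr)
            gcongr
      _ = w ζ * (‖F‖ * √r * (a ^ s * (2 / a)) +
          ‖F‖ * √r * (2 * |s|) * (a ^ (s - 1) + b ^ (s - 1))) := by ring
      _ = ‖F‖ * √r * (2 + 2 * |s|) * (w ζ * a ^ (s - 1) + w ζ * b ^ (s - 1)) -
          w ζ * (‖F‖ * √r * 2 * b ^ (s - 1)) := by rw [h4]; ring
      _ ≤ _ := sub_le_self _ (by positivity)

theorem norm_kfun_sub_le (hw : ChordWeight n s w C) (F : ZS n ℝ) (x y : Sph n) :
    ‖hw.kfun F x - hw.kfun F y‖ ≤ (4 + 4 * |s|) * C * ‖F‖ * √(dist x y) := by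
  rw [kfun, kfun, ← integral_sub (hw.integrable_mul F x) (hw.integrable_mul F y)]
  refine (norm_integral_le_of_norm_le (((hw.integrable x).add (hw.integrable y)).const_mul
    (‖F‖ * √(dist x y) * (2 + 2 * |s|)))
    (Eventually.of_forall (hw.norm_sub_le F x y))).trans ?_
  have e : ∫ ζ, ‖F‖ * √(dist x y) * (2 + 2 * |s|) * ((fun ζ => w ζ * ‖ζ - x‖ ^ (s - 1)) +
      fun ζ => w ζ * ‖ζ - y‖ ^ (s - 1)) ζ = ‖F‖ * √(dist x y) * (2 + 2 * |s|) *
      ((∫ ζ, w ζ * ‖ζ - x‖ ^ (s - 1)) + ∫ ζ, w ζ * ‖ζ - y‖ ^ (s - 1)) := by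
    rw [integral_const_mul, integral_add' (hw.integrable x) (hw.integrable y)]
  rw [e]
  calc _ ≤ ‖F‖ * √(dist x y) * (2 + 2 * |s|) * (C + C) := by
        gcongr
        exacts [hw.le x, hw.le y]
    _ = _ := by ring

/-- The chord operator. -/
def kL (hw : ChordWeight n s w C) : ZS n ℝ →L[ℝ] YS n :=
  LipW.mkCLM hw.kfun ((4 + 4 * |s|) * C)
    (fun F G x => by
      simp only [kfun]
      rw [← integral_add (hw.integrable_mul F x) (hw.integrable_mul G x)]
      exact integral_congr_ae (Eventually.of_forall fun ζ => by simp [mul_add]))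
    (fun c F x => by
      simp only [kfun]
      rw [smul_eq_mul, ← integral_const_mul]
      exact integral_congr_ae (Eventually.of_forall fun ζ => by
        simp only [LipW.coe_smul, smul_eq_mul]; ring))
    (fun F => (continuous_of_le_sqrt (hw.norm_kfun_sub_le F)).stronglyMeasurable)
    (fun F x => (hw.norm_kfun_le F x).trans (by
      have := hw.nonneg_const
      gcongr
      have := abs_nonneg s
      linarith))
    (fun F x y _ => by
      rw [wS, abs_of_nonneg (Real.sqrt_nonneg _)]
      exact hw.norm_kfun_sub_le F x y)

@[simp] theorem kL_apply (hw : ChordWeight n s w C) (F : ZS n ℝ) (x : Sph n) :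
    hw.kL F x = ∫ ζ, w ζ * ‖ζ - x‖ ^ s * F (ζ, x) := rfl

theorem norm_kL_le (hw : ChordWeight n s w C) (F : ZS n ℝ) :
    ‖hw.kL F‖ ≤ (4 + 4 * |s|) * C * ‖F‖ := by
  have := hw.nonneg_const
  refine (LipW.norm_mkCLM_apply_le _ _ _ _ _ _ _ F).trans (le_of_eq ?_)
  rw [abs_of_nonneg (by positivity)]

end ChordWeight

end ChordOperator

section ChordWeights

variable {n : ℕ} [hn : Fact (2 ≤ n)]

/-- The normalisation of the chord weights. -/
def wbar (n : ℕ) [Fact (2 ≤ n)] (s b : ℝ) : ℝ :=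
  ∫ ζ in Metric.closedBall (0 : Eucl n) (1 / 2), Real.exp (-b * ‖ζ‖ ^ 2) * ‖ζ - baseP n‖ ^ s

/-- The inner region. -/
def innR (n : ℕ) : Set (Eucl n) := Metric.closedBall 0 (1 / 2)

/-- The outer region. -/
def outR (n : ℕ) : Set (Eucl n) := Metric.ball 0 1 \ Metric.closedBall 0 (1 / 2)

theorem measurableSet_innR : MeasurableSet (innR n) := Metric.isClosed_closedBall.measurableSet

theorem measurableSet_outR : MeasurableSet (outR n) :=
  Metric.isOpen_ball.measurableSet.diff Metric.isClosed_closedBall.measurableSet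

theorem mem_innR {ζ : Eucl n} : ζ ∈ innR n ↔ ‖ζ‖ ≤ 1 / 2 := by simp [innR]

theorem mem_outR {ζ : Eucl n} : ζ ∈ outR n ↔ ‖ζ‖ < 1 ∧ 1 / 2 < ‖ζ‖ := by
  simp [outR]

/-- The inner chord weight. -/
def wIn (n : ℕ) [Fact (2 ≤ n)] (s b : ℝ) : Eucl n → ℝ :=
  (innR n).indicator fun ζ => Real.exp (-b * ‖ζ‖ ^ 2) / wbar n s b

/-- The outer chord weight. -/
def wOut (n : ℕ) [Fact (2 ≤ n)] (s b : ℝ) : Eucl n → ℝ :=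
  (outR n).indicator fun ζ => Real.exp (-b * ‖ζ‖ ^ 2 + b / 8) / wbar n s b

theorem half_le_norm_sub {ζ : Eucl n} (h : ‖ζ‖ ≤ 1 / 2) (x : Sph n) : 1 / 2 ≤ ‖ζ - x‖ := by
  have := norm_sub_norm_le (x : Eucl n) ζ
  rw [Sph.norm_eq, norm_sub_rev] at this
  linarith

theorem continuousOn_inner (s b : ℝ) (x : Sph n) :
    ContinuousOn (fun ζ : Eucl n => Real.exp (-b * ‖ζ‖ ^ 2) * ‖ζ - x‖ ^ s) (innR n) := by
  refine ContinuousOn.mul (by fun_prop) ?_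
  refine ContinuousOn.rpow_const (by fun_prop) fun ζ hζ => Or.inl ?_
  have := half_le_norm_sub (mem_innR.1 hζ) x
  positivity

theorem integrableOn_inner (s b : ℝ) (x : Sph n) :
    IntegrableOn (fun ζ : Eucl n => Real.exp (-b * ‖ζ‖ ^ 2) * ‖ζ - x‖ ^ s) (innR n) :=
  (continuousOn_inner s b x).integrableOn_compact (isCompact_closedBall _ _)

theorem wbar_eq (s b : ℝ) (x : Sph n) :
    ∫ ζ in innR n, Real.exp (-b * ‖ζ‖ ^ 2) * ‖ζ - x‖ ^ s = wbar n s b := by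
  obtain ⟨A, hA⟩ := exists_isometry_sph (baseP n) x
  rw [wbar, ← integral_indicator measurableSet_innR,
    ← integral_indicator Metric.isClosed_closedBall.measurableSet,
    ← A.measurePreserving.integral_comp A.toMeasurableEquiv.measurableEmbedding]
  congr 1
  ext ζ
  have h : (A ζ ∈ innR n) ↔ ζ ∈ Metric.closedBall (0 : Eucl n) (1 / 2) := by simp [innR]
  have hx : ‖A ζ - (x : Eucl n)‖ = ‖ζ - baseP n‖ := by
    rw [← hA, coe_sphMap, ← map_sub, A.norm_map]
  by_cases h1 : ζ ∈ Metric.closedBall (0 : Eucl n) (1 / 2)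
  · rw [Set.indicator_of_mem h1, Set.indicator_of_mem (h.2 h1), hx, A.norm_map]
  · rw [Set.indicator_of_notMem h1, Set.indicator_of_notMem (fun h' => h1 (h.1 h'))]

/-- A lower bound for the normalisation constant. -/
def cW (n : ℕ) (s : ℝ) : ℝ :=
  2 ^ (-|s|) * volume.real (Metric.closedBall (0 : Eucl n) (1 / 4))

theorem cW_pos (s : ℝ) : 0 < cW n s := by
  unfold cW
  have : 0 < volume.real (Metric.closedBall (0 : Eucl n) (1 / 4)) :=
    ENNReal.toReal_pos (Metric.measure_closedBall_pos _ _ (by norm_num)).ne'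
      measure_closedBall_lt_top.ne
  positivity

theorem two_rpow_le {d : ℝ} (h1 : 1 / 2 ≤ d) (h2 : d ≤ 2) (s : ℝ) : 2 ^ (-|s|) ≤ d ^ s := by
  have h0 : 0 < d := by linarith
  rcases le_total 0 s with hs | hs
  · rw [abs_of_nonneg hs, Real.rpow_neg (by norm_num), ← Real.inv_rpow (by norm_num)]
    exact Real.rpow_le_rpow (by norm_num) (by linarith) hs
  · rw [abs_of_nonpos hs, neg_neg]
    exact Real.rpow_le_rpow_of_nonpos h0 h2 hs

theorem le_wbar (s : ℝ) {b : ℝ} (hb : 0 ≤ b) : Real.exp (-b / 16) * cW n s ≤ wbar n s b := by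
  have hsub : Metric.closedBall (0 : Eucl n) (1 / 4) ⊆ innR n :=
    Metric.closedBall_subset_closedBall (by norm_num)
  have h1 : ∫ ζ in Metric.closedBall (0 : Eucl n) (1 / 4), Real.exp (-b * ‖ζ‖ ^ 2) *
      ‖ζ - baseP n‖ ^ s ≤ wbar n s b := by
    rw [← wbar_eq s b (baseP n)]
    exact setIntegral_mono_set (integrableOn_inner s b _)
      (Eventually.of_forall fun ζ => by positivity) hsub.eventuallyLE
  refine le_trans ?_ h1
  have h2 : ∫ ζ in Metric.closedBall (0 : Eucl n) (1 / 4), Real.exp (-b / 16) * 2 ^ (-|s|) =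
      Real.exp (-b / 16) * cW n s := by
    rw [setIntegral_const, smul_eq_mul, cW]; ring
  rw [← h2]
  refine setIntegral_mono_on ?_ ((integrableOn_inner s b _).mono_set hsub)
    Metric.isClosed_closedBall.measurableSet fun ζ hζ => ?_
  · exact integrableOn_const measure_closedBall_lt_top.ne
  · have hζ' : ‖ζ‖ ≤ 1 / 4 := by simpa using hζ
    gcongr
    · nlinarith [norm_nonneg ζ, mul_nonneg hb (norm_nonneg ζ), mul_nonneg hb (sub_nonneg.2 hζ')]
    · exact two_rpow_le (half_le_norm_sub (by linarith) _)
        (ChordWeight.norm_sub_le_two (by linarith) _) s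

theorem wbar_pos (s : ℝ) {b : ℝ} (hb : 0 ≤ b) : 0 < wbar n s b :=
  lt_of_lt_of_le (mul_pos (Real.exp_pos _) (cW_pos s)) (le_wbar s hb)

theorem indicator_mul_eq (S : Set (Eucl n)) (f g : Eucl n → ℝ) :
    (fun ζ => S.indicator f ζ * g ζ) = S.indicator fun ζ => f ζ * g ζ := by
  ext ζ
  by_cases h : ζ ∈ S <;> simp [h]

theorem integrable_wIn (s b t : ℝ) (x : Sph n) :
    Integrable fun ζ => wIn n s b ζ * ‖ζ - x‖ ^ t := by
  have e : (fun ζ => wIn n s b ζ * ‖ζ - x‖ ^ t) = (innR n).indicator fun ζ =>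
      (wbar n s b)⁻¹ * (Real.exp (-b * ‖ζ‖ ^ 2) * ‖ζ - x‖ ^ t) := by
    rw [wIn, indicator_mul_eq]
    congr 1; ext ζ; ring
  rw [e, integrable_indicator_iff measurableSet_innR]
  exact (integrableOn_inner t b x).const_mul _

theorem integral_wIn (s : ℝ) {b : ℝ} (hb : 0 ≤ b) (x : Sph n) :
    ∫ ζ, wIn n s b ζ * ‖ζ - x‖ ^ s = 1 := by
  have e : (fun ζ => wIn n s b ζ * ‖ζ - x‖ ^ s) = (innR n).indicator fun ζ =>
      (wbar n s b)⁻¹ * (Real.exp (-b * ‖ζ‖ ^ 2) * ‖ζ - x‖ ^ s) := by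
    rw [wIn, indicator_mul_eq]
    congr 1; ext ζ; ring
  rw [e, integral_indicator measurableSet_innR, integral_const_mul, wbar_eq,
    inv_mul_cancel₀ (wbar_pos s hb).ne']

theorem chordWeight_in (s : ℝ) {b : ℝ} (hb : 0 ≤ b) : ChordWeight n s (wIn n s b) 2 where
  meas := by
    refine Measurable.indicator ?_ measurableSet_innR
    fun_prop
  nonneg ζ := Set.indicator_nonneg (fun ζ _ => by have := wbar_pos (n := n) s hb; positivity) ζ
  zero ζ h := Set.indicator_of_notMem (fun h' => by have := mem_innR.1 h'; linarith) _
  integrable x := integrable_wIn s b _ x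
  le x := by
    have h : ∫ ζ, wIn n s b ζ * ‖ζ - x‖ ^ (s - 1) ≤ ∫ ζ, 2 * (wIn n s b ζ * ‖ζ - x‖ ^ s) := by
      refine integral_mono (integrable_wIn s b _ x) ((integrable_wIn s b s x).const_mul 2)
        fun ζ => ?_
      by_cases h : ζ ∈ innR n
      · have h1 := half_le_norm_sub (mem_innR.1 h) x
        have h0 : 0 < ‖ζ - x‖ := by linarith
        have h2 : ‖ζ - x‖ ^ (s - 1) ≤ 2 * ‖ζ - x‖ ^ s := by
          rw [Real.rpow_sub_one h0.ne', div_le_iff₀ h0]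
          have : 0 < ‖ζ - (x : Eucl n)‖ ^ s := by positivity
          nlinarith
        have h3 : 0 ≤ wIn n s b ζ := Set.indicator_nonneg (fun ζ _ => by
          have := wbar_pos (n := n) s hb; positivity) ζ
        simp only
        nlinarith [mul_le_mul_of_nonneg_left h2 h3]
      · simp [wIn, h]
    rw [integral_const_mul, integral_wIn s hb] at h
    linarith

theorem kL_in_const (s : ℝ) {b : ℝ} (hb : 0 ≤ b) :
    (chordWeight_in (n := n) s hb).kL (LipW.constL _ 1) = LipW.constL _ 1 := by
  ext x
  rw [ChordWeight.kL_apply]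
  simp [integral_wIn s hb]

theorem integrableOn_rpow_norm {t : ℝ} (ht : -(n : ℝ) < t) (r : ℝ) (hr : 0 < r) :
    IntegrableOn (fun v : Eucl n => ‖v‖ ^ t) (Metric.ball 0 r) := by
  have h2 : 2 ≤ n := hn.out
  have : Nontrivial (Eucl n) := by
    have : Nonempty (Fin n) := ⟨⟨0, by omega⟩⟩
    infer_instance
  rw [integrableOn_fun_norm_addHaar (volume : Measure (Eucl n)) (f := fun y => y ^ t)]
  have e : Set.EqOn (fun y : ℝ => y ^ (Module.finrank ℝ (Eucl n) - 1) • y ^ t)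
      (fun y => y ^ ((n : ℝ) - 1 + t)) (Set.Ioo 0 r) := fun y hy => by
    simp only [finrank_euclideanSpace, Fintype.card_fin, smul_eq_mul]
    rw [Real.rpow_add hy.1, ← Real.rpow_natCast, Nat.cast_sub (by omega)]
    simp
  rw [integrableOn_congr_fun e measurableSet_Ioo, intervalIntegral.integrableOn_Ioo_rpow_iff hr]
  linarith

theorem integrableOn_rpow_norm_sub {t : ℝ} (ht : -(n : ℝ) < t) (x : Sph n) :
    IntegrableOn (fun ζ : Eucl n => ‖ζ - x‖ ^ t) (Metric.ball (x : Eucl n) 2) ∧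
    ∫ ζ in Metric.ball (x : Eucl n) 2, ‖ζ - x‖ ^ t =
      ∫ v in Metric.ball (0 : Eucl n) 2, ‖v‖ ^ t := by
  have hp := measurePreserving_sub_right (volume : Measure (Eucl n)) (x : Eucl n)
  have he : MeasurableEmbedding fun ζ : Eucl n => ζ - x :=
    (MeasurableEquiv.subRight (x : Eucl n)).measurableEmbedding
  have hpre : Metric.ball (x : Eucl n) 2 = (fun ζ => ζ - (x : Eucl n)) ⁻¹' Metric.ball 0 2 := by
    ext ζ; simp [dist_eq_norm]
  rw [hpre]
  exact ⟨(hp.integrableOn_comp_preimage he).2 (integrableOn_rpow_norm ht 2 (by norm_num)),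
    hp.setIntegral_preimage_emb he (fun v => ‖v‖ ^ t) _⟩

/-- The constant bounding the outer chord weight. -/
def CW (n : ℕ) (s : ℝ) : ℝ := (cW n s)⁻¹ * ∫ v in Metric.ball (0 : Eucl n) 2, ‖v‖ ^ (s - 1)

theorem wOut_nonneg (s : ℝ) {b : ℝ} (hb : 0 ≤ b) (ζ : Eucl n) : 0 ≤ wOut n s b ζ :=
  Set.indicator_nonneg (fun ζ _ => by have := wbar_pos (n := n) s hb; positivity) ζ

theorem wOut_le (s : ℝ) {b : ℝ} (hb : 0 ≤ b) (ζ : Eucl n) : wOut n s b ζ ≤ (cW n s)⁻¹ := by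
  by_cases h : ζ ∈ outR n
  · have h1 := (mem_outR.1 h).2
    rw [wOut, Set.indicator_of_mem h, div_le_iff₀ (wbar_pos s hb), inv_mul_eq_div,
      le_div_iff₀ (cW_pos s)]
    refine le_trans ?_ (le_wbar s hb)
    have := (cW_pos (n := n) s).le
    gcongr
    nlinarith [mul_nonneg hb (by nlinarith : 0 ≤ ‖ζ‖ ^ 2 - 1 / 4)]
  · have := cW_pos (n := n) s
    rw [wOut, Set.indicator_of_notMem h]; positivity

theorem measurable_wOut (s b : ℝ) : Measurable (wOut n s b) :=
  Measurable.indicator (by fun_prop) measurableSet_outR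

theorem chordWeight_out {s : ℝ} (hs : 1 - (n : ℝ) < s) {b : ℝ} (hb : 0 ≤ b) :
    ChordWeight n s (wOut n s b) (CW n s) := by
  have key : ∀ (x : Sph n) (ζ : Eucl n), ‖wOut n s b ζ * ‖ζ - x‖ ^ (s - 1)‖ ≤
      (cW n s)⁻¹ * (Metric.ball (x : Eucl n) 2).indicator (fun ζ => ‖ζ - x‖ ^ (s - 1)) ζ := by
    intro x ζ
    by_cases h : ζ ∈ Metric.ball (x : Eucl n) 2
    · rw [Set.indicator_of_mem h,
        Real.norm_of_nonneg (mul_nonneg (wOut_nonneg s hb ζ) (by positivity))]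
      gcongr
      exact wOut_le s hb ζ
    · have : ζ ∉ outR n := fun h' => h (by
        have h1 := (mem_outR.1 h').1
        rw [Metric.mem_ball, dist_eq_norm]
        have := norm_sub_le ζ (x : Eucl n)
        rw [Sph.norm_eq] at this
        linarith)
      rw [Set.indicator_of_notMem h, wOut, Set.indicator_of_notMem this]
      simp
  have hi := fun x : Sph n => integrableOn_rpow_norm_sub (n := n) (t := s - 1) (by linarith) x
  have hi' := fun x : Sph n =>
    (((integrable_indicator_iff Metric.isOpen_ball.measurableSet).2 (hi x).1).const_mul
      (cW n s)⁻¹)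
  refine ⟨measurable_wOut s b, wOut_nonneg s hb, fun ζ h => ?_, fun x => ?_, fun x => ?_⟩
  · exact Set.indicator_of_notMem (fun h' => by have := (mem_outR.1 h').1; linarith) _
  · refine (hi' x).mono' ?_ (Eventually.of_forall (key x))
    exact ((measurable_wOut s b).mul
      ((measurable_id.sub_const _).norm.pow_const _)).aestronglyMeasurable
  · refine (le_abs_self _).trans ((norm_integral_le_of_norm_le (hi' x)
      (Eventually.of_forall (key x))).trans ?_)
    rw [integral_const_mul, integral_indicator Metric.isOpen_ball.measurableSet, (hi x).2, CW]

end ChordWeights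

section Lifts

variable {n : ℕ} [hn : Fact (2 ≤ n)]
variable {V V' : Type} [NormedAddCommGroup V] [NormedSpace ℝ V] [NormedAddCommGroup V']
  [NormedSpace ℝ V']

theorem measurable_nx : Measurable (nx : Eucl n → Eucl n) := by
  unfold nx; fun_prop

theorem measurable_sx : Measurable (sx : Eucl n → Sph n) := by
  refine (MeasurableEmbedding.subtype_coe
    (Metric.isClosed_sphere.measurableSet)).measurable_comp_iff.1 ?_
  have : (Subtype.val ∘ sx : Eucl n → Eucl n) =
      ({0}ᶜ : Set (Eucl n)).piecewise nx fun _ => (baseP n : Eucl n) := by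
    ext1 x
    by_cases h : x = 0
    · rw [Set.piecewise_eq_of_notMem _ _ _ (by simpa using h)]
      simp [sx, h]
    · rw [Set.piecewise_eq_of_mem _ _ _ (by simpa using h)]
      exact coe_sx h
  rw [this]
  exact measurable_nx.piecewise (measurableSet_singleton _).compl measurable_const

/-- Functions of `(ζ, x)` of the form `c ζ (F (ζ / ‖ζ‖))`. -/
def zL {ω : Sph n → Sph n → ℝ} (c : Eucl n → V →L[ℝ] V') (C : ℝ) (hc : StronglyMeasurable c)
    (hb : ∀ ζ, ‖c ζ‖ ≤ C) : LipW ω V →L[ℝ] ZS n V' :=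
  LipW.mkCLM (fun F a => c a.1 (F (sx a.1))) C (fun _ _ _ => by simp) (fun _ _ _ => by simp)
    (fun F => isBoundedBilinearMap_apply.continuous.comp_stronglyMeasurable
      ((hc.comp_measurable measurable_fst).prodMk
        (F.stronglyMeasurable.comp_measurable (measurable_sx.comp measurable_fst))))
    (fun F a => ((c a.1).le_opNorm _).trans
      (mul_le_mul (hb _) (F.norm_apply_le _) (norm_nonneg _) ((norm_nonneg _).trans (hb a.1))))
    (fun F a b h => by
      have hC : 0 ≤ C := (norm_nonneg _).trans (hb a.1)
      by_cases h1 : a.1 = b.1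
      · rw [h1, sub_self, norm_zero]; positivity
      · simp [wZ, h1] at h)

@[simp] theorem zL_apply {ω : Sph n → Sph n → ℝ} (c : Eucl n → V →L[ℝ] V') (C : ℝ) (hc) (hb)
    (F : LipW ω V) (a : Eucl n × Sph n) : zL c C hc hb F a = c a.1 (F (sx a.1)) := rfl

theorem abs_sub_le_dist (ζ : Eucl n) (x y : Sph n) : |‖ζ - x‖ - ‖ζ - y‖| ≤ dist x y := by
  refine (abs_norm_sub_norm_le _ _).trans (le_of_eq ?_)
  rw [sub_sub_sub_cancel_left, dist_comm, Subtype.dist_eq, dist_eq_norm]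

theorem norm_quot_sub_le {N N' : V} {d d' C r : ℝ} (hd : 0 ≤ d) (hd' : 0 ≤ d') (hC : 0 ≤ C)
    (hr : 0 ≤ r) (h : ‖N‖ ≤ C * d) (h' : ‖N'‖ ≤ C * d') (hN : ‖N - N'‖ ≤ C * r)
    (hdd : |d - d'| ≤ r) :
    ‖d⁻¹ • N - d'⁻¹ • N'‖ ≤ 2 * C * √(r / max d d') := by
  wlog hle : d' ≤ d generalizing N N' d d'
  · have := this hd' hd h' h (by rwa [norm_sub_rev]) (by rwa [abs_sub_comm]) (le_of_not_ge hle)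
    rwa [norm_sub_rev, max_comm]
  rw [max_eq_left hle]
  rcases hd.eq_or_lt with h0 | h0
  · have : d' = 0 := le_antisymm (hle.trans h0.symm.le) hd'
    subst this; rw [← h0]; simp
  have hq : ‖d'⁻¹ • N'‖ ≤ C := by
    rw [norm_smul, norm_inv, Real.norm_of_nonneg hd']
    rcases hd'.eq_or_lt with h1 | h1
    · rw [← h1]; simpa using hC
    · rw [inv_mul_le_iff₀ h1, mul_comm]; exact h'
  have hq' : ‖d⁻¹ • N‖ ≤ C := by
    rw [norm_smul, norm_inv, Real.norm_of_nonneg hd, inv_mul_le_iff₀ h0, mul_comm]; exact h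
  rcases le_or_gt 1 (r / d) with h2 | h2
  · have : 1 ≤ √(r / d) := Real.one_le_sqrt.2 h2
    calc _ ≤ C + C := (norm_sub_le _ _).trans (add_le_add hq' hq)
      _ ≤ _ := by nlinarith
  · have hN' : N' = d' • d'⁻¹ • N' := by
      rcases hd'.eq_or_lt with h1 | h1
      · rw [← h1, zero_mul C |> fun e => (mul_comm C 0).trans e] at h'
        rw [norm_le_zero_iff.1 h']; simp
      · rw [smul_inv_smul₀ h1.ne']
    have e : d⁻¹ • N - d'⁻¹ • N' = d⁻¹ • (N - N') - (d⁻¹ * (d - d')) • d'⁻¹ • N' := by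
      conv_rhs => rw [hN']
      have h3 : d⁻¹ * (d - d') = 1 - d⁻¹ * d' := by field_simp
      rw [h3]
      rcases hd'.eq_or_lt with h1 | h1
      · rw [← h1]; simp
      · rw [smul_inv_smul₀ h1.ne', sub_smul, smul_sub, one_smul, mul_smul,
          smul_inv_smul₀ h1.ne']
        abel
    have hs : r / d ≤ √(r / d) := Real.le_sqrt_of_sq_le (by
      have : 0 ≤ r / d := by positivity
      nlinarith)
    rw [e]
    calc _ ≤ d⁻¹ * (C * r) + d⁻¹ * r * C := by
          refine (norm_sub_le _ _).trans (add_le_add ?_ ?_)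
          · rw [norm_smul, norm_inv, Real.norm_of_nonneg hd]
            gcongr
          · rw [norm_smul, norm_mul, norm_inv, Real.norm_of_nonneg hd, Real.norm_eq_abs]
            gcongr
      _ = 2 * C * (r / d) := by ring
      _ ≤ _ := by gcongr

/-- The direction `(ζ - x) / ‖ζ - x‖`. -/
def D0 (n : ℕ) [Fact (2 ≤ n)] : ZS n (Eucl n) :=
  LipW.mk (fun a => ‖a.1 - a.2‖⁻¹ • (a.1 - (a.2 : Eucl n))) 2
    (by
      have h : Measurable fun a : Eucl n × Sph n => a.1 - (a.2 : Eucl n) :=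
        measurable_fst.sub (measurable_subtype_coe.comp measurable_snd)
      exact (h.norm.inv.smul h).stronglyMeasurable)
    (fun a => by
      rw [norm_smul, norm_inv, norm_norm]
      exact inv_mul_le_one.trans one_le_two)
    (fun a b h => le_wZ (F := fun a => ‖a.1 - a.2‖⁻¹ • (a.1 - (a.2 : Eucl n))) h
      fun ζ x y => by
        refine (norm_quot_sub_le (norm_nonneg _) (norm_nonneg _) zero_le_one dist_nonneg (by simp)
          (by simp) ?_ (abs_sub_le_dist ζ x y)).trans (by simp)
        rw [sub_sub_sub_cancel_left, one_mul, dist_comm, Subtype.dist_eq, dist_eq_norm])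

@[simp] theorem D0_apply (a : Eucl n × Sph n) : D0 n a = ‖a.1 - a.2‖⁻¹ • (a.1 - (a.2 : Eucl n)) :=
  rfl

/-- The profile of the radial change of variables. -/
def chi (r : ℝ) : ℝ := max 0 (2 * r - 1)

theorem chi_nonneg (r : ℝ) : 0 ≤ chi r := le_max_left _ _

theorem chi_le_one {r : ℝ} (h : r ≤ 1) : chi r ≤ 1 := max_le (by norm_num) (by linarith)

theorem measurable_chi : Measurable chi := by unfold chi; fun_prop

open Classical in
/-- The perturbation of the direction in the inner region. -/
def D1in (n : ℕ) [Fact (2 ≤ n)] : LipW (wS n) (Eucl n) →L[ℝ] ZS n (Eucl n) :=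
  LipW.mkCLM (fun A a => if a.1 ∈ innR n then -(‖a.1 - a.2‖⁻¹ • A a.2) else 0) 20
    (fun _ _ _ => by split_ifs <;> simp [add_comm])
    (fun c A a => by
      split_ifs
      · rw [LipW.coe_smul, smul_neg, smul_comm]
      · simp)
    (fun A => by
      have h : Measurable fun a : Eucl n × Sph n => ‖a.1 - (a.2 : Eucl n)‖⁻¹ :=
        (measurable_fst.sub (measurable_subtype_coe.comp measurable_snd)).norm.inv
      exact StronglyMeasurable.ite (measurable_fst measurableSet_innR)
        (h.stronglyMeasurable.smul (A.stronglyMeasurable.comp_measurable measurable_snd)).neg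
        stronglyMeasurable_const)
    (fun A a => by
      split_ifs with h
      · have h1 := half_le_norm_sub (mem_innR.1 h) a.2
        rw [norm_neg, norm_smul, norm_inv, norm_norm]
        have h2 : ‖a.1 - (a.2 : Eucl n)‖⁻¹ ≤ 20 := by
          rw [inv_le_comm₀ (by linarith) (by norm_num)]; linarith
        have := A.norm_apply_le a.2
        gcongr
      · simp)
    (fun A a b hab => le_wZ
      (F := fun a => if a.1 ∈ innR n then -(‖a.1 - a.2‖⁻¹ • A a.2) else 0) hab
      fun ζ x y => by
        dsimp only
        split_ifs with h
        · have hx := half_le_norm_sub (mem_innR.1 h) x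
          have hy := half_le_norm_sub (mem_innR.1 h) y
          have hζ : ‖ζ‖ < 1 := by have := mem_innR.1 h; linarith
          have hx2 := ChordWeight.norm_sub_le_two hζ x
          have hy2 := ChordWeight.norm_sub_le_two hζ y
          have hd := abs_sub_le_dist ζ x y
          set d := ‖ζ - x‖
          set d' := ‖ζ - y‖
          set r := dist x y with hr
          have hr0 : 0 ≤ r := dist_nonneg
          have hr2 : r ≤ 2 * √r := le_two_mul_sqrt hr0 (dist_sph_le_two x y)
          have hd0 : 0 < d := by linarith
          have hd'0 : 0 < d' := by linarith
          have hi : d⁻¹ ≤ 2 := by rw [inv_le_comm₀ hd0 (by norm_num)]; linarith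
          have hi' : d'⁻¹ ≤ 2 := by rw [inv_le_comm₀ hd'0 (by norm_num)]; linarith
          have hii : |d'⁻¹ - d⁻¹| ≤ 2 * 2 * r := by
            have : d'⁻¹ - d⁻¹ = d⁻¹ * d'⁻¹ * (d - d') := by field_simp
            rw [this, abs_mul, abs_of_nonneg (by positivity)]
            gcongr
          have e : -(d⁻¹ • A x) - -(d'⁻¹ • A y) =
              d⁻¹ • (A y - A x) + (d'⁻¹ - d⁻¹) • A y := by
            rw [smul_sub, sub_smul]; abel
          have h1 : √r ≤ 2 * √(r / max d d') := by
            have : √r = √(r / max d d') * √(max d d') := by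
              rw [← Real.sqrt_mul (by positivity), div_mul_cancel₀]
              exact (lt_max_of_lt_left hd0).ne'
            rw [this, mul_comm]
            gcongr
            rw [Real.sqrt_le_iff]
            exact ⟨by norm_num, (max_le hx2 hy2).trans (by norm_num)⟩
          have h2 := A.norm_apply_le y
          have h3 : ‖A y - A x‖ ≤ ‖A‖ * √r := by
            rw [hr, dist_comm]; exact norm_sub_le_sqrt_dist A y x
          rw [e]
          calc _ ≤ 2 * (‖A‖ * √r) + 2 * 2 * (2 * √r) * ‖A‖ := by
                refine (norm_add_le _ _).trans (add_le_add ?_ ?_)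
                · rw [norm_smul, norm_inv, Real.norm_of_nonneg hd0.le]
                  gcongr
                · rw [norm_smul, Real.norm_eq_abs]
                  have : |d'⁻¹ - d⁻¹| ≤ 2 * 2 * (2 * √r) := hii.trans (by gcongr)
                  gcongr
            _ = 10 * ‖A‖ * √r := by ring
            _ ≤ 10 * ‖A‖ * (2 * √(r / max d d')) := by gcongr
            _ = _ := by ring
        · simp only [sub_self, norm_zero]; positivity)

open Classical in
@[simp] theorem D1in_apply (A : LipW (wS n) (Eucl n)) (a : Eucl n × Sph n) :
    D1in n A a = if a.1 ∈ innR n then -(‖a.1 - a.2‖⁻¹ • A a.2) else 0 := rfl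

theorem norm_chi_smul_sub_le (e : LipW (wL n) (Eucl n)) {ζ : Eucl n} (h : ζ ∈ outR n)
    (x : Sph n) : ‖chi ‖ζ‖ • e (sx ζ) - e x‖ ≤ 4 * ‖e‖ * ‖ζ - x‖ := by
  obtain ⟨h1, h2⟩ := mem_outR.1 h
  have h0 : ζ ≠ 0 := fun h => by rw [h, norm_zero] at h2; linarith
  have hd : 1 - ‖ζ‖ ≤ ‖ζ - x‖ := by
    have := norm_sub_norm_le (x : Eucl n) ζ
    rwa [Sph.norm_eq, norm_sub_rev] at this
  have hc : chi ‖ζ‖ = 2 * ‖ζ‖ - 1 := max_eq_right (by linarith)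
  have hs : dist (sx ζ) x ≤ 2 * ‖ζ - x‖ := by
    have h3 : ‖nx ζ - ζ‖ = 1 - ‖ζ‖ := by
      have : nx ζ - ζ = (1 - ‖ζ‖) • nx ζ := by
        rw [sub_smul, one_smul, nx, smul_inv_smul₀ (norm_ne_zero_iff.2 h0)]
      rw [this, norm_smul, norm_nx h0, mul_one, Real.norm_of_nonneg (by linarith)]
    rw [Subtype.dist_eq, dist_eq_norm, coe_sx h0]
    have := norm_sub_le_norm_sub_add_norm_sub (nx ζ) ζ (x : Eucl n)
    linarith
  have e1 : chi ‖ζ‖ • e (sx ζ) - e x = chi ‖ζ‖ • (e (sx ζ) - e x) + (chi ‖ζ‖ - 1) • e x := by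
    rw [smul_sub, sub_smul, one_smul]; abel
  have h4 := norm_sub_le_dist e (sx ζ) x
  have h5 := e.norm_apply_le x
  rw [e1]
  calc _ ≤ 1 * (‖e‖ * (2 * ‖ζ - x‖)) + 2 * ‖ζ - x‖ * ‖e‖ := by
        refine (norm_add_le _ _).trans (add_le_add ?_ ?_)
        · rw [norm_smul, Real.norm_of_nonneg (chi_nonneg _)]
          gcongr
          · exact chi_le_one h1.le
          · exact h4.trans (by gcongr)
        · rw [norm_smul, Real.norm_eq_abs, hc, abs_of_nonpos (by linarith)]
          gcongr
          linarith
    _ = _ := by ring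

open Classical in
/-- The perturbation of the direction in the outer region. -/
def D1out (n : ℕ) [Fact (2 ≤ n)] : LipW (wL n) (Eucl n) →L[ℝ] ZS n (Eucl n) :=
  LipW.mkCLM (fun e a => if a.1 ∈ outR n then
      ‖a.1 - a.2‖⁻¹ • (chi ‖a.1‖ • e (sx a.1) - e a.2) else 0) 8
    (fun _ _ _ => by
      split_ifs
      · simp only [LipW.coe_add, smul_add, smul_sub]; abel
      · simp)
    (fun c e a => by
      split_ifs
      · simp only [LipW.coe_smul, smul_sub, smul_comm c]
      · simp)
    (fun e => by
      have h : Measurable fun a : Eucl n × Sph n => ‖a.1 - (a.2 : Eucl n)‖⁻¹ :=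
        (measurable_fst.sub (measurable_subtype_coe.comp measurable_snd)).norm.inv
      refine StronglyMeasurable.ite (measurable_fst measurableSet_outR)
        (h.stronglyMeasurable.smul (StronglyMeasurable.sub ?_
          (e.stronglyMeasurable.comp_measurable measurable_snd)))
        stronglyMeasurable_const
      exact ((measurable_chi.comp measurable_fst.norm).stronglyMeasurable).smul
        (e.stronglyMeasurable.comp_measurable (measurable_sx.comp measurable_fst)))
    (fun e a => by
      split_ifs with h
      · have h0 := ChordWeight.norm_sub_pos (mem_outR.1 h).1 a.2
        rw [norm_smul, norm_inv, norm_norm, inv_mul_le_iff₀ h0]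
        refine (norm_chi_smul_sub_le e h a.2).trans ?_
        have : 0 ≤ ‖e‖ * ‖a.1 - a.2‖ := by positivity
        linarith
      · simp)
    (fun e a b hab => le_wZ
      (F := fun a => if a.1 ∈ outR n then
        ‖a.1 - a.2‖⁻¹ • (chi ‖a.1‖ • e (sx a.1) - e a.2) else 0) hab
      fun ζ x y => by
        dsimp only
        split_ifs with h
        · refine (norm_quot_sub_le (norm_nonneg _) (norm_nonneg _) (by positivity) dist_nonneg
            (norm_chi_smul_sub_le e h x) (norm_chi_smul_sub_le e h y) ?_
            (abs_sub_le_dist ζ x y)).trans (le_of_eq (by ring))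
          rw [sub_sub_sub_cancel_left]
          refine (norm_sub_le_dist e y x).trans ?_
          rw [dist_comm]
          have : 0 ≤ ‖e‖ * dist x y := by positivity
          linarith
        · simp only [sub_self, norm_zero]; positivity)

open Classical in
@[simp] theorem D1out_apply (e : LipW (wL n) (Eucl n)) (a : Eucl n × Sph n) :
    D1out n e a = if a.1 ∈ outR n then
      ‖a.1 - a.2‖⁻¹ • (chi ‖a.1‖ • e (sx a.1) - e a.2) else 0 := rfl

end Lifts

section ChordPerturbation

variable {n : ℕ} [hn : Fact (2 ≤ n)]

/-- The inner integrand. -/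
def phiIn (s : ℝ) (D : Eucl n) : ℝ := powE (s / 2) (‖D‖ ^ 2)

theorem contDiff_phiIn (s : ℝ) : ContDiff ℝ (⊤ : ℕ∞) (phiIn (n := n) s) :=
  (contDiff_powE _).comp (contDiff_norm_sq ℝ)

/-- The data entering the outer integrand: `1/R`, `⟪ζ, A⟫`, `A`, `D`, `B`. -/
abbrev XO (n : ℕ) := ℝ × ℝ × Eucl n × Eucl n × (Eucl n →L[ℝ] Eucl n)

/-- The Gaussian factor of the outer integrand. -/
def phiE (p : XO n) : ℝ := expNegInvGlue (p.1 ^ 2 * powE (-1) (1 / 16 + p.2.1 * p.1))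

/-- The remaining factors of the outer integrand. -/
def phiR (s : ℝ) (p : XO n) : ℝ :=
  Real.exp (-‖p.2.2.1‖ ^ 2 / 2) * powE (s / 2) (‖p.2.2.2.1‖ ^ 2) * (1 + p.2.2.2.2).det

/-- The outer integrand. -/
def phiOut (s : ℝ) (p : XO n) : ℝ := phiE p * phiR s p

theorem contDiff_phiE_arg : ContDiff ℝ (⊤ : ℕ∞)
    fun p : XO n => powE (-1) (1 / 16 + p.2.1 * p.1) := by
  refine (contDiff_powE _).comp ?_
  fun_prop

theorem contDiff_phiE : ContDiff ℝ (⊤ : ℕ∞) (phiE (n := n)) := by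
  refine expNegInvGlue.contDiff.comp (ContDiff.mul (by fun_prop) contDiff_phiE_arg)

theorem contDiff_phiR (s : ℝ) : ContDiff ℝ (⊤ : ℕ∞) (phiR (n := n) s) := by
  have h1 : ContDiff ℝ (⊤ : ℕ∞) fun p : XO n => p.2.2.1 := by fun_prop
  have h2 : ContDiff ℝ (⊤ : ℕ∞) fun p : XO n => p.2.2.2.1 := by fun_prop
  have h3 : ContDiff ℝ (⊤ : ℕ∞) fun p : XO n => 1 + p.2.2.2.2 :=
    contDiff_const.add (by fun_prop)
  refine ContDiff.mul (ContDiff.mul ?_ ((contDiff_powE _).comp (h2.norm_sq ℝ)))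
    (contDiff_det.comp h3)
  exact Real.contDiff_exp.comp (((h1.norm_sq ℝ).neg).div_const 2)

theorem contDiff_phiOut (s : ℝ) : ContDiff ℝ (⊤ : ℕ∞) (phiOut (n := n) s) :=
  contDiff_phiE.mul (contDiff_phiR s)

theorem hasFDerivAt_mul_of_eq_zero {E : Type} [NormedAddCommGroup E] [NormedSpace ℝ E]
    {f g : E → ℝ} {p : E} (h0 : f p = 0) (hf : HasFDerivAt f (0 : E →L[ℝ] ℝ) p)
    (hg : DifferentiableAt ℝ g p) :
    HasFDerivAt (fun x => f x * g x) (0 : E →L[ℝ] ℝ) p := by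
  refine (hf.mul hg.hasFDerivAt).congr_fderiv ?_
  rw [h0]; simp

theorem phiE_of_zero (p : XO n) (h : p.1 = 0) : phiE p = 0 := by simp [phiE, h]

theorem hasFDerivAt_phiOut (s : ℝ) (p : XO n) (h : p.1 = 0) :
    HasFDerivAt (phiOut s) (0 : XO n →L[ℝ] ℝ) p := by
  refine hasFDerivAt_mul_of_eq_zero (phiE_of_zero p h) ?_
    ((contDiff_phiR s).differentiable (by simp) p)
  have h1 : HasFDerivAt (fun p : XO n => p.1 ^ 2) (0 : XO n →L[ℝ] ℝ) p := by
    refine (HasFDerivAt.pow (hasFDerivAt_fst (𝕜 := ℝ) (p := p)) 2).congr_fderiv ?_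
    rw [h]; simp
  have h2 := hasFDerivAt_mul_of_eq_zero (by simp [h]) h1
    (contDiff_phiE_arg.differentiable (by simp) p)
  have h3 := ((expNegInvGlue.contDiff (n := (1 : ℕ∞))).differentiable (by simp)
    (p.1 ^ 2 * powE (-1) (1 / 16 + p.2.1 * p.1))).hasFDerivAt
  refine (h3.comp p h2).congr_fderiv ?_
  simp

section Abstract

variable {V V' : Type} [NormedAddCommGroup V] [NormedSpace ℝ V] [NormedAddCommGroup V']
  [NormedSpace ℝ V']

/-- Pairing of two linear families. -/
def LipW.pairL {T : Type} [MeasurableSpace T] {ω : T → T → ℝ} {X : Type} [NormedAddCommGroup X]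
    [NormedSpace ℝ X] (L : X →L[ℝ] LipW ω V) (L' : X →L[ℝ] LipW ω V') :
    X →L[ℝ] LipW ω (V × V') := LipW.pair.comp (L.prod L')

@[simp] theorem LipW.pairL_apply {T : Type} [MeasurableSpace T] {ω : T → T → ℝ} {X : Type}
    [NormedAddCommGroup X] [NormedSpace ℝ X] (L : X →L[ℝ] LipW ω V) (L' : X →L[ℝ] LipW ω V')
    (x : X) (t : T) : LipW.pairL L L' x t = (L x t, L' x t) := by
  simp [LipW.pairL]

theorem LipW.hasStrictFDerivAt_nem_of_fderiv_eq_zero [FiniteDimensional ℝ V] {T : Type}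
    [MeasurableSpace T] {ω : T → T → ℝ} {Φ : V → ℝ} (h : ContDiff ℝ (⊤ : ℕ∞) Φ) (F : LipW ω V)
    (h0 : ∀ t, fderiv ℝ Φ (F t) = 0) :
    HasStrictFDerivAt (LipW.nem (ω := ω) Φ) (0 : LipW ω V →L[ℝ] LipW ω ℝ) F := by
  refine ((LipW.contDiff_nem h).contDiffAt.hasStrictFDerivAt'
    (LipW.hasFDerivAt_nem h F) (by simp)).congr_fderiv ?_
  ext1 G
  apply LipW.ext
  intro t
  rw [LipW.bilin_apply, LipW.nem_apply (contDiff_infty_iff_fderiv.1 h).2, h0]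
  simp

/-- Lift by a scalar multiplier. -/
def zS {ω : Sph n → Sph n → ℝ} (c : Eucl n → ℝ) (C : ℝ) (hc : Measurable c)
    (hb : ∀ ζ, |c ζ| ≤ C) : LipW ω V →L[ℝ] ZS n V :=
  zL (fun ζ => c ζ • ContinuousLinearMap.id ℝ V) C
    (hc.stronglyMeasurable.smul stronglyMeasurable_const) fun ζ => by
      rw [norm_smul, Real.norm_eq_abs]
      calc _ ≤ |c ζ| * 1 := by gcongr; exact ContinuousLinearMap.norm_id_le
        _ ≤ C := by rw [mul_one]; exact hb ζ

@[simp] theorem zS_apply {ω : Sph n → Sph n → ℝ} (c : Eucl n → ℝ) (C : ℝ) (hc) (hb)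
    (F : LipW ω V) (a : Eucl n × Sph n) : zS c C hc hb F a = c a.1 • F (sx a.1) := rfl

/-- Lift by a bilinear multiplier. -/
def zB {W : Type} [NormedAddCommGroup W] [NormedSpace ℝ W] {ω : Sph n → Sph n → ℝ}
    (B : W →L[ℝ] V →L[ℝ] V') (k : Eucl n → W) (C : ℝ)
    (hk : StronglyMeasurable k) (hb : ∀ ζ, ‖k ζ‖ ≤ C) : LipW ω V →L[ℝ] ZS n V' :=
  zL (fun ζ => B (k ζ)) (‖B‖ * C) (B.continuous.comp_stronglyMeasurable hk)
    fun ζ => (B.le_opNorm _).trans (by gcongr; exact hb ζ)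

@[simp] theorem zB_apply {W : Type} [NormedAddCommGroup W] [NormedSpace ℝ W]
    {ω : Sph n → Sph n → ℝ} (B : W →L[ℝ] V →L[ℝ] V') (k : Eucl n → W) (C : ℝ) (hk) (hb)
    (F : LipW ω V) (a : Eucl n × Sph n) : zB B k C hk hb F a = B (k a.1) (F (sx a.1)) := rfl

variable (V V') in
/-- The bilinear map `(f, v) ↦ f(·) v`. -/
def smulRB : (V →L[ℝ] ℝ) →L[ℝ] V' →L[ℝ] (V →L[ℝ] V') := ContinuousLinearMap.smulRightL ℝ V V'

theorem smulRB_apply (f : V →L[ℝ] ℝ) (v : V') : smulRB V V' f v = f.smulRight v := rfl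

end Abstract

/-- The cut-off of the outer region. -/
def outI (n : ℕ) (ζ : Eucl n) : ℝ := (outR n).indicator (fun _ => 1) ζ

theorem outI_of_mem {ζ : Eucl n} (h : ζ ∈ outR n) : outI n ζ = 1 := by simp [outI, h]

theorem outI_of_notMem {ζ : Eucl n} (h : ζ ∉ outR n) : outI n ζ = 0 := by simp [outI, h]

theorem measurable_outI : Measurable (outI n) := measurable_const.indicator measurableSet_outR

theorem measurable_chi_norm : Measurable fun ζ : Eucl n => chi ‖ζ‖ :=
  measurable_chi.comp measurable_norm

theorem ne_zero_of_mem_outR {ζ : Eucl n} (h : ζ ∈ outR n) : ζ ≠ 0 := fun h0 => by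
  have := (mem_outR.1 h).2
  rw [h0, norm_zero] at this
  linarith

theorem abs_outI_mul_chi_le (ζ : Eucl n) : |outI n ζ * chi ‖ζ‖| ≤ 1 := by
  by_cases h : ζ ∈ outR n
  · rw [outI_of_mem h, one_mul, abs_of_nonneg (chi_nonneg _)]
    exact chi_le_one (mem_outR.1 h).1.le
  · rw [outI_of_notMem h, zero_mul, abs_zero]
    exact zero_le_one

theorem abs_outI_mul_div_le (ζ : Eucl n) : |outI n ζ * (chi ‖ζ‖ / ‖ζ‖)| ≤ 2 := by
  by_cases h : ζ ∈ outR n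
  · obtain ⟨h1, h2⟩ := mem_outR.1 h
    rw [outI_of_mem h, one_mul, abs_of_nonneg (div_nonneg (chi_nonneg _) (norm_nonneg _)),
      div_le_iff₀ (by linarith)]
    have := chi_le_one h1.le
    linarith
  · rw [outI_of_notMem h, zero_mul, abs_zero]
    exact zero_le_two

theorem norm_outI_smul_le (ζ : Eucl n) : ‖(outI n ζ * chi ‖ζ‖) • ζ‖ ≤ 1 := by
  by_cases h : ζ ∈ outR n
  · rw [norm_smul]
    exact mul_le_one₀ (abs_outI_mul_chi_le ζ) (norm_nonneg _) (mem_outR.1 h).1.le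
  · rw [outI_of_notMem h, zero_mul, zero_smul, norm_zero]
    exact zero_le_one

theorem norm_outI_smul_nx_le (ζ : Eucl n) : ‖innerSL ℝ ((2 * outI n ζ) • nx ζ)‖ ≤ 2 := by
  rw [innerSL_apply_norm]
  by_cases h : ζ ∈ outR n
  · rw [norm_smul, norm_nx (ne_zero_of_mem_outR h), outI_of_mem h]
    norm_num
  · rw [outI_of_notMem h, mul_zero, zero_smul, norm_zero]
    exact zero_le_two

/-- The gradient, rescaled gradient and Hessian data. -/
abbrev JetS (n : ℕ) [Fact (2 ≤ n)] := LipW (wS n) (Eucl n) × LipW (wL n) (Eucl n) ×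
  LipW (wS n) (Eucl n →L[ℝ] Eucl n)

/-- The radial part of the rescaled gradient. -/
def outLI (n : ℕ) [Fact (2 ≤ n)] : LipW (wS n) (Eucl n) →L[ℝ] ZS n ℝ :=
  zB (innerSL ℝ) (fun ζ => (outI n ζ * chi ‖ζ‖) • ζ) 1
    ((measurable_outI.mul measurable_chi_norm).smul measurable_id).stronglyMeasurable
    norm_outI_smul_le

/-- The rescaled gradient. -/
def outLA (n : ℕ) [Fact (2 ≤ n)] : LipW (wS n) (Eucl n) →L[ℝ] ZS n (Eucl n) :=
  zS (fun ζ => outI n ζ * chi ‖ζ‖) 1 (measurable_outI.mul measurable_chi_norm) abs_outI_mul_chi_le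

/-- The gradient part of the differential of the change of variables. -/
def outLE (n : ℕ) [Fact (2 ≤ n)] : LipW (wL n) (Eucl n) →L[ℝ] ZS n (Eucl n →L[ℝ] Eucl n) :=
  zB (smulRB (Eucl n) (Eucl n)) (fun ζ => innerSL ℝ ((2 * outI n ζ) • nx ζ)) 2
    ((innerSL ℝ).continuous.comp_stronglyMeasurable
      ((measurable_outI.const_mul 2).smul measurable_nx).stronglyMeasurable) norm_outI_smul_nx_le

/-- The Hessian part of the differential of the change of variables. -/
def outLM (n : ℕ) [Fact (2 ≤ n)] :
    LipW (wS n) (Eucl n →L[ℝ] Eucl n) →L[ℝ] ZS n (Eucl n →L[ℝ] Eucl n) :=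
  zS (fun ζ => outI n ζ * (chi ‖ζ‖ / ‖ζ‖)) 2
    (measurable_outI.mul (measurable_chi_norm.div measurable_norm)) abs_outI_mul_div_le

/-- The differential of the change of variables. -/
def outB (n : ℕ) [Fact (2 ≤ n)] : JetS n →L[ℝ] ZS n (Eucl n →L[ℝ] Eucl n) :=
  (outLE n).comp ((ContinuousLinearMap.fst ℝ _ _).comp (ContinuousLinearMap.snd ℝ _ _)) +
  (outLM n).comp ((ContinuousLinearMap.snd ℝ _ _).comp (ContinuousLinearMap.snd ℝ _ _))

/-- The displacement data of the outer region. -/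
def outDB (n : ℕ) [Fact (2 ≤ n)] : JetS n →L[ℝ] ZS n (Eucl n × (Eucl n →L[ℝ] Eucl n)) :=
  LipW.pairL ((D1out n).comp
    ((ContinuousLinearMap.fst ℝ _ _).comp (ContinuousLinearMap.snd ℝ _ _))) (outB n)

/-- The spatial data of the outer region. -/
def outJ (n : ℕ) [Fact (2 ≤ n)] :
    JetS n →L[ℝ] ZS n (ℝ × Eucl n × Eucl n × (Eucl n →L[ℝ] Eucl n)) :=
  LipW.pairL ((outLI n).comp (ContinuousLinearMap.fst ℝ _ _))
    (LipW.pairL ((outLA n).comp (ContinuousLinearMap.fst ℝ _ _)) (outDB n))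

/-- The linear dependence of the outer data on gradient and Hessian. -/
def outL (n : ℕ) [Fact (2 ≤ n)] : (ℝ × JetS n) →L[ℝ] ZS n (XO n) :=
  LipW.pairL ((LipW.constL (wZ n)).comp (ContinuousLinearMap.fst ℝ _ _))
    ((outJ n).comp (ContinuousLinearMap.snd ℝ _ _))

/-- The outer data of the unperturbed ball. -/
def baseZ (n : ℕ) [Fact (2 ≤ n)] : ZS n (XO n) :=
  LipW.post (ContinuousLinearMap.inr ℝ _ _) (LipW.post (ContinuousLinearMap.inr ℝ _ _)
    (LipW.post (ContinuousLinearMap.inr ℝ _ _) (LipW.post (ContinuousLinearMap.inl ℝ _ _) (D0 n))))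

theorem baseZ_apply (a : Eucl n × Sph n) : baseZ n a = (0, 0, 0, D0 n a, 0) := by
  simp only [baseZ, LipW.post_apply]
  rfl

theorem outB_apply (J : JetS n) {ζ : Eucl n} (h : ζ ∈ outR n) (x : Sph n) :
    outB n J (ζ, x) = (2 : ℝ) • tens (nx ζ) (J.2.1 (sx ζ)) + (chi ‖ζ‖ / ‖ζ‖) • J.2.2 (sx ζ) := by
  have h1 : outB n J (ζ, x) = outLE n J.2.1 (ζ, x) + outLM n J.2.2 (ζ, x) := rfl
  rw [h1]
  congr 1
  · ext1 v
    rw [outLE, zB_apply, smulRB_apply]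
    simp only [outI_of_mem h, mul_one, ContinuousLinearMap.smulRight_apply, innerSL_apply_apply,
      smul_apply, tens_apply, inner_smul_left, mul_smul]
    simp
  · rw [outLM, zS_apply, outI_of_mem h, one_mul]

theorem outDB_apply (J : JetS n) (a : Eucl n × Sph n) :
    outDB n J a = (D1out n J.2.1 a, outB n J a) := by
  rw [outDB, LipW.pairL_apply]; rfl

theorem outJ_apply (J : JetS n) (a : Eucl n × Sph n) :
    outJ n J a = (outLI n J.1 a, outLA n J.1 a, outDB n J a) := by
  rw [outJ, LipW.pairL_apply, LipW.pairL_apply]; rfl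

theorem outL_apply (t : ℝ) (J : JetS n) (a : Eucl n × Sph n) :
    outL n (t, J) a = (t, outJ n J a) := by
  rw [outL, LipW.pairL_apply]; rfl

theorem outL_add_apply (A : LipW (wS n) (Eucl n)) (e : LipW (wL n) (Eucl n))
    (M : LipW (wS n) (Eucl n →L[ℝ] Eucl n)) (t : ℝ) {ζ : Eucl n} (h : ζ ∈ outR n) (x : Sph n) :
    (baseZ n + outL n (t, A, e, M)) (ζ, x) =
      (t, chi ‖ζ‖ * ⟪ζ, A (sx ζ)⟫, chi ‖ζ‖ • A (sx ζ),
        ‖ζ - x‖⁻¹ • (ζ + chi ‖ζ‖ • e (sx ζ) - (x + e x)),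
        (2 : ℝ) • tens (nx ζ) (e (sx ζ)) + (chi ‖ζ‖ / ‖ζ‖) • M (sx ζ)) := by
  have hD : ‖ζ - x‖⁻¹ • (ζ + chi ‖ζ‖ • e (sx ζ) - (x + e x)) =
      ‖ζ - x‖⁻¹ • (ζ - x) + ‖ζ - x‖⁻¹ • (chi ‖ζ‖ • e (sx ζ) - e x) := by
    rw [← smul_add]; congr 1; abel
  rw [hD, LipW.coe_add, baseZ_apply, outL_apply, outJ_apply, outDB_apply, outB_apply _ h, outLI,
    outLA, zB_apply, zS_apply, outI_of_mem h, one_mul, D0_apply, D1out_apply, if_pos h,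
    innerSL_apply_apply, real_inner_smul_left]
  simp only [Prod.mk_add_mk, zero_add]

theorem fderiv_phiOut_base (s : ℝ) (a : Eucl n × Sph n) :
    fderiv ℝ (phiOut s) (baseZ n a) = 0 := by
  refine (hasFDerivAt_phiOut s _ ?_).fderiv
  rw [baseZ_apply]

theorem hasStrictFDerivAt_nem_phiOut (s : ℝ) :
    HasStrictFDerivAt (LipW.nem (ω := wZ n) (phiOut s)) (0 : ZS n (XO n) →L[ℝ] ZS n ℝ)
      (baseZ n) :=
  LipW.hasStrictFDerivAt_nem_of_fderiv_eq_zero (contDiff_phiOut s) _ (fderiv_phiOut_base s)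

theorem nem_phiOut_base (s : ℝ) : LipW.nem (phiOut s) (baseZ n) = 0 := by
  apply LipW.ext
  intro t
  rw [LipW.nem_apply (contDiff_phiOut s), phiOut, phiE_of_zero _ (by rw [baseZ_apply])]
  simp

variable {η s : ℝ}

/-- Half the squared radius. -/
def wb (η : ℝ) : ℝ := (2 * η ^ 4)⁻¹

theorem wb_nonneg (η : ℝ) : 0 ≤ wb η := by unfold wb; positivity

/-- The normalised dual curvature quantity of the perturbed ball. -/
def What (hs : 1 - (n : ℝ) < s) (hη : 0 < η) (hη1 : η ≤ 1) (g : YS n) : YS n :=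
  (chordWeight_in s (wb_nonneg η)).kL
      (LipW.nem (phiIn s) (D0 n + η ^ 2 • D1in n (Aop hη hη1 g))) +
    (chordWeight_out hs (wb_nonneg η)).kL
      (LipW.nem (phiOut s) (baseZ n + outL n (η ^ 2, Aop hη hη1 g, Eop hη hη1 g, Mop hη hη1 g)))

theorem contDiff_What (hs : 1 - (n : ℝ) < s) (hη : 0 < η) (hη1 : η ≤ 1) :
    ContDiff ℝ (⊤ : ℕ∞) (What hs hη hη1) := by
  unfold What
  refine ContDiff.add ?_ ?_
  · refine (ContinuousLinearMap.contDiff _).comp ((LipW.contDiff_nem (contDiff_phiIn s)).comp ?_)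
    exact contDiff_const.add (((D1in n).contDiff.comp (Aop hη hη1).contDiff).const_smul _)
  · refine (ContinuousLinearMap.contDiff _).comp
      ((LipW.contDiff_nem (contDiff_phiOut s)).comp ?_)
    refine contDiff_const.add ((outL n).contDiff.comp (contDiff_const.prodMk ?_))
    exact (Aop hη hη1).contDiff.prodMk ((Eop hη hη1).contDiff.prodMk (Mop hη hη1).contDiff)

theorem kL_in_base (s : ℝ) {b : ℝ} (hb : 0 ≤ b) :
    (chordWeight_in (n := n) s hb).kL (LipW.nem (phiIn s) (D0 n)) = LipW.constL _ 1 := by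
  rw [← kL_in_const (n := n) s hb]
  ext x
  rw [ChordWeight.kL_apply, ChordWeight.kL_apply]
  refine integral_congr_ae (Eventually.of_forall fun ζ => ?_)
  by_cases h : ζ ∈ innR n
  · have h1 := half_le_norm_sub (mem_innR.1 h) x
    have h2 : LipW.nem (phiIn s) (D0 n) (ζ, x) = 1 := by
      rw [LipW.nem_apply (contDiff_phiIn s), phiIn, D0_apply, norm_smul, norm_inv, norm_norm,
        inv_mul_cancel₀ (by linarith), one_pow, powE_of_le _ (by norm_num), Real.one_rpow]
    simp [h2]
  · simp [wIn, h]

end ChordPerturbation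

section WhatBounds

variable {n : ℕ} [hn : Fact (2 ≤ n)] {s : ℝ}

theorem exists_outer_bound (hs : 1 - (n : ℝ) < s) {c : ℝ} (hc : 0 < c) :
    ∃ μ > 0, ∀ (b : ℝ) (hb : 0 ≤ b) (p p' : ℝ × JetS n), ‖p‖ ≤ μ → ‖p'‖ ≤ μ →
      ‖(chordWeight_out hs hb).kL (LipW.nem (phiOut s) (baseZ n + outL n p)) -
        (chordWeight_out hs hb).kL (LipW.nem (phiOut s) (baseZ n + outL n p'))‖ ≤
        c * ‖p - p'‖ := by
  set K := |(4 + 4 * |s|) * CW n s|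
  have hK : 0 ≤ K := abs_nonneg _
  set l := ‖outL n‖
  have hl : 0 ≤ l := norm_nonneg _
  obtain ⟨δ, hδ, H⟩ := exists_strict_bound (hasStrictFDerivAt_nem_phiOut (n := n) s)
    (c := c / (K * l + 1)) (by positivity)
  refine ⟨δ / (l + 1), by positivity, fun b hb p p' hp hp' => ?_⟩
  have hr : ∀ p : ℝ × JetS n, ‖p‖ ≤ δ / (l + 1) → ‖baseZ n + outL n p - baseZ n‖ ≤ δ := by
    intro p hp
    rw [add_sub_cancel_left]
    calc _ ≤ l * (δ / (l + 1)) := ((outL n).le_opNorm p).trans (by gcongr)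
      _ ≤ (l + 1) * (δ / (l + 1)) := by gcongr; linarith
      _ = δ := by field_simp
  have h1 := H _ _ (hr p hp) (hr p' hp')
  rw [add_sub_add_left_eq_sub, ← map_sub, zero_apply, sub_zero] at h1
  rw [← map_sub]
  calc _ ≤ K * (c / (K * l + 1) * (l * ‖p - p'‖)) := by
        refine (ChordWeight.norm_kL_le _ _).trans ?_
        gcongr
        · exact le_abs_self _
        · refine h1.trans ?_
          gcongr
          exact (outL n).le_opNorm _
    _ = K * l / (K * l + 1) * (c * ‖p - p'‖) := by field_simp
    _ ≤ 1 * (c * ‖p - p'‖) := by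
        gcongr
        rw [div_le_one (by positivity)]
        linarith
    _ = _ := one_mul _

theorem exists_inner_bound (s : ℝ) {c : ℝ} (hc : 0 < c) :
    ∃ μ > 0, ∀ (η b : ℝ) (hb : 0 ≤ b) (A A' : LipW (wS n) (Eucl n)), 0 ≤ η → η ≤ μ → ‖A‖ ≤ 1 →
      ‖A'‖ ≤ 1 → ‖(chordWeight_in s hb).kL (LipW.nem (phiIn s) (D0 n + η ^ 2 • D1in n A)) -
        (chordWeight_in s hb).kL (LipW.nem (phiIn s) (D0 n + η ^ 2 • D1in n A'))‖ ≤
        c * ‖A - A'‖ := by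
  obtain ⟨δ, hδ, H⟩ := exists_lipschitz_near
    (((LipW.contDiff_nem (ω := wZ n) (contDiff_phiIn (n := n) s)).contDiffAt).hasStrictFDerivAt'
      (LipW.hasFDerivAt_nem (contDiff_phiIn s) (D0 n)) (by simp))
  set LI := ‖LipW.bilin (ω := wZ n) (ContinuousLinearMap.id ℝ (Eucl n →L[ℝ] ℝ))
    (LipW.nem (fderiv ℝ (phiIn s)) (D0 n))‖ + 1
  have hLI : 0 ≤ LI := by positivity
  set K := (4 + 4 * |s|) * 2
  have hK : 0 ≤ K := by positivity
  set l := ‖D1in n‖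
  have hl : 0 ≤ l := norm_nonneg _
  refine ⟨min 1 (min (δ / (l + 1)) (c / (K * LI * l + 1))), by positivity,
    fun η b hb A A' hη0 hη hA hA' => ?_⟩
  have hη1 : η ≤ 1 := hη.trans (min_le_left _ _)
  have hη2 : η ≤ δ / (l + 1) := hη.trans ((min_le_right _ _).trans (min_le_left _ _))
  have hη3 : η ≤ c / (K * LI * l + 1) := hη.trans ((min_le_right _ _).trans (min_le_right _ _))
  have hsq : η ^ 2 ≤ η := by nlinarith
  have hr : ∀ A : LipW (wS n) (Eucl n), ‖A‖ ≤ 1 → ‖D0 n + η ^ 2 • D1in n A - D0 n‖ ≤ δ := by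
    intro A hA
    rw [add_sub_cancel_left, norm_smul, Real.norm_of_nonneg (by positivity)]
    calc _ ≤ (δ / (l + 1)) * (l * 1) := by
          gcongr
          · exact hsq.trans hη2
          · exact ((D1in n).le_opNorm A).trans (by gcongr)
      _ ≤ (δ / (l + 1)) * (l + 1) := by gcongr; linarith
      _ = δ := by field_simp
  have h1 := H _ _ (hr A hA) (hr A' hA')
  rw [add_sub_add_left_eq_sub, ← smul_sub, ← map_sub, norm_smul,
    Real.norm_of_nonneg (by positivity)] at h1
  rw [← map_sub]
  calc _ ≤ K * (LI * (c / (K * LI * l + 1) * (l * ‖A - A'‖))) := by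
        refine (ChordWeight.norm_kL_le _ _).trans ?_
        gcongr
        refine h1.trans ?_
        gcongr
        · exact hsq.trans hη3
        · exact (D1in n).le_opNorm _
    _ = K * LI * l / (K * LI * l + 1) * (c * ‖A - A'‖) := by field_simp
    _ ≤ 1 * (c * ‖A - A'‖) := by
        gcongr
        rw [div_le_one (by positivity)]
        linarith
    _ = _ := one_mul _

variable {η : ℝ}

/-- Gradient, rescaled gradient and Hessian of the resolvent. -/
def jetL (hη : 0 < η) (hη1 : η ≤ 1) : YS n →L[ℝ] JetS n :=
  (Aop hη hη1).prod ((Eop hη hη1).prod (Mop hη hη1))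

theorem jetL_apply (hη : 0 < η) (hη1 : η ≤ 1) (g : YS n) :
    jetL hη hη1 g = (Aop hη hη1 g, Eop hη hη1 g, Mop hη hη1 g) := rfl

theorem norm_jetL_le (hη : 0 < η) (hη1 : η ≤ 1) (g : YS n) :
    ‖jetL hη hη1 g‖ ≤ CO n * ‖g‖ := by
  rw [jetL_apply, Prod.norm_def, Prod.norm_def]
  exact max_le (norm_Aop_le hη hη1 g) (max_le (norm_Eop_le hη hη1 g) (norm_Mop_le hη hη1 g))

theorem norm_jetL_le_of_near {L : ℝ} {φ : YS n} (hb : ∀ x, |φ x| ≤ L)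
    (hL : ∀ x y, |φ x - φ y| ≤ L * dist x y) (hη : 0 < η) (hη1 : η ≤ 1) (g : YS n) :
    ‖jetL hη hη1 g‖ ≤ CO n * (L * η + ‖g - φ‖) := by
  have h1 : jetL hη hη1 g = jetL hη hη1 φ + jetL hη hη1 (g - φ) := by
    rw [← map_add, add_sub_cancel]
  have h2 : ‖jetL hη hη1 φ‖ ≤ CO n * L * η := by
    rw [jetL_apply, Prod.norm_def, Prod.norm_def]
    exact max_le (norm_Aop_le_of_lipschitz hb hL hη hη1)
      (max_le (norm_Eop_le_of_lipschitz hb hL hη hη1) (norm_Mop_le_of_lipschitz hb hL hη hη1))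
  rw [h1]
  refine (norm_add_le _ _).trans ?_
  have := norm_jetL_le hη hη1 (g - φ)
  linarith

theorem What_eq (hs : 1 - (n : ℝ) < s) (hη : 0 < η) (hη1 : η ≤ 1) (g : YS n) :
    What hs hη hη1 g = (chordWeight_in s (wb_nonneg η)).kL
      (LipW.nem (phiIn s) (D0 n + η ^ 2 • D1in n (jetL hη hη1 g).1)) +
    (chordWeight_out hs (wb_nonneg η)).kL
      (LipW.nem (phiOut s) (baseZ n + outL n (η ^ 2, jetL hη hη1 g))) := rfl

theorem exists_jet_small (L : ℝ) {μ : ℝ} (hμ : 0 < μ) :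
    ∃ δ > 0, ∃ η₀ > 0, ∀ η (hη : 0 < η) (hη1 : η ≤ 1), η ≤ η₀ → ∀ φ : YS n,
      (∀ x, |φ x| ≤ L) → (∀ x y, |φ x - φ y| ≤ L * dist x y) → ∀ g, ‖g - φ‖ ≤ δ →
        ‖jetL hη hη1 g‖ ≤ μ := by
  have hC : 0 < CO n := CO_pos
  refine ⟨μ / (2 * CO n), by positivity, μ / (2 * CO n * (|L| + 1)), by positivity,
    fun η hη hη1 hη0 φ hb hL g hg => (norm_jetL_le_of_near hb hL hη hη1 g).trans ?_⟩
  calc _ ≤ CO n * ((|L| + 1) * (μ / (2 * CO n * (|L| + 1))) + μ / (2 * CO n)) := by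
        gcongr
        exact (le_abs_self L).trans (by linarith)
    _ = μ := by field_simp; ring

theorem exists_What_bound (hs : 1 - (n : ℝ) < s) (L : ℝ) {c : ℝ} (hc : 0 < c) :
    ∃ δ > 0, ∃ η₀ > 0, ∀ η (hη : 0 < η) (hη1 : η ≤ 1), η ≤ η₀ → ∀ φ : YS n,
      (∀ x, |φ x| ≤ L) → (∀ x y, |φ x - φ y| ≤ L * dist x y) → ∀ g g', ‖g - φ‖ ≤ δ →
        ‖g' - φ‖ ≤ δ → ‖What hs hη hη1 g - What hs hη hη1 g'‖ ≤ c * ‖g - g'‖ ∧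
          ‖What hs hη hη1 g - LipW.constL _ 1‖ ≤ c := by
  have hC : 0 < CO n := CO_pos
  set c1 := c / (2 * (CO n + 1))
  have hc1 : 0 < c1 := by positivity
  obtain ⟨μ1, hμ1, H1⟩ := exists_outer_bound hs hc1
  obtain ⟨μ2, hμ2, H2⟩ := exists_inner_bound (n := n) s hc1
  set μ := min 1 μ1
  have hμ : 0 < μ := by positivity
  obtain ⟨δ, hδ, η₀, hη₀, H3⟩ := exists_jet_small (n := n) L hμ
  refine ⟨δ, hδ, min η₀ (min μ μ2), by positivity,
    fun η hη hη1 hη0 φ hb hL g g' hg hg' => ?_⟩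
  have hημ : η ≤ μ := hη0.trans ((min_le_right _ _).trans (min_le_left _ _))
  have hη2 : η ≤ μ2 := hη0.trans ((min_le_right _ _).trans (min_le_right _ _))
  have hJ : ∀ g, ‖g - φ‖ ≤ δ → ‖jetL hη hη1 g‖ ≤ μ :=
    fun g hg => H3 η hη hη1 (hη0.trans (min_le_left _ _)) φ hb hL g hg
  have hfst : ∀ J : JetS n, ‖J.1‖ ≤ ‖J‖ := fun J => norm_fst_le J
  have hJ1 : ∀ g, ‖g - φ‖ ≤ δ → ‖(jetL hη hη1 g).1‖ ≤ 1 :=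
    fun g hg => (hfst _).trans ((hJ g hg).trans (min_le_left _ _))
  have hsq : η ^ 2 ≤ μ := by nlinarith
  have hP : ∀ g, ‖g - φ‖ ≤ δ → ‖((η ^ 2, jetL hη hη1 g) : ℝ × JetS n)‖ ≤ μ := by
    intro g hg
    rw [Prod.norm_def]
    refine max_le ?_ (hJ g hg)
    rwa [Real.norm_of_nonneg (by positivity)]
  have hμμ : μ ≤ μ1 := min_le_right _ _
  constructor
  · have h1 := H1 _ (wb_nonneg η) _ _ ((hP g hg).trans hμμ) ((hP g' hg').trans hμμ)
    have h2 := H2 η _ (wb_nonneg η) _ _ hη.le hη2 (hJ1 g hg) (hJ1 g' hg')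
    have h3 : ‖((η ^ 2, jetL hη hη1 g) : ℝ × JetS n) - (η ^ 2, jetL hη hη1 g')‖ ≤
        CO n * ‖g - g'‖ := by
      rw [Prod.mk_sub_mk, sub_self, Prod.norm_def, ← map_sub]
      refine max_le (by rw [norm_zero]; positivity) (norm_jetL_le hη hη1 _)
    have h4 : ‖(jetL hη hη1 g).1 - (jetL hη hη1 g').1‖ ≤ CO n * ‖g - g'‖ := by
      rw [← Prod.fst_sub, ← map_sub]
      exact (hfst _).trans (norm_jetL_le hη hη1 _)
    rw [What_eq, What_eq, add_sub_add_comm]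
    calc _ ≤ c1 * (CO n * ‖g - g'‖) + c1 * (CO n * ‖g - g'‖) :=
          (norm_add_le _ _).trans (add_le_add (h2.trans (by gcongr)) (h1.trans (by gcongr)))
      _ ≤ c1 * ((CO n + 1) * ‖g - g'‖) + c1 * ((CO n + 1) * ‖g - g'‖) := by
          gcongr <;> linarith
      _ = c * ‖g - g'‖ := by simp only [c1]; field_simp; ring
  · have h1 := H1 _ (wb_nonneg η) _ 0 ((hP g hg).trans hμμ) (by rw [norm_zero]; exact hμ1.le)
    have h2 := H2 η _ (wb_nonneg η) _ 0 hη.le hη2 (hJ1 g hg) (by rw [norm_zero]; exact zero_le_one)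
    rw [map_zero, add_zero, nem_phiOut_base, map_zero, sub_zero, sub_zero] at h1
    rw [map_zero, smul_zero, add_zero, kL_in_base s (wb_nonneg η), sub_zero] at h2
    rw [What_eq, add_sub_right_comm]
    calc _ ≤ c1 * 1 + c1 * 1 :=
          (norm_add_le _ _).trans (add_le_add (h2.trans (by gcongr; exact hJ1 g hg))
            (h1.trans (by gcongr; exact (hP g hg).trans (min_le_left _ _))))
      _ ≤ c1 * (CO n + 1) + c1 * (CO n + 1) := by gcongr <;> linarith
      _ = c := by simp only [c1]; field_simp; ring

end WhatBounds

section MainNonlinearity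

variable {n : ℕ} [hn : Fact (2 ≤ n)]

/-- The pointwise data of the equation: `ε`, `1/f`, `u`, `A`, `M` and the normalised `W`. -/
abbrev YO (n : ℕ) := ℝ × ℝ × ℝ × Eucl n × (Eucl n →L[ℝ] Eucl n) × ℝ

/-- The pointwise defect of the equation. -/
def Phi (p : ℝ) (v : YO n) : ℝ :=
  v.2.1 * Real.exp (-v.2.2.1 - ‖v.2.2.2.1‖ ^ 2 / 2) * powE (1 - p) (1 + v.1 * v.2.2.1) *
    (1 + v.2.2.2.2.1).det * v.2.2.2.2.2 - 1

section Abstract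

variable {E : Type} [NormedAddCommGroup E] [NormedSpace ℝ E]

theorem contDiff_Phi_aux (p : ℝ) (ε ψ u w : E →L[ℝ] ℝ) (A : E →L[ℝ] Eucl n)
    (M : E →L[ℝ] (Eucl n →L[ℝ] Eucl n)) :
    ContDiff ℝ (⊤ : ℕ∞) fun v => ψ v * Real.exp (-u v - ‖A v‖ ^ 2 / 2) *
      powE (1 - p) (1 + ε v * u v) * (1 + M v).det * w v - 1 := by
  have h1 : ContDiff ℝ (⊤ : ℕ∞) fun v => (1 + M v).det :=
    contDiff_det.comp (contDiff_const.add M.contDiff)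
  have h2 : ContDiff ℝ (⊤ : ℕ∞) fun v => powE (1 - p) (1 + ε v * u v) :=
    (contDiff_powE _).comp (contDiff_const.add (ε.contDiff.mul u.contDiff))
  have h3 : ContDiff ℝ (⊤ : ℕ∞) fun v => Real.exp (-u v - ‖A v‖ ^ 2 / 2) :=
    Real.contDiff_exp.comp (u.contDiff.neg.sub ((A.contDiff.norm_sq ℝ).div_const 2))
  exact ((((ψ.contDiff.mul h3).mul h2).mul h1).mul w.contDiff).sub contDiff_const

theorem hasFDerivAt_mul_of_eq_one {f g : E → ℝ} {f' g' : E →L[ℝ] ℝ} {v : E}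
    (hf : HasFDerivAt f f' v) (hg : HasFDerivAt g g' v) (hf1 : f v = 1) (hg1 : g v = 1) :
    HasFDerivAt (fun x => f x * g x) (f' + g') v := by
  refine (hf.mul hg).congr_fderiv ?_
  rw [hf1, hg1, one_smul, one_smul, add_comm]

theorem hasFDerivAt_Phi_aux (p : ℝ) (ε ψ u w : E →L[ℝ] ℝ) (A : E →L[ℝ] Eucl n)
    (M : E →L[ℝ] (Eucl n →L[ℝ] Eucl n)) {v : E} (hε : ε v = 0) (hA : A v = 0) (hM : M v = 0)
    (hw : w v = 1) (hψ : ψ v * Real.exp (-u v) = 1) :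
    HasFDerivAt (fun v => ψ v * Real.exp (-u v - ‖A v‖ ^ 2 / 2) *
      powE (1 - p) (1 + ε v * u v) * (1 + M v).det * w v - 1)
      (Real.exp (-u v) • ψ - u + (deriv (powE (1 - p)) 1 * u v) • ε + (trL n).comp M + w) v := by
  have h1 : HasFDerivAt (fun v => (1 + M v).det) ((trL n).comp M) v := by
    have := hasFDerivAt_det_one_add (n := n)
    rw [← hM] at this
    exact this.comp v M.hasFDerivAt
  have h2 : HasFDerivAt (fun v => powE (1 - p) (1 + ε v * u v))
      ((deriv (powE (1 - p)) 1 * u v) • ε) v := by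
    have h : HasFDerivAt (fun v => 1 + ε v * u v) (u v • ε) v := by
      refine ((ε.hasFDerivAt.mul u.hasFDerivAt).const_add 1).congr_fderiv ?_
      rw [hε, zero_smul, zero_add]
    have h' : HasDerivAt (powE (1 - p)) (deriv (powE (1 - p)) 1) (1 + ε v * u v) := by
      rw [hε, zero_mul, add_zero]
      exact (((contDiff_powE _).differentiable (by simp)) 1).hasDerivAt
    refine (h'.comp_hasFDerivAt v h).congr_fderiv ?_
    rw [smul_smul]
  have h3 : HasFDerivAt (fun v => ψ v * Real.exp (-u v - ‖A v‖ ^ 2 / 2))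
      (Real.exp (-u v) • ψ - u) v := by
    have h : HasFDerivAt (fun v => -u v - ‖A v‖ ^ 2 / 2) (-u) v := by
      have hA2 : HasFDerivAt (fun v => ‖A v‖ ^ 2 / 2) (0 : E →L[ℝ] ℝ) v := by
        have := (A.hasFDerivAt (x := v)).norm_sq.mul_const (2⁻¹ : ℝ)
        simp only [div_eq_mul_inv]
        refine this.congr_fderiv ?_
        rw [hA]; simp
      refine (u.hasFDerivAt.neg.sub hA2).congr_fderiv (sub_zero _)
    refine (ψ.hasFDerivAt.mul h.exp).congr_fderiv ?_
    rw [hA, norm_zero]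
    norm_num
    rw [smul_smul, hψ, one_smul]
    abel
  have e3 : ψ v * Real.exp (-u v - ‖A v‖ ^ 2 / 2) = 1 := by
    rw [hA, norm_zero]; simpa using hψ
  have e2 : powE (1 - p) (1 + ε v * u v) = 1 := by
    rw [hε, zero_mul, add_zero, powE_of_le _ (by norm_num), Real.one_rpow]
  have e1 : (1 + M v).det = 1 := by
    rw [hM, add_zero]; exact LinearMap.det_id
  have h4 := hasFDerivAt_mul_of_eq_one h3 h2 e3 e2
  have h5 := hasFDerivAt_mul_of_eq_one h4 h1 (by rw [e3, e2, one_mul]) e1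
  have h6 := hasFDerivAt_mul_of_eq_one h5 w.hasFDerivAt
    (by rw [e3, e2, e1, one_mul, one_mul]) hw
  exact h6.sub_const 1

end Abstract

section Projections

/-- Projection to `ε`. -/
def pE (n : ℕ) : YO n →L[ℝ] ℝ := ContinuousLinearMap.fst ℝ _ _
/-- Projection to `1/f`. -/
def pP (n : ℕ) : YO n →L[ℝ] ℝ := (ContinuousLinearMap.fst ℝ _ _).comp (ContinuousLinearMap.snd ℝ _ _)
/-- Projection to `u`. -/
def pU (n : ℕ) : YO n →L[ℝ] ℝ := (ContinuousLinearMap.fst ℝ _ _).comp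
  ((ContinuousLinearMap.snd ℝ _ _).comp (ContinuousLinearMap.snd ℝ _ _))
/-- Projection to `A`. -/
def pA (n : ℕ) : YO n →L[ℝ] Eucl n := (ContinuousLinearMap.fst ℝ _ _).comp
  ((ContinuousLinearMap.snd ℝ _ _).comp
    ((ContinuousLinearMap.snd ℝ _ _).comp (ContinuousLinearMap.snd ℝ _ _)))
/-- Projection to `M`. -/
def pM (n : ℕ) : YO n →L[ℝ] (Eucl n →L[ℝ] Eucl n) := (ContinuousLinearMap.fst ℝ _ _).comp
  ((ContinuousLinearMap.snd ℝ _ _).comp ((ContinuousLinearMap.snd ℝ _ _).comp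
    ((ContinuousLinearMap.snd ℝ _ _).comp (ContinuousLinearMap.snd ℝ _ _))))
/-- Projection to the normalised `W`. -/
def pW (n : ℕ) : YO n →L[ℝ] ℝ := (ContinuousLinearMap.snd ℝ _ _).comp
  ((ContinuousLinearMap.snd ℝ _ _).comp ((ContinuousLinearMap.snd ℝ _ _).comp
    ((ContinuousLinearMap.snd ℝ _ _).comp (ContinuousLinearMap.snd ℝ _ _))))

end Projections

theorem contDiff_Phi (p : ℝ) : ContDiff ℝ (⊤ : ℕ∞) (Phi (n := n) p) :=
  contDiff_Phi_aux p (pE n) (pP n) (pU n) (pW n) (pA n) (pM n)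

theorem fderiv_Phi (p : ℝ) {ψ u : ℝ} (h : ψ * Real.exp (-u) = 1) (du : ℝ) (dA : Eucl n)
    (dM : Eucl n →L[ℝ] Eucl n) (dw : ℝ) :
    fderiv ℝ (Phi p) ((0, ψ, u, 0, 0, 1) : YO n) (0, 0, du, dA, dM, dw) =
      -du + trL n dM + dw := by
  have h1 := hasFDerivAt_Phi_aux p (pE n) (pP n) (pU n) (pW n) (pA n) (pM n)
    (v := (0, ψ, u, 0, 0, 1)) rfl rfl rfl rfl h
  have h2 : HasFDerivAt (Phi p) _ ((0, ψ, u, 0, 0, 1) : YO n) := h1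
  rw [h2.fderiv]
  simp only [add_apply, sub_apply, smul_apply, ContinuousLinearMap.comp_apply]
  change Real.exp (-u) • (0 : ℝ) - du + (deriv (powE (1 - p)) 1 * u) • (0 : ℝ) + trL n dM + dw = _
  rw [smul_zero, smul_zero]
  ring

theorem Phi_base (p : ℝ) {ψ u : ℝ} (h : ψ * Real.exp (-u) = 1) :
    Phi p ((0, ψ, u, 0, 0, 1) : YO n) = 0 := by
  have hd : (1 : Eucl n →L[ℝ] Eucl n).det = 1 := LinearMap.det_id
  simp only [Phi, norm_zero, zero_mul, add_zero, hd, mul_one]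
  rw [powE_of_le _ (by norm_num), Real.one_rpow]
  norm_num
  rw [h, sub_self]

end MainNonlinearity

section Contraction

variable {n : ℕ} [hn : Fact (2 ≤ n)] {η s : ℝ}

/-- The data of the equation as functions on the sphere. -/
abbrev SO (n : ℕ) [Fact (2 ≤ n)] := ℝ × YS n × YS n × LipW (wS n) (Eucl n) ×
  LipW (wS n) (Eucl n →L[ℝ] Eucl n) × YS n

section Six

variable {X : Type} [NormedAddCommGroup X] [NormedSpace ℝ X]

/-- Assembling the data of the equation. -/
def sixL (ε : X →L[ℝ] ℝ) (ψ u w : X →L[ℝ] YS n) (A : X →L[ℝ] LipW (wS n) (Eucl n))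
    (M : X →L[ℝ] LipW (wS n) (Eucl n →L[ℝ] Eucl n)) : X →L[ℝ] LipW (wS n) (YO n) :=
  LipW.pairL ((LipW.constL (wS n)).comp ε)
    (LipW.pairL ψ (LipW.pairL u (LipW.pairL A (LipW.pairL M w))))

theorem sixL_apply (ε : X →L[ℝ] ℝ) (ψ u w : X →L[ℝ] YS n) (A : X →L[ℝ] LipW (wS n) (Eucl n))
    (M : X →L[ℝ] LipW (wS n) (Eucl n →L[ℝ] Eucl n)) (a : X) (x : Sph n) :
    sixL ε ψ u w A M a x = (ε a, ψ a x, u a x, A a x, M a x, w a x) := by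
  simp only [sixL, LipW.pairL_apply]
  rfl

end Six

section SixProj

open ContinuousLinearMap in
/-- Assembling the data of the equation. -/
def six (n : ℕ) [Fact (2 ≤ n)] : SO n →L[ℝ] LipW (wS n) (YO n) :=
  sixL (fst ℝ _ _) ((fst ℝ _ _).comp (snd ℝ _ _))
    ((fst ℝ _ _).comp ((snd ℝ _ _).comp (snd ℝ _ _)))
    ((snd ℝ _ _).comp ((snd ℝ _ _).comp ((snd ℝ _ _).comp ((snd ℝ _ _).comp (snd ℝ _ _)))))
    ((fst ℝ _ _).comp ((snd ℝ _ _).comp ((snd ℝ _ _).comp (snd ℝ _ _))))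
    ((fst ℝ _ _).comp ((snd ℝ _ _).comp ((snd ℝ _ _).comp ((snd ℝ _ _).comp (snd ℝ _ _)))))

theorem six_apply (a : SO n) (x : Sph n) :
    six n a x = (a.1, a.2.1 x, a.2.2.1 x, a.2.2.2.1 x, a.2.2.2.2.1 x, a.2.2.2.2.2 x) := by
  rw [six, sixL_apply]; rfl

end SixProj

/-- The defect of the equation as a function on the sphere. -/
def defect (p : ℝ) (a : SO n) : YS n := LipW.nem (Phi p) (six n a)

theorem defect_apply (p : ℝ) (a : SO n) (x : Sph n) :
    defect p a x = Phi p (a.1, a.2.1 x, a.2.2.1 x, a.2.2.2.1 x, a.2.2.2.2.1 x, a.2.2.2.2.2 x) := by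
  rw [defect, LipW.nem_apply (contDiff_Phi p), six_apply]

theorem contDiff_defect (p : ℝ) : ContDiff ℝ (⊤ : ℕ∞) (defect (n := n) p) :=
  (LipW.contDiff_nem (contDiff_Phi p)).comp (six n).contDiff

theorem LipW.hasStrictFDerivAt_nem {T : Type} [MeasurableSpace T] {ω : T → T → ℝ} {V V' : Type}
    [NormedAddCommGroup V] [NormedSpace ℝ V] [FiniteDimensional ℝ V] [NormedAddCommGroup V']
    [NormedSpace ℝ V'] {Φ : V → V'}
    (h : ContDiff ℝ (⊤ : ℕ∞) Φ) (F : LipW ω V) :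
    ∃ L : LipW ω V →L[ℝ] LipW ω V', HasStrictFDerivAt (LipW.nem (ω := ω) Φ) L F ∧
      ∀ G t, L G t = fderiv ℝ Φ (F t) (G t) := by
  refine ⟨_, (LipW.contDiff_nem h).contDiffAt.hasStrictFDerivAt'
    (LipW.hasFDerivAt_nem h F) (by simp), fun G t => ?_⟩
  rw [LipW.bilin_apply, LipW.nem_apply (contDiff_infty_iff_fderiv.1 h).2]
  rfl

/-- The data of the unperturbed problem. -/
def baseS (ψ φ : YS n) : SO n := (0, ψ, φ, 0, 0, LipW.constL (wS n) 1)

theorem defect_baseS (p : ℝ) {ψ φ : YS n} (h : ∀ x, ψ x * Real.exp (-φ x) = 1) :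
    defect p (baseS ψ φ) = 0 := by
  apply LipW.ext
  intro x
  rw [defect_apply]
  exact Phi_base p (h x)

theorem exists_hasStrictFDerivAt_defect (p : ℝ) {ψ φ : YS n}
    (h : ∀ x, ψ x * Real.exp (-φ x) = 1) :
    ∃ L : SO n →L[ℝ] YS n, HasStrictFDerivAt (defect p) L (baseS ψ φ) ∧
      ∀ (u : YS n) (A : LipW (wS n) (Eucl n)) (M : LipW (wS n) (Eucl n →L[ℝ] Eucl n)) (w : YS n),
        L (0, 0, u, A, M, w) = -u + LipW.post (trL n) M + w := by
  obtain ⟨L, hL, hL'⟩ := LipW.hasStrictFDerivAt_nem (contDiff_Phi p) (six n (baseS ψ φ))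
  refine ⟨L.comp (six n), hL.comp _ (six n).hasStrictFDerivAt, fun u A M w => ?_⟩
  apply LipW.ext
  intro x
  rw [ContinuousLinearMap.comp_apply, hL', six_apply, six_apply]
  exact fderiv_Phi p (h x) _ _ _ _

/-- The data generated by the unknown. -/
def dataS (hs : 1 - (n : ℝ) < s) (hη : 0 < η) (hη1 : η ≤ 1) (ψ g : YS n) : SO n :=
  (η ^ 4, ψ, Rop hη g, (jetL hη hη1 g).1, (jetL hη hη1 g).2.2, What hs hη hη1 g)

/-- The fixed-point map. -/
def Tmap (p : ℝ) (hs : 1 - (n : ℝ) < s) (hη : 0 < η) (hη1 : η ≤ 1) (ψ g : YS n) : YS n :=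
  g + defect p (dataS hs hη hη1 ψ g)

theorem contDiff_Tmap (p : ℝ) (hs : 1 - (n : ℝ) < s) (hη : 0 < η) (hη1 : η ≤ 1) :
    ContDiff ℝ (⊤ : ℕ∞) fun a : YS n × YS n => Tmap p hs hη hη1 a.1 a.2 := by
  have h1 : ContDiff ℝ (⊤ : ℕ∞) fun a : YS n × YS n => (jetL hη hη1 a.2).1 :=
    contDiff_fst.comp ((jetL hη hη1).contDiff.comp contDiff_snd)
  have h2 : ContDiff ℝ (⊤ : ℕ∞) fun a : YS n × YS n => (jetL hη hη1 a.2).2.2 :=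
    contDiff_snd.comp (contDiff_snd.comp ((jetL hη hη1).contDiff.comp contDiff_snd))
  refine contDiff_snd.add ((contDiff_defect p).comp ?_)
  exact contDiff_const.prodMk (contDiff_fst.prodMk (((Rop hη).contDiff.comp contDiff_snd).prodMk
    (h1.prodMk (h2.prodMk ((contDiff_What hs hη hη1).comp contDiff_snd)))))

theorem sub_Rop_add_trL (hη : 0 < η) (hη1 : η ≤ 1) (g : YS n) :
    g - Rop hη g + LipW.post (trL n) (jetL hη hη1 g).2.2 =
      (η ^ 4 * ((n : ℝ) - 1)) • Rop hη g := by
  apply LipW.ext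
  intro x
  have := Rop_sub_trL_Mop hη hη1 g x
  rw [LipW.coe_add, LipW.coe_sub, LipW.post_apply, LipW.coe_smul, jetL_apply, smul_eq_mul]
  dsimp only
  linarith

theorem one_le_n : (0 : ℝ) ≤ (n : ℝ) - 1 := by
  have : (2 : ℝ) ≤ n := by exact_mod_cast hn.out
  linarith

theorem norm_SO_le (a : SO n) {r : ℝ} (h1 : |a.1| ≤ r) (h2 : ‖a.2.1‖ ≤ r) (h3 : ‖a.2.2.1‖ ≤ r)
    (h4 : ‖a.2.2.2.1‖ ≤ r) (h5 : ‖a.2.2.2.2.1‖ ≤ r) (h6 : ‖a.2.2.2.2.2‖ ≤ r) : ‖a‖ ≤ r :=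
  max_le h1 (max_le h2 (max_le h3 (max_le h4 (max_le h5 h6))))

theorem norm_dataS_sub_le (hs : 1 - (n : ℝ) < s) (hη : 0 < η) (hη1 : η ≤ 1) (ψ g g' : YS n)
    (hW : ‖What hs hη hη1 g - What hs hη hη1 g'‖ ≤ ‖g - g'‖) :
    ‖dataS hs hη hη1 ψ g - dataS hs hη hη1 ψ g'‖ ≤ (CO n + 1) * ‖g - g'‖ := by
  have hC : 0 < CO n := CO_pos
  have hJ : ‖jetL hη hη1 g - jetL hη hη1 g'‖ ≤ (CO n + 1) * ‖g - g'‖ := by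
    rw [← map_sub]
    refine (norm_jetL_le hη hη1 _).trans ?_
    gcongr; linarith
  have h0 : 0 ≤ (CO n + 1) * ‖g - g'‖ := by positivity
  have hR : ‖Rop hη g - Rop hη g'‖ ≤ (CO n + 1) * ‖g - g'‖ := by
    rw [← map_sub]
    refine (norm_Rop_le hη _).trans ?_
    gcongr; linarith
  have hw : ‖What hs hη hη1 g - What hs hη hη1 g'‖ ≤ (CO n + 1) * ‖g - g'‖ := by
    refine hW.trans ?_
    have := mul_nonneg hC.le (norm_nonneg (g - g'))
    linarith
  refine norm_SO_le _ ?_ ?_ hR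
    ((norm_fst_le (jetL hη hη1 g - jetL hη hη1 g')).trans hJ)
    ((norm_snd_le (jetL hη hη1 g - jetL hη hη1 g').2).trans
      ((norm_snd_le (jetL hη hη1 g - jetL hη hη1 g')).trans hJ)) hw
  · simp only [dataS, Prod.fst_sub, sub_self, abs_zero]; exact h0
  · simp only [dataS, Prod.fst_sub, Prod.snd_sub, sub_self, norm_zero]; exact h0

theorem norm_dataS_sub_baseS_le (hs : 1 - (n : ℝ) < s) (hη : 0 < η) (hη1 : η ≤ 1)
    (ψ' ψ φ g : YS n) {r : ℝ} (h1 : η ^ 4 ≤ r) (h2 : ‖ψ' - ψ‖ ≤ r) (h3 : ‖Rop hη g - φ‖ ≤ r)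
    (h4 : ‖jetL hη hη1 g‖ ≤ r) (h5 : ‖What hs hη hη1 g - LipW.constL (wS n) 1‖ ≤ r) :
    ‖dataS hs hη hη1 ψ' g - baseS ψ φ‖ ≤ r := by
  have e1 : |η ^ 4 - 0| ≤ r := by rw [sub_zero, abs_of_nonneg (by positivity)]; exact h1
  have e4 : ‖(jetL hη hη1 g).1 - 0‖ ≤ r := by
    rw [sub_zero]; exact (norm_fst_le (jetL hη hη1 g)).trans h4
  have e5 : ‖(jetL hη hη1 g).2.2 - 0‖ ≤ r := by
    rw [sub_zero]
    exact (norm_snd_le (jetL hη hη1 g).2).trans ((norm_snd_le (jetL hη hη1 g)).trans h4)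
  exact norm_SO_le _ e1 h2 h3 e4 e5 h5

theorem Tmap_sub_eq (p : ℝ) (hs : 1 - (n : ℝ) < s) (hη : 0 < η) (hη1 : η ≤ 1) (ψ g g' : YS n)
    {L : SO n →L[ℝ] YS n} (hL : ∀ (u : YS n) (A : LipW (wS n) (Eucl n))
      (M : LipW (wS n) (Eucl n →L[ℝ] Eucl n)) (w : YS n),
        L (0, 0, u, A, M, w) = -u + LipW.post (trL n) M + w) :
    Tmap p hs hη hη1 ψ g - Tmap p hs hη hη1 ψ g' =
      (η ^ 4 * ((n : ℝ) - 1)) • Rop hη (g - g') + (What hs hη hη1 g - What hs hη hη1 g') +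
      (defect p (dataS hs hη hη1 ψ g) - defect p (dataS hs hη hη1 ψ g') -
        L (dataS hs hη hη1 ψ g - dataS hs hη hη1 ψ g')) := by
  have h1 : dataS hs hη hη1 ψ g - dataS hs hη hη1 ψ g' = (0, 0, Rop hη (g - g'),
      (jetL hη hη1 (g - g')).1, (jetL hη hη1 (g - g')).2.2,
      What hs hη hη1 g - What hs hη hη1 g') := by
    simp only [dataS, map_sub, Prod.mk_sub_mk, Prod.fst_sub, Prod.snd_sub, sub_self]
  rw [h1, hL, ← sub_Rop_add_trL hη hη1, Tmap, Tmap]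
  abel

theorem norm_Rop_sub_le (hη : 0 < η) (hη1 : η ≤ 1) (g : YS n) :
    ‖Rop hη g - g‖ ≤ ‖trL n‖ * ‖jetL hη hη1 g‖ + η * (((n : ℝ) - 1) * (CO n * ‖g‖)) := by
  have h := sub_Rop_add_trL hη hη1 g
  have e : Rop hη g - g = LipW.post (trL n) (jetL hη hη1 g).2.2 -
      (η ^ 4 * ((n : ℝ) - 1)) • Rop hη g := by rw [← h]; abel
  have h1 : (0 : ℝ) ≤ (n : ℝ) - 1 := one_le_n
  have h4 : η ^ 4 ≤ η := by
    calc η ^ 4 ≤ η ^ 1 := pow_le_pow_of_le_one hη.le hη1 (by norm_num)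
      _ = η := pow_one _
  rw [e]
  refine (norm_sub_le _ _).trans (add_le_add ?_ ?_)
  · refine (LipW.norm_post_le _ _).trans ?_
    gcongr
    exact (norm_snd_le _).trans (norm_snd_le _)
  · rw [norm_smul, Real.norm_of_nonneg (by positivity), mul_assoc]
    gcongr
    exact norm_Rop_le hη g

set_option maxHeartbeats 1000000 in
theorem exists_Tmap_contraction (p : ℝ) (hs : 1 - (n : ℝ) < s) {L : ℝ} {ψ φ : YS n}
    (hψ : ∀ x, ψ x * Real.exp (-φ x) = 1) (hb : ∀ x, |φ x| ≤ L)
    (hL : ∀ x y, |φ x - φ y| ≤ L * dist x y) {μ : ℝ} (hμ : 0 < μ) :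
    ∃ δ > 0, ∃ η, ∃ hη : 0 < η, ∃ hη1 : η ≤ 1, η ≤ μ ∧
      (∀ g, ‖g - φ‖ ≤ δ → ‖jetL hη hη1 g‖ ≤ μ ∧ ‖Rop hη g - φ‖ ≤ μ ∧
        ‖What hs hη hη1 g - LipW.constL (wS n) 1‖ ≤ μ) ∧
      (∀ ψ', ‖ψ' - ψ‖ ≤ δ → ∀ g g', ‖g - φ‖ ≤ δ → ‖g' - φ‖ ≤ δ →
        ‖Tmap p hs hη hη1 ψ' g - Tmap p hs hη hη1 ψ' g'‖ ≤ 1 / 2 * ‖g - g'‖) ∧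
      ‖Tmap p hs hη hη1 ψ φ - φ‖ ≤ δ / 8 := by
  have hC : 0 < CO n := CO_pos
  have hn1 : (0 : ℝ) ≤ (n : ℝ) - 1 := one_le_n
  obtain ⟨D, hD, hD'⟩ := exists_hasStrictFDerivAt_defect p hψ
  obtain ⟨δ1, hδ1, H1⟩ := exists_strict_bound hD (c := 1 / (6 * (CO n + 1))) (by positivity)
  obtain ⟨δ2, hδ2, H2⟩ := exists_lipschitz_near hD
  set K := ‖D‖ + 1
  have hK : 0 < K := by positivity
  -- smallness of the data on a ball
  set ν := min (1 / 6) (min μ (min δ1 δ2))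
  have hν : 0 < ν := by positivity
  have hν6 : ν ≤ 1 / 6 := min_le_left _ _
  have hνμ : ν ≤ μ := (min_le_right _ _).trans (min_le_left _ _)
  have hν1 : ν ≤ δ1 := (min_le_right _ _).trans ((min_le_right _ _).trans (min_le_left _ _))
  obtain ⟨δ3, hδ3, η3, hη3, H3⟩ := exists_What_bound (n := n) hs L hν
  set t := ‖trL n‖
  have ht : 0 ≤ t := norm_nonneg (trL n)
  set m := ((n : ℝ) - 1) * (CO n * ‖φ‖)
  have hm : 0 ≤ m := by positivity
  obtain ⟨δ4, hδ4, η4, hη4, H4⟩ := exists_jet_small (n := n) L (μ := ν / (4 * (t + 1)))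
    (by positivity)
  set δ := min ν (min δ3 (min δ4 (ν / (4 * (CO n + 1)))))
  have hδ : 0 < δ := by positivity
  have hδν : δ ≤ ν := min_le_left _ _
  have hδ3' : δ ≤ δ3 := (min_le_right _ _).trans (min_le_left _ _)
  have hδ4' : δ ≤ δ4 := (min_le_right _ _).trans ((min_le_right _ _).trans (min_le_left _ _))
  have hδC : δ ≤ ν / (4 * (CO n + 1)) :=
    (min_le_right _ _).trans ((min_le_right _ _).trans (min_le_right _ _))
  -- smallness of the initial defect
  set κ := min ν (min δ2 (δ / (8 * K)))
  have hκ : 0 < κ := by positivity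
  obtain ⟨δ5, hδ5, η5, hη5, H5⟩ := exists_What_bound (n := n) hs L hκ
  obtain ⟨δ6, hδ6, η6, hη6, H6⟩ := exists_jet_small (n := n) L (μ := κ / (4 * (t + 1)))
    (by positivity)
  set η := min 1 (min (κ / (4 * (m + 1))) (min (1 / (6 * (((n : ℝ) - 1) * CO n + 1)))
    (min κ (min η3 (min η4 (min η5 η6))))))
  have hη : 0 < η := by positivity
  have hη1 : η ≤ 1 := min_le_left _ _
  have q1 : η ≤ κ / (4 * (m + 1)) := (min_le_right _ _).trans (min_le_left _ _)
  have q2 : η ≤ 1 / (6 * (((n : ℝ) - 1) * CO n + 1)) :=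
    (min_le_right _ _).trans ((min_le_right _ _).trans (min_le_left _ _))
  have q3' : η ≤ min κ (min η3 (min η4 (min η5 η6))) :=
    (min_le_right _ _).trans ((min_le_right _ _).trans (min_le_right _ _))
  have q3 : η ≤ κ := q3'.trans (min_le_left _ _)
  have q4 : η ≤ η3 := q3'.trans ((min_le_right _ _).trans (min_le_left _ _))
  have q5' : η ≤ min η4 (min η5 η6) := q3'.trans ((min_le_right _ _).trans (min_le_right _ _))
  have q5 : η ≤ η4 := q5'.trans (min_le_left _ _)
  have q6 : η ≤ η5 := q5'.trans ((min_le_right _ _).trans (min_le_left _ _))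
  have q7 : η ≤ η6 := q5'.trans ((min_le_right _ _).trans (min_le_right _ _))
  have hκν : κ ≤ ν := min_le_left _ _
  have hη4le : η ^ 4 ≤ η := by
    calc η ^ 4 ≤ η ^ 1 := pow_le_pow_of_le_one hη.le hη1 (by norm_num)
      _ = η := pow_one _
  have hRφ : ‖Rop hη φ - φ‖ ≤ κ / 2 := by
    have h6 := H6 η hη hη1 q7 φ hb hL φ (by rw [sub_self, norm_zero]; exact hδ6.le)
    calc _ ≤ t * (κ / (4 * (t + 1))) + κ / (4 * (m + 1)) * m :=
          (norm_Rop_sub_le hη hη1 φ).trans (by gcongr)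
      _ = t / (t + 1) * (κ / 4) + m / (m + 1) * (κ / 4) := by field_simp
      _ ≤ 1 * (κ / 4) + 1 * (κ / 4) := by
          gcongr <;> rw [div_le_one (by positivity)] <;> linarith
      _ = κ / 2 := by ring
  have hR : ∀ g, ‖g - φ‖ ≤ δ → ‖Rop hη g - φ‖ ≤ ν := by
    intro g hg
    have e : Rop hη g - φ = Rop hη (g - φ) + (Rop hη φ - φ) := by rw [map_sub]; abel
    rw [e]
    calc _ ≤ CO n * (ν / (4 * (CO n + 1))) + κ / 2 :=
          (norm_add_le _ _).trans (add_le_add ((norm_Rop_le hη _).trans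
            (by gcongr; exact hg.trans hδC)) hRφ)
      _ ≤ (CO n + 1) * (ν / (4 * (CO n + 1))) + ν / 2 := by gcongr; linarith
      _ ≤ ν := by
          have : (CO n + 1) * (ν / (4 * (CO n + 1))) = ν / 4 := by field_simp
          linarith
  have hsmall : ∀ r : ℝ, 0 < r → r / (4 * (t + 1)) ≤ r := fun r hr => by
    rw [div_le_iff₀ (by positivity)]; nlinarith
  have hJ : ∀ g, ‖g - φ‖ ≤ δ → ‖jetL hη hη1 g‖ ≤ ν := fun g hg =>
    (H4 η hη hη1 q5 φ hb hL g (hg.trans hδ4')).trans (hsmall ν hν)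
  have hW : ∀ g, ‖g - φ‖ ≤ δ → ‖What hs hη hη1 g - LipW.constL (wS n) 1‖ ≤ ν := fun g hg =>
    (H3 η hη hη1 q4 φ hb hL g g (hg.trans hδ3') (hg.trans hδ3')).2
  refine ⟨δ, hδ, η, hη, hη1, q3.trans (hκν.trans hνμ), fun g hg =>
    ⟨(hJ g hg).trans hνμ, (hR g hg).trans hνμ, (hW g hg).trans hνμ⟩, ?_, ?_⟩
  · intro ψ' hψ' g g' hg hg'
    have hdat : ∀ g, ‖g - φ‖ ≤ δ → ‖dataS hs hη hη1 ψ' g - baseS ψ φ‖ ≤ δ1 := fun g hg =>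
      (norm_dataS_sub_baseS_le hs hη hη1 ψ' ψ φ g (hη4le.trans (q3.trans hκν)) (hψ'.trans hδν)
        (hR g hg) (hJ g hg) (hW g hg)).trans hν1
    have h1 := H1 _ _ (hdat g hg) (hdat g' hg')
    have h2 := (H3 η hη hη1 q4 φ hb hL g g' (hg.trans hδ3') (hg'.trans hδ3')).1
    have h3 := norm_dataS_sub_le hs hη hη1 ψ' g g'
      (h2.trans (mul_le_of_le_one_left (norm_nonneg _) (by linarith)))
    have h4 : ‖(η ^ 4 * ((n : ℝ) - 1)) • Rop hη (g - g')‖ ≤ 1 / 6 * ‖g - g'‖ := by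
      rw [norm_smul, Real.norm_of_nonneg (by positivity)]
      calc _ ≤ 1 / (6 * (((n : ℝ) - 1) * CO n + 1)) * ((n : ℝ) - 1) * (CO n * ‖g - g'‖) := by
            gcongr
            · exact hη4le.trans q2
            · exact norm_Rop_le hη _
        _ = (((n : ℝ) - 1) * CO n) / (((n : ℝ) - 1) * CO n + 1) * (1 / 6 * ‖g - g'‖) := by
            field_simp
        _ ≤ 1 * (1 / 6 * ‖g - g'‖) := by
            gcongr; rw [div_le_one (by positivity)]; linarith
        _ = _ := one_mul _
    rw [Tmap_sub_eq p hs hη hη1 ψ' g g' hD']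
    calc _ ≤ 1 / 6 * ‖g - g'‖ + 1 / 6 * ‖g - g'‖ +
          1 / (6 * (CO n + 1)) * ((CO n + 1) * ‖g - g'‖) := by
          refine (norm_add₃_le).trans (add_le_add (add_le_add h4 (h2.trans ?_)) (h1.trans ?_)) <;>
            gcongr
      _ = 1 / 2 * ‖g - g'‖ := by field_simp; ring
  · have h0 : ‖φ - φ‖ ≤ δ5 := by rw [sub_self, norm_zero]; exact hδ5.le
    have h6 := (H6 η hη hη1 q7 φ hb hL φ (by rw [sub_self, norm_zero]; exact hδ6.le)).trans
      (hsmall κ hκ)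
    have hdat : ‖dataS hs hη hη1 ψ φ - baseS ψ φ‖ ≤ κ :=
      norm_dataS_sub_baseS_le hs hη hη1 ψ ψ φ φ (hη4le.trans q3)
        (by rw [sub_self, norm_zero]; exact hκ.le) (hRφ.trans (by linarith)) h6
        (H5 η hη hη1 q6 φ hb hL φ φ h0 h0).2
    have h7 := H2 _ (baseS ψ φ) (hdat.trans ((min_le_right _ _).trans (min_le_left _ _)))
      (by rw [sub_self, norm_zero]; exact hδ2.le)
    rw [defect_baseS p hψ, sub_zero] at h7
    rw [Tmap, add_sub_cancel_left]
    calc _ ≤ K * (δ / (8 * K)) := h7.trans (by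
          gcongr; exact hdat.trans ((min_le_right _ _).trans (min_le_right _ _)))
      _ = δ / 8 := by field_simp

theorem exists_fixedPoint_of_contraction {Y : Type} [NormedAddCommGroup Y] [CompleteSpace Y]
    {T : Y → Y} {φ : Y} {δ : ℝ} (hδ : 0 < δ)
    (hT : ∀ g g', ‖g - φ‖ ≤ δ → ‖g' - φ‖ ≤ δ → ‖T g - T g'‖ ≤ 1 / 2 * ‖g - g'‖)
    (h0 : ‖T φ - φ‖ ≤ δ / 8) : ∃ g, T g = g ∧ ‖g - φ‖ ≤ δ / 4 := by
  have hφ : ‖φ - φ‖ ≤ δ := by rw [sub_self, norm_zero]; exact hδ.le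
  have hmem : ∀ g, g ∈ Metric.closedBall φ δ ↔ ‖g - φ‖ ≤ δ := fun g => by
    rw [mem_closedBall_iff_norm]
  have hmaps : Set.MapsTo T (Metric.closedBall φ δ) (Metric.closedBall φ δ) := fun g hg => by
    rw [hmem] at hg ⊢
    have h1 := hT g φ hg hφ
    have h2 := norm_sub_le_norm_sub_add_norm_sub (T g) (T φ) φ
    linarith
  have hc : ContractingWith (1 / 2) (hmaps.restrict T _ _) := by
    refine ⟨by rw [← NNReal.coe_lt_coe]; norm_num, LipschitzWith.of_dist_le_mul fun a b => ?_⟩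
    have := hT a b ((hmem _).1 a.2) ((hmem _).1 b.2)
    rw [Subtype.dist_eq, Subtype.dist_eq, dist_eq_norm, dist_eq_norm]
    simpa using this
  obtain ⟨g, hg, hfix, -⟩ := ContractingWith.exists_fixedPoint' (f := T)
    Metric.isClosed_closedBall.isComplete hmaps hc (Metric.mem_closedBall_self hδ.le)
    (edist_ne_top _ _)
  refine ⟨g, hfix, ?_⟩
  have h1 := hT g φ ((hmem _).1 hg) hφ
  have h2 := norm_sub_le_norm_sub_add_norm_sub (T g) (T φ) φ
  have h3 : T g = g := hfix
  rw [h3] at h1 h2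
  linarith

end Contraction

section Equivariance

variable {n : ℕ} [hn : Fact (2 ≤ n)] {η s : ℝ}

theorem wS_sphMap (A : Eucl n ≃ₗᵢ[ℝ] Eucl n) (x y : Sph n) :
    wS n (sphMap A x) (sphMap A y) = wS n x y := by
  rw [wS, wS, Subtype.dist_eq, Subtype.dist_eq, coe_sphMap, coe_sphMap, A.dist_map]

/-- Precomposition with a rotation. -/
def pre (A : Eucl n ≃ₗᵢ[ℝ] Eucl n) : YS n →L[ℝ] YS n :=
  LipW.mkCLM (fun g x => g (sphMap A x)) 1 (fun _ _ _ => rfl) (fun _ _ _ => rfl)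
    (fun g => g.stronglyMeasurable.comp_measurable (continuous_sphMap A).measurable)
    (fun g x => by rw [one_mul]; exact g.norm_apply_le _)
    (fun g x y h => by
      rw [one_mul, ← wS_sphMap A]
      exact g.norm_sub_le (by rwa [wS_sphMap A]))

theorem pre_apply (A : Eucl n ≃ₗᵢ[ℝ] Eucl n) (g : YS n) (x : Sph n) :
    pre A g x = g (sphMap A x) := rfl

theorem norm_pre_le (A : Eucl n ≃ₗᵢ[ℝ] Eucl n) (g : YS n) : ‖pre A g‖ ≤ ‖g‖ := by
  refine (LipW.norm_mkCLM_apply_le _ _ _ _ _ _ _ g).trans (le_of_eq ?_)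
  rw [abs_one, one_mul]

theorem kerZ_map (A : Eucl n ≃ₗᵢ[ℝ] Eucl n) (N : ℕ) (x y : Eucl n) :
    kerZ N (A x) (A y) = kerZ N x y := by
  unfold kerZ
  rw [bb, bb, A.inner_map_map]

theorem Rop_pre (hη : 0 < η) (A : Eucl n ≃ₗᵢ[ℝ] Eucl n) (g : YS n) (x : Sph n) :
    Rop hη (pre A g) x = Rop hη g (sphMap A x) := by
  change ∑' N, (1 * cf n η N) • kop (fun N (x y : Sph n) => kerZ N (x : Eucl n) y) N _ x =
    ∑' N, (1 * cf n η N) • kop (fun N (x y : Sph n) => kerZ N (x : Eucl n) y) N _ (sphMap A x)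
  congr 1; ext1 N
  congr 1
  rw [kop, kop]
  congr 1
  refine Eq.trans ?_ (integral_sphMap A _)
  simp only [coe_sphMap, kerZ_map]
  rfl

theorem sx_map (A : Eucl n ≃ₗᵢ[ℝ] Eucl n) {x : Eucl n} (hx : x ≠ 0) :
    sx (A x) = sphMap A (sx x) := by
  have h : A x ≠ 0 := by simpa using hx
  ext1
  rw [coe_sphMap, coe_sx hx, coe_sx h, nx, nx, A.norm_map, map_smul]

theorem Eop_pre (hη : 0 < η) (hη1 : η ≤ 1) (A : Eucl n ≃ₗᵢ[ℝ] Eucl n) (g : YS n) (x : Sph n) :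
    Eop hη hη1 (pre A g) x = A.symm (Eop hη hη1 g (sphMap A x)) := by
  have hx : (x : Eucl n) ≠ 0 := Sph.ne_zero x
  have hAx : A (x : Eucl n) ≠ 0 := by simpa using hx
  have h1 := hasFDerivAt_Rop hη hη1 (pre A g) hx
  have h2 := (hasFDerivAt_Rop hη hη1 g hAx).comp (x : Eucl n)
    (A.toContinuousLinearEquiv.hasFDerivAt)
  have h3 : (fun y : Eucl n => η ^ 4 * (‖y‖ * Rop hη (pre A g) (sx y))) =ᶠ[𝓝 (x : Eucl n)]
      ((fun y : Eucl n => η ^ 4 * (‖y‖ * Rop hη g (sx y))) ∘ A.toContinuousLinearEquiv) := by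
    filter_upwards [isOpen_ne.mem_nhds hx] with y hy
    change _ = η ^ 4 * (‖A y‖ * Rop hη g (sx (A y)))
    rw [Rop_pre, sx_map A hy, A.norm_map]
  have h4 := h1.unique (h2.congr_of_eventuallyEq h3)
  refine ext_inner_right ℝ fun v => ?_
  have h5 := congrArg (fun L => L v) h4
  simp only [innerSL_apply_apply, ContinuousLinearMap.comp_apply, sx_coe, sx_map A hx] at h5
  rw [h5]
  conv_rhs => rw [← A.inner_map_map, A.apply_symm_apply]
  rfl

theorem Aop_pre (hη : 0 < η) (hη1 : η ≤ 1) (A : Eucl n ≃ₗᵢ[ℝ] Eucl n) (g : YS n) (x : Sph n) :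
    Aop hη hη1 (pre A g) x = A.symm (Aop hη hη1 g (sphMap A x)) := by
  have h := Eop_pre hη hη1 A g x
  rw [← Aop_apply, ← Aop_apply, map_smul] at h
  exact smul_right_injective _ (pow_pos hη 2).ne' h

theorem Mop_pre (hη : 0 < η) (hη1 : η ≤ 1) (A : Eucl n ≃ₗᵢ[ℝ] Eucl n) (g : YS n) (x : Sph n) :
    Mop hη hη1 (pre A g) x = (A.symm.toContinuousLinearEquiv : Eucl n →L[ℝ] Eucl n).comp
      ((Mop hη hη1 g (sphMap A x)).comp (A.toContinuousLinearEquiv : Eucl n →L[ℝ] Eucl n)) := by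
  have hx : (x : Eucl n) ≠ 0 := Sph.ne_zero x
  have hAx : A (x : Eucl n) ≠ 0 := by simpa using hx
  have h1 := hasFDerivAt_Eop hη hη1 (pre A g) hx
  have h2 := (A.symm.toContinuousLinearEquiv.hasFDerivAt).comp (x : Eucl n)
    ((hasFDerivAt_Eop hη hη1 g hAx).comp (x : Eucl n) (A.toContinuousLinearEquiv.hasFDerivAt))
  have h3 : (fun y : Eucl n => Eop hη hη1 (pre A g) (sx y)) =ᶠ[𝓝 (x : Eucl n)]
      (A.symm.toContinuousLinearEquiv ∘ ((fun y : Eucl n => Eop hη hη1 g (sx y)) ∘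
        A.toContinuousLinearEquiv)) := by
    filter_upwards [isOpen_ne.mem_nhds hx] with y hy
    change _ = A.symm (Eop hη hη1 g (sx (A y)))
    rw [Eop_pre, sx_map A hy]
  have h4 := h1.unique (h2.congr_of_eventuallyEq h3)
  have hAn : ‖A (x : Eucl n)‖ = 1 := by rw [A.norm_map, Sph.norm_eq]
  rw [sx_coe, sx_map A hx, sx_coe, Sph.norm_eq, hAn, inv_one, one_smul, one_smul] at h4
  exact h4

theorem phiIn_map (A : Eucl n ≃ₗᵢ[ℝ] Eucl n) (D : Eucl n) : phiIn s (A D) = phiIn s D := by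
  rw [phiIn, phiIn, A.norm_map]

theorem det_one_add_conj (A : Eucl n ≃ₗᵢ[ℝ] Eucl n) (B : Eucl n →L[ℝ] Eucl n) :
    (1 + (A.symm.toContinuousLinearEquiv : Eucl n →L[ℝ] Eucl n).comp
      (B.comp (A.toContinuousLinearEquiv : Eucl n →L[ℝ] Eucl n))).det = (1 + B).det := by
  have h := LinearMap.det_conj ((1 + B : Eucl n →L[ℝ] Eucl n) : Eucl n →ₗ[ℝ] Eucl n)
    A.symm.toLinearEquiv
  rw [ContinuousLinearMap.det, ContinuousLinearMap.det, ← h]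
  congr 1
  ext1 v
  change v + A.symm (B (A v)) = A.symm (A v + B (A v))
  rw [map_add, A.symm_apply_apply]

theorem phiOut_map (A : Eucl n ≃ₗᵢ[ℝ] Eucl n) (t a : ℝ) (v D : Eucl n) (B : Eucl n →L[ℝ] Eucl n) :
    phiOut s (t, a, A.symm v, A.symm D,
      (A.symm.toContinuousLinearEquiv : Eucl n →L[ℝ] Eucl n).comp
        (B.comp (A.toContinuousLinearEquiv : Eucl n →L[ℝ] Eucl n))) =
      phiOut s (t, a, v, D, B) := by
  simp only [phiOut, phiE, phiR, A.symm.norm_map, det_one_add_conj]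

theorem nx_map (A : Eucl n ≃ₗᵢ[ℝ] Eucl n) (x : Eucl n) : nx (A x) = A (nx x) := by
  rw [nx, nx, A.norm_map, map_smul]

theorem mem_innR_map (A : Eucl n ≃ₗᵢ[ℝ] Eucl n) {ζ : Eucl n} : A ζ ∈ innR n ↔ ζ ∈ innR n := by
  rw [mem_innR, mem_innR, A.norm_map]

theorem mem_outR_map (A : Eucl n ≃ₗᵢ[ℝ] Eucl n) {ζ : Eucl n} : A ζ ∈ outR n ↔ ζ ∈ outR n := by
  rw [mem_outR, mem_outR, A.norm_map]

theorem wIn_map (A : Eucl n ≃ₗᵢ[ℝ] Eucl n) (s b : ℝ) (ζ : Eucl n) :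
    wIn n s b (A ζ) = wIn n s b ζ := by
  by_cases h : ζ ∈ innR n
  · rw [wIn, Set.indicator_of_mem h, Set.indicator_of_mem ((mem_innR_map A).2 h), A.norm_map]
  · rw [wIn, Set.indicator_of_notMem h,
      Set.indicator_of_notMem (fun h' => h ((mem_innR_map A).1 h'))]

theorem wOut_of_notMem (s b : ℝ) {ζ : Eucl n} (h : ζ ∉ outR n) : wOut n s b ζ = 0 := by
  rw [wOut, Set.indicator_of_notMem h]

theorem wOut_map (A : Eucl n ≃ₗᵢ[ℝ] Eucl n) (s b : ℝ) (ζ : Eucl n) :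
    wOut n s b (A ζ) = wOut n s b ζ := by
  by_cases h : ζ ∈ outR n
  · rw [wOut, Set.indicator_of_mem h, Set.indicator_of_mem ((mem_outR_map A).2 h), A.norm_map]
  · rw [wOut, Set.indicator_of_notMem h,
      Set.indicator_of_notMem (fun h' => h ((mem_outR_map A).1 h'))]

theorem tens_symm_map (A : Eucl n ≃ₗᵢ[ℝ] Eucl n) (u v : Eucl n) :
    tens u (A.symm v) = (A.symm.toContinuousLinearEquiv : Eucl n →L[ℝ] Eucl n).comp
      ((tens (A u) v).comp (A.toContinuousLinearEquiv : Eucl n →L[ℝ] Eucl n)) := by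
  ext1 w
  change _ = A.symm (tens (A u) v (A w))
  rw [tens_apply, tens_apply, A.inner_map_map, map_smul]

theorem norm_map_sub_coe (A : Eucl n ≃ₗᵢ[ℝ] Eucl n) (ζ : Eucl n) (x : Sph n) :
    ‖A ζ - (sphMap A x : Eucl n)‖ = ‖ζ - x‖ := by
  rw [coe_sphMap, ← map_sub, A.norm_map]

theorem phiOut_outL_map (A : Eucl n ≃ₗᵢ[ℝ] Eucl n) {A₁ A₂ : LipW (wS n) (Eucl n)}
    {e₁ e₂ : LipW (wL n) (Eucl n)} {M₁ M₂ : LipW (wS n) (Eucl n →L[ℝ] Eucl n)}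
    (hA : ∀ x, A₁ x = A.symm (A₂ (sphMap A x))) (he : ∀ x, e₁ x = A.symm (e₂ (sphMap A x)))
    (hM : ∀ x, M₁ x = (A.symm.toContinuousLinearEquiv : Eucl n →L[ℝ] Eucl n).comp
      ((M₂ (sphMap A x)).comp (A.toContinuousLinearEquiv : Eucl n →L[ℝ] Eucl n)))
    (t : ℝ) {ζ : Eucl n} (h : ζ ∈ outR n) (x : Sph n) :
    phiOut s ((baseZ n + outL n (t, A₁, e₁, M₁)) (ζ, x)) =
      phiOut s ((baseZ n + outL n (t, A₂, e₂, M₂)) (A ζ, sphMap A x)) := by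
  have hz : ζ ≠ 0 := ne_zero_of_mem_outR h
  rw [outL_add_apply _ _ _ _ h, outL_add_apply _ _ _ _ ((mem_outR_map A).2 h),
    norm_map_sub_coe, A.norm_map, sx_map A hz]
  have e1 : ⟪ζ, A₁ (sx ζ)⟫ = ⟪A ζ, A₂ (sphMap A (sx ζ))⟫ := by
    rw [hA, ← A.inner_map_map, A.apply_symm_apply]
  have e2 : chi ‖ζ‖ • A₁ (sx ζ) = A.symm (chi ‖ζ‖ • A₂ (sphMap A (sx ζ))) := by
    rw [hA, map_smul]
  have e3 : ‖ζ - x‖⁻¹ • (ζ + chi ‖ζ‖ • e₁ (sx ζ) - (x + e₁ x)) =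
      A.symm (‖ζ - x‖⁻¹ • (A ζ + chi ‖ζ‖ • e₂ (sphMap A (sx ζ)) -
        (sphMap A x + e₂ (sphMap A x)))) := by
    rw [he, he, map_smul, map_sub, map_add, map_add, map_smul, coe_sphMap, A.symm_apply_apply,
      A.symm_apply_apply]
  have e4 : (2 : ℝ) • tens (nx ζ) (e₁ (sx ζ)) + (chi ‖ζ‖ / ‖ζ‖) • M₁ (sx ζ) =
      (A.symm.toContinuousLinearEquiv : Eucl n →L[ℝ] Eucl n).comp
        (((2 : ℝ) • tens (nx (A ζ)) (e₂ (sphMap A (sx ζ))) +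
          (chi ‖ζ‖ / ‖ζ‖) • M₂ (sphMap A (sx ζ))).comp
            (A.toContinuousLinearEquiv : Eucl n →L[ℝ] Eucl n)) := by
    rw [he, hM, tens_symm_map, nx_map]
    ext1 v
    simp
  rw [e1, e2, e3, e4, phiOut_map]

theorem phiIn_D0_map (A : Eucl n ≃ₗᵢ[ℝ] Eucl n) {A₁ A₂ : LipW (wS n) (Eucl n)}
    (hA : ∀ x, A₁ x = A.symm (A₂ (sphMap A x))) (t : ℝ) (ζ : Eucl n) (x : Sph n) :
    phiIn s ((D0 n + t • D1in n A₁) (ζ, x)) =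
      phiIn s ((D0 n + t • D1in n A₂) (A ζ, sphMap A x)) := by
  rw [LipW.coe_add, LipW.coe_add, LipW.coe_smul, LipW.coe_smul, D0_apply, D0_apply, D1in_apply,
    D1in_apply, ← phiIn_map A]
  dsimp only
  rw [norm_map_sub_coe, hA, coe_sphMap, ← map_sub]
  by_cases h : ζ ∈ innR n
  · rw [if_pos h, if_pos ((mem_innR_map A).2 h)]
    simp only [map_add, map_smul, map_neg, A.apply_symm_apply]
  · rw [if_neg h, if_neg (fun h' => h ((mem_innR_map A).1 h'))]
    simp only [map_add, map_smul, map_zero]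

theorem What_pre (hs : 1 - (n : ℝ) < s) (hη : 0 < η) (hη1 : η ≤ 1) (A : Eucl n ≃ₗᵢ[ℝ] Eucl n)
    (g : YS n) (x : Sph n) :
    What hs hη hη1 (pre A g) x = What hs hη hη1 g (sphMap A x) := by
  rw [What, What, LipW.coe_add, LipW.coe_add, ChordWeight.kL_apply, ChordWeight.kL_apply,
    ChordWeight.kL_apply, ChordWeight.kL_apply]
  congr 1
  · refine Eq.trans ?_
      (A.measurePreserving.integral_comp A.toMeasurableEquiv.measurableEmbedding _)
    congr 1; ext1 ζ
    rw [norm_map_sub_coe, wIn_map, LipW.nem_apply (contDiff_phiIn s),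
      LipW.nem_apply (contDiff_phiIn s), phiIn_D0_map A (Aop_pre hη hη1 A g)]
  · refine Eq.trans ?_
      (A.measurePreserving.integral_comp A.toMeasurableEquiv.measurableEmbedding _)
    congr 1; ext1 ζ
    rw [norm_map_sub_coe, wOut_map]
    by_cases h : ζ ∈ outR n
    · rw [LipW.nem_apply (contDiff_phiOut s), LipW.nem_apply (contDiff_phiOut s),
        phiOut_outL_map A (Aop_pre hη hη1 A g) (Eop_pre hη hη1 A g) (Mop_pre hη hη1 A g) _ h]
    · rw [wOut_of_notMem _ _ h, zero_mul, zero_mul, zero_mul]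

theorem Tmap_pre (p : ℝ) (hs : 1 - (n : ℝ) < s) (hη : 0 < η) (hη1 : η ≤ 1)
    (A : Eucl n ≃ₗᵢ[ℝ] Eucl n) (ψ g : YS n) :
    Tmap p hs hη hη1 (pre A ψ) (pre A g) = pre A (Tmap p hs hη hη1 ψ g) := by
  apply LipW.ext
  intro x
  rw [pre_apply, Tmap, Tmap, LipW.coe_add, LipW.coe_add, defect_apply, defect_apply]
  have hd : (1 + Mop hη hη1 (pre A g) x).det = (1 + Mop hη hη1 g (sphMap A x)).det := by
    rw [Mop_pre, det_one_add_conj]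
  have ha : ‖Aop hη hη1 (pre A g) x‖ = ‖Aop hη hη1 g (sphMap A x)‖ := by
    rw [Aop_pre, A.symm.norm_map]
  have hw := What_pre hs hη hη1 A g x
  have hr := Rop_pre hη A g x
  rw [Phi, Phi]
  simp only [dataS, jetL_apply]
  rw [hd, ha, hw, hr]
  rfl

end Equivariance

/-- Smooth dependence of a fixed point on the parameter. -/
theorem exists_smooth_fixedPoint {X Y : Type} [NormedAddCommGroup X] [NormedSpace ℝ X]
    [CompleteSpace X] [NormedAddCommGroup Y] [NormedSpace ℝ Y] [CompleteSpace Y] {T : X × Y → Y}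
    (hT : ContDiff ℝ (⊤ : ℕ∞) T) {ψ : X} {g : Y} (hfix : T (ψ, g) = g)
    (hc : ∀ᶠ g' in 𝓝 g, ‖T (ψ, g') - T (ψ, g)‖ ≤ 1 / 2 * ‖g' - g‖) :
    ∃ G : X → Y, ContDiffAt ℝ (⊤ : ℕ∞) G ψ ∧ G ψ = g ∧ ∀ᶠ ψ' in 𝓝 ψ, T (ψ', G ψ') = G ψ' := by
  have hd : HasFDerivAt T (fderiv ℝ T (ψ, g)) (ψ, g) :=
    (hT.differentiable (by simp) _).hasFDerivAt
  set D := fderiv ℝ T (ψ, g) ∘L ContinuousLinearMap.inr ℝ X Y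
  have hD : HasFDerivAt (fun g' => T (ψ, g')) D g := hd.comp g (hasFDerivAt_prodMk_right ψ g)
  have hn : ‖D‖ ≤ 1 / 2 := hD.le_of_lip' (by norm_num) hc
  have cdf : ContDiffAt ℝ (⊤ : ℕ∞) (fun a : X × Y => a.2 - T a) (ψ, g) :=
    (contDiff_snd.sub hT).contDiffAt
  have hf : fderiv ℝ (fun a : X × Y => a.2 - T a) (ψ, g) ∘L ContinuousLinearMap.inr ℝ X Y =
      1 - D := by
    have h : HasFDerivAt (fun a : X × Y => a.2 - T a)
        (ContinuousLinearMap.snd ℝ X Y - fderiv ℝ T (ψ, g)) (ψ, g) := hasFDerivAt_snd.sub hd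
    rw [h.fderiv]
    ext1 v
    simp [D]
  have hinv : (fderiv ℝ (fun a : X × Y => a.2 - T a) (ψ, g) ∘L
      ContinuousLinearMap.inr ℝ X Y).IsInvertible := by
    rw [hf]
    exact ⟨ContinuousLinearEquiv.unitsEquiv ℝ Y (Units.oneSub D (by linarith)), rfl⟩
  have hne : ((⊤ : ℕ∞) : WithTop ℕ∞) ≠ 0 := by simp
  refine ⟨cdf.implicitFunction hne hinv, cdf.contDiffAt_implicitFunction hne hinv,
    cdf.implicitFunction_apply_self hne hinv, ?_⟩
  filter_upwards [cdf.eventually_apply_implicitFunction hne hinv] with ψ' h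
  rw [hfix, sub_self, sub_eq_zero] at h
  exact h.symm

section Rotation

variable {n : ℕ} [hn : Fact (2 ≤ n)]

/-- The restriction of linear maps to the sphere. -/
def restrL (n : ℕ) [Fact (2 ≤ n)] : (Eucl n →L[ℝ] Eucl n) →L[ℝ] LipW (wS n) (Eucl n) :=
  LipW.mkCLM (fun B x => B (x : Eucl n)) 2 (fun _ _ _ => rfl) (fun _ _ _ => rfl)
    (fun B => (B.continuous.comp continuous_subtype_val).stronglyMeasurable)
    (fun B x => by
      refine (B.le_opNorm _).trans ?_
      rw [Sph.norm_eq]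
      have := norm_nonneg B
      linarith)
    (fun B x y h => by
      rw [← map_sub, wS, abs_of_nonneg (Real.sqrt_nonneg _)]
      refine (B.le_opNorm _).trans ?_
      have h1 : ‖(x : Eucl n) - y‖ = dist x y := by rw [Subtype.dist_eq, dist_eq_norm]
      have h2 := le_two_mul_sqrt dist_nonneg (dist_sph_le_two x y)
      have h3 := mul_le_mul_of_nonneg_left h2 (norm_nonneg B)
      rw [h1]
      linarith)

theorem restrL_apply (B : Eucl n →L[ℝ] Eucl n) (x : Sph n) : restrL n B x = B (x : Eucl n) := rfl

/-- A family of rotations taking a given point of the sphere to nearby ones. -/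
def rotA (x₀ : Sph n) (x : Eucl n) : Eucl n ≃ₗᵢ[ℝ] Eucl n :=
  ((ℝ ∙ (x₀ : Eucl n)).reflection).trans ((ℝ ∙ (nx x + (x₀ : Eucl n))).reflection)

theorem nx_add_ne_zero (x₀ : Sph n) : ∀ᶠ x in 𝓝 (x₀ : Eucl n), x ≠ 0 ∧ nx x + (x₀ : Eucl n) ≠ 0 := by
  have h1 : ∀ᶠ x in 𝓝 (x₀ : Eucl n), x ≠ 0 := isOpen_ne.mem_nhds (Sph.ne_zero x₀)
  have h2 : ContinuousAt (fun x : Eucl n => nx x + (x₀ : Eucl n)) (x₀ : Eucl n) := by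
    unfold nx
    exact ((continuous_norm.continuousAt.inv₀ (norm_ne_zero_iff.2 (Sph.ne_zero x₀))).smul
      continuousAt_id).add continuousAt_const
  have h3 : nx (x₀ : Eucl n) + x₀ ≠ 0 := by
    rw [nx_of_norm (Sph.norm_eq x₀), ← two_smul ℝ]
    exact smul_ne_zero two_ne_zero (Sph.ne_zero x₀)
  exact h1.and (h2.eventually_ne h3)

theorem sphMap_rotA (x₀ : Sph n) {x : Eucl n} (hx : x ≠ 0) (h : nx x + (x₀ : Eucl n) ≠ 0) :
    sphMap (rotA x₀ x) x₀ = sx x := by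
  ext1
  rw [coe_sphMap, coe_sx hx, rotA, LinearIsometryEquiv.trans_apply,
    Submodule.reflection_mem_subspace_eq_self (Submodule.mem_span_singleton_self _),
    Submodule.reflection_singleton_apply]
  have h1 : ⟪nx x, nx x⟫ = (1 : ℝ) := by rw [real_inner_self_eq_norm_sq, norm_nx hx]; norm_num
  have h2 : ‖nx x + (x₀ : Eucl n)‖ ^ 2 = 2 * ⟪nx x + (x₀ : Eucl n), (x₀ : Eucl n)⟫ := by
    rw [← real_inner_self_eq_norm_sq]
    simp only [inner_add_left, inner_add_right, h1, Sph.inner_self,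
      real_inner_comm (x₀ : Eucl n) (nx x)]
    ring
  have h3 : ‖nx x + (x₀ : Eucl n)‖ ^ 2 ≠ 0 := pow_ne_zero _ (norm_ne_zero_iff.2 h)
  have h4 : ⟪nx x + (x₀ : Eucl n), (x₀ : Eucl n)⟫ / ((‖nx x + (x₀ : Eucl n)‖ : ℝ) ^ 2) = 1 / 2 := by
    rw [h2] at h3 ⊢
    have h3' := right_ne_zero_of_mul h3
    field_simp
  have h5 : (2 : ℕ) • (⟪nx x + (x₀ : Eucl n), (x₀ : Eucl n)⟫ / ((‖nx x + (x₀ : Eucl n)‖ : ℝ) ^ 2)) • (nx x + (x₀ : Eucl n)) =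
      nx x + (x₀ : Eucl n) := by
    rw [h4, ← Nat.cast_smul_eq_nsmul ℝ, smul_smul]
    norm_num
  refine (congrArg (· - (x₀ : Eucl n)) h5).trans ?_
  abel

/-- The reflection in the line spanned by `w`. -/
def reflL (w : Eucl n) : Eucl n →L[ℝ] Eucl n :=
  (2 * (‖w‖ ^ 2)⁻¹) • tens w w - ContinuousLinearMap.id ℝ (Eucl n)

theorem reflL_apply (w v : Eucl n) : reflL w v = (ℝ ∙ w).reflection v := by
  rw [Submodule.reflection_singleton_apply, ← Nat.cast_smul_eq_nsmul ℝ, smul_smul]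
  simp only [reflL, sub_apply, smul_apply, tens_apply, ContinuousLinearMap.id_apply, smul_smul]
  congr 2
  simp only [Nat.cast_ofNat, RCLike.ofReal_real_eq_id, id_eq]
  ring

/-- The rotations as continuous linear maps. -/
def rotL (x₀ : Sph n) (x : Eucl n) : Eucl n →L[ℝ] Eucl n :=
  reflL (nx x + (x₀ : Eucl n)) ∘L reflL (x₀ : Eucl n)

theorem rotL_apply (x₀ : Sph n) (x v : Eucl n) : rotL x₀ x v = rotA x₀ x v := by
  rw [rotA, LinearIsometryEquiv.trans_apply, rotL, ContinuousLinearMap.comp_apply, reflL_apply,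
    reflL_apply]

theorem contDiffAt_reflL {w : Eucl n} (hw : w ≠ 0) : ContDiffAt ℝ (⊤ : ℕ∞) (reflL (n := n)) w := by
  have h4 : ContDiff ℝ (⊤ : ℕ∞) fun w : Eucl n => tens w w := by
    have h : (fun w : Eucl n => tens w w) = fun w => ContinuousLinearMap.smulRightL ℝ (Eucl n)
        (Eucl n) (innerSL ℝ w) w := by
      ext1 w
      unfold tens
      rfl
    rw [h]
    exact ((ContinuousLinearMap.smulRightL ℝ (Eucl n)
      (Eucl n)).isBoundedBilinearMap.contDiff).comp
      ((innerSL ℝ (E := Eucl n)).contDiff.prodMk contDiff_id)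
  have h5 : ContDiffAt ℝ (⊤ : ℕ∞) (fun w : Eucl n => (‖w‖ ^ 2)⁻¹) w :=
    (contDiffAt_id.norm_sq ℝ).inv (pow_ne_zero _ (norm_ne_zero_iff.2 hw))
  unfold reflL
  exact ((contDiffAt_const.mul h5).smul h4.contDiffAt).sub contDiffAt_const

theorem contDiffAt_nx {x : Eucl n} (hx : x ≠ 0) : ContDiffAt ℝ (⊤ : ℕ∞) (nx (n := n)) x := by
  unfold nx
  exact ((contDiffAt_norm ℝ hx).inv (norm_ne_zero_iff.2 hx)).smul contDiffAt_id

theorem contDiffAt_rotL (x₀ : Sph n) : ContDiffAt ℝ (⊤ : ℕ∞) (rotL x₀) (x₀ : Eucl n) := by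
  obtain ⟨h1, h2⟩ := (nx_add_ne_zero x₀).self_of_nhds
  have h3 : ContDiffAt ℝ (⊤ : ℕ∞) (fun x : Eucl n => nx x + (x₀ : Eucl n)) (x₀ : Eucl n) :=
    (contDiffAt_nx h1).add contDiffAt_const
  have h4 : ContDiffAt ℝ (⊤ : ℕ∞) (fun x : Eucl n => reflL (nx x + (x₀ : Eucl n)))
      (x₀ : Eucl n) := ContDiffAt.comp (f := fun x : Eucl n => nx x + (x₀ : Eucl n)) _ (contDiffAt_reflL h2) h3
  unfold rotL
  exact h4.clm_comp contDiffAt_const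

theorem pre_nem (A : Eucl n ≃ₗᵢ[ℝ] Eucl n) {B : Eucl n →L[ℝ] Eucl n} (hB : ∀ v, B v = A v)
    {F : Eucl n → ℝ} (hF : ContDiff ℝ (⊤ : ℕ∞) F) :
    pre A (LipW.nem F (restrL n 1)) = LipW.nem F (restrL n B) := by
  apply LipW.ext
  intro x
  rw [pre_apply, LipW.nem_apply hF, LipW.nem_apply hF, restrL_apply, restrL_apply, hB]
  rfl

theorem contDiffAt_nem_rotL (x₀ : Sph n) {F : Eucl n → ℝ} (hF : ContDiff ℝ (⊤ : ℕ∞) F) :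
    ContDiffAt ℝ (⊤ : ℕ∞) (fun x : Eucl n => LipW.nem F (restrL n (rotL x₀ x))) (x₀ : Eucl n) :=
  (((LipW.contDiff_nem hF).comp (restrL n).contDiff).contDiffAt).comp _ (contDiffAt_rotL x₀)

theorem rotL_self (x₀ : Sph n) : rotL x₀ (x₀ : Eucl n) = 1 := by
  ext1 v
  have h : (ℝ ∙ ((x₀ : Eucl n) + (x₀ : Eucl n))) = ℝ ∙ (x₀ : Eucl n) := by
    rw [← two_smul ℝ]
    exact Submodule.span_singleton_smul_eq (IsUnit.mk0 _ two_ne_zero) _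
  rw [rotL, ContinuousLinearMap.comp_apply, nx_of_norm (Sph.norm_eq x₀), reflL_apply,
    reflL_apply]
  simp only [h, Submodule.reflection_reflection]
  rfl

end Rotation

section Solution

variable {n : ℕ} [hn : Fact (2 ≤ n)] {s η : ℝ}

theorem exists_pos_lower_bound {f : Eucl n → ℝ} (hf : Continuous f)
    (hpos : ∀ x ∈ Metric.sphere (0 : Eucl n) 1, 0 < f x) :
    ∃ m > 0, ∀ x : Sph n, m ≤ f x := by
  obtain ⟨x₀, hx₀, hm⟩ := (isCompact_sphere (0 : Eucl n) 1).exists_isMinOn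
    ⟨_, (baseP n).2⟩ hf.continuousOn
  exact ⟨f x₀, hpos x₀ hx₀, fun x => hm x.2⟩

/-- A fixed point which is unique in a ball is invariant under the symmetries of the map. -/
theorem eq_of_contraction {Y : Type} [NormedAddCommGroup Y] {T : Y → Y} {φ g g' : Y} {δ : ℝ}
    (hT : ∀ g g', ‖g - φ‖ ≤ δ → ‖g' - φ‖ ≤ δ → ‖T g - T g'‖ ≤ 1 / 2 * ‖g - g'‖)
    (hg : ‖g - φ‖ ≤ δ) (hg' : ‖g' - φ‖ ≤ δ) (h : T g = g) (h' : T g' = g') : g = g' := by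
  have h1 := hT g g' hg hg'
  rw [h, h'] at h1
  have h2 := norm_nonneg (g - g')
  exact sub_eq_zero.1 (norm_eq_zero.1 (by linarith))

theorem contDiffAt_Rop_of_fixedPoint (p : ℝ) (hs : 1 - (n : ℝ) < s) (hη : 0 < η) (hη1 : η ≤ 1)
    {F₁ F₂ : Eucl n → ℝ} (hF₁ : ContDiff ℝ (⊤ : ℕ∞) F₁) (hF₂ : ContDiff ℝ (⊤ : ℕ∞) F₂)
    {ψ φ g : YS n} (hψ : ψ = LipW.nem F₁ (restrL n 1)) (hφ : φ = LipW.nem F₂ (restrL n 1))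
    {δ : ℝ} (hδ : 0 < δ)
    (hT : ∀ ψ', ‖ψ' - ψ‖ ≤ δ → ∀ g g', ‖g - φ‖ ≤ δ → ‖g' - φ‖ ≤ δ →
      ‖Tmap p hs hη hη1 ψ' g - Tmap p hs hη hη1 ψ' g'‖ ≤ 1 / 2 * ‖g - g'‖)
    (hfix : Tmap p hs hη hη1 ψ g = g) (hg : ‖g - φ‖ ≤ δ / 4) (x₀ : Sph n) :
    ContDiffAt ℝ (⊤ : ℕ∞) (fun x => Rop hη g (sx x)) (x₀ : Eucl n) := by
  have hball : ∀ᶠ g' in 𝓝 g, ‖g' - φ‖ ≤ δ := by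
    have h1 : ContinuousAt (fun g' : YS n => ‖g' - φ‖) g := by fun_prop
    exact (h1.eventually_lt continuousAt_const (by linarith : ‖g - φ‖ < δ)).mono
      fun _ h => h.le
  obtain ⟨G, hG, hGg, hGfix⟩ := exists_smooth_fixedPoint (contDiff_Tmap p hs hη hη1)
    (ψ := ψ) (g := g) hfix (by
      filter_upwards [hball] with g' hg'
      exact hT ψ (by rw [sub_self, norm_zero]; exact hδ.le) g' g hg' hball.self_of_nhds)
  have hPψ : ContDiffAt ℝ (⊤ : ℕ∞) (fun x : Eucl n => LipW.nem F₁ (restrL n (rotL x₀ x)))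
    (x₀ : Eucl n) := contDiffAt_nem_rotL x₀ hF₁
  have hPφ : ContDiffAt ℝ (⊤ : ℕ∞) (fun x : Eucl n => LipW.nem F₂ (restrL n (rotL x₀ x)))
    (x₀ : Eucl n) := contDiffAt_nem_rotL x₀ hF₂
  have hψ0 : LipW.nem F₁ (restrL n (rotL x₀ (x₀ : Eucl n))) = ψ := by rw [rotL_self, hψ]
  have hφ0 : LipW.nem F₂ (restrL n (rotL x₀ (x₀ : Eucl n))) = φ := by rw [rotL_self, hφ]
  have htψ : Tendsto (fun x : Eucl n => LipW.nem F₁ (restrL n (rotL x₀ x))) (𝓝 (x₀ : Eucl n))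
      (𝓝 ψ) := by
    have := hPψ.continuousAt.tendsto
    rwa [hψ0] at this
  have htφ : Tendsto (fun x : Eucl n => LipW.nem F₂ (restrL n (rotL x₀ x))) (𝓝 (x₀ : Eucl n))
      (𝓝 φ) := by
    have := hPφ.continuousAt.tendsto
    rwa [hφ0] at this
  have htG : Tendsto G (𝓝 ψ) (𝓝 g) := by
    have := hG.continuousAt.tendsto
    rwa [hGg] at this
  have hev : (fun x => Rop hη g (sx x)) =ᶠ[𝓝 (x₀ : Eucl n)]
      fun x => LipW.ev x₀ (Rop hη (G (LipW.nem F₁ (restrL n (rotL x₀ x))))) := by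
    filter_upwards [nx_add_ne_zero x₀, htψ.eventually (Metric.closedBall_mem_nhds ψ hδ),
      htφ.eventually (Metric.closedBall_mem_nhds φ (by positivity : 0 < δ / 2)),
      htψ.eventually hGfix, (htG.comp htψ).eventually hball] with x hx h1 h2 h3 h4
    rw [dist_eq_norm] at h1 h2
    have e1 : pre (rotA x₀ x) ψ = LipW.nem F₁ (restrL n (rotL x₀ x)) := by
      rw [hψ]; exact pre_nem _ (rotL_apply x₀ x) hF₁
    have e2 : pre (rotA x₀ x) φ = LipW.nem F₂ (restrL n (rotL x₀ x)) := by
      rw [hφ]; exact pre_nem _ (rotL_apply x₀ x) hF₂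
    have h5 : Tmap p hs hη hη1 (LipW.nem F₁ (restrL n (rotL x₀ x))) (pre (rotA x₀ x) g) =
        pre (rotA x₀ x) g := by
      rw [← e1, Tmap_pre, hfix]
    have h6 : ‖pre (rotA x₀ x) g - φ‖ ≤ δ := by
      have i1 : pre (rotA x₀ x) g - φ = pre (rotA x₀ x) (g - φ) +
          (LipW.nem F₂ (restrL n (rotL x₀ x)) - φ) := by
        rw [← e2, map_sub]; abel
      rw [i1]
      refine (norm_add_le _ _).trans ?_
      have i2 := norm_pre_le (rotA x₀ x) (g - φ)
      linarith
    have h7 := eq_of_contraction (hT _ h1) h6 h4 h5 h3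
    have h8 : G (LipW.nem F₁ (restrL n (rotL x₀ x))) = pre (rotA x₀ x) g := h7.symm
    rw [h8, LipW.ev_apply, Rop_pre, sphMap_rotA x₀ hx.1 hx.2]
  refine ContDiffAt.congr_of_eventuallyEq ?_ hev
  have h9 : ContDiffAt ℝ (⊤ : ℕ∞) (fun x : Eucl n => G (LipW.nem F₁ (restrL n (rotL x₀ x))))
      (x₀ : Eucl n) := by
    refine ContDiffAt.comp (g := G) _ ?_ hPψ
    rw [hψ0]; exact hG
  exact (LipW.ev x₀).contDiff.contDiffAt.comp _ ((Rop hη).contDiff.contDiffAt.comp _ h9)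

theorem sx_nx {x : Eucl n} (hx : x ≠ 0) : sx (nx x) = sx x := by
  ext1
  have h : nx x ≠ 0 := fun h => by
    have := norm_nx hx
    rw [h, norm_zero] at this
    norm_num at this
  rw [coe_sx h, coe_sx hx, nx_of_norm (norm_nx hx)]

theorem exists_smooth_even_solution (p : ℝ) (hs : 1 - (n : ℝ) < s) {f : Eucl n → ℝ}
    (hf : ContDiff ℝ (⊤ : ℕ∞) f) (hpos : ∀ x ∈ Metric.sphere (0 : Eucl n) 1, 0 < f x)
    (heven : ∀ x : Eucl n, f (-x) = f x) {μ : ℝ} (hμ : 0 < μ) :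
    ∃ η, ∃ hη : 0 < η, ∃ hη1 : η ≤ 1, ∃ g : YS n, η ≤ μ ∧ ‖jetL hη hη1 g‖ ≤ μ ∧
      (∀ x, |η ^ 4 * Rop hη g x| ≤ μ) ∧
      (∀ x : Sph n, Phi p (η ^ 4, (f x)⁻¹, Rop hη g x, (jetL hη hη1 g).1 x,
        (jetL hη hη1 g).2.2 x, What hs hη hη1 g x) = 0) ∧
      (∀ x : Eucl n, x ≠ 0 → ContDiffAt ℝ (⊤ : ℕ∞) (fun y => Rop hη g (sx y)) x) ∧
      ∀ x : Eucl n, x ≠ 0 → Rop hη g (sx (-x)) = Rop hη g (sx x) := by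
  obtain ⟨m, hm, hmf⟩ := exists_pos_lower_bound hf.continuous hpos
  have hfm : ∀ x : Sph n, 1 / 32 ≤ f x / m := fun x => by
    have : 1 ≤ f x / m := (one_le_div hm).2 (hmf x)
    linarith
  have hfp : ∀ x : Sph n, 0 < f x := fun x => hpos _ x.2
  have hfd : ContDiff ℝ (⊤ : ℕ∞) fun x => f x / m := hf.div_const m
  set F₁ : Eucl n → ℝ := fun x => m⁻¹ * powE (-1) (f x / m) with hF₁d
  set F₂ : Eucl n → ℝ := fun x => -Real.log (clampE (f x / m)) - Real.log m with hF₂d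
  have hF₁ : ContDiff ℝ (⊤ : ℕ∞) F₁ := contDiff_const.mul ((contDiff_powE _).comp hfd)
  have hF₂ : ContDiff ℝ (⊤ : ℕ∞) F₂ :=
    ((contDiff_clampE.comp hfd).log fun x => (clampE_pos _).ne').neg.sub contDiff_const
  have e1 : ∀ x : Sph n, F₁ x = (f x)⁻¹ := fun x => by
    have := hfp x
    rw [hF₁d]
    simp only
    rw [powE_of_le _ (hfm x), Real.rpow_neg_one]
    field_simp
  have e2 : ∀ x : Sph n, F₂ x = -Real.log (f x) := fun x => by
    rw [hF₂d]
    simp only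
    rw [clampE_of_le (hfm x), Real.log_div (hfp x).ne' hm.ne']
    ring
  set ψ : YS n := LipW.nem F₁ (restrL n 1) with hψ
  set φ : YS n := LipW.nem F₂ (restrL n 1) with hφ
  have hψx : ∀ x : Sph n, ψ x = (f x)⁻¹ := fun x => by
    rw [hψ, LipW.nem_apply hF₁, ← e1]; rfl
  have hφx : ∀ x : Sph n, φ x = F₂ x := fun x => by
    rw [hφ, LipW.nem_apply hF₂]; rfl
  obtain ⟨C₁, hC₁, hb⟩ := exists_norm_le_on_ball hF₂.continuous 1
  obtain ⟨C₂, hC₂, hl⟩ := exists_lipschitz_on_ball hF₂ 1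
  set L := C₁ + C₂
  have hφb : ∀ x, |φ x| ≤ L := fun x => by
    rw [hφx]
    exact (hb x (Sph.norm_eq x).le).trans (le_add_of_nonneg_right hC₂)
  obtain ⟨δ, hδ, η, hη, hη1, hημ, hsmall, hT, h0⟩ := exists_Tmap_contraction p hs (ψ := ψ) (φ := φ)
    (L := L) (fun x => by
      rw [hψx, hφx, e2, neg_neg, Real.exp_log (hfp x), inv_mul_cancel₀ (hfp x).ne'])
    hφb
    (fun x y => by
      rw [hφx, hφx, Subtype.dist_eq, dist_eq_norm]
      refine (hl _ _ (Sph.norm_eq x).le (Sph.norm_eq y).le).trans ?_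
      exact mul_le_mul_of_nonneg_right (le_add_of_nonneg_left hC₁) (norm_nonneg _))
    (μ := min 1 (μ / (L + 1))) (by positivity)
  have hψψ : ‖ψ - ψ‖ ≤ δ := by rw [sub_self, norm_zero]; exact hδ.le
  obtain ⟨g, hfix, hg⟩ := exists_fixedPoint_of_contraction hδ (hT ψ hψψ) h0
  have hg' : ‖g - φ‖ ≤ δ := by linarith
  obtain ⟨hj, hR, -⟩ := hsmall g hg'
  have hL : 0 ≤ L := by positivity
  have hμ1 : min 1 (μ / (L + 1)) ≤ μ := (min_le_right _ _).trans
    (div_le_self hμ.le (by linarith))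
  refine ⟨η, hη, hη1, g, hημ.trans hμ1, hj.trans hμ1, fun x => ?_, fun x => ?_, fun x hx => ?_,
    fun x hx => ?_⟩
  · have h1 := (Rop hη g - φ).norm_apply_le x
    rw [LipW.coe_sub, Real.norm_eq_abs] at h1
    have h2 : |Rop hη g x| ≤ L + 1 := by
      have h3 := abs_sub_abs_le_abs_sub (Rop hη g x) (φ x)
      have h4 := hR.trans (min_le_left _ _)
      have h5 := hφb x
      linarith
    have h3 : η ^ 4 ≤ η := pow_le_of_le_one hη.le hη1 (by norm_num)
    have h4 := h3.trans (hημ.trans (min_le_right _ _))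
    rw [abs_mul, abs_of_pos (by positivity)]
    calc η ^ 4 * |Rop hη g x| ≤ μ / (L + 1) * (L + 1) :=
          mul_le_mul h4 h2 (abs_nonneg _) (by positivity)
      _ = μ := div_mul_cancel₀ _ (by positivity)
  · have h1 : defect p (dataS hs hη hη1 ψ g) = 0 := by
      have : g + defect p (dataS hs hη hη1 ψ g) = g + 0 := by rw [add_zero]; exact hfix
      exact add_left_cancel this
    have h2 := defect_apply p (dataS hs hη hη1 ψ g) x
    rw [h1] at h2
    rw [← hψx]
    exact h2.symm
  · have h1 := contDiffAt_Rop_of_fixedPoint p hs hη hη1 hF₁ hF₂ hψ hφ hδ hT hfix hg (sx x)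
    rw [coe_sx hx] at h1
    have h2 : ContDiffAt ℝ (⊤ : ℕ∞) (fun y => Rop hη g (sx (nx y))) x :=
      h1.comp (f := fun y => nx y) x (contDiffAt_nx hx)
    refine h2.congr_of_eventuallyEq ?_
    filter_upwards [isOpen_ne.mem_nhds hx] with y hy
    rw [sx_nx hy]
  · set N : Eucl n ≃ₗᵢ[ℝ] Eucl n := LinearIsometryEquiv.neg ℝ
    have i1 : pre N ψ = ψ := by
      apply LipW.ext
      intro y
      rw [pre_apply, hψx, hψx, coe_sphMap]
      exact congrArg _ (heven _)
    have i2 : pre N φ = φ := by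
      apply LipW.ext
      intro y
      rw [pre_apply, hφx, hφx, e2, e2, coe_sphMap]
      exact congrArg (fun t => -Real.log t) (heven _)
    have i3 : Tmap p hs hη hη1 ψ (pre N g) = pre N g := by
      conv_lhs => rw [← i1]
      rw [Tmap_pre, hfix]
    have i4 : ‖pre N g - φ‖ ≤ δ := by
      conv_lhs => rw [← i2]
      rw [← map_sub]
      exact (norm_pre_le _ _).trans hg'
    have i5 := eq_of_contraction (hT ψ hψψ) i4 hg' i3 hfix
    have i6 := Rop_pre hη N g (sx x)
    rw [i5, ← sx_map N hx] at i6
    exact i6.symm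

end Solution

section Body

variable {n : ℕ} [hn : Fact (2 ≤ n)]

/-- `x ↦ ‖x‖ (1 + ε u (x / ‖x‖))` is a small perturbation of the norm; `e` and `M` are the
gradient and the Hessian of the perturbation. -/
structure SmallJet (ε : ℝ) (u : Sph n → ℝ) (e : Sph n → Eucl n)
    (M : Sph n → Eucl n →L[ℝ] Eucl n) : Prop where
  hasFDerivAt_u : ∀ x : Eucl n, x ≠ 0 →
    HasFDerivAt (fun x => ε * (‖x‖ * u (sx x))) (innerSL ℝ (e (sx x))) x
  hasFDerivAt_e : ∀ x : Eucl n, x ≠ 0 → HasFDerivAt (fun x => e (sx x)) (‖x‖⁻¹ • M (sx x)) x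
  inner_e : ∀ x : Sph n, ⟪(x : Eucl n), e x⟫ = ε * u x
  inner_M : ∀ (x : Sph n) (v : Eucl n), ⟪(x : Eucl n), M x v⟫ = 0
  norm_e : ∀ x, ‖e x‖ ≤ 1 / 64
  norm_e_sub : ∀ x y, ‖e x - e y‖ ≤ 1 / 64 * dist x y
  norm_M : ∀ x, ‖M x‖ ≤ 1 / 64

theorem hasFDerivAt_norm_nx {x : Eucl n} (hx : x ≠ 0) :
    HasFDerivAt (fun x : Eucl n => ‖x‖) (innerSL ℝ (nx x)) x := by
  have := (hasFDerivAt_id x).norm_sq.sqrt (by simpa using hx)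
  simp only [id, Real.sqrt_sq (norm_nonneg _)] at this
  refine this.congr_fderiv ?_
  ext1 v
  simp [nx]
  ring

theorem norm_smul_sx (x : Eucl n) : ‖x‖ • (sx x : Eucl n) = x := by
  by_cases hx : x = 0
  · simp [hx]
  · rw [coe_sx hx, norm_smul_nx]

theorem sx_smul {c : ℝ} (hc : 0 < c) (x : Eucl n) (hx : x ≠ 0) : sx (c • x) = sx x := by
  ext1
  rw [coe_sx hx, coe_sx (smul_ne_zero hc.ne' hx)]
  unfold nx
  rw [norm_smul, Real.norm_of_nonneg hc.le, smul_smul]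
  congr 1
  field_simp

theorem dist_sx_le (x : Sph n) (z : Eucl n) : dist (sx z) x ≤ 2 * ‖z - x‖ := by
  rw [Subtype.dist_eq, dist_eq_norm]
  have h1 : ‖(sx z : Eucl n) - z‖ = |1 - ‖z‖| := by
    have : (sx z : Eucl n) - z = (1 - ‖z‖) • (sx z : Eucl n) := by
      rw [sub_smul, one_smul, norm_smul_sx]
    rw [this, norm_smul, Sph.norm_eq, mul_one, Real.norm_eq_abs]
  have h2 := abs_norm_sub_norm_le (x : Eucl n) z
  rw [Sph.norm_eq, norm_sub_rev] at h2
  have h3 := norm_sub_le_norm_sub_add_norm_sub (sx z : Eucl n) z x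
  linarith

/-- The convex body with support function `R ‖x‖ (1 + ε u (x / ‖x‖))`. -/
def bodyOf (R ε : ℝ) (u : Sph n → ℝ) : Set (Eucl n) :=
  {y | ∀ x : Sph n, ⟪(x : Eucl n), y⟫ ≤ R * (1 + ε * u x)}

theorem det_smul_pjL_add_tens (x : Sph n) {R : ℝ} (hR : R ≠ 0) :
    (R • pjL (x : Eucl n) + tens (x : Eucl n) x).det = R ^ n / R := by
  have h : ((R • pjL (x : Eucl n) + tens (x : Eucl n) x : Eucl n →L[ℝ] Eucl n) :
      Eucl n →ₗ[ℝ] Eucl n) =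
      R • LinearMap.transvection (((1 - R) / R) • innerₛₗ ℝ (x : Eucl n)) (x : Eucl n) := by
    ext1 v
    change R • pjL (x : Eucl n) v + tens (x : Eucl n) x v = R • (v + (((1 - R) / R) *
      ⟪(x : Eucl n), v⟫) • (x : Eucl n))
    rw [pjL_apply, tens_apply, smul_add, smul_sub, smul_smul, smul_smul]
    have : R * (((1 - R) / R) * ⟪(x : Eucl n), v⟫) =
      ⟪(x : Eucl n), v⟫ - R * ⟪(x : Eucl n), v⟫ := by field_simp
    rw [this, sub_smul]
    abel
  rw [ContinuousLinearMap.det, h, LinearMap.det_smul, LinearMap.transvection.det]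
  have h2 : (((1 - R) / R) • innerₛₗ ℝ (x : Eucl n)) (x : Eucl n) = (1 - R) / R := by
    change (1 - R) / R * ⟪(x : Eucl n), (x : Eucl n)⟫ = _
    rw [Sph.inner_self, mul_one]
  rw [h2, finrank_euclideanSpace_fin]
  field_simp
  ring

theorem det_one_add_pos {B : Eucl n →L[ℝ] Eucl n} (hB : ‖B‖ < 1) : 0 < (1 + B).det := by
  have hne : ∀ t ∈ Set.Icc (0 : ℝ) 1, (1 + t • B).det ≠ 0 := fun t ht => by
    have h1 : ‖-(t • B)‖ < 1 := by
      rw [norm_neg, norm_smul, Real.norm_of_nonneg ht.1]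
      nlinarith [ht.2, norm_nonneg B]
    have h2 : IsUnit (1 + t • B) := by
      rw [← sub_neg_eq_add]
      exact (Units.oneSub _ h1).isUnit
    have h3 : IsUnit ((1 + t • B : Eucl n →L[ℝ] Eucl n) : Eucl n →ₗ[ℝ] Eucl n) :=
      h2.map (ContinuousLinearMap.toLinearMapRingHom : (Eucl n →L[ℝ] Eucl n) →+* _)
    exact (LinearMap.isUnit_iff_isUnit_det _).1 h3 |>.ne_zero
  have hc : ContinuousOn (fun t : ℝ => (1 + t • B).det) (Set.Icc 0 1) :=
    (contDiff_det.continuous.comp (by fun_prop)).continuousOn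
  by_contra hneg
  rw [not_lt] at hneg
  have h0 : (1 + (0 : ℝ) • B).det = 1 := by
    have : 1 + (0 : ℝ) • B = ContinuousLinearMap.id ℝ (Eucl n) := by ext1 v; simp
    rw [this]
    exact LinearMap.det_id
  have h1 : (1 + (1 : ℝ) • B).det = (1 + B).det := by rw [one_smul]
  obtain ⟨t, ht, h⟩ := intermediate_value_Icc' zero_le_one hc
    (show (0 : ℝ) ∈ Set.Icc (1 + (1 : ℝ) • B).det (1 + (0 : ℝ) • B).det by
      rw [h0, h1]; exact ⟨hneg, zero_le_one⟩)
  exact hne t ht h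

namespace SmallJet

variable {ε R : ℝ} {u : Sph n → ℝ} {e : Sph n → Eucl n} {M : Sph n → Eucl n →L[ℝ] Eucl n}

theorem abs_u_le (h : SmallJet ε u e M) (x : Sph n) : |ε * u x| ≤ 1 / 64 := by
  rw [← h.inner_e]
  have := abs_real_inner_le_norm (x : Eucl n) (e x)
  rw [Sph.norm_eq, one_mul] at this
  exact this.trans (h.norm_e x)

theorem inner_le (h : SmallJet ε u e M) (x y : Sph n) :
    ⟪(y : Eucl n), (x : Eucl n) + e x⟫ ≤ 1 + ε * u y := by
  have hd : ⟪(y : Eucl n), (x : Eucl n)⟫ = 1 - dist x y ^ 2 / 2 := by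
    have h1 := norm_sub_sq_real (x : Eucl n) y
    rw [Sph.norm_eq, Sph.norm_eq, real_inner_comm] at h1
    rw [Subtype.dist_eq, dist_eq_norm, h1]
    ring
  suffices h2 : -(1 / 16 * dist x y ^ 2) ≤ ⟪(y : Eucl n), e y⟫ - ⟪(y : Eucl n), e x⟫ by
    rw [inner_add_right, hd, ← h.inner_e]
    nlinarith [sq_nonneg (dist x y)]
  have hd0 : 0 ≤ dist x y := dist_nonneg
  have hdn : dist x y = ‖(y : Eucl n) - x‖ := by
    rw [Subtype.dist_eq, dist_eq_norm, norm_sub_rev]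
  rcases lt_or_ge (dist x y) 1 with h1 | h1
  · set F : Eucl n → ℝ := fun z => ε * (‖z‖ * u (sx z)) with hF
    have hseg : ∀ z ∈ segment ℝ (x : Eucl n) y, ‖z - x‖ ≤ dist x y := fun z hz => by
      rw [hdn]
      exact norm_sub_le_of_mem_segment hz
    have hz0 : ∀ z ∈ segment ℝ (x : Eucl n) y, z ≠ 0 := fun z hz h0 => by
      have := hseg z hz
      rw [h0, zero_sub, norm_neg, Sph.norm_eq] at this
      linarith
    have hmv := (convex_segment (x : Eucl n) y).norm_image_sub_le_of_norm_hasFDerivWithin_le'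
      (f := F) (f' := fun z => innerSL ℝ (e (sx z))) (φ := innerSL ℝ (e x))
      (C := 1 / 32 * dist x y)
      (fun z hz => (h.hasFDerivAt_u z (hz0 z hz)).hasFDerivWithinAt)
      (fun z hz => by
        rw [← map_sub, innerSL_apply_norm]
        have i1 := h.norm_e_sub (sx z) x
        have i2 := dist_sx_le x z
        have i3 := hseg z hz
        linarith)
      (left_mem_segment ℝ _ _) (right_mem_segment ℝ _ _)
    have e1 : F y = ⟪(y : Eucl n), e y⟫ := by
      rw [hF, h.inner_e]
      simp only
      rw [sx_coe, Sph.norm_eq, one_mul]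
    have e2 : F x = ⟪(x : Eucl n), e x⟫ := by
      rw [hF, h.inner_e]
      simp only
      rw [sx_coe, Sph.norm_eq, one_mul]
    rw [e1, e2, innerSL_apply_apply, inner_sub_right, ← hdn, real_inner_comm (y : Eucl n),
      real_inner_comm (x : Eucl n), Real.norm_eq_abs] at hmv
    have := neg_abs_le (⟪(y : Eucl n), e y⟫ - ⟪(x : Eucl n), e x⟫ -
      (⟪(y : Eucl n), e x⟫ - ⟪(x : Eucl n), e x⟫))
    nlinarith
  · rw [← inner_sub_right]
    have i1 := abs_real_inner_le_norm (y : Eucl n) (e y - e x)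
    rw [Sph.norm_eq, one_mul] at i1
    have i2 := h.norm_e_sub y x
    rw [dist_comm] at i2
    have i3 := neg_abs_le ⟪(y : Eucl n), e y - e x⟫
    nlinarith

theorem smul_mem_bodyOf (h : SmallJet ε u e M) (hR : 0 < R) (x : Sph n) :
    R • ((x : Eucl n) + e x) ∈ bodyOf R ε u := fun y => by
  rw [inner_smul_right]
  exact mul_le_mul_of_nonneg_left (h.inner_le x y) hR.le

theorem suppFun_bodyOf_sph (h : SmallJet ε u e M) (hR : 0 < R) (x : Sph n) {c : ℝ} (hc : 0 ≤ c) :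
    suppFun (bodyOf R ε u) (c • (x : Eucl n)) = c * (R * (1 + ε * u x)) := by
  refine IsGreatest.csSup_eq ⟨⟨_, h.smul_mem_bodyOf hR x, ?_⟩, ?_⟩
  · simp only
    rw [real_inner_smul_left, inner_smul_right, inner_add_right, Sph.inner_self, h.inner_e]
  · rintro _ ⟨y, hy, rfl⟩
    simp only
    rw [real_inner_smul_left]
    exact mul_le_mul_of_nonneg_left (hy x) hc

theorem suppFun_bodyOf (h : SmallJet ε u e M) (hR : 0 < R) (x : Eucl n) :
    suppFun (bodyOf R ε u) x = R * (‖x‖ + ε * (‖x‖ * u (sx x))) := by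
  conv_lhs => rw [← norm_smul_sx x]
  rw [h.suppFun_bodyOf_sph hR _ (norm_nonneg x)]
  ring

theorem hasGradientAt_suppFun (h : SmallJet ε u e M) (hR : 0 < R) {x : Eucl n} (hx : x ≠ 0) :
    HasGradientAt (suppFun (bodyOf R ε u)) (R • (nx x + e (sx x))) x := by
  have h2 := ((hasFDerivAt_norm_nx hx).add (h.hasFDerivAt_u x hx)).const_mul R
  rw [hasGradientAt_iff_hasFDerivAt]
  refine HasFDerivAt.congr_fderiv (h2.congr_of_eventuallyEq
    (Eventually.of_forall fun y => h.suppFun_bodyOf hR y)) ?_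
  ext1 v
  simp

theorem curvDet_bodyOf (h : SmallJet ε u e M) (hR : 0 < R) (x : Sph n) :
    curvDet (suppFun (bodyOf R ε u)) x = R ^ n / R * (1 + M x).det := by
  have h1 : HasFDerivAt (fun y => gradient (suppFun (bodyOf R ε u)) y)
      (R • (pjL (x : Eucl n) + M x)) (x : Eucl n) := by
    have i1 := (hasFDerivAt_nx (Sph.ne_zero x)).add (h.hasFDerivAt_e x (Sph.ne_zero x))
    have i2 := (i1.const_smul R).congr_of_eventuallyEq
      (f₁ := fun y => gradient (suppFun (bodyOf R ε u)) y) (by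
        filter_upwards [isOpen_ne.mem_nhds (Sph.ne_zero x)] with y hy
        exact (h.hasGradientAt_suppFun hR hy).gradient)
    refine i2.congr_fderiv ?_
    rw [Sph.norm_eq, inv_one, one_smul, one_smul, nx_of_norm (Sph.norm_eq x), sx_coe]
  rw [curvDet, h1.fderiv]
  have h2 : ((R • (pjL (x : Eucl n) + M x) : Eucl n →L[ℝ] Eucl n) : Eucl n →ₗ[ℝ] Eucl n) +
      rankOne (x : Eucl n) = ((R • pjL (x : Eucl n) + tens (x : Eucl n) x :
        Eucl n →L[ℝ] Eucl n) : Eucl n →ₗ[ℝ] Eucl n) ∘ₗ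
        ((1 + M x : Eucl n →L[ℝ] Eucl n) : Eucl n →ₗ[ℝ] Eucl n) := by
    ext1 v
    change R • (pjL (x : Eucl n) v + M x v) + ⟪(x : Eucl n), v⟫ • (x : Eucl n) =
      R • pjL (x : Eucl n) (v + M x v) + tens (x : Eucl n) x (v + M x v)
    rw [tens_apply, pjL_apply, pjL_apply, inner_add_right, h.inner_M, add_zero]
    simp only [smul_add, smul_sub]
    abel
  rw [h2, LinearMap.det_comp]
  exact congrArg (· * _) (det_smul_pjL_add_tens x hR.ne')

theorem isSmoothBody (h : SmallJet ε u e M) (hR : 0 < R)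
    (hsm : ∀ x : Eucl n, x ≠ 0 → ContDiffAt ℝ (⊤ : ℕ∞) (fun y => u (sx y)) x)
    (heven : ∀ x : Eucl n, x ≠ 0 → u (sx (-x)) = u (sx x)) : IsSmoothBody (bodyOf R ε u) := by
  have hcoe : ∀ x : Sph n, sx (x : Eucl n) = x := sx_coe
  have hclosed : IsClosed (bodyOf R ε u) := by
    simp only [bodyOf, Set.ofPred_forall]
    exact isClosed_iInter fun x => isClosed_le (by fun_prop) continuous_const
  have hb : bodyOf R ε u ⊆ Metric.closedBall 0 (2 * R) := fun y hy => by
    rw [mem_closedBall_zero_iff]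
    have h1 := hy (sx y)
    have h2 : ⟪(sx y : Eucl n), y⟫ = ‖y‖ := by
      conv_lhs => rw [← norm_smul_sx y]
      by_cases h0 : y = 0
      · simp [h0]
      · rw [sx_smul (norm_pos_iff.2 h0) _ (Sph.ne_zero _), hcoe, inner_smul_right,
          Sph.inner_self, mul_one]
    have h3 := (abs_le.1 (h.abs_u_le (sx y))).2
    rw [h2] at h1
    nlinarith
  refine ⟨(isCompact_closedBall _ _).of_isClosed_subset hclosed hb, ?_, ?_, ?_, ?_, ?_⟩
  · intro y hy z hz a b ha hb hab x
    rw [inner_add_right, inner_smul_right, inner_smul_right]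
    have h1 := mul_le_mul_of_nonneg_left (hy x) ha
    have h2 := mul_le_mul_of_nonneg_left (hz x) hb
    have h3 : a * (R * (1 + ε * u x)) + b * (R * (1 + ε * u x)) = R * (1 + ε * u x) := by
      rw [← add_mul, hab, one_mul]
    linarith
  · rw [mem_interior]
    refine ⟨Metric.ball 0 (R / 2), fun y hy x => ?_, Metric.isOpen_ball,
      Metric.mem_ball_self (by positivity)⟩
    rw [mem_ball_zero_iff] at hy
    have h1 := real_inner_le_norm (x : Eucl n) y
    rw [Sph.norm_eq, one_mul] at h1
    have h3 := (abs_le.1 (h.abs_u_le x)).1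
    nlinarith
  · intro y hy x
    have h1 := hy (sx (-(x : Eucl n)))
    have h2 := neg_ne_zero.2 (Sph.ne_zero x)
    rw [coe_sx h2, nx_of_norm (by rw [norm_neg, Sph.norm_eq]), heven _ (Sph.ne_zero x), hcoe,
      inner_neg_left] at h1
    rw [inner_neg_right]
    exact h1
  · have h1 : suppFun (bodyOf R ε u) = fun x => R * (‖x‖ + ε * (‖x‖ * u (sx x))) :=
      funext (h.suppFun_bodyOf hR)
    rw [h1]
    intro x hx
    have hx' : x ≠ 0 := hx
    have hnorm := contDiffAt_norm ℝ (n := (⊤ : ℕ∞)) hx'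
    exact (contDiffAt_const.mul (hnorm.add (contDiffAt_const.mul
      (hnorm.mul (hsm x hx'))))).contDiffWithinAt
  · intro x hx
    rw [h.curvDet_bodyOf hR ⟨x, hx⟩]
    exact mul_pos (by positivity) (det_one_add_pos ((h.norm_M _).trans_lt (by norm_num)))

end SmallJet

end Body

section Body

variable {n : ℕ} [hn : Fact (2 ≤ n)]

/-- The deformation of the unit ball onto the normalised body. -/
def psiMap (e : Sph n → Eucl n) (ζ : Eucl n) : Eucl n := ζ + chi ‖ζ‖ • e (sx ζ)

/-- The derivative of the deformation in the outer region, minus the identity. -/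
def psiD (e : Sph n → Eucl n) (M : Sph n → Eucl n →L[ℝ] Eucl n) (ζ : Eucl n) :
    Eucl n →L[ℝ] Eucl n :=
  (2 : ℝ) • tens (nx ζ) (e (sx ζ)) + (chi ‖ζ‖ / ‖ζ‖) • M (sx ζ)

theorem abs_chi_sub_le (r t : ℝ) : |chi r - chi t| ≤ 2 * |r - t| := by
  unfold chi
  have h := abs_max_sub_max_le_max 0 (2 * r - 1) 0 (2 * t - 1)
  refine h.trans ?_
  rw [sub_zero, abs_zero, max_eq_right (abs_nonneg _)]
  have : 2 * r - 1 - (2 * t - 1) = 2 * (r - t) := by ring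
  rw [this, abs_mul, abs_two]

theorem chi_le_two_mul {r : ℝ} (hr : 0 ≤ r) : chi r ≤ 2 * r := max_le (by positivity) (by linarith)

theorem psiMap_of_le (e : Sph n → Eucl n) {ζ : Eucl n} (h : ‖ζ‖ ≤ 1 / 2) : psiMap e ζ = ζ := by
  rw [psiMap, chi, max_eq_left (by linarith), zero_smul, add_zero]

namespace SmallJet

variable {ε R : ℝ} {u : Sph n → ℝ} {e : Sph n → Eucl n} {M : Sph n → Eucl n →L[ℝ] Eucl n}

theorem norm_chi_smul_sub_le (h : SmallJet ε u e M) (ζ z : Eucl n) :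
    ‖chi ‖ζ‖ • e (sx ζ) - chi ‖z‖ • e (sx z)‖ ≤ 1 / 8 * ‖ζ - z‖ := by
  have e1 : chi ‖ζ‖ • e (sx ζ) - chi ‖z‖ • e (sx z) =
      chi ‖ζ‖ • (e (sx ζ) - e (sx z)) + (chi ‖ζ‖ - chi ‖z‖) • e (sx z) := by
    rw [smul_sub, sub_smul]; abel
  have h1 : ‖ζ‖ * dist (sx ζ) (sx z) ≤ 2 * ‖ζ - z‖ := by
    rw [Subtype.dist_eq, dist_eq_norm, ← norm_norm ζ, ← norm_smul, smul_sub, norm_smul_sx]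
    have i1 : z - ‖ζ‖ • (sx z : Eucl n) = (‖z‖ - ‖ζ‖) • (sx z : Eucl n) := by
      rw [sub_smul, norm_smul_sx]
    have i2 : ‖z - ‖ζ‖ • (sx z : Eucl n)‖ ≤ ‖ζ - z‖ := by
      rw [i1, norm_smul, Sph.norm_eq, mul_one, norm_sub_rev]
      exact abs_norm_sub_norm_le ζ z |>.trans' (by rw [Real.norm_eq_abs])
    have i3 := norm_sub_le_norm_sub_add_norm_sub ζ z (‖ζ‖ • (sx z : Eucl n))
    linarith
  have h2 : ‖chi ‖ζ‖ • (e (sx ζ) - e (sx z))‖ ≤ 1 / 16 * ‖ζ - z‖ := by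
    rw [norm_smul, Real.norm_of_nonneg (chi_nonneg _)]
    have i1 := mul_le_mul (chi_le_two_mul (norm_nonneg ζ)) (h.norm_e_sub (sx ζ) (sx z))
      (norm_nonneg _) (by positivity)
    linarith
  have h3 : ‖(chi ‖ζ‖ - chi ‖z‖) • e (sx z)‖ ≤ 1 / 32 * ‖ζ - z‖ := by
    rw [norm_smul, Real.norm_eq_abs]
    have i1 := (abs_chi_sub_le ‖ζ‖ ‖z‖).trans
      (mul_le_mul_of_nonneg_left (abs_norm_sub_norm_le ζ z) zero_le_two)
    have i2 := mul_le_mul i1 (h.norm_e (sx z)) (norm_nonneg _) (by positivity)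
    linarith
  rw [e1]
  have h4 := norm_add_le (chi ‖ζ‖ • (e (sx ζ) - e (sx z))) ((chi ‖ζ‖ - chi ‖z‖) • e (sx z))
  have := norm_nonneg (ζ - z)
  linarith

theorem injective_psiMap (h : SmallJet ε u e M) : Function.Injective (psiMap e) := by
  intro ζ z hz
  have h1 := h.norm_chi_smul_sub_le ζ z
  have h2 : chi ‖ζ‖ • e (sx ζ) - chi ‖z‖ • e (sx z) = -(ζ - z) := by
    unfold psiMap at hz
    rw [neg_sub, sub_eq_sub_iff_add_eq_add, add_comm, hz]
  rw [h2, norm_neg] at h1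
  have := norm_nonneg (ζ - z)
  exact sub_eq_zero.1 (norm_eq_zero.1 (by linarith))

theorem surjective_psiMap (h : SmallJet ε u e M) : Function.Surjective (psiMap e) := by
  intro y
  have hc : ContractingWith (1 / 8) fun ζ => y - chi ‖ζ‖ • e (sx ζ) := by
    refine ⟨by rw [← NNReal.coe_lt_coe]; norm_num, LipschitzWith.of_dist_le_mul fun a b => ?_⟩
    rw [dist_eq_norm, dist_eq_norm, sub_sub_sub_cancel_left, norm_sub_rev]
    simpa using h.norm_chi_smul_sub_le a b
  refine ⟨hc.fixedPoint, ?_⟩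
  have h1 : y - chi ‖hc.fixedPoint‖ • e (sx hc.fixedPoint) = hc.fixedPoint :=
    hc.fixedPoint_isFixedPt
  rw [psiMap]
  nth_rewrite 1 [← h1]
  abel

theorem hasFDerivAt_psiMap_inner (e : Sph n → Eucl n) {ζ : Eucl n} (hζ : ‖ζ‖ < 1 / 2) :
    HasFDerivAt (psiMap e) (1 : Eucl n →L[ℝ] Eucl n) ζ := by
  refine (hasFDerivAt_id ζ).congr_of_eventuallyEq ?_
  filter_upwards [(isOpen_lt continuous_norm continuous_const).mem_nhds hζ] with z hz
  exact psiMap_of_le e (le_of_lt hz)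

theorem hasFDerivAt_psiMap (h : SmallJet ε u e M) {ζ : Eucl n} (hζ : 1 / 2 < ‖ζ‖) :
    HasFDerivAt (psiMap e) (1 + psiD e M ζ) ζ := by
  have h0 : ζ ≠ 0 := norm_pos_iff.1 (by linarith)
  have h1 : HasFDerivAt (fun z : Eucl n => 2 * ‖z‖ - 1) ((2 : ℝ) • innerSL ℝ (nx ζ)) ζ :=
    ((hasFDerivAt_norm_nx h0).const_mul 2).sub_const 1
  have h2 := (hasFDerivAt_id ζ).add (h1.smul (h.hasFDerivAt_e ζ h0))
  have h3 : chi ‖ζ‖ = 2 * ‖ζ‖ - 1 := max_eq_right (by linarith)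
  refine (h2.congr_of_eventuallyEq (f₁ := psiMap e) ?_).congr_fderiv ?_
  · filter_upwards [(isOpen_lt continuous_const continuous_norm).mem_nhds hζ] with z hz
    have hz' : 1 / 2 < ‖z‖ := hz
    rw [psiMap, chi, max_eq_right (by linarith)]
    rfl
  · ext1 v
    change v + ((2 * ‖ζ‖ - 1) • ‖ζ‖⁻¹ • M (sx ζ) v + (2 * ⟪nx ζ, v⟫) • e (sx ζ)) =
      v + ((2 : ℝ) • tens (nx ζ) (e (sx ζ)) v + (chi ‖ζ‖ / ‖ζ‖) • M (sx ζ) v)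
    rw [tens_apply, h3, smul_smul, smul_smul, div_eq_mul_inv, add_comm ((_ : ℝ) • M (sx ζ) v)]

theorem psiMap_mem_iff (h : SmallJet ε u e M) (ζ : Eucl n) :
    psiMap e ζ ∈ bodyOf 1 ε u ↔ ‖ζ‖ ≤ 1 := by
  have hu := fun x => abs_le.1 (h.abs_u_le x)
  constructor
  · intro hm
    by_contra! h1
    have h2 := hm (sx ζ)
    have h3 : psiMap e ζ = ‖ζ‖ • (sx ζ : Eucl n) + (2 * ‖ζ‖ - 1) • e (sx ζ) := by
      rw [norm_smul_sx, psiMap, chi, max_eq_right (by linarith)]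
    rw [h3, inner_add_right, inner_smul_right, inner_smul_right, Sph.inner_self, h.inner_e] at h2
    nlinarith [hu (sx ζ)]
  · intro h1 x
    have hi := real_inner_le_norm (x : Eucl n) (sx ζ)
    rw [Sph.norm_eq, Sph.norm_eq] at hi
    rcases le_total ‖ζ‖ (1 / 2) with h2 | h2
    · rw [psiMap_of_le e h2]
      have h3 := real_inner_le_norm (x : Eucl n) ζ
      rw [Sph.norm_eq] at h3
      linarith [(hu x).1]
    · have h3 : psiMap e ζ = (2 * ‖ζ‖ - 1) • ((sx ζ : Eucl n) + e (sx ζ)) +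
          (1 - ‖ζ‖) • (sx ζ : Eucl n) := by
        rw [psiMap, chi, max_eq_right (by linarith)]
        nth_rewrite 1 [← norm_smul_sx ζ]
        module
      rw [h3, inner_add_right, inner_smul_right, inner_smul_right]
      have h4 := mul_le_mul_of_nonneg_left (h.inner_le (sx ζ) x)
        (by linarith : 0 ≤ 2 * ‖ζ‖ - 1)
      have h5 := mul_le_mul_of_nonneg_left hi (by linarith : 0 ≤ 1 - ‖ζ‖)
      nlinarith [(hu x).1]

theorem bodyOf_eq_image (h : SmallJet ε u e M) (hR : 0 < R) :
    bodyOf R ε u = (fun ζ => R • psiMap e ζ) '' Metric.closedBall 0 1 := by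
  have hs : ∀ y, R • y ∈ bodyOf R ε u ↔ y ∈ bodyOf 1 ε u := fun y => by
    refine forall_congr' fun x => ?_
    rw [inner_smul_right, one_mul]
    exact mul_le_mul_iff_right₀ hR
  ext y
  constructor
  · intro hy
    obtain ⟨ζ, hζ⟩ := h.surjective_psiMap (R⁻¹ • y)
    have h1 : R • psiMap e ζ = y := by rw [hζ, smul_inv_smul₀ hR.ne']
    refine ⟨ζ, ?_, h1⟩
    rw [mem_closedBall_zero_iff, ← h.psiMap_mem_iff, ← hs, h1]
    exact hy
  · rintro ⟨ζ, hζ, rfl⟩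
    rw [mem_closedBall_zero_iff, ← h.psiMap_mem_iff, ← hs] at hζ
    exact hζ

theorem norm_psiD_le (h : SmallJet ε u e M) {ζ : Eucl n} (hζ : 1 / 2 < ‖ζ‖) :
    ‖psiD e M ζ‖ ≤ 1 / 16 := by
  have h0 : ζ ≠ 0 := norm_pos_iff.1 (by linarith)
  have h1 := norm_tens_le (nx ζ) (e (sx ζ))
  rw [norm_nx h0, one_mul] at h1
  have h2 : chi ‖ζ‖ / ‖ζ‖ ≤ 2 := by
    rw [div_le_iff₀ (by linarith)]
    exact chi_le_two_mul (norm_nonneg _)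
  rw [psiD]
  refine (norm_add_le _ _).trans ?_
  rw [norm_smul, norm_smul, Real.norm_of_nonneg (div_nonneg (chi_nonneg _) (norm_nonneg _)),
    Real.norm_two]
  have h3 := mul_le_mul h2 (h.norm_M (sx ζ)) (norm_nonneg _) zero_le_two
  linarith [h.norm_e (sx ζ)]

open Classical in
theorem integral_bodyOf (h : SmallJet ε u e M) (hR : 0 < R) (F : Eucl n → ℝ)
    (h1 : IntegrableOn (fun ζ => F (R • ζ)) (innR n))
    (h2 : IntegrableOn (fun ζ => (1 + psiD e M ζ).det * F (R • psiMap e ζ)) (outR n)) :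
    ∫ z in bodyOf R ε u, F z = R ^ n * ((∫ ζ in innR n, F (R • ζ)) +
      ∫ ζ in outR n, (1 + psiD e M ζ).det * F (R • psiMap e ζ)) := by
  have : Nontrivial (Eucl n) := nontrivial_of_ne _ _ (Sph.ne_zero (baseP n))
  set B : Set (Eucl n) := Metric.ball 0 (1 / 2) with hB
  have hBmem : ∀ ζ, ζ ∈ B ↔ ‖ζ‖ < 1 / 2 := fun ζ => by rw [hB, mem_ball_zero_iff]
  set f : Eucl n → Eucl n := fun ζ => R • psiMap e ζ with hf
  set f' : Eucl n → Eucl n →L[ℝ] Eucl n := fun ζ =>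
    if ‖ζ‖ < 1 / 2 then R • 1 else R • (1 + psiD e M ζ) with hf'
  have hinj : Function.Injective f := (smul_right_injective _ hR.ne').comp h.injective_psiMap
  have hd : ∀ ζ ∈ B ∪ outR n, HasFDerivAt f (f' ζ) ζ := by
    rintro ζ (hζ | hζ)
    · rw [hBmem] at hζ
      simp only [hf', if_pos hζ]
      exact (hasFDerivAt_psiMap_inner e hζ).const_smul R
    · rw [mem_outR] at hζ
      simp only [hf', if_neg (not_lt.2 hζ.2.le)]
      exact (h.hasFDerivAt_psiMap hζ.2).const_smul R
  have hBinn : B =ᵐ[volume] innR n := by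
    have e1 : innR n = B ∪ Metric.sphere 0 (1 / 2) := Metric.ball_union_sphere.symm
    rw [e1]
    exact (union_ae_eq_left_of_ae_eq_empty
      (ae_eq_empty.2 (Measure.addHaar_sphere _ _ _))).symm
  have hsplit : bodyOf R ε u = f '' (B ∪ outR n) ∪ (f '' Metric.sphere 0 (1 / 2) ∪
      f '' Metric.sphere 0 1) := by
    rw [h.bodyOf_eq_image hR, ← Set.image_union, ← Set.image_union]
    congr 1
    ext ζ
    simp only [Set.mem_union, hBmem, mem_outR, mem_closedBall_zero_iff, mem_sphere_zero_iff_norm]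
    grind
  have hnull1 : volume (f '' Metric.sphere 0 (1 / 2)) = 0 := by
    have e1 : f '' Metric.sphere 0 (1 / 2) =
        (fun ζ : Eucl n => R • ζ) '' Metric.sphere 0 (1 / 2) :=
      Set.image_congr fun ζ hζ => by
        rw [mem_sphere_zero_iff_norm] at hζ
        simp only [hf, psiMap_of_le e hζ.le]
    rw [e1]
    exact addHaar_image_eq_zero_of_differentiableOn_of_addHaar_eq_zero _
      (by fun_prop) (Measure.addHaar_sphere _ _ _)
  have hnull2 : volume (f '' Metric.sphere 0 1) = 0 :=
    addHaar_image_eq_zero_of_differentiableOn_of_addHaar_eq_zero _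
      (fun ζ hζ => by
        rw [mem_sphere_zero_iff_norm] at hζ
        exact ((h.hasFDerivAt_psiMap (ζ := ζ) (by rw [hζ]; norm_num)).const_smul
          R).differentiableAt.differentiableWithinAt)
      (Measure.addHaar_sphere _ _ _)
  have hae : bodyOf R ε u =ᵐ[volume] f '' (B ∪ outR n) := by
    rw [hsplit]
    exact union_ae_eq_left_of_ae_eq_empty
      (ae_eq_empty.2 (measure_union_null hnull1 hnull2))
  have hBm : MeasurableSet B := Metric.isOpen_ball.measurableSet
  have hdet : ∀ L : Eucl n →L[ℝ] Eucl n, (R • L).det = R ^ n * L.det := fun L => by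
    have := LinearMap.det_smul R (L : Eucl n →ₗ[ℝ] Eucl n)
    rw [finrank_euclideanSpace_fin] at this
    exact this
  have e1 : Set.EqOn (fun ζ => |(f' ζ).det| • F (f ζ)) (fun ζ => R ^ n * F (R • ζ)) B := by
    intro ζ hζ
    rw [hBmem] at hζ
    have : (1 : Eucl n →L[ℝ] Eucl n).det = 1 := LinearMap.det_id
    simp only [hf', hf, if_pos hζ, hdet, this, psiMap_of_le e hζ.le]
    rw [mul_one, abs_of_pos (by positivity), smul_eq_mul]
  have e2 : Set.EqOn (fun ζ => |(f' ζ).det| • F (f ζ))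
      (fun ζ => R ^ n * ((1 + psiD e M ζ).det * F (R • psiMap e ζ))) (outR n) := by
    intro ζ hζ
    rw [mem_outR] at hζ
    have hp := det_one_add_pos ((h.norm_psiD_le hζ.2).trans_lt (by norm_num))
    simp only [hf', hf, if_neg (not_lt.2 hζ.2.le), hdet]
    rw [abs_of_pos (by positivity), smul_eq_mul, mul_assoc]
  have hdisj : Disjoint B (outR n) := Set.disjoint_left.2 fun ζ hζ hζ' => by
    rw [hBmem] at hζ
    rw [mem_outR] at hζ'
    linarith [hζ'.2]
  have h1' : IntegrableOn (fun ζ => R ^ n * F (R • ζ)) B :=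
    (h1.mono_set Metric.ball_subset_closedBall).const_mul _
  rw [setIntegral_congr_set hae, integral_image_eq_integral_abs_det_fderiv_smul volume
    (hBm.union measurableSet_outR) (fun ζ hζ => (hd ζ hζ).hasFDerivWithinAt) hinj.injOn F,
    setIntegral_union hdisj measurableSet_outR
      ((integrableOn_congr_fun e1 hBm).2 h1')
      ((integrableOn_congr_fun e2 measurableSet_outR).2 (h2.const_mul _)),
    setIntegral_congr_fun hBm e1, setIntegral_congr_fun measurableSet_outR e2,
    integral_const_mul, integral_const_mul, setIntegral_congr_set hBinn]
  ring

end SmallJet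

end Body

section Chord

variable {n : ℕ} [hn : Fact (2 ≤ n)] {s η : ℝ}

theorem smallJet_of_norm_jetL_le (hη : 0 < η) (hη1 : η ≤ 1) {g : YS n}
    (h : ‖jetL hη hη1 g‖ ≤ 1 / 64) :
    SmallJet (η ^ 4) (Rop hη g) (Eop hη hη1 g) (Mop hη hη1 g) := by
  rw [jetL_apply] at h
  have h2 := (norm_snd_le (Aop hη hη1 g, Eop hη hη1 g, Mop hη hη1 g)).trans h
  have hE := (norm_fst_le (Eop hη hη1 g, Mop hη hη1 g)).trans h2
  have hM := (norm_snd_le (Eop hη hη1 g, Mop hη hη1 g)).trans h2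
  exact
    { hasFDerivAt_u := fun x hx => hasFDerivAt_Rop hη hη1 g hx
      hasFDerivAt_e := fun x hx => hasFDerivAt_Eop hη hη1 g hx
      inner_e := inner_Eop hη hη1 g
      inner_M := inner_Mop hη hη1 g
      norm_e := fun x => (LipW.norm_apply_le _ x).trans hE
      norm_e_sub := fun x y => (norm_sub_le_dist _ x y).trans
        (mul_le_mul_of_nonneg_right hE dist_nonneg)
      norm_M := fun x => (LipW.norm_apply_le _ x).trans hM }

theorem rpow_mul_powE (s : ℝ) {a : ℝ} {v w : Eucl n} (ha : 0 < a) (haw : a = ‖w‖)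
    (h : ‖v - w‖ ≤ 1 / 2 * a) : a ^ s * powE (s / 2) (‖a⁻¹ • v‖ ^ 2) = ‖v‖ ^ s := by
  have h1 : 1 / 2 * a ≤ ‖v‖ := by
    have := norm_sub_norm_le w v
    rw [norm_sub_rev, ← haw] at this
    linarith
  have h2 : ‖a⁻¹ • v‖ = a⁻¹ * ‖v‖ := by rw [norm_smul, Real.norm_of_nonneg (by positivity)]
  have h3 : 1 / 2 ≤ a⁻¹ * ‖v‖ := by
    rw [inv_mul_eq_div, le_div_iff₀ ha]
    exact h1
  rw [h2, powE_of_le _ (by nlinarith), ← Real.rpow_natCast (a⁻¹ * ‖v‖) 2,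
    ← Real.rpow_mul (by positivity), Nat.cast_ofNat, mul_div_cancel₀ s two_ne_zero,
    ← Real.mul_rpow ha.le (by positivity), mul_inv_cancel_left₀ ha.ne']

theorem norm_smul_sub_smul_rpow {R : ℝ} (hR : 0 < R) (s : ℝ) (v w : Eucl n) :
    ‖R • v - R • w‖ ^ s = R ^ s * ‖v - w‖ ^ s := by
  rw [← smul_sub, norm_smul, Real.norm_of_nonneg hR.le, Real.mul_rpow hR.le (norm_nonneg _)]

theorem expNegInvGlue_sq_mul {t a : ℝ} (ht : 0 < t) (h : 1 / 32 ≤ 1 / 16 + a * t) :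
    expNegInvGlue (t ^ 2 * powE (-1) (1 / 16 + a * t)) =
      Real.exp (-(t⁻¹ ^ 2 / 16) - a * t⁻¹) := by
  have h0 : 0 < 1 / 16 + a * t := by linarith
  rw [powE_of_le _ h, Real.rpow_neg_one, expNegInvGlue, if_neg (not_le.2 (by positivity))]
  congr 1
  field_simp
  ring

theorem wbar_mul_inner_integrand (s : ℝ) (hη : 0 < η) (hη1 : η ≤ 1) {g : YS n}
    (h : ‖jetL hη hη1 g‖ ≤ 1 / 64) {ζ : Eucl n} (hζ : ζ ∈ innR n) (x : Sph n) :
    wbar n s (wb η) * (wIn n s (wb η) ζ * ‖ζ - x‖ ^ s *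
      LipW.nem (phiIn s) (D0 n + η ^ 2 • D1in n (Aop hη hη1 g)) (ζ, x)) =
    Real.exp (-‖(η ^ 2)⁻¹ • ζ‖ ^ 2 / 2) * ‖ζ - (x + Eop hη hη1 g x)‖ ^ s := by
  have hJ := smallJet_of_norm_jetL_le hη hη1 h
  have hw := wbar_pos (n := n) s (wb_nonneg η)
  have hd := half_le_norm_sub (mem_innR.1 hζ) x
  have hD : (D0 n + η ^ 2 • D1in n (Aop hη hη1 g)) (ζ, x) =
      ‖ζ - x‖⁻¹ • (ζ - (x + Eop hη hη1 g x)) := by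
    change D0 n (ζ, x) + η ^ 2 • D1in n (Aop hη hη1 g) (ζ, x) = _
    rw [D0_apply, D1in_apply, if_pos hζ, ← Aop_apply hη hη1 g x]
    simp only [smul_sub, smul_add, smul_neg, smul_comm (η ^ 2) ‖ζ - x‖⁻¹]
    abel
  have hb : -wb η * ‖ζ‖ ^ 2 = -‖(η ^ 2)⁻¹ • ζ‖ ^ 2 / 2 := by
    rw [norm_smul, wb, Real.norm_of_nonneg (by positivity)]
    field_simp
  rw [LipW.nem_apply (contDiff_phiIn s), hD, phiIn, mul_assoc (wIn n s (wb η) ζ),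
    rpow_mul_powE s (w := ζ - (x : Eucl n)) (by linarith) rfl, wIn, Set.indicator_of_mem hζ, hb]
  · field_simp
  · rw [show ζ - (x + Eop hη hη1 g x) - (ζ - (x : Eucl n)) = -Eop hη hη1 g x by abel, norm_neg]
    linarith [hJ.norm_e x]

theorem wbar_mul_outer_integrand (s : ℝ) (hη : 0 < η) (hη1 : η ≤ 1) {g : YS n}
    (h : ‖jetL hη hη1 g‖ ≤ 1 / 64) {ζ : Eucl n} (hζ : ζ ∈ outR n) (x : Sph n) :
    wbar n s (wb η) * (wOut n s (wb η) ζ * ‖ζ - x‖ ^ s *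
      LipW.nem (phiOut s) (baseZ n + outL n (η ^ 2, Aop hη hη1 g, Eop hη hη1 g, Mop hη hη1 g))
        (ζ, x)) =
    (1 + psiD (Eop hη hη1 g) (Mop hη hη1 g) ζ).det *
      (Real.exp (-‖(η ^ 2)⁻¹ • psiMap (Eop hη hη1 g) ζ‖ ^ 2 / 2) *
        ‖psiMap (Eop hη hη1 g) ζ - (x + Eop hη hη1 g x)‖ ^ s) := by
  have hw := wbar_pos (n := n) s (wb_nonneg η)
  obtain ⟨h1, h2⟩ := mem_outR.1 hζ
  have hd := ChordWeight.norm_sub_pos h1 x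
  have hA : ‖Aop hη hη1 g (sx ζ)‖ ≤ 1 / 64 :=
    (LipW.norm_apply_le _ _).trans
      ((norm_fst_le (Aop hη hη1 g, Eop hη hη1 g, Mop hη hη1 g)).trans h)
  have hE : ‖Eop hη hη1 g‖ ≤ 1 / 64 :=
    (norm_fst_le (Eop hη hη1 g, Mop hη hη1 g)).trans
      ((norm_snd_le (Aop hη hη1 g, Eop hη hη1 g, Mop hη hη1 g)).trans h)
  have hη2 : η ^ 2 ≤ 1 := pow_le_one₀ hη.le hη1
  have hη0 : 0 < η ^ 2 := by positivity
  have ha : |chi ‖ζ‖ * ⟪ζ, Aop hη hη1 g (sx ζ)⟫| ≤ 1 / 64 := by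
    rw [abs_mul, abs_of_nonneg (chi_nonneg _)]
    have i1 := abs_real_inner_le_norm ζ (Aop hη hη1 g (sx ζ))
    have i2 : ‖ζ‖ * ‖Aop hη hη1 g (sx ζ)‖ ≤ 1 * (1 / 64) := by gcongr
    have i3 := mul_le_mul (chi_le_one h1.le) (i1.trans i2) (abs_nonneg _) zero_le_one
    linarith
  have ha' : 1 / 32 ≤ 1 / 16 + chi ‖ζ‖ * ⟪ζ, Aop hη hη1 g (sx ζ)⟫ * η ^ 2 := by
    have := neg_abs_le (chi ‖ζ‖ * ⟪ζ, Aop hη hη1 g (sx ζ)⟫ * η ^ 2)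
    rw [abs_mul, abs_of_pos hη0] at this
    have i2 := mul_le_mul ha hη2 hη0.le (by norm_num)
    linarith
  have hR : (η ^ 2)⁻¹ • psiMap (Eop hη hη1 g) ζ =
      (η ^ 2)⁻¹ • ζ + chi ‖ζ‖ • Aop hη hη1 g (sx ζ) := by
    rw [psiMap, smul_add, ← Aop_apply hη hη1 g (sx ζ), smul_comm (chi ‖ζ‖) (η ^ 2),
      inv_smul_smul₀ hη0.ne']
  have hexp : Real.exp (-wb η * ‖ζ‖ ^ 2 + wb η / 8) *
      (Real.exp (-((η ^ 2)⁻¹ ^ 2 / 16) - chi ‖ζ‖ * ⟪ζ, Aop hη hη1 g (sx ζ)⟫ * (η ^ 2)⁻¹) *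
        Real.exp (-‖chi ‖ζ‖ • Aop hη hη1 g (sx ζ)‖ ^ 2 / 2)) =
      Real.exp (-‖(η ^ 2)⁻¹ • psiMap (Eop hη hη1 g) ζ‖ ^ 2 / 2) := by
    rw [← Real.exp_add, ← Real.exp_add, hR, norm_add_sq_real, norm_smul (η ^ 2)⁻¹,
      Real.norm_of_nonneg (by positivity), real_inner_smul_left, real_inner_smul_right, wb]
    congr 1
    field_simp
    ring
  have hv : ‖psiMap (Eop hη hη1 g) ζ - (x + Eop hη hη1 g x) - (ζ - (x : Eucl n))‖ ≤ 1 / 2 * ‖ζ - x‖ := by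
    rw [show psiMap (Eop hη hη1 g) ζ - (x + Eop hη hη1 g x) - (ζ - (x : Eucl n)) =
      chi ‖ζ‖ • Eop hη hη1 g (sx ζ) - Eop hη hη1 g x by rw [psiMap]; abel]
    refine (norm_chi_smul_sub_le (Eop hη hη1 g) hζ x).trans ?_
    gcongr
    linarith
  rw [LipW.nem_apply (contDiff_phiOut s), outL_add_apply _ _ _ _ hζ, phiOut, phiE, phiR]
  dsimp only
  rw [expNegInvGlue_sq_mul hη0 ha', ← rpow_mul_powE s hd rfl hv, ← hexp, wOut,
    Set.indicator_of_mem hζ, psiD, psiMap]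
  field_simp

theorem integral_gaussian_bodyOf (hs : 1 - (n : ℝ) < s) (hη : 0 < η) (hη1 : η ≤ 1)
    {g : YS n} (h : ‖jetL hη hη1 g‖ ≤ 1 / 64) (x : Sph n) :
    ∫ z in bodyOf (η ^ 2)⁻¹ (η ^ 4) (Rop hη g), Real.exp (-‖z‖ ^ 2 / 2) *
      ‖z - (η ^ 2)⁻¹ • ((x : Eucl n) + Eop hη hη1 g x)‖ ^ s =
    (η ^ 2)⁻¹ ^ n * ((η ^ 2)⁻¹ ^ s * (wbar n s (wb η) * What hs hη hη1 g x)) := by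
  have hJ := smallJet_of_norm_jetL_le hη hη1 h
  have hR : 0 < (η ^ 2)⁻¹ := by positivity
  set R := (η ^ 2)⁻¹ with hRdef
  set FI := LipW.nem (phiIn s) (D0 n + η ^ 2 • D1in n (Aop hη hη1 g)) with hFI
  set FO := LipW.nem (phiOut s)
    (baseZ n + outL n (η ^ 2, Aop hη hη1 g, Eop hη hη1 g, Mop hη hη1 g)) with hFO
  set F : Eucl n → ℝ := fun z => Real.exp (-‖z‖ ^ 2 / 2) *
    ‖z - R • ((x : Eucl n) + Eop hη hη1 g x)‖ ^ s with hF
  have e1 : Set.EqOn (fun ζ => F (R • ζ)) (fun ζ => R ^ s * (wbar n s (wb η) *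
      (wIn n s (wb η) ζ * ‖ζ - x‖ ^ s * FI (ζ, x)))) (innR n) := fun ζ hζ => by
    simp only [hF]
    rw [wbar_mul_inner_integrand s hη hη1 h hζ x, norm_smul_sub_smul_rpow hR]
    ring
  have e2 : Set.EqOn (fun ζ => (1 + psiD (Eop hη hη1 g) (Mop hη hη1 g) ζ).det *
      F (R • psiMap (Eop hη hη1 g) ζ)) (fun ζ => R ^ s * (wbar n s (wb η) *
      (wOut n s (wb η) ζ * ‖ζ - x‖ ^ s * FO (ζ, x)))) (outR n) := fun ζ hζ => by
    simp only [hF]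
    rw [wbar_mul_outer_integrand s hη hη1 h hζ x, norm_smul_sub_smul_rpow hR]
    ring
  have i1 := (chordWeight_in s (wb_nonneg η)).integrable_mul FI x
  have i2 := (chordWeight_out hs (wb_nonneg η)).integrable_mul FO x
  have z1 : ∫ ζ in innR n, wIn n s (wb η) ζ * ‖ζ - x‖ ^ s * FI (ζ, x) =
      ∫ ζ, wIn n s (wb η) ζ * ‖ζ - x‖ ^ s * FI (ζ, x) :=
    setIntegral_eq_integral_of_forall_compl_eq_zero fun ζ hζ => by
      rw [wIn, Set.indicator_of_notMem hζ, zero_mul, zero_mul]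
  have z2 : ∫ ζ in outR n, wOut n s (wb η) ζ * ‖ζ - x‖ ^ s * FO (ζ, x) =
      ∫ ζ, wOut n s (wb η) ζ * ‖ζ - x‖ ^ s * FO (ζ, x) :=
    setIntegral_eq_integral_of_forall_compl_eq_zero fun ζ hζ => by
      rw [wOut, Set.indicator_of_notMem hζ, zero_mul, zero_mul]
  have hW : What hs hη hη1 g x = (∫ ζ, wIn n s (wb η) ζ * ‖ζ - x‖ ^ s * FI (ζ, x)) +
      ∫ ζ, wOut n s (wb η) ζ * ‖ζ - x‖ ^ s * FO (ζ, x) := rfl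
  rw [hJ.integral_bodyOf hR F
      ((integrableOn_congr_fun e1 measurableSet_innR).2
        ((i1.integrableOn.const_mul _).const_mul _))
      ((integrableOn_congr_fun e2 measurableSet_outR).2
        ((i2.integrableOn.const_mul _).const_mul _)),
    setIntegral_congr_fun measurableSet_innR e1, setIntegral_congr_fun measurableSet_outR e2,
    integral_const_mul, integral_const_mul, integral_const_mul, integral_const_mul, z1, z2, hW]
  ring

end Chord

/-- Smooth even solution to the `L_p`-Gaussian chord Minkowski problem.
For `n ≥ 2`, `q > 2`, `p > 0` and a positive smooth even function `f` on `S^{n-1}`, there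
exist an origin-symmetric convex body `Ω` with smooth strictly convex boundary and a
constant `τ₁ > 0` whose support function `h` satisfies
`τ₁ Ṽ_{γ,q}(Ω, ∇h + h x) h^{1-p} det(∇²h + h I) = f` on `S^{n-1}`. -/
theorem lp_gaussian_chord_minkowski_smooth_even_solution
    (n : ℕ) (hn : 2 ≤ n) (q p : ℝ) (hq : 2 < q) (hp : 0 < p)
    (f : Eucl n → ℝ) (hf : ContDiff ℝ (⊤ : ℕ∞) f)
    (hfpos : ∀ x ∈ Metric.sphere (0 : Eucl n) 1, 0 < f x)
    (hfeven : ∀ x : Eucl n, f (-x) = f x) :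
    ∃ (Ω : Set (Eucl n)) (τ₁ : ℝ), 0 < τ₁ ∧ IsSmoothBody Ω ∧
      ∀ x ∈ Metric.sphere (0 : Eucl n) 1,
        τ₁ * Vtilde q Ω (gradient (suppFun Ω) x) * suppFun Ω x ^ (1 - p) *
          curvDet (suppFun Ω) x = f x := by
  have : Fact (2 ≤ n) := ⟨hn⟩
  have hs : 1 - (n : ℝ) < q - n - 1 := by linarith
  obtain ⟨η, hη, hη1, g, -, hjet, -, hPhi, hsm, heven⟩ :=
    exists_smooth_even_solution p hs hf hfpos hfeven (μ := 1 / 64) (by norm_num)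
  have hJ := smallJet_of_norm_jetL_le hη hη1 hjet
  have hw := wbar_pos (n := n) (q - n - 1) (wb_nonneg η)
  have hR : 0 < (η ^ 2)⁻¹ := by positivity
  refine ⟨bodyOf (η ^ 2)⁻¹ (η ^ 4) (Rop hη g),
    (2 * Real.exp (-(η ^ 2)⁻¹ ^ 2 / 2) * ((η ^ 2)⁻¹ ^ n * ((η ^ 2)⁻¹ ^ (q - n - 1) *
      wbar n (q - n - 1) (wb η))) * (η ^ 2)⁻¹ ^ (1 - p) * ((η ^ 2)⁻¹ ^ n / (η ^ 2)⁻¹))⁻¹,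
    by positivity, hJ.isSmoothBody hR hsm heven, fun x hx => ?_⟩
  obtain ⟨x, rfl⟩ : ∃ y : Sph n, (y : Eucl n) = x := ⟨⟨x, hx⟩, rfl⟩
  have hfx := hfpos x hx
  have hgrad : gradient (suppFun (bodyOf (η ^ 2)⁻¹ (η ^ 4) (Rop hη g))) x =
      (η ^ 2)⁻¹ • ((x : Eucl n) + Eop hη hη1 g x) := by
    rw [(hJ.hasGradientAt_suppFun hR (Sph.ne_zero x)).gradient, sx_coe, nx, Sph.norm_eq,
      inv_one, one_smul]
  have hsupp : suppFun (bodyOf (η ^ 2)⁻¹ (η ^ 4) (Rop hη g)) x =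
      (η ^ 2)⁻¹ * (1 + η ^ 4 * Rop hη g x) := by
    simpa using hJ.suppFun_bodyOf_sph hR x zero_le_one
  have hu := abs_le.1 (hJ.abs_u_le x)
  have hgauss : Real.exp (-‖(η ^ 2)⁻¹ • ((x : Eucl n) + Eop hη hη1 g x)‖ ^ 2 / 2) =
      Real.exp (-(η ^ 2)⁻¹ ^ 2 / 2) *
        Real.exp (-Rop hη g x - ‖Aop hη hη1 g x‖ ^ 2 / 2) := by
    rw [← Real.exp_add, norm_smul, mul_pow, norm_add_sq_real, inner_Eop, ← Aop_apply hη hη1 g x,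
      norm_smul, Sph.norm_eq, Real.norm_of_nonneg hR.le,
      Real.norm_of_nonneg (by positivity : (0 : ℝ) ≤ η ^ 2)]
    congr 1
    field_simp
    ring
  have hV : Vtilde q (bodyOf (η ^ 2)⁻¹ (η ^ 4) (Rop hη g))
      ((η ^ 2)⁻¹ • ((x : Eucl n) + Eop hη hη1 g x)) =
      2 * (Real.exp (-(η ^ 2)⁻¹ ^ 2 / 2) *
        Real.exp (-Rop hη g x - ‖Aop hη hη1 g x‖ ^ 2 / 2)) *
      ((η ^ 2)⁻¹ ^ n * ((η ^ 2)⁻¹ ^ (q - n - 1) * (wbar n (q - n - 1) (wb η) *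
        What hs hη hη1 g x))) := by
    rw [Vtilde, hgauss, ← integral_gaussian_bodyOf hs hη hη1 hjet x]
    congr 2
    ext z
    rw [div_eq_mul_inv, ← Real.rpow_neg (norm_nonneg _)]
    congr 2
    ring
  have hΦ := hPhi x
  rw [Phi] at hΦ
  simp only [jetL_apply] at hΦ
  rw [powE_of_le _ (by linarith)] at hΦ
  have hkey : Real.exp (-Rop hη g x - ‖Aop hη hη1 g x‖ ^ 2 / 2) *
      (1 + η ^ 4 * Rop hη g x) ^ (1 - p) * (1 + Mop hη hη1 g x).det * What hs hη hη1 g x =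
      f x := by
    linear_combination f x * hΦ -
      Real.exp (-Rop hη g x - ‖Aop hη hη1 g x‖ ^ 2 / 2) *
      (1 + η ^ 4 * Rop hη g x) ^ (1 - p) * (1 + Mop hη hη1 g x).det * What hs hη hη1 g x *
      mul_inv_cancel₀ hfx.ne'
  rw [hgrad, hV, hsupp, hJ.curvDet_bodyOf hR, Real.mul_rpow hR.le (by linarith), ← hkey]
  have := (Real.rpow_pos_of_pos hR (1 - p)).ne'
  have := (Real.rpow_pos_of_pos hR (q - n - 1)).ne'
  have := hw.ne'
  generalize (η ^ 2)⁻¹ ^ (1 - p) = a at *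
  generalize (η ^ 2)⁻¹ ^ (q - n - 1) = b at *
  generalize (1 + η ^ 4 * Rop hη g x) ^ (1 - p) = c at *
  field_simp
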